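/- Let m and n be positive integers. Suppose cr(K_{a,b}) = Z(a,b) holds for all positive integers a, b (Zarankiewicz's conjecture), and suppose cr(K_{2,m,n}) = Z(m+2,n+2) − mn (Harborth's conjecture for K_{2,m,n}). Then cr(K_{1,1,m,n}) = Z(m+2,n+2) − mn + ⌊m/2⌋⌊n/2⌋ (Harborth's conjecture for K_{1,1,m,n}). -/

import Mathlib

open SimpleGraph

variable {V : Type*}

/-- A drawing of a simple graph in the plane: an injective placement of the
vertices in `ℝ²` together with, for each edge, a continuous arc joining the
positions of its endpoints (parametrised compatibly in both directions),
such that no arc passes through the position of a vertex other than its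
endpoints. -/
structure Drawing (G : SimpleGraph V) where
  pos : V → ℝ × ℝ
  pos_inj : Function.Injective pos
  arc : V → V → ℝ → ℝ × ℝ
  arc_cont : ∀ ⦃a b⦄, G.Adj a b → ContinuousOn (arc a b) (Set.Icc 0 1)
  arc_zero : ∀ ⦃a b⦄, G.Adj a b → arc a b 0 = pos a
  arc_one : ∀ ⦃a b⦄, G.Adj a b → arc a b 1 = pos b
  arc_symm : ∀ ⦃a b⦄, G.Adj a b → ∀ t, arc b a t = arc a b (1 - t)
  arc_avoid : ∀ ⦃a b⦄, G.Adj a b → ∀ c, c ≠ a → c ≠ b →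
      pos c ∉ arc a b '' Set.Icc 0 1

namespace Drawing

variable {G : SimpleGraph V} (D : Drawing G)

/-- The set of points of the plane used by the edge `e`. -/
def edgePoints (e : Sym2 V) : Set (ℝ × ℝ) :=
  {p | ∃ a b, e = s(a, b) ∧ G.Adj a b ∧ p ∈ D.arc a b '' Set.Icc 0 1}

/-- The positions of the endpoints of an edge. -/
def ends (e : Sym2 V) : Set (ℝ × ℝ) := {p | ∃ a ∈ e, p = D.pos a}

/-- `p` is a crossing of the (distinct) edges `e` and `f` in the drawing `D`:
a common point of the two edges other than an endpoint. -/
def IsCrossing (e f : Sym2 V) (p : ℝ × ℝ) : Prop :=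
  e ∈ G.edgeSet ∧ f ∈ G.edgeSet ∧ e ≠ f ∧
    p ∈ D.edgePoints e ∧ p ∈ D.edgePoints f ∧ p ∉ D.ends e ∧ p ∉ D.ends f

/-- The crossings between an edge of `A` and an edge of `B`: a crossing is
recorded as a point of the plane together with the unordered pair of edges
crossing there. -/
def crossings (A B : Set (Sym2 V)) : Set ((ℝ × ℝ) × Sym2 (Sym2 V)) :=
  {q | ∃ e f, q.2 = s(e, f) ∧ e ∈ A ∧ f ∈ B ∧ D.IsCrossing e f q.1}

/-- `cr_D(A, B)`: the number of crossings between an edge of `A` and an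
edge of `B`. -/
noncomputable def crBetween (A B : Set (Sym2 V)) : ℕ := Nat.card (D.crossings A B)

/-- `cr(D)`: the total number of crossings of the drawing `D`. -/
noncomputable def crNum : ℕ := D.crBetween G.edgeSet G.edgeSet

/-- A good drawing: no edge crosses itself (each arc is a simple arc),
no two adjacent edges cross, no two edges cross more than once, and no three
edges cross at a common point. -/
structure IsGood : Prop where
  arc_inj : ∀ ⦃a b⦄, G.Adj a b → Set.InjOn (D.arc a b) (Set.Icc 0 1)
  adj_no_cross : ∀ e f : Sym2 V, (∃ a, a ∈ e ∧ a ∈ f) → ∀ p, ¬ D.IsCrossing e f p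
  cross_once : ∀ e f : Sym2 V, {p | D.IsCrossing e f p}.Subsingleton
  no_triple : ∀ p, ∀ e f g : Sym2 V, e ≠ f → e ≠ g → f ≠ g →
      ¬ (D.IsCrossing e f p ∧ D.IsCrossing f g p ∧ D.IsCrossing e g p)

end Drawing

/-- The crossing number of a graph: the minimum number of crossings among
all good drawings of `G` in the plane. -/
noncomputable def crossingNumber (G : SimpleGraph V) : ℕ :=
  sInf {n | ∃ D : Drawing G, D.IsGood ∧ D.crNum = n}

/-- The Zarankiewicz function `Z(m,n) = ⌊m/2⌋⌊(m-1)/2⌋⌊n/2⌋⌊(n-1)/2⌋`. -/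
def Z (m n : ℕ) : ℕ := m / 2 * ((m - 1) / 2) * (n / 2) * ((n - 1) / 2)

/-- The complete bipartite graph `K_{a,b}`. -/
abbrev bipK (a b : ℕ) : SimpleGraph (Fin a ⊕ Fin b) :=
  completeBipartiteGraph (Fin a) (Fin b)

/-- The complete tripartite graph `K_{a,b,c}`. -/
abbrev triK (a b c : ℕ) : SimpleGraph (Σ i : Fin 3, ![Fin a, Fin b, Fin c] i) :=
  completeMultipartiteGraph ![Fin a, Fin b, Fin c]

/-- The complete 4-partite graph `K_{a,b,c,d}`. -/
abbrev quadK (a b c d : ℕ) : SimpleGraph (Σ i : Fin 4, ![Fin a, Fin b, Fin c, Fin d] i) :=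
  completeMultipartiteGraph ![Fin a, Fin b, Fin c, Fin d]

/-- `E(V₁, V₂)`: the set of pairs `{v₁, v₂}` with `v₁ ∈ V₁` and `v₂ ∈ V₂`. -/
def pairEdges {α : Type*} (V₁ V₂ : Set α) : Set (Sym2 α) :=
  {e | ∃ a ∈ V₁, ∃ b ∈ V₂, e = s(a, b)}

namespace HB

open Set

abbrev Pl := ℝ × ℝ

/-- `S` is a simple arc from `p` to `q`. -/
def IsArc (S : Set Pl) (p q : Pl) : Prop :=
  ∃ γ : ℝ → Pl, ContinuousOn γ (Icc 0 1) ∧ InjOn γ (Icc 0 1) ∧ γ 0 = p ∧ γ 1 = q ∧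
    γ '' Icc 0 1 = S

theorem IsArc.symm {S : Set Pl} {p q : Pl} (h : IsArc S p q) : IsArc S q p := by
  obtain ⟨γ, hc, hi, h0, h1, hS⟩ := h
  have hm : MapsTo (fun t : ℝ => 1 - t) (Icc 0 1) (Icc 0 1) := by
    intro t ht; simp only [mem_Icc] at *; constructor <;> linarith
  refine ⟨fun t => γ (1 - t), ?_, ?_, ?_, ?_, ?_⟩
  · exact hc.comp (by fun_prop) hm
  · intro a ha b hb hab
    have := hi (hm ha) (hm hb) hab
    linarith
  · simp [h1]
  · simp [h0]
  · rw [← hS]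
    ext z
    constructor
    · rintro ⟨t, ht, rfl⟩; exact ⟨_, hm ht, rfl⟩
    · rintro ⟨t, ht, rfl⟩; exact ⟨_, hm ht, by simp⟩

theorem IsArc.left_mem {S : Set Pl} {p q : Pl} (h : IsArc S p q) : p ∈ S := by
  obtain ⟨γ, hc, hi, h0, h1, hS⟩ := h
  rw [← hS, ← h0]; exact ⟨0, by simp, rfl⟩

theorem IsArc.right_mem {S : Set Pl} {p q : Pl} (h : IsArc S p q) : q ∈ S := h.symm.left_mem

theorem IsArc.trans {S T : Set Pl} {p q r : Pl} (h : IsArc S p q) (h' : IsArc T q r)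
    (hST : S ∩ T ⊆ {q}) : IsArc (S ∪ T) p r := by
  obtain ⟨γ, hc, hi, h0, h1, hS⟩ := h
  obtain ⟨δ, hc', hi', h0', h1', hS'⟩ := h'
  have m1 : ∀ t : ℝ, t ∈ Icc (0:ℝ) (1/2) → 2 * t ∈ Icc (0:ℝ) 1 := by
    intro t ht; simp only [mem_Icc] at *; constructor <;> linarith
  have m2 : ∀ t : ℝ, t ∈ Icc (1/2:ℝ) 1 → 2 * t - 1 ∈ Icc (0:ℝ) 1 := by
    intro t ht; simp only [mem_Icc] at *; constructor <;> linarith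
  have e2 : ∀ t : ℝ, t ∈ Icc (1/2:ℝ) 1 →
      (if t ≤ 1/2 then γ (2*t) else δ (2*t-1)) = δ (2*t-1) := by
    intro t ht
    split_ifs with h
    · have : t = 1/2 := le_antisymm h ht.1
      subst this; norm_num [h1, h0']
    · rfl
  have e1 : ∀ t : ℝ, t ∈ Icc (0:ℝ) (1/2) →
      (if t ≤ 1/2 then γ (2*t) else δ (2*t-1)) = γ (2*t) := by
    intro t ht; rw [if_pos ht.2]
  refine ⟨fun t => if t ≤ 1/2 then γ (2*t) else δ (2*t-1), ?_, ?_, ?_, ?_, ?_⟩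
  · have : Icc (0:ℝ) 1 = Icc 0 (1/2) ∪ Icc (1/2) 1 := by
      rw [Icc_union_Icc_eq_Icc] <;> norm_num
    rw [this]
    apply ContinuousOn.union_of_isClosed _ _ isClosed_Icc isClosed_Icc
    · exact (hc.comp (f := fun t : ℝ => 2 * t) (by fun_prop) m1).congr e1
    · exact (hc'.comp (f := fun t : ℝ => 2 * t - 1) (by fun_prop) m2).congr e2
  · have key : ∀ a b : ℝ, a ∈ Icc (0:ℝ) (1/2) → b ∈ Icc (1/2:ℝ) 1 →
        γ (2*a) = δ (2*b-1) → a = b := by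
      intro a b ha hb hab
      have : γ (2*a) ∈ S ∩ T := ⟨hS ▸ ⟨_, m1 a ha, rfl⟩, hab ▸ hS' ▸ ⟨_, m2 b hb, rfl⟩⟩
      have hq : γ (2*a) = q := hST this
      have h3 := hi (m1 a ha) (by simp) (hq.trans h1.symm)
      have h4 := hi' (m2 b hb) (by simp) ((hab.symm.trans hq).trans h0'.symm)
      linarith
    intro a ha b hb hab
    dsimp only at hab
    rcases le_total a (1/2) with h | h <;> rcases le_total b (1/2) with h' | h'
    · rw [e1 a ⟨ha.1, h⟩, e1 b ⟨hb.1, h'⟩] at hab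
      have := hi (m1 a ⟨ha.1, h⟩) (m1 b ⟨hb.1, h'⟩) hab
      linarith
    · rw [e1 a ⟨ha.1, h⟩, e2 b ⟨h', hb.2⟩] at hab
      exact key a b ⟨ha.1, h⟩ ⟨h', hb.2⟩ hab
    · rw [e2 a ⟨h, ha.2⟩, e1 b ⟨hb.1, h'⟩] at hab
      exact (key b a ⟨hb.1, h'⟩ ⟨h, ha.2⟩ hab.symm).symm
    · rw [e2 a ⟨h, ha.2⟩, e2 b ⟨h', hb.2⟩] at hab
      have := hi' (m2 a ⟨h, ha.2⟩) (m2 b ⟨h', hb.2⟩) hab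
      linarith
  · norm_num [h0]
  · norm_num [h1']
  · ext z
    constructor
    · rintro ⟨t, ht, rfl⟩
      rcases le_total t (1/2) with h | h
      · left; rw [← hS]; exact ⟨2*t, m1 t ⟨ht.1, h⟩, (e1 t ⟨ht.1, h⟩).symm⟩
      · right; rw [← hS']; exact ⟨2*t-1, m2 t ⟨h, ht.2⟩, (e2 t ⟨h, ht.2⟩).symm⟩
    · rintro (h | h)
      · rw [← hS] at h
        obtain ⟨t, ht, rfl⟩ := h
        have : t / 2 ∈ Icc (0:ℝ) (1/2) := by
          simp only [mem_Icc] at *; constructor <;> linarith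
        refine ⟨t/2, ⟨this.1, by linarith [this.2]⟩, ?_⟩
        refine (e1 _ this).trans ?_; congr 1; ring
      · rw [← hS'] at h
        obtain ⟨t, ht, rfl⟩ := h
        have : (t + 1) / 2 ∈ Icc (1/2:ℝ) 1 := by
          simp only [mem_Icc] at *; constructor <;> linarith
        refine ⟨(t+1)/2, ⟨by linarith [this.1], this.2⟩, ?_⟩
        refine (e2 _ this).trans ?_; congr 1; ring

/-- image of a parametrised segment under a map -/
theorem isArc_image {α : Type*} [TopologicalSpace α] {γ : ℝ → α} {f : α → Pl} {K : Set α}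
    (hγ : ContinuousOn γ (Icc 0 1)) (hf : ContinuousOn f K) (hm : MapsTo γ (Icc 0 1) K)
    (hi : InjOn (fun t => f (γ t)) (Icc 0 1)) :
    IsArc ((fun t => f (γ t)) '' Icc 0 1) (f (γ 0)) (f (γ 1)) :=
  ⟨_, hf.comp hγ hm, hi, rfl, rfl, rfl⟩

theorem isArc_segment {p q : Pl} (h : p ≠ q) : IsArc (segment ℝ p q) p q := by
  refine ⟨fun t => AffineMap.lineMap p q t, ?_, ?_, by simp, by simp, ?_⟩
  · exact (AffineMap.lineMap_continuous).continuousOn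
  · exact (AffineMap.lineMap_injective ℝ h).injOn
  · rw [segment_eq_image_lineMap]

variable {V : Type*}

/-- Building a drawing from arcs given as sets. -/
theorem exists_drawing (G : SimpleGraph V) (pos : V → Pl) (hpos : Function.Injective pos)
    (S : V → V → Set Pl) (hsymm : ∀ a b, G.Adj a b → S a b = S b a)
    (harc : ∀ a b, G.Adj a b → IsArc (S a b) (pos a) (pos b))
    (havoid : ∀ a b, G.Adj a b → ∀ c, c ≠ a → c ≠ b → pos c ∉ S a b) :
    ∃ D : Drawing G, D.pos = pos ∧ (∀ a b, G.Adj a b → D.arc a b '' Icc 0 1 = S a b) ∧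
      ∀ a b, G.Adj a b → InjOn (D.arc a b) (Icc 0 1) := by
  classical
  let _ : LinearOrder V := linearOrderOfSTO WellOrderingRel
  choose! γ hc hi h0 h1 hS using harc
  let arc : V → V → ℝ → Pl := fun a b => if a < b then γ a b else fun t => γ b a (1 - t)
  have hm : MapsTo (fun t : ℝ => 1 - t) (Icc 0 1) (Icc 0 1) := by
    intro t ht; simp only [mem_Icc] at *; constructor <;> linarith
  have him : ∀ a b, G.Adj a b → arc a b '' Icc 0 1 = S a b := by
    intro a b hab
    by_cases h : a < b
    · simp only [arc, if_pos h]; exact hS a b hab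
    · simp only [arc, if_neg h]
      rw [hsymm a b hab, ← hS b a hab.symm]
      ext z
      constructor
      · rintro ⟨t, ht, rfl⟩; exact ⟨_, hm ht, rfl⟩
      · rintro ⟨t, ht, rfl⟩; exact ⟨_, hm ht, by simp⟩
  refine ⟨⟨pos, hpos, arc, ?_, ?_, ?_, ?_, ?_⟩, rfl, him, ?_⟩
  · intro a b hab
    by_cases h : a < b
    · simp only [arc, if_pos h]; exact hc a b hab
    · simp only [arc, if_neg h]
      exact (hc b a hab.symm).comp (by fun_prop) hm
  · intro a b hab
    by_cases h : a < b
    · simp only [arc, if_pos h]; exact h0 a b hab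
    · simp only [arc, if_neg h]; simpa using h1 b a hab.symm
  · intro a b hab
    by_cases h : a < b
    · simp only [arc, if_pos h]; exact h1 a b hab
    · simp only [arc, if_neg h]; simpa using h0 b a hab.symm
  · intro a b hab t
    rcases lt_or_gt_of_ne hab.ne with h | h
    · simp only [arc, if_pos h, if_neg (not_lt.2 h.le)]
    · simp only [arc, if_pos h, if_neg (not_lt.2 h.le)]; simp
  · intro a b hab c hca hcb
    rw [him a b hab]; exact havoid a b hab c hca hcb
  · intro a b hab
    change InjOn (arc a b) _
    by_cases h : a < b
    · simp only [arc, if_pos h]; exact hi a b hab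
    · simp only [arc, if_neg h]
      intro s hs t ht hst
      have := hi b a hab.symm (hm hs) (hm ht) hst
      linarith

/-- point set of an edge -/
def es {G : SimpleGraph V} (D : Drawing G) (a b : V) : Set Pl := D.arc a b '' Icc 0 1

theorem es_symm {G : SimpleGraph V} (D : Drawing G) {a b : V} (h : G.Adj a b) :
    es D a b = es D b a := by
  have hm : MapsTo (fun t : ℝ => 1 - t) (Icc 0 1) (Icc 0 1) := by
    intro t ht; simp only [mem_Icc] at *; constructor <;> linarith
  ext z
  constructor
  · rintro ⟨t, ht, rfl⟩; exact ⟨_, hm ht, by rw [D.arc_symm h]; simp⟩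
  · rintro ⟨t, ht, rfl⟩; exact ⟨_, hm ht, by rw [D.arc_symm h]⟩

theorem edgePoints_eq {G : SimpleGraph V} (D : Drawing G) {a b : V} (h : G.Adj a b) :
    D.edgePoints s(a, b) = es D a b := by
  ext z
  constructor
  · rintro ⟨c, d, hcd, hadj, hz⟩
    rw [Sym2.eq_iff] at hcd
    rcases hcd with ⟨rfl, rfl⟩ | ⟨rfl, rfl⟩
    · exact hz
    · rw [es_symm D h]; exact hz
  · intro hz; exact ⟨a, b, rfl, h, hz⟩

theorem mem_ends {G : SimpleGraph V} (D : Drawing G) {a b : V} {p : Pl} :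
    p ∈ D.ends s(a, b) ↔ p = D.pos a ∨ p = D.pos b := by
  simp [Drawing.ends]

/-- crossing predicate -/
def X {G : SimpleGraph V} (D : Drawing G) (a b c d : V) : Prop :=
  ∃ p, D.IsCrossing s(a, b) s(c, d) p

theorem isCrossing_iff {G : SimpleGraph V} (D : Drawing G) {a b c d : V} {p : Pl} :
    D.IsCrossing s(a, b) s(c, d) p ↔ G.Adj a b ∧ G.Adj c d ∧ s(a, b) ≠ s(c, d) ∧
      p ∈ es D a b ∧ p ∈ es D c d ∧ p ≠ D.pos a ∧ p ≠ D.pos b ∧ p ≠ D.pos c ∧ p ≠ D.pos d := by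
  unfold Drawing.IsCrossing
  simp only [SimpleGraph.mem_edgeSet, mem_ends, not_or]
  constructor
  · rintro ⟨h1, h2, h3, h4, h5, h6, h7⟩
    rw [edgePoints_eq D h1] at h4
    rw [edgePoints_eq D h2] at h5
    exact ⟨h1, h2, h3, h4, h5, h6.1, h6.2, h7.1, h7.2⟩
  · rintro ⟨h1, h2, h3, h4, h5, h6⟩
    rw [edgePoints_eq D h1, edgePoints_eq D h2]
    exact ⟨h1, h2, h3, h4, h5, ⟨h6.1, h6.2.1⟩, h6.2.2⟩

/-- Criterion for a drawing to be good. -/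
theorem isGood_of {G : SimpleGraph V} (D : Drawing G)
    (hinj : ∀ a b, G.Adj a b → InjOn (D.arc a b) (Icc 0 1))
    (hadj : ∀ a b c, G.Adj a b → G.Adj a c → b ≠ c → es D a b ∩ es D a c ⊆ {D.pos a})
    (honce : ∀ a b c d, G.Adj a b → G.Adj c d → a ≠ c → a ≠ d → b ≠ c → b ≠ d →
      (es D a b ∩ es D c d).Subsingleton)
    (htri : ∀ a b c d e f, G.Adj a b → G.Adj c d → G.Adj e f → a ≠ c → a ≠ d → b ≠ c → b ≠ d →
      a ≠ e → a ≠ f → b ≠ e → b ≠ f → c ≠ e → c ≠ f → d ≠ e → d ≠ f →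
      es D a b ∩ es D c d ∩ es D e f = ∅) : D.IsGood := by
  have key : ∀ a b c, ∀ p, ¬ D.IsCrossing s(a, b) s(a, c) p := by
    intro a b c p hp
    rw [isCrossing_iff] at hp
    obtain ⟨h1, h2, h3, h4, h5, h6, -⟩ := hp
    have hbc : b ≠ c := by rintro rfl; exact h3 rfl
    exact h6 (hadj a b c h1 h2 hbc ⟨h4, h5⟩)
  have hA : ∀ e f : Sym2 V, (∃ a, a ∈ e ∧ a ∈ f) → ∀ p, ¬ D.IsCrossing e f p := by
    rintro e f ⟨a, ha, hb⟩ p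
    obtain ⟨b, rfl⟩ := Sym2.mem_iff_exists.1 ha
    obtain ⟨c, rfl⟩ := Sym2.mem_iff_exists.1 hb
    exact key a b c p
  refine ⟨fun a b h => hinj a b h, hA, ?_, ?_⟩
  · intro e f
    induction e using Sym2.ind with | _ a b =>
    induction f using Sym2.ind with | _ c d =>
    intro p hp q hq
    have hp' := hp
    have hn := fun hh => hA _ _ hh p hp
    simp only [mem_ofPred_eq, isCrossing_iff] at hp hq
    have hac : a ≠ c := by rintro rfl; exact hn ⟨a, by simp, by simp⟩
    have had : a ≠ d := by rintro rfl; exact hn ⟨a, by simp, by simp⟩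
    have hbc : b ≠ c := by rintro rfl; exact hn ⟨b, by simp, by simp⟩
    have hbd : b ≠ d := by rintro rfl; exact hn ⟨b, by simp, by simp⟩
    exact honce a b c d hp.1 hp.2.1 hac had hbc hbd ⟨hp.2.2.2.1, hp.2.2.2.2.1⟩
      ⟨hq.2.2.2.1, hq.2.2.2.2.1⟩
  · intro p e f g _ _ _
    induction e using Sym2.ind with | _ a b =>
    induction f using Sym2.ind with | _ c d =>
    induction g using Sym2.ind with | _ u v =>
    rintro ⟨h1, h2, h3⟩
    have hn1 := fun hh => hA _ _ hh p h1
    have hn2 := fun hh => hA _ _ hh p h2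
    have hn3 := fun hh => hA _ _ hh p h3
    rw [isCrossing_iff] at h1 h2
    have := htri a b c d u v h1.1 h1.2.1 h2.2.1
      (by rintro rfl; exact hn1 ⟨a, by simp, by simp⟩) (by rintro rfl; exact hn1 ⟨a, by simp, by simp⟩)
      (by rintro rfl; exact hn1 ⟨b, by simp, by simp⟩) (by rintro rfl; exact hn1 ⟨b, by simp, by simp⟩)
      (by rintro rfl; exact hn3 ⟨a, by simp, by simp⟩) (by rintro rfl; exact hn3 ⟨a, by simp, by simp⟩)
      (by rintro rfl; exact hn3 ⟨b, by simp, by simp⟩) (by rintro rfl; exact hn3 ⟨b, by simp, by simp⟩)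
      (by rintro rfl; exact hn2 ⟨c, by simp, by simp⟩) (by rintro rfl; exact hn2 ⟨c, by simp, by simp⟩)
      (by rintro rfl; exact hn2 ⟨d, by simp, by simp⟩) (by rintro rfl; exact hn2 ⟨d, by simp, by simp⟩)
    exact (this.subset ⟨⟨h1.2.2.2.1, h1.2.2.2.2.1⟩, h2.2.2.2.2.1⟩ : p ∈ (∅ : Set Pl))

end HB

namespace HB

open Set

abbrev La := ℤ × ℤ

/-- lattice adjacency -/
def LAdj (z w : La) : Prop :=
  w = (z.1 + 1, z.2) ∨ w = (z.1 - 1, z.2) ∨ w = (z.1, z.2 + 1) ∨ w = (z.1, z.2 - 1)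

theorem LAdj.symm {z w : La} (h : LAdj z w) : LAdj w z := by
  obtain ⟨z1, z2⟩ := z
  rcases h with rfl | rfl | rfl | rfl <;> simp [LAdj]

/-- point on the common side of the cells `z`, `w`, with offset `s` to the left -/
noncomputable def sp (z w : La) (s : ℝ) : Pl :=
  (((z.1 : ℝ) + w.1) / 2 - s * ((w.2 : ℝ) - z.2), ((z.2 : ℝ) + w.2) / 2 + s * ((w.1 : ℝ) - z.1))

/-- closed unit cell -/
def InCell (z : La) (q : Pl) : Prop := |q.1 - z.1| ≤ 1 / 2 ∧ |q.2 - z.2| ≤ 1 / 2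

def InOpenCell (z : La) (q : Pl) : Prop := |q.1 - z.1| < 1 / 2 ∧ |q.2 - z.2| < 1 / 2

theorem eq_of_cells {z w : La} {q : Pl} (h : InOpenCell z q) (h' : InCell w q) : z = w := by
  obtain ⟨h1, h2⟩ := h
  obtain ⟨h3, h4⟩ := h'
  rw [abs_lt] at h1 h2
  rw [abs_le] at h3 h4
  have a1 : (z.1 : ℝ) < w.1 + 1 := by linarith
  have a2 : (w.1 : ℝ) < z.1 + 1 := by linarith
  have b1 : (z.2 : ℝ) < w.2 + 1 := by linarith
  have b2 : (w.2 : ℝ) < z.2 + 1 := by linarith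
  norm_cast at a1 a2 b1 b2
  ext <;> omega

theorem sp_swap (z w : La) (s : ℝ) : sp z w s = sp w z (-s) := by
  unfold sp; ext <;> simp <;> ring

theorem inCell_sp {a b z : La} {s : ℝ} (hab : LAdj a b) (hs : |s| < 1 / 2)
    (h : InCell z (sp a b s)) : z = a ∨ z = b := by
  obtain ⟨a1, a2⟩ := a
  obtain ⟨z1, z2⟩ := z
  obtain ⟨h1, h2⟩ := h
  rw [abs_lt] at hs
  rw [abs_le] at h1 h2
  rcases hab with rfl | rfl | rfl | rfl <;> simp only [sp] at h1 h2 <;> push_cast at h1 h2 <;>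
    simp only [Prod.mk.injEq]
  · have c1 : (z1 : ℝ) < a1 + 2 := by linarith
    have c2 : (a1 : ℝ) - 1 < z1 := by linarith
    have c3 : (z2 : ℝ) < a2 + 1 := by linarith
    have c4 : (a2 : ℝ) - 1 < z2 := by linarith
    norm_cast at c1 c2 c3 c4
    omega
  · have c1 : (z1 : ℝ) < a1 + 1 := by linarith
    have c2 : (a1 : ℝ) - 2 < z1 := by linarith
    have c3 : (z2 : ℝ) < a2 + 1 := by linarith
    have c4 : (a2 : ℝ) - 1 < z2 := by linarith
    norm_cast at c1 c2 c3 c4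
    omega
  · have c1 : (z1 : ℝ) < a1 + 1 := by linarith
    have c2 : (a1 : ℝ) - 1 < z1 := by linarith
    have c3 : (z2 : ℝ) < a2 + 2 := by linarith
    have c4 : (a2 : ℝ) - 1 < z2 := by linarith
    norm_cast at c1 c2 c3 c4
    omega
  · have c1 : (z1 : ℝ) < a1 + 1 := by linarith
    have c2 : (a1 : ℝ) - 1 < z1 := by linarith
    have c3 : (z2 : ℝ) < a2 + 1 := by linarith
    have c4 : (a2 : ℝ) - 2 < z2 := by linarith
    norm_cast at c1 c2 c3 c4
    omega

theorem sp_inCell_left {a b : La} {s : ℝ} (hab : LAdj a b) (hs : |s| < 1 / 2) :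
    InCell a (sp a b s) := by
  obtain ⟨a1, a2⟩ := a
  rw [abs_lt] at hs
  rcases hab with rfl | rfl | rfl | rfl <;> simp only [sp, InCell, abs_le] <;> push_cast <;>
    refine ⟨⟨?_, ?_⟩, ⟨?_, ?_⟩⟩ <;> linarith

theorem sp_inCell_right {a b : La} {s : ℝ} (hab : LAdj a b) (hs : |s| < 1 / 2) :
    InCell b (sp a b s) := by
  rw [sp_swap]; exact sp_inCell_left hab.symm (by simpa using hs)

theorem sp_inj_s {a b : La} {s s' : ℝ} (hab : LAdj a b) (h : sp a b s = sp a b s') : s = s' := by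
  obtain ⟨a1, a2⟩ := a
  rcases hab with rfl | rfl | rfl | rfl <;> simp only [sp, Prod.mk.injEq] at h <;>
    push_cast at h <;> obtain ⟨h1, h2⟩ := h <;> linarith

/-- a segment of a strand inside the cell `z` -/
theorem seg_cell {a z b : La} {s : ℝ} (h1 : LAdj a z) (h2 : LAdj z b) (hab : a ≠ b)
    (hs : |s| < 1 / 2) {q : Pl} (hq : q ∈ segment ℝ (sp a z s) (sp z b s)) :
    InOpenCell z q ∨ q = sp a z s ∨ q = sp z b s := by
  obtain ⟨x, y, hx, hy, hxy, rfl⟩ := hq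
  rcases hx.eq_or_lt with rfl | hx
  · right; right
    have : y = 1 := by linarith
    subst this; simp
  rcases hy.eq_or_lt with rfl | hy
  · right; left
    have : x = 1 := by linarith
    subst this; simp
  left
  have h1 := h1.symm
  obtain ⟨z1, z2⟩ := z
  rw [abs_lt] at hs
  obtain rfl : x = 1 - y := by linarith
  have e1 : 0 < y * (1/2 - s) := mul_pos hy (by linarith)
  have e2 : 0 < y * (1/2 + s) := mul_pos hy (by linarith)
  have e3 : 0 < (1-y) * (1/2 - s) := mul_pos hx (by linarith)
  have e4 : 0 < (1-y) * (1/2 + s) := mul_pos hx (by linarith)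
  rcases h1 with rfl | rfl | rfl | rfl <;> rcases h2 with rfl | rfl | rfl | rfl <;>
    first
    | exact absurd rfl hab
    | (simp only [sp, InOpenCell, abs_lt, Prod.fst_add, Prod.snd_add, Prod.smul_fst,
        Prod.smul_snd, smul_eq_mul]
       push_cast
       refine ⟨⟨?_, ?_⟩, ⟨?_, ?_⟩⟩ <;> linarith)

/-- different strands in the same cell are disjoint -/
theorem seg_cell_disj {a z b : La} {s s' : ℝ} (h1 : LAdj a z) (h2 : LAdj z b) (hab : a ≠ b)
    {q : Pl} (hq : q ∈ segment ℝ (sp a z s) (sp z b s))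
    (hq' : q ∈ segment ℝ (sp a z s') (sp z b s')) : s = s' := by
  obtain ⟨x, y, hx, hy, hxy, rfl⟩ := hq
  obtain ⟨x', y', hx', hy', hxy', he⟩ := hq'
  obtain rfl : x = 1 - y := by linarith
  obtain rfl : x' = 1 - y' := by linarith
  have h1 := h1.symm
  obtain ⟨z1, z2⟩ := z
  rw [Prod.ext_iff] at he
  simp only [sp, Prod.fst_add, Prod.snd_add, Prod.smul_fst, Prod.smul_snd, smul_eq_mul] at he
  obtain ⟨e1, e2⟩ := he
  rcases h1 with rfl | rfl | rfl | rfl <;> rcases h2 with rfl | rfl | rfl | rfl <;>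
    first
    | exact absurd rfl hab
    | (push_cast at e1 e2
       first | linarith | skip)

/-- master lemma: a strand leaves a cell only through its ports -/
theorem seg_master {a z b w : La} {s : ℝ} (h1 : LAdj a z) (h2 : LAdj z b) (hab : a ≠ b)
    (hs : |s| < 1 / 2) {q : Pl} (hq : q ∈ segment ℝ (sp a z s) (sp z b s))
    (hw : InCell w q) (hwz : w ≠ z) :
    (w = a ∧ q = sp a z s) ∨ (w = b ∧ q = sp z b s) := by
  rcases seg_cell h1 h2 hab hs hq with h | rfl | rfl
  · exact absurd (eq_of_cells h hw).symm hwz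
  · left
    rcases inCell_sp h1 hs hw with h | h
    · exact ⟨h, rfl⟩
    · exact absurd h hwz
  · right
    rcases inCell_sp h2 hs hw with h | h
    · exact absurd h hwz
    · exact ⟨h, rfl⟩

theorem seg_inCell {a z b : La} {s : ℝ} (h1 : LAdj a z) (h2 : LAdj z b) (hab : a ≠ b)
    (hs : |s| < 1 / 2) {q : Pl} (hq : q ∈ segment ℝ (sp a z s) (sp z b s)) : InCell z q := by
  rcases seg_cell h1 h2 hab hs hq with h | rfl | rfl
  · exact ⟨h.1.le, h.2.le⟩
  · exact sp_inCell_right h1 hs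
  · exact sp_inCell_left h2 hs

/-- A simple lattice path. -/
structure LPath (p : ℕ → La) (L : ℕ) : Prop where
  two_le : 2 ≤ L
  adj : ∀ i < L, LAdj (p i) (p (i + 1))
  inj : ∀ i ≤ L, ∀ j ≤ L, p i = p j → i = j

/-- `t`-th segment of the strand with offset `s` -/
def sg (p : ℕ → La) (s : ℝ) (t : ℕ) : Set Pl :=
  segment ℝ (sp (p t) (p (t + 1)) s) (sp (p (t + 1)) (p (t + 2)) s)

def strand (p : ℕ → La) (L : ℕ) (s : ℝ) : Set Pl := {q | ∃ t, t + 2 ≤ L ∧ q ∈ sg p s t}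

namespace LPath

variable {p : ℕ → La} {L : ℕ} {s : ℝ}

theorem ne2 (h : LPath p L) {t : ℕ} (ht : t + 2 ≤ L) : p t ≠ p (t + 2) := by
  intro he
  have := h.inj t (by omega) (t + 2) ht he
  omega

theorem sp_ne (h : LPath p L) {t : ℕ} (ht : t + 2 ≤ L) (hs : |s| < 1 / 2) :
    sp (p t) (p (t + 1)) s ≠ sp (p (t + 1)) (p (t + 2)) s := by
  intro he
  have h1 := sp_inCell_left (h.adj t (by omega)) hs
  rw [he] at h1
  rcases inCell_sp (h.adj (t + 1) (by omega)) hs h1 with h2 | h2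
  · have := h.inj t (by omega) (t + 1) (by omega) h2; omega
  · exact h.ne2 ht h2

theorem sg_master (h : LPath p L) (hs : |s| < 1 / 2) {t : ℕ} (ht : t + 2 ≤ L) {q : Pl} (hq : q ∈ sg p s t) {w : La}
    (hw : InCell w q) (hne : w ≠ p (t + 1)) :
    (w = p t ∧ q = sp (p t) (p (t + 1)) s) ∨
      (w = p (t + 2) ∧ q = sp (p (t + 1)) (p (t + 2)) s) :=
  seg_master (h.adj t (by omega)) (h.adj (t + 1) (by omega)) (h.ne2 ht) hs hq hw hne

theorem sg_inCell (h : LPath p L) (hs : |s| < 1 / 2) {t : ℕ} (ht : t + 2 ≤ L) {q : Pl} (hq : q ∈ sg p s t) :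
    InCell (p (t + 1)) q :=
  seg_inCell (h.adj t (by omega)) (h.adj (t + 1) (by omega)) (h.ne2 ht) hs hq

theorem isArc_aux (h : LPath p L) (hs : |s| < 1 / 2) (j : ℕ) (hj : j + 2 ≤ L) :
    IsArc {q | ∃ t ≤ j, q ∈ sg p s t} (sp (p 0) (p 1) s) (sp (p (j + 1)) (p (j + 2)) s) := by
  induction j with
  | zero =>
    have : {q | ∃ t ≤ 0, q ∈ sg p s t} = sg p s 0 := by ext q; simp
    rw [this]
    exact isArc_segment (h.sp_ne hj hs)
  | succ j ih =>
    have : {q | ∃ t ≤ j + 1, q ∈ sg p s t} = {q | ∃ t ≤ j, q ∈ sg p s t} ∪ sg p s (j + 1) := by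
      ext q
      constructor
      · rintro ⟨t, ht, hq⟩
        rcases Nat.lt_or_ge j t with h | h
        · right; obtain rfl : t = j + 1 := by omega
          exact hq
        · exact Or.inl ⟨t, h, hq⟩
      · rintro (⟨t, ht, hq⟩ | hq)
        · exact ⟨t, by omega, hq⟩
        · exact ⟨j + 1, le_rfl, hq⟩
    rw [this]
    refine (ih (by omega)).trans (isArc_segment (h.sp_ne hj hs)) ?_
    rintro q ⟨⟨t, ht, hq⟩, hq'⟩
    have hc := h.sg_inCell hs (by omega) hq
    have hne : p (t + 1) ≠ p (j + 1 + 1) := by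
      intro he; have := h.inj _ (by omega) _ (by omega) he; omega
    rcases h.sg_master hs hj hq' hc hne with h1 | h1
    · exact h1.2
    · have := h.inj _ (by omega) _ (by omega) h1.1
      omega

theorem isArc_strand (h : LPath p L) (hs : |s| < 1 / 2) :
    IsArc (strand p L s) (sp (p 0) (p 1) s) (sp (p (L - 1)) (p L) s) := by
  have h2 := h.two_le
  have := h.isArc_aux hs (L - 2) (by omega)
  have e1 : L - 2 + 1 = L - 1 := by omega
  have e2 : L - 2 + 2 = L := by omega
  rw [e1, e2] at this
  convert this using 1
  ext q
  constructor
  · rintro ⟨t, ht, hq⟩; exact ⟨t, by omega, hq⟩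
  · rintro ⟨t, ht, hq⟩; exact ⟨t, by omega, hq⟩

theorem strand_disj_self (h : LPath p L) {s' : ℝ} (hs : |s| < 1 / 2) (hs' : |s'| < 1 / 2) {q : Pl}
    (hq : q ∈ strand p L s) (hq' : q ∈ strand p L s') : s = s' := by
  obtain ⟨t, ht, hq⟩ := hq
  obtain ⟨t', ht', hq'⟩ := hq'
  have c1 := h.sg_inCell hs ht hq
  have c2 := h.sg_inCell hs' ht' hq'
  by_cases he : t = t'
  · subst he
    exact seg_cell_disj (h.adj t (by omega)) (h.adj (t + 1) (by omega)) (h.ne2 ht) hq hq'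
  · have hne : p (t + 1) ≠ p (t' + 1) := by
      intro he; have := h.inj _ (by omega) _ (by omega) he; omega
    rcases h.sg_master hs ht hq c2 hne.symm with ⟨h1, h1'⟩ | ⟨h1, h1'⟩ <;>
      rcases h.sg_master hs' ht' hq' c1 hne with ⟨h2, h2'⟩ | ⟨h2, h2'⟩
    · have := h.inj _ (by omega) _ (by omega) h1
      have := h.inj _ (by omega) _ (by omega) h2
      omega
    · have := h.inj _ (by omega) _ (by omega) h1
      subst this
      exact sp_inj_s (h.adj _ (by omega)) (h1'.symm.trans h2')
    · have := h.inj _ (by omega) _ (by omega) h2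
      subst this
      exact sp_inj_s (h.adj _ (by omega)) (h1'.symm.trans h2')
    · have := h.inj _ (by omega) _ (by omega) h1
      have := h.inj _ (by omega) _ (by omega) h2
      omega

end LPath

theorem strand_disj {p p' : ℕ → La} {L L' : ℕ} (h : LPath p L) (h' : LPath p' L')
    (hd : ∀ i j, 0 < i → i < L → 0 < j → j < L' → p i ≠ p' j)
    (hd0 : ∀ j, 0 < j → j < L' → p 0 ≠ p' j ∧ p L ≠ p' j) {s s' : ℝ}
    (hs : |s| < 1 / 2) (hs' : |s'| < 1 / 2) {q : Pl}
    (hq : q ∈ strand p L s) (hq' : q ∈ strand p' L' s') : False := by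
  obtain ⟨t, ht, hq⟩ := hq
  obtain ⟨t', ht', hq'⟩ := hq'
  have c2 := h'.sg_inCell hs' ht' hq'
  have hne := hd (t + 1) (t' + 1) (by omega) (by omega) (by omega) (by omega)
  rcases h.sg_master hs ht hq c2 hne.symm with ⟨h1, h1'⟩ | ⟨h1, h1'⟩
  · rcases Nat.eq_zero_or_pos t with rfl | h0
    · exact (hd0 (t' + 1) (by omega) (by omega)).1 h1.symm
    · exact hd t (t' + 1) h0 (by omega) (by omega) (by omega) h1.symm
  · rcases Nat.lt_or_ge (t + 2) L with h0 | h0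
    · exact hd (t + 2) (t' + 1) (by omega) (by omega) (by omega) (by omega) h1.symm
    · obtain rfl : L = t + 2 := by omega
      exact (hd0 (t' + 1) (by omega) (by omega)).2 h1.symm

/-- lattice box -/
def LBox (c : La) (R : ℕ) (z : La) : Prop := |z.1 - c.1| ≤ R ∧ |z.2 - c.2| ≤ R

/-- closed real box -/
def RBox (c : La) (R : ℕ) (q : Pl) : Prop :=
  |q.1 - c.1| ≤ (R : ℝ) + 1 / 2 ∧ |q.2 - c.2| ≤ (R : ℝ) + 1 / 2

theorem exists_cell1 (c : ℤ) (R : ℕ) (x : ℝ) (h : |x - c| ≤ (R : ℝ) + 1 / 2) :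
    ∃ z : ℤ, |z - c| ≤ R ∧ |x - z| ≤ 1 / 2 := by
  rw [abs_le] at h
  by_cases h1 : x < c + R + 1/2
  · refine ⟨⌊x + 1/2⌋, ?_, ?_⟩
    · have a := Int.floor_le (x + 1/2)
      have b := Int.lt_floor_add_one (x + 1/2)
      have c1 : ((⌊x + 1/2⌋ : ℤ) : ℝ) < c + R + 1 := by linarith
      have c2 : (c : ℝ) - R - 1 < ((⌊x + 1/2⌋ : ℤ) : ℝ) := by linarith
      norm_cast at c1 c2
      rw [abs_le]; push_cast at *; constructor <;> omega
    · have a := Int.floor_le (x + 1/2)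
      have b := Int.lt_floor_add_one (x + 1/2)
      rw [abs_le]; constructor <;> linarith
  · refine ⟨c + R, by simp, ?_⟩
    push_cast
    rw [abs_le]; constructor <;> linarith

theorem exists_cell {c : La} {R : ℕ} {q : Pl} (h : RBox c R q) : ∃ z, LBox c R z ∧ InCell z q := by
  obtain ⟨z1, h1, h2⟩ := exists_cell1 c.1 R q.1 h.1
  obtain ⟨z2, h3, h4⟩ := exists_cell1 c.2 R q.2 h.2
  exact ⟨(z1, z2), ⟨h1, h3⟩, ⟨h2, h4⟩⟩

theorem strand_box {p : ℕ → La} {L : ℕ} (h : LPath p L) {c : La} {R : ℕ}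
    (hb : ∀ i, 0 < i → i < L → ¬ LBox c R (p i)) {s : ℝ} (hs : |s| < 1 / 2) {q : Pl}
    (hq : q ∈ strand p L s) (hR : RBox c R q) :
    (LBox c R (p 0) ∧ q = sp (p 0) (p 1) s) ∨ (LBox c R (p L) ∧ q = sp (p (L - 1)) (p L) s) := by
  obtain ⟨t, ht, hq⟩ := hq
  obtain ⟨z, hz, hzq⟩ := exists_cell hR
  have hne : z ≠ p (t + 1) := by
    rintro rfl; exact hb _ (by omega) (by omega) hz
  rcases h.sg_master hs ht hq hzq hne with ⟨rfl, h1⟩ | ⟨rfl, h1⟩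
  · left
    have : t = 0 := by
      by_contra h0; exact hb t (by omega) (by omega) hz
    subst this; exact ⟨hz, h1⟩
  · right
    have : L = t + 2 := by
      by_contra h0; exact hb (t + 2) (by omega) (by omega) hz
    subst this; exact ⟨hz, h1⟩

end HB

namespace HB

open Set

noncomputable def clamp (h t : ℝ) : ℝ := max (-h) (min h t)

theorem clamp_high {h t : ℝ} (hh : 0 ≤ h) (ht : h ≤ t) : clamp h t = h := by
  unfold clamp; rw [min_eq_left ht, max_eq_right (by linarith)]

theorem clamp_low {h t : ℝ} (hh : 0 ≤ h) (ht : t ≤ -h) : clamp h t = -h := by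
  unfold clamp; rw [min_eq_right (by linarith), max_eq_left ht]

theorem clamp_mid {h t : ℝ} (h1 : -h ≤ t) (h2 : t ≤ h) : clamp h t = t := by
  unfold clamp; rw [min_eq_right h2, max_eq_right h1]

/-- perimeter parametrisation of the square of half-width `h` (two turns) -/
noncomputable def bx (h U : ℝ) : ℝ := clamp h (2 * h - min (min |U - h| |U - 9 * h|) |U - 17 * h|)
noncomputable def bY (h U : ℝ) : ℝ := clamp h (2 * h - min |U - 3 * h| |U - 11 * h|)

theorem bx_cont (h : ℝ) : Continuous (bx h) := by unfold bx clamp; fun_prop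
theorem bY_cont (h : ℝ) : Continuous (bY h) := by unfold bY clamp; fun_prop

section
variable {h U : ℝ} (hh : 0 < h)

theorem bx_high1 (hh : 0 < h) (h1 : 0 ≤ U) (h2 : U ≤ 2 * h) : bx h U = h := by
  unfold bx
  apply clamp_high hh.le
  have : |U - h| ≤ h := by rw [abs_le]; constructor <;> linarith
  have := (min_le_left (min |U - h| |U - 9 * h|) |U - 17 * h|).trans (min_le_left _ _)
  linarith

theorem bx_high2 (hh : 0 < h) (h1 : 8 * h ≤ U) (h2 : U ≤ 10 * h) : bx h U = h := by
  unfold bx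
  apply clamp_high hh.le
  have : |U - 9 * h| ≤ h := by rw [abs_le]; constructor <;> linarith
  have := (min_le_left (min |U - h| |U - 9 * h|) |U - 17 * h|).trans (min_le_right _ _)
  linarith

theorem bx_low (hh : 0 < h) (h1 : 4 * h ≤ U) (h2 : U ≤ 6 * h) : bx h U = -h := by
  unfold bx
  apply clamp_low hh.le
  have a : 3 * h ≤ |U - h| := by rw [le_abs]; left; linarith
  have b : 3 * h ≤ |U - 9 * h| := by rw [le_abs]; right; linarith
  have c : 3 * h ≤ |U - 17 * h| := by rw [le_abs]; right; linarith
  have := le_min (le_min a b) c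
  linarith

theorem bx_low2 (hh : 0 < h) (h1 : 12 * h ≤ U) (h2 : U ≤ 14 * h) : bx h U = -h := by
  unfold bx
  apply clamp_low hh.le
  have a : 3 * h ≤ |U - h| := by rw [le_abs]; left; linarith
  have b : 3 * h ≤ |U - 9 * h| := by rw [le_abs]; left; linarith
  have c : 3 * h ≤ |U - 17 * h| := by rw [le_abs]; right; linarith
  have := le_min (le_min a b) c
  linarith

theorem bx_mid1 (hh : 0 < h) (h1 : 2 * h ≤ U) (h2 : U ≤ 4 * h) : bx h U = 3 * h - U := by
  unfold bx
  have a : |U - h| = U - h := abs_of_nonneg (by linarith)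
  have b : |U - 9 * h| = 9 * h - U := by rw [abs_of_nonpos (by linarith)]; ring
  have c : |U - 17 * h| = 17 * h - U := by rw [abs_of_nonpos (by linarith)]; ring
  rw [a, b, c, min_eq_left (a := U - h) (by linarith), min_eq_left (by linarith),
    clamp_mid (by linarith) (by linarith)]; ring

theorem bx_mid2 (hh : 0 < h) (h1 : 6 * h ≤ U) (h2 : U ≤ 8 * h) : bx h U = U - 7 * h := by
  unfold bx
  have a : |U - h| = U - h := abs_of_nonneg (by linarith)
  have b : |U - 9 * h| = 9 * h - U := by rw [abs_of_nonpos (by linarith)]; ring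
  have c : |U - 17 * h| = 17 * h - U := by rw [abs_of_nonpos (by linarith)]; ring
  rw [a, b, c, min_eq_right (a := U - h) (by linarith), min_eq_left (by linarith),
    clamp_mid (by linarith) (by linarith)]; ring

theorem bx_mid3 (hh : 0 < h) (h1 : 10 * h ≤ U) (h2 : U ≤ 12 * h) : bx h U = 11 * h - U := by
  unfold bx
  have a : |U - h| = U - h := abs_of_nonneg (by linarith)
  have b : |U - 9 * h| = U - 9 * h := abs_of_nonneg (by linarith)
  have c : |U - 17 * h| = 17 * h - U := by rw [abs_of_nonpos (by linarith)]; ring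
  rw [a, b, c, min_eq_right (a := U - h) (by linarith), min_eq_left (by linarith),
    clamp_mid (by linarith) (by linarith)]; ring

theorem bx_mid4 (hh : 0 < h) (h1 : 14 * h ≤ U) (h2 : U ≤ 16 * h) : bx h U = U - 15 * h := by
  unfold bx
  have a : |U - h| = U - h := abs_of_nonneg (by linarith)
  have b : |U - 9 * h| = U - 9 * h := abs_of_nonneg (by linarith)
  have c : |U - 17 * h| = 17 * h - U := by rw [abs_of_nonpos (by linarith)]; ring
  rw [a, b, c, min_eq_right (a := U - h) (by linarith), min_eq_right (by linarith),
    clamp_mid (by linarith) (by linarith)]; ring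

theorem bY_high1 (hh : 0 < h) (h1 : 2 * h ≤ U) (h2 : U ≤ 4 * h) : bY h U = h := by
  unfold bY
  apply clamp_high hh.le
  have : |U - 3 * h| ≤ h := by rw [abs_le]; constructor <;> linarith
  have := (min_le_left |U - 3 * h| |U - 11 * h|)
  linarith

theorem bY_high2 (hh : 0 < h) (h1 : 10 * h ≤ U) (h2 : U ≤ 12 * h) : bY h U = h := by
  unfold bY
  apply clamp_high hh.le
  have : |U - 11 * h| ≤ h := by rw [abs_le]; constructor <;> linarith
  have := (min_le_right |U - 3 * h| |U - 11 * h|)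
  linarith

theorem bY_low1 (hh : 0 < h) (h1 : 6 * h ≤ U) (h2 : U ≤ 8 * h) : bY h U = -h := by
  unfold bY
  apply clamp_low hh.le
  have a : 3 * h ≤ |U - 3 * h| := by rw [le_abs]; left; linarith
  have b : 3 * h ≤ |U - 11 * h| := by rw [le_abs]; right; linarith
  have := le_min a b
  linarith

theorem bY_low2 (hh : 0 < h) (h1 : 14 * h ≤ U) (h2 : U ≤ 16 * h) : bY h U = -h := by
  unfold bY
  apply clamp_low hh.le
  have a : 3 * h ≤ |U - 3 * h| := by rw [le_abs]; left; linarith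
  have b : 3 * h ≤ |U - 11 * h| := by rw [le_abs]; left; linarith
  have := le_min a b
  linarith

theorem bY_mid1 (hh : 0 < h) (h1 : 0 ≤ U) (h2 : U ≤ 2 * h) : bY h U = U - h := by
  unfold bY
  have a : |U - 3 * h| = 3 * h - U := by rw [abs_of_nonpos (by linarith)]; ring
  have b : |U - 11 * h| = 11 * h - U := by rw [abs_of_nonpos (by linarith)]; ring
  rw [a, b, min_eq_left (by linarith), clamp_mid (by linarith) (by linarith)]; ring

theorem bY_mid2 (hh : 0 < h) (h1 : 4 * h ≤ U) (h2 : U ≤ 6 * h) : bY h U = 5 * h - U := by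
  unfold bY
  have a : |U - 3 * h| = U - 3 * h := abs_of_nonneg (by linarith)
  have b : |U - 11 * h| = 11 * h - U := by rw [abs_of_nonpos (by linarith)]; ring
  rw [a, b, min_eq_left (by linarith), clamp_mid (by linarith) (by linarith)]; ring

theorem bY_mid3 (hh : 0 < h) (h1 : 8 * h ≤ U) (h2 : U ≤ 10 * h) : bY h U = U - 9 * h := by
  unfold bY
  have a : |U - 3 * h| = U - 3 * h := abs_of_nonneg (by linarith)
  have b : |U - 11 * h| = 11 * h - U := by rw [abs_of_nonpos (by linarith)]; ring
  rw [a, b, min_eq_right (by linarith), clamp_mid (by linarith) (by linarith)]; ring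

theorem bY_mid4 (hh : 0 < h) (h1 : 12 * h ≤ U) (h2 : U ≤ 14 * h) : bY h U = 13 * h - U := by
  unfold bY
  have a : |U - 3 * h| = U - 3 * h := abs_of_nonneg (by linarith)
  have b : |U - 11 * h| = U - 11 * h := abs_of_nonneg (by linarith)
  rw [a, b, min_eq_right (by linarith), clamp_mid (by linarith) (by linarith)]; ring

/-- explicit description of the perimeter parametrisation -/
theorem b_sides (hh : 0 < h) (h1 : 0 ≤ U) (h2 : U ≤ 16 * h) :
    (0 ≤ U ∧ U ≤ 2 * h ∧ bx h U = h ∧ bY h U = U - h) ∨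
    (2 * h ≤ U ∧ U ≤ 4 * h ∧ bx h U = 3 * h - U ∧ bY h U = h) ∨
    (4 * h ≤ U ∧ U ≤ 6 * h ∧ bx h U = -h ∧ bY h U = 5 * h - U) ∨
    (6 * h ≤ U ∧ U ≤ 8 * h ∧ bx h U = U - 7 * h ∧ bY h U = -h) ∨
    (8 * h ≤ U ∧ U ≤ 10 * h ∧ bx h U = h ∧ bY h U = U - 9 * h) ∨
    (10 * h ≤ U ∧ U ≤ 12 * h ∧ bx h U = 11 * h - U ∧ bY h U = h) ∨
    (12 * h ≤ U ∧ U ≤ 14 * h ∧ bx h U = -h ∧ bY h U = 13 * h - U) ∨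
    (14 * h ≤ U ∧ U ≤ 16 * h ∧ bx h U = U - 15 * h ∧ bY h U = -h) := by
  rcases le_total U (2 * h) with a | a
  · exact Or.inl ⟨h1, a, bx_high1 hh h1 a, bY_mid1 hh h1 a⟩
  right
  rcases le_total U (4 * h) with b | b
  · exact Or.inl ⟨a, b, bx_mid1 hh a b, bY_high1 hh a b⟩
  right
  rcases le_total U (6 * h) with a | a
  · exact Or.inl ⟨b, a, bx_low hh b a, bY_mid2 hh b a⟩
  right
  rcases le_total U (8 * h) with b | b
  · exact Or.inl ⟨a, b, bx_mid2 hh a b, bY_low1 hh a b⟩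
  right
  rcases le_total U (10 * h) with a | a
  · exact Or.inl ⟨b, a, bx_high2 hh b a, bY_mid3 hh b a⟩
  right
  rcases le_total U (12 * h) with b | b
  · exact Or.inl ⟨a, b, bx_mid3 hh a b, bY_high2 hh a b⟩
  right
  rcases le_total U (14 * h) with a | a
  · exact Or.inl ⟨b, a, bx_low2 hh b a, bY_mid4 hh b a⟩
  right
  exact ⟨a, h2, bx_mid4 hh a h2, bY_low2 hh a h2⟩

theorem b_norm (hh : 0 < h) (h1 : 0 ≤ U) (h2 : U ≤ 16 * h) : max |bx h U| |bY h U| = h := by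
  have key : ∀ x y : ℝ, |x| ≤ h → |y| ≤ h → (|x| = h ∨ |y| = h) → max |x| |y| = h := by
    intro x y hx hy h
    rcases h with h | h
    · rw [h]; exact max_eq_left hy
    · rw [h]; exact max_eq_right hx
  have hb : |h| = h := abs_of_pos hh
  have hb' : |-h| = h := by rw [abs_neg, hb]
  rcases b_sides hh h1 h2 with ⟨a, b, c, d⟩ | ⟨a, b, c, d⟩ | ⟨a, b, c, d⟩ | ⟨a, b, c, d⟩ |
    ⟨a, b, c, d⟩ | ⟨a, b, c, d⟩ | ⟨a, b, c, d⟩ | ⟨a, b, c, d⟩ <;> rw [c, d]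
  · exact key _ _ hb.le (abs_le.2 ⟨by linarith, by linarith⟩) (Or.inl hb)
  · exact key _ _ (abs_le.2 ⟨by linarith, by linarith⟩) hb.le (Or.inr hb)
  · exact key _ _ hb'.le (abs_le.2 ⟨by linarith, by linarith⟩) (Or.inl hb')
  · exact key _ _ (abs_le.2 ⟨by linarith, by linarith⟩) hb'.le (Or.inr hb')
  · exact key _ _ hb.le (abs_le.2 ⟨by linarith, by linarith⟩) (Or.inl hb)
  · exact key _ _ (abs_le.2 ⟨by linarith, by linarith⟩) hb.le (Or.inr hb)
  · exact key _ _ hb'.le (abs_le.2 ⟨by linarith, by linarith⟩) (Or.inl hb')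
  · exact key _ _ (abs_le.2 ⟨by linarith, by linarith⟩) hb'.le (Or.inr hb')

theorem b_inj_aux {W : ℝ} (hh : 0 < h) (h1 : 0 ≤ U) (h2 : W ≤ 16 * h) (hUW : U < W)
    (hWU : W < U + 8 * h) (hx : bx h U = bx h W) (hy : bY h U = bY h W) : False := by
  rcases b_sides (U := U) hh h1 (by linarith) with ⟨a, b, c, d⟩ | ⟨a, b, c, d⟩ | ⟨a, b, c, d⟩ | ⟨a, b, c, d⟩ |
    ⟨a, b, c, d⟩ | ⟨a, b, c, d⟩ | ⟨a, b, c, d⟩ | ⟨a, b, c, d⟩ <;>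
  rcases b_sides (U := W) hh (by linarith) h2 with ⟨a', b', c', d'⟩ | ⟨a', b', c', d'⟩ | ⟨a', b', c', d'⟩ |
    ⟨a', b', c', d'⟩ | ⟨a', b', c', d'⟩ | ⟨a', b', c', d'⟩ | ⟨a', b', c', d'⟩ | ⟨a', b', c', d'⟩ <;>
  rw [c, c'] at hx <;> rw [d, d'] at hy <;> linarith

theorem b_inj {W : ℝ} (hh : 0 < h) (h1 : 0 ≤ U) (h1' : 0 ≤ W) (h2' : U ≤ 16 * h) (h2 : W ≤ 16 * h)
    (hUW : U < W + 8 * h)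
    (hWU : W < U + 8 * h) (hx : bx h U = bx h W) (hy : bY h U = bY h W) : U = W := by
  rcases lt_trichotomy U W with h' | h' | h'
  · exact (b_inj_aux hh h1 h2 h' hWU hx hy).elim
  · exact h'
  · exact (b_inj_aux hh h1' h2' h' hUW hx.symm hy.symm).elim

theorem b_periodic (hh : 0 < h) (h1 : 0 ≤ U) (h2 : U ≤ 8 * h) :
    bx h (U + 8 * h) = bx h U ∧ bY h (U + 8 * h) = bY h U := by
  rcases le_total U (2 * h) with a | a
  · rw [bx_high1 hh h1 a, bY_mid1 hh h1 a, bx_high2 hh (by linarith) (by linarith),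
      bY_mid3 hh (by linarith) (by linarith)]
    exact ⟨rfl, by ring⟩
  rcases le_total U (4 * h) with b | b
  · rw [bx_mid1 hh a b, bY_high1 hh a b, bx_mid3 hh (by linarith) (by linarith),
      bY_high2 hh (by linarith) (by linarith)]
    exact ⟨by ring, rfl⟩
  rcases le_total U (6 * h) with a | a
  · rw [bx_low hh b a, bY_mid2 hh b a, bx_low2 hh (by linarith) (by linarith),
      bY_mid4 hh (by linarith) (by linarith)]
    exact ⟨rfl, by ring⟩
  · rw [bx_mid2 hh a h2, bY_low1 hh a h2, bx_mid4 hh (by linarith) (by linarith),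
      bY_low2 hh (by linarith) (by linarith)]
    exact ⟨by ring, rfl⟩

end

/-- half-width -/
noncomputable def hw (R : ℕ) : ℝ := (R : ℝ) + 1 / 2

theorem hw_pos (R : ℕ) : 0 < hw R := by unfold hw; positivity

/-- box chart -/
noncomputable def ch (c : La) (R : ℕ) (u : ℝ × ℝ) : Pl :=
  ((c.1 : ℝ) + u.2 * bx (hw R) u.1, (c.2 : ℝ) + u.2 * bY (hw R) u.1)

theorem ch_cont (c : La) (R : ℕ) : Continuous (ch c R) := by
  have h1 := bx_cont (hw R)
  have h2 := bY_cont (hw R)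
  unfold ch
  fun_prop

/-- ports of a box -/
theorem port (c : La) (R : ℕ) {z w : La} (hz : LBox c R z) (hw' : ¬ LBox c R w) (hzw : LAdj z w) :
    ∃ k : ℕ, k < 8 * R + 4 ∧ ∀ s : ℝ, |s| < 1 / 2 → sp z w s = ch c R ((k : ℝ) + 1 / 2 + s, 1) := by
  obtain ⟨z1, z2⟩ := z
  obtain ⟨c1, c2⟩ := c
  have hp := hw_pos R
  obtain ⟨h1, h2⟩ := hz
  simp only [LBox, abs_le, not_and_or, not_le] at *
  rcases hzw with rfl | rfl | rfl | rfl
  · obtain rfl : z1 = c1 + R := by dsimp only at *; omega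
    dsimp only at *
    obtain ⟨k, hk⟩ : ∃ k : ℕ, (k : ℤ) = z2 - c2 + R := ⟨(z2 - c2 + R).toNat, by omega⟩
    refine ⟨k, by omega, fun s hs => ?_⟩
    rw [abs_lt] at hs
    have e : (k : ℝ) = z2 - c2 + R := by exact_mod_cast hk
    have b1 : (0 : ℝ) ≤ k := by positivity
    have b2 : (k : ℝ) ≤ 2 * R := by exact_mod_cast (by omega : k ≤ 2 * R)
    unfold ch sp
    dsimp only
    rw [bx_high1 hp, bY_mid1 hp]
    · unfold hw; ext <;> dsimp only <;> push_cast <;> linarith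
    all_goals ((try unfold hw); linarith)
  · obtain rfl : z1 = c1 - R := by dsimp only at *; omega
    dsimp only at *
    obtain ⟨k, hk⟩ : ∃ k : ℕ, (k : ℤ) = c2 - z2 + 5 * R + 2 := ⟨(c2 - z2 + 5 * R + 2).toNat, by omega⟩
    refine ⟨k, by omega, fun s hs => ?_⟩
    rw [abs_lt] at hs
    have e : (k : ℝ) = c2 - z2 + 5 * R + 2 := by exact_mod_cast hk
    have b1 : (4 * R + 2 : ℝ) ≤ k := by exact_mod_cast (by omega : 4 * R + 2 ≤ k)
    have b2 : (k : ℝ) ≤ 6 * R + 2 := by exact_mod_cast (by omega : k ≤ 6 * R + 2)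
    unfold ch sp
    dsimp only
    rw [bx_low hp, bY_mid2 hp]
    · unfold hw; ext <;> dsimp only <;> push_cast <;> linarith
    all_goals ((try unfold hw); linarith)
  · obtain rfl : z2 = c2 + R := by dsimp only at *; omega
    dsimp only at *
    obtain ⟨k, hk⟩ : ∃ k : ℕ, (k : ℤ) = c1 - z1 + 3 * R + 1 := ⟨(c1 - z1 + 3 * R + 1).toNat, by omega⟩
    refine ⟨k, by omega, fun s hs => ?_⟩
    rw [abs_lt] at hs
    have e : (k : ℝ) = c1 - z1 + 3 * R + 1 := by exact_mod_cast hk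
    have b1 : (2 * R + 1 : ℝ) ≤ k := by exact_mod_cast (by omega : 2 * R + 1 ≤ k)
    have b2 : (k : ℝ) ≤ 4 * R + 1 := by exact_mod_cast (by omega : k ≤ 4 * R + 1)
    unfold ch sp
    dsimp only
    rw [bx_mid1 hp, bY_high1 hp]
    · unfold hw; ext <;> dsimp only <;> push_cast <;> linarith
    all_goals ((try unfold hw); linarith)
  · obtain rfl : z2 = c2 - R := by dsimp only at *; omega
    dsimp only at *
    obtain ⟨k, hk⟩ : ∃ k : ℕ, (k : ℤ) = z1 - c1 + 7 * R + 3 := ⟨(z1 - c1 + 7 * R + 3).toNat, by omega⟩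
    refine ⟨k, by omega, fun s hs => ?_⟩
    rw [abs_lt] at hs
    have e : (k : ℝ) = z1 - c1 + 7 * R + 3 := by exact_mod_cast hk
    have b1 : (6 * R + 3 : ℝ) ≤ k := by exact_mod_cast (by omega : 6 * R + 3 ≤ k)
    have b2 : (k : ℝ) ≤ 8 * R + 3 := by exact_mod_cast (by omega : k ≤ 8 * R + 3)
    unfold ch sp
    dsimp only
    rw [bx_mid2 hp, bY_low1 hp]
    · unfold hw; ext <;> dsimp only <;> push_cast <;> linarith
    all_goals ((try unfold hw); linarith)

/-- admissible perimeter coordinates -/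
def Per (R : ℕ) (c U : ℝ) : Prop := 0 ≤ c ∧ c ≤ 8 * hw R ∧ c ≤ U ∧ U < c + 8 * hw R

theorem ch_rbox {c : La} {R : ℕ} {U ρ : ℝ} (h1 : 0 ≤ U) (h2 : U ≤ 16 * hw R) (h3 : 0 ≤ ρ)
    (h4 : ρ ≤ 1) : RBox c R (ch c R (U, ρ)) := by
  have hp := hw_pos R
  have := b_norm hp h1 h2
  have a1 : |bx (hw R) U| ≤ hw R := (le_max_left _ _).trans this.le
  have a2 : |bY (hw R) U| ≤ hw R := (le_max_right _ _).trans this.le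
  unfold RBox ch
  dsimp only
  rw [add_sub_cancel_left, add_sub_cancel_left, abs_mul, abs_mul, abs_of_nonneg h3]
  change ρ * _ ≤ hw R ∧ _ * _ ≤ hw R
  constructor
  · calc _ ≤ 1 * hw R := mul_le_mul h4 a1 (abs_nonneg _) (by norm_num)
      _ = _ := one_mul _
  · calc _ ≤ 1 * hw R := mul_le_mul h4 a2 (abs_nonneg _) (by norm_num)
      _ = _ := one_mul _

theorem ch_rho {c : La} {R : ℕ} {U ρ U' ρ' : ℝ} (h1 : 0 ≤ U) (h2 : U ≤ 16 * hw R) (h3 : 0 ≤ ρ)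
    (h1' : 0 ≤ U') (h2' : U' ≤ 16 * hw R) (h3' : 0 ≤ ρ')
    (h : ch c R (U, ρ) = ch c R (U', ρ')) : ρ = ρ' := by
  have hp := hw_pos R
  simp only [ch, Prod.mk.injEq, add_right_inj] at h
  obtain ⟨e1, e2⟩ := h
  have a := b_norm hp h1 h2
  have b := b_norm hp h1' h2'
  have : ρ * hw R = ρ' * hw R := by
    calc ρ * hw R = ρ * max |bx (hw R) U| |bY (hw R) U| := by rw [a]
      _ = max (ρ * |bx (hw R) U|) (ρ * |bY (hw R) U|) := mul_max_of_nonneg _ _ h3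
      _ = max |ρ * bx (hw R) U| |ρ * bY (hw R) U| := by rw [abs_mul, abs_mul, abs_of_nonneg h3]
      _ = max |ρ' * bx (hw R) U'| |ρ' * bY (hw R) U'| := by rw [e1, e2]
      _ = max (ρ' * |bx (hw R) U'|) (ρ' * |bY (hw R) U'|) := by
          rw [abs_mul, abs_mul, abs_of_nonneg h3']
      _ = ρ' * max |bx (hw R) U'| |bY (hw R) U'| := (mul_max_of_nonneg _ _ h3').symm
      _ = ρ' * hw R := by rw [b]
  exact mul_right_cancel₀ hp.ne' this

theorem ch_inj {c : La} {R : ℕ} {U ρ U' ρ' c0 : ℝ} (hU : Per R c0 U) (hU' : Per R c0 U')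
    (h3 : 0 < ρ) (h3' : 0 ≤ ρ') (h : ch c R (U, ρ) = ch c R (U', ρ')) : U = U' ∧ ρ = ρ' := by
  have hp := hw_pos R
  obtain ⟨a1, a2, a3, a4⟩ := hU
  obtain ⟨-, -, b3, b4⟩ := hU'
  have e := ch_rho (by linarith) (by linarith) h3.le (by linarith) (by linarith) h3' h
  subst e
  simp only [ch, Prod.mk.injEq, add_right_inj] at h
  refine ⟨b_inj hp (by linarith) (by linarith) (by linarith) (by linarith) (by linarith)
    (by linarith) (mul_left_cancel₀ h3.ne' h.1) (mul_left_cancel₀ h3.ne' h.2), rfl⟩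

theorem ch_zero (c : La) (R : ℕ) (U : ℝ) : ch c R (U, 0) = ((c.1 : ℝ), (c.2 : ℝ)) := by
  simp [ch]

theorem ch_per {c : La} {R : ℕ} {U ρ : ℝ} (h1 : 0 ≤ U) (h2 : U ≤ 8 * hw R) :
    ch c R (U + 8 * hw R, ρ) = ch c R (U, ρ) := by
  obtain ⟨a, b⟩ := b_periodic (hw_pos R) h1 h2
  simp [ch, a, b]

end HB

namespace HB

open Set

/-- step inside a set of cells -/
def CStep (C : Set La) (z w : La) : Prop := LAdj z w ∧ z ∈ C ∧ w ∈ C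

theorem walk_of_conn {C : Set La} {z w : La} (hz : z ∈ C) (h : Relation.ReflTransGen (CStep C) z w) :
    ∃ (L : ℕ) (p : ℕ → La), p 0 = z ∧ p L = w ∧ (∀ i ≤ L, p i ∈ C) ∧
      ∀ i < L, LAdj (p i) (p (i + 1)) := by
  induction h with
  | refl => exact ⟨0, fun _ => z, rfl, rfl, fun _ _ => hz, fun i hi => absurd hi (by omega)⟩
  | @tail b c _ hbc ih =>
    obtain ⟨L, p, h0, hL, hC, ha⟩ := ih
    refine ⟨L + 1, fun i => if i ≤ L then p i else c, by simp [h0], by simp, ?_, ?_⟩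
    · intro i hi
      dsimp only
      split_ifs with h
      · exact hC i h
      · exact hbc.2.2
    · intro i hi
      dsimp only
      rw [if_pos (by omega : i ≤ L)]
      split_ifs with h
      · exact ha i (by omega)
      · obtain rfl : i = L := by omega
        rw [hL]; exact hbc.1

theorem min_walk {C A B : Set La} (h : ∃ (L : ℕ) (p : ℕ → La), p 0 ∈ A ∧ p L ∈ B ∧
      (∀ i ≤ L, p i ∈ C) ∧ ∀ i < L, LAdj (p i) (p (i + 1))) :
    ∃ (L : ℕ) (p : ℕ → La), p 0 ∈ A ∧ p L ∈ B ∧ (∀ i ≤ L, p i ∈ C) ∧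
      (∀ i < L, LAdj (p i) (p (i + 1))) ∧ (∀ i ≤ L, ∀ j ≤ L, p i = p j → i = j) ∧
      (∀ i, 0 < i → i < L → p i ∉ A ∧ p i ∉ B) := by
  classical
  obtain ⟨p, h0, hL, hC, ha⟩ := Nat.find_spec h
  set L := Nat.find h with hLdef
  have hmin : ∀ L' < L, ¬ _ := fun L' hL' => Nat.find_min h hL'
  have key : ∀ i j, i < j → j ≤ L → p i ≠ p j := by
    intro i j hij hj he
    refine hmin (L - (j - i)) (by omega) ⟨fun k => if k ≤ i then p k else p (k + (j - i)), ?_, ?_, ?_, ?_⟩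
    · simp [h0]
    · dsimp only
      split_ifs with h1
      · have : j = L := by omega
        have h2 : L - (j - i) = i := by omega
        rw [h2, he, this]; exact hL
      · rw [show L - (j - i) + (j - i) = L by omega]; exact hL
    · intro k hk
      dsimp only
      split_ifs with h1
      · exact hC k (by omega)
      · exact hC _ (by omega)
    · intro k hk
      dsimp only
      split_ifs with h1 h2 h2
      · exact ha k (by omega)
      · obtain rfl : k = i := by omega
        rw [he, show k + 1 + (j - k) = j + 1 by omega]
        exact ha j (by omega)
      · omega
      · rw [show k + 1 + (j - i) = k + (j - i) + 1 by omega]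
        exact ha _ (by omega)
  refine ⟨L, p, h0, hL, hC, ha, ?_, ?_⟩
  · intro i hi j hj he
    rcases lt_trichotomy i j with h1 | h1 | h1
    · exact absurd he (key i j h1 hj)
    · exact h1
    · exact absurd he.symm (key j i h1 hi)
  · intro i hi hiL
    constructor
    · intro hA
      refine hmin (L - i) (by omega) ⟨fun k => p (k + i), by simpa using hA, ?_, ?_, ?_⟩
      · dsimp only; rw [show L - i + i = L by omega]; exact hL
      · intro k hk; exact hC _ (by omega)
      · intro k hk
        dsimp only
        rw [show k + 1 + i = k + i + 1 by omega]
        exact ha _ (by omega)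
    · intro hB
      exact hmin i hiL ⟨p, h0, hB, fun k hk => hC k (by omega), fun k hk => ha k (by omega)⟩

/-- cell of a scaled point -/
noncomputable def cellOf (N : ℝ) (q : Pl) : La := (round (N * q.1), round (N * q.2))

theorem round_close {x y : ℝ} (h : |x - y| < 1 / 2) :
    round y = round x ∨ round y = round x + 1 ∨ round y = round x - 1 := by
  have a := abs_sub_round x
  have b := abs_sub_round y
  rw [abs_le] at a b
  rw [abs_lt] at h
  have h1 : ((round y : ℤ) : ℝ) < (round x : ℤ) + 2 := by linarith
  have h2 : ((round x : ℤ) : ℝ) < (round y : ℤ) + 2 := by linarith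
  have h1' : round y < round x + 2 := by exact_mod_cast h1
  have h2' : round x < round y + 2 := by exact_mod_cast h2
  omega

/-- cells close to a scaled set -/
def CellsNear (N : ℝ) (K : Set Pl) : Set La :=
  {z | ∃ q ∈ K, |N * q.1 - z.1| ≤ 1 ∧ |N * q.2 - z.2| ≤ 1}

theorem conn_close {N : ℝ} {K : Set Pl} {x y : Pl} (hx : x ∈ K) (hy : y ∈ K)
    (h1 : |N * x.1 - N * y.1| < 1 / 2) (h2 : |N * x.2 - N * y.2| < 1 / 2) :
    Relation.ReflTransGen (CStep (CellsNear N K)) (cellOf N x) (cellOf N y) := by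
  have a1 := abs_sub_round (N * x.1)
  have a2 := abs_sub_round (N * x.2)
  have b1 := abs_sub_round (N * y.1)
  have b2 := abs_sub_round (N * y.2)
  have m1 : ((round (N * x.1), round (N * x.2)) : La) ∈ CellsNear N K :=
    ⟨x, hx, by dsimp only; linarith, by dsimp only; linarith⟩
  have m2 : ((round (N * y.1), round (N * x.2)) : La) ∈ CellsNear N K := by
    refine ⟨x, hx, ?_, by dsimp only; linarith⟩
    dsimp only
    rw [abs_le] at *
    rw [abs_lt] at h1
    constructor <;> linarith
  have m3 : ((round (N * y.1), round (N * y.2)) : La) ∈ CellsNear N K :=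
    ⟨y, hy, by dsimp only; linarith, by dsimp only; linarith⟩
  have s1 : Relation.ReflTransGen (CStep (CellsNear N K)) (round (N * x.1), round (N * x.2))
      (round (N * y.1), round (N * x.2)) := by
    rcases round_close h1 with h | h | h
    · rw [h]
    · exact Relation.ReflTransGen.single ⟨by rw [h]; simp [LAdj], m1, m2⟩
    · exact Relation.ReflTransGen.single ⟨by rw [h]; simp [LAdj], m1, m2⟩
  have s2 : Relation.ReflTransGen (CStep (CellsNear N K)) (round (N * y.1), round (N * x.2))
      (round (N * y.1), round (N * y.2)) := by
    rcases round_close h2 with h | h | h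
    · rw [h]
    · exact Relation.ReflTransGen.single ⟨by rw [h]; simp [LAdj], m2, m3⟩
    · exact Relation.ReflTransGen.single ⟨by rw [h]; simp [LAdj], m2, m3⟩
  exact s1.trans s2

theorem conn_all {N : ℝ} (hN : 0 < N) {K : Set Pl} (hK : IsPreconnected K) {x y : Pl} (hx : x ∈ K)
    (hy : y ∈ K) : Relation.ReflTransGen (CStep (CellsNear N K)) (cellOf N x) (cellOf N y) := by
  refine hK.induction₂ (fun x y => Relation.ReflTransGen (CStep (CellsNear N K)) (cellOf N x) (cellOf N y))
    ?_ ?_ ?_ hx hy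
  · intro x hx
    rw [eventually_nhdsWithin_iff]
    have : ∀ᶠ y in nhds x, Dist.dist y x < 1 / (2 * N) := Metric.ball_mem_nhds x (by positivity)
    filter_upwards [this] with y hyx hy
    have hd : max (Dist.dist y.1 x.1) (Dist.dist y.2 x.2) < 1 / (2 * N) := hyx
    rw [max_lt_iff, Real.dist_eq, Real.dist_eq, lt_div_iff₀ (by positivity), lt_div_iff₀ (by positivity)] at hd
    apply conn_close hx hy
    · rw [← mul_sub, abs_mul, abs_of_pos hN, abs_sub_comm]; linarith [hd.1]
    · rw [← mul_sub, abs_mul, abs_of_pos hN, abs_sub_comm]; linarith [hd.2]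
  · intro x y z _ _ _ h1 h2; exact h1.trans h2
  · intro x y _ _ h
    have := Relation.reflTransGen_swap.mpr h
    exact Relation.ReflTransGen.mono (fun a b hab => ⟨hab.1.symm, hab.2.2, hab.2.1⟩) _ _ this

theorem sep_compact {K K' : Set Pl} (hK : IsCompact K) (hK' : IsCompact K') (hd : Disjoint K K') :
    ∃ r : ℝ, 0 < r ∧ ∀ x ∈ K, ∀ y ∈ K', r < Dist.dist x y := by
  obtain ⟨r, hr, h⟩ := Metric.exists_pos_forall_lt_edist hK hK'.isClosed hd
  refine ⟨r, hr, fun x hx y hy => ?_⟩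
  have := h x hx y hy
  rw [edist_nndist] at this
  rw [← coe_nndist]
  exact_mod_cast this

theorem ev_small {P : ℝ → Prop} {r : ℝ} (hr : 0 < r) (h : ∀ x, 0 < x → x < r → P x) :
    ∀ᶠ x in nhdsWithin (0 : ℝ) (Ioi 0), P x := by
  have : Ioo (0 : ℝ) r ∈ nhdsWithin (0 : ℝ) (Ioi 0) := Ioo_mem_nhdsGT hr
  filter_upwards [this] with x hx using h x hx.1 hx.2

theorem ev_exists {P : ℝ → Prop} (h : ∀ᶠ x in nhdsWithin (0 : ℝ) (Ioi 0), P x) : ∃ x, 0 < x ∧ P x := by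
  obtain ⟨x, hx1, hx2⟩ := (h.and self_mem_nhdsWithin).exists
  exact ⟨x, hx2, hx1⟩

theorem dist_pl (x y : Pl) : Dist.dist x y = max |x.1 - y.1| |x.2 - y.2| := rfl

theorem lbox_near {N : ℝ} (hN : 0 < N) {R : ℕ} {x q : Pl} {z : La}
    (h1 : |N * q.1 - z.1| ≤ 1 ∧ |N * q.2 - z.2| ≤ 1) (h : LBox (cellOf N x) R z) :
    N * Dist.dist q x ≤ R + 3 / 2 := by
  have a1 := abs_sub_round (N * x.1)
  have a2 := abs_sub_round (N * x.2)
  have b1 : |(z.1 : ℝ) - (round (N * x.1) : ℤ)| ≤ R := by exact_mod_cast h.1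
  have b2 : |(z.2 : ℝ) - (round (N * x.2) : ℤ)| ≤ R := by exact_mod_cast h.2
  obtain ⟨c1, c2⟩ := h1
  rw [dist_pl, mul_max_of_nonneg _ _ hN.le, max_le_iff]
  have hh : ∀ t, N * |t| = |N * t| := fun t => by rw [abs_mul, abs_of_pos hN]
  rw [hh, hh, mul_sub, mul_sub]
  rw [abs_le] at a1 a2 b1 b2 c1 c2
  constructor <;> rw [abs_le] <;> constructor <;> linarith

theorem lbox_far {N : ℝ} (hN : 0 < N) {R : ℕ} {x q : Pl} {z : La}
    (h1 : |N * q.1 - z.1| ≤ 1 ∧ |N * q.2 - z.2| ≤ 1) (h : ¬ LBox (cellOf N x) R z) :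
    (R : ℝ) - 1 / 2 ≤ N * Dist.dist q x := by
  by_contra hc
  push Not at hc
  apply h
  have a1 := abs_sub_round (N * x.1)
  have a2 := abs_sub_round (N * x.2)
  rw [dist_pl, mul_max_of_nonneg _ _ hN.le, max_lt_iff] at hc
  have hh : ∀ t, N * |t| = |N * t| := fun t => by rw [abs_mul, abs_of_pos hN]
  rw [hh, hh, mul_sub, mul_sub] at hc
  obtain ⟨c1, c2⟩ := h1
  obtain ⟨d1, d2⟩ := hc
  rw [abs_le] at a1 a2 c1 c2
  rw [abs_lt] at d1 d2
  constructor
  · have e1 : ((z.1 : ℤ) : ℝ) < (round (N * x.1) : ℤ) + R + 1 := by linarith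
    have e2 : ((round (N * x.1) : ℤ) : ℝ) < z.1 + R + 1 := by linarith
    have e1' : z.1 < round (N * x.1) + R + 1 := by exact_mod_cast e1
    have e2' : round (N * x.1) < z.1 + R + 1 := by exact_mod_cast e2
    change |z.1 - round (N * x.1)| ≤ R
    rw [abs_le]; omega
  · have e1 : ((z.2 : ℤ) : ℝ) < (round (N * x.2) : ℤ) + R + 1 := by linarith
    have e2 : ((round (N * x.2) : ℤ) : ℝ) < z.2 + R + 1 := by linarith
    have e1' : z.2 < round (N * x.2) + R + 1 := by exact_mod_cast e1
    have e2' : round (N * x.2) < z.2 + R + 1 := by exact_mod_cast e2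
    change |z.2 - round (N * x.2)| ≤ R
    rw [abs_le]; omega

/-- centers far apart -/
def FarApart (R : ℕ) (a b : La) : Prop := 2 * (R : ℤ) + 3 ≤ |a.1 - b.1| ∨ 2 * (R : ℤ) + 3 ≤ |a.2 - b.2|

theorem farApart_of {N : ℝ} (hN : 0 < N) {R : ℕ} {x y : Pl} (h : 2 * (R : ℝ) + 4 ≤ N * Dist.dist x y) :
    FarApart R (cellOf N x) (cellOf N y) := by
  by_contra hc
  unfold FarApart at hc
  push Not at hc
  obtain ⟨h1, h2⟩ := hc
  simp only [cellOf] at h1 h2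
  have h1' : |((round (N * x.1) : ℤ) : ℝ) - (round (N * y.1) : ℤ)| < 2 * (R : ℝ) + 3 := by exact_mod_cast h1
  have h2' : |((round (N * x.2) : ℤ) : ℝ) - (round (N * y.2) : ℤ)| < 2 * (R : ℝ) + 3 := by exact_mod_cast h2
  have a1 := abs_sub_round (N * x.1)
  have a2 := abs_sub_round (N * x.2)
  have b1 := abs_sub_round (N * y.1)
  have b2 := abs_sub_round (N * y.2)
  rw [abs_lt] at h1' h2'
  rw [abs_le] at a1 a2 b1 b2
  have : N * Dist.dist x y < 2 * (R : ℝ) + 4 := by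
    rw [dist_pl, mul_max_of_nonneg _ _ hN.le, max_lt_iff]
    have hh : ∀ t, N * |t| = |N * t| := fun t => by rw [abs_mul, abs_of_pos hN]
    rw [hh, hh, mul_sub, mul_sub, abs_lt, abs_lt]
    refine ⟨⟨?_, ?_⟩, ⟨?_, ?_⟩⟩ <;> linarith
  linarith

/-- Discretization of a finite family of arcs. -/
theorem discretize {W ι : Type*} [Finite W] [Finite ι] (w : W → Pl) (hw : Function.Injective w)
    (K : ι → Set Pl) (hKc : ∀ σ, IsCompact (K σ)) (hKp : ∀ σ, IsPreconnected (K σ))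
    (u v : ι → W) (huv : ∀ σ, u σ ≠ v σ) (hu : ∀ σ, w (u σ) ∈ K σ) (hv : ∀ σ, w (v σ) ∈ K σ)
    (honly : ∀ σ c, w c ∈ K σ → c = u σ ∨ c = v σ)
    (hdis : ∀ σ σ', σ ≠ σ' → ∀ q ∈ K σ, q ∈ K σ' → ∃ c, q = w c) :
    ∃ (cen : W → La) (R : ℕ) (p : ι → ℕ → La) (L : ι → ℕ),
      (∀ c c', c ≠ c' → FarApart R (cen c) (cen c')) ∧
      ∀ σ, LPath (p σ) (L σ) ∧ LBox (cen (u σ)) R (p σ 0) ∧ LBox (cen (v σ)) R (p σ (L σ)) ∧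
        (∀ c i, 0 < i → i < L σ → ¬ LBox (cen c) R (p σ i)) ∧
        (∀ σ', σ ≠ σ' → ∀ i j, 0 < i → i < L σ → 0 < j → j < L σ' → p σ i ≠ p σ' j) := by
  -- choose ρ
  obtain ⟨ρ, hρ, hρ1, hρ2⟩ : ∃ ρ : ℝ, 0 < ρ ∧ (∀ c c', c ≠ c' → 10 * ρ < Dist.dist (w c) (w c')) ∧
      (∀ σ c, c ≠ u σ → c ≠ v σ → ∀ q ∈ K σ, 10 * ρ < Dist.dist q (w c)) := by
    apply ev_exists
    refine Filter.Eventually.and ?_ ?_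
    · rw [Filter.eventually_all]; intro c
      rw [Filter.eventually_all]; intro c'
      by_cases h : c = c'
      · exact Filter.Eventually.of_forall fun x hx => absurd h hx
      · have hd : 0 < Dist.dist (w c) (w c') := _root_.dist_pos.mpr fun he => h (hw he)
        exact ev_small (r := Dist.dist (w c) (w c') / 10) (by positivity) (fun x _ hx _ => by linarith)
    · rw [Filter.eventually_all]; intro σ
      rw [Filter.eventually_all]; intro c
      by_cases h : w c ∈ K σ
      · refine Filter.Eventually.of_forall fun x h1 h2 => ?_
        rcases honly σ c h with h | h
        · exact absurd h h1
        · exact absurd h h2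
      · obtain ⟨r, hr, hh⟩ := sep_compact (hKc σ) (isCompact_singleton (x := w c))
          (by rw [Set.disjoint_singleton_right]; exact h)
        exact ev_small (r := r / 10) (by positivity)
          (fun x _ hx _ _ q hq => by have := hh q hq (w c) rfl; linarith)
  obtain ⟨δ, hδ, hδ1⟩ : ∃ δ : ℝ, 0 < δ ∧ (∀ σ σ', σ ≠ σ' → ∀ q ∈ K σ, ∀ q' ∈ K σ',
      (∀ c, ρ / 2 ≤ Dist.dist q (w c)) → (∀ c, ρ / 2 ≤ Dist.dist q' (w c)) → δ < Dist.dist q q') := by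
    apply ev_exists
    rw [Filter.eventually_all]; intro σ
    rw [Filter.eventually_all]; intro σ'
    by_cases h : σ = σ'
    · exact Filter.Eventually.of_forall fun x hx => absurd h hx
    · have hcl : IsClosed {q : Pl | ∀ c, ρ / 2 ≤ Dist.dist q (w c)} := by
        rw [Set.ofPred_forall]
        exact isClosed_iInter fun c => isClosed_le continuous_const (by fun_prop)
      obtain ⟨r, hr, hh⟩ := sep_compact ((hKc σ).inter_right hcl) ((hKc σ').inter_right hcl) (by
        rw [Set.disjoint_left]
        rintro q ⟨h1, h2⟩ ⟨h3, -⟩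
        obtain ⟨c, rfl⟩ := hdis σ σ' h q h1 h3
        have := h2 c
        rw [_root_.dist_self] at this
        linarith)
      exact ev_small hr (fun x _ hx _ q hq q' hq' a b => by
        have := hh q ⟨hq, a⟩ q' ⟨hq', b⟩; linarith)
  obtain ⟨N, hN⟩ := exists_nat_gt (max (100 / ρ) (4 / δ))
  rw [max_lt_iff, div_lt_iff₀ hρ, div_lt_iff₀ hδ] at hN
  obtain ⟨hN1, hN2⟩ := hN
  have hN0 : (0 : ℝ) < N := by
    by_contra hc
    have : (N : ℝ) * ρ ≤ 0 := mul_nonpos_of_nonpos_of_nonneg (by linarith) hρ.le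
    linarith
  set R := ⌈(N : ℝ) * ρ⌉₊ with hR
  have hR1 : (N : ℝ) * ρ ≤ R := Nat.le_ceil _
  have hR2 : (R : ℝ) < N * ρ + 1 := Nat.ceil_lt_add_one (by positivity)
  let cen : W → La := fun c => cellOf N (w c)
  have hself : ∀ (K : Set Pl) q, q ∈ K → cellOf N q ∈ CellsNear N K := fun K q hq =>
    ⟨q, hq, (abs_sub_round _).trans (by norm_num), (abs_sub_round _).trans (by norm_num)⟩
  have hbox : ∀ c, LBox (cen c) R (cen c) := fun c => by simp [LBox]
  have hfar : ∀ c c', c ≠ c' → FarApart R (cen c) (cen c') := by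
    intro c c' h
    apply farApart_of hN0
    have := mul_lt_mul_of_pos_left (hρ1 c c' h) hN0
    linarith
  have hex : ∀ σ, ∃ (L : ℕ) (p : ℕ → La), p 0 ∈ {z | LBox (cen (u σ)) R z} ∧
      p L ∈ {z | LBox (cen (v σ)) R z} ∧ (∀ i ≤ L, p i ∈ CellsNear N (K σ)) ∧
      (∀ i < L, LAdj (p i) (p (i + 1))) ∧ (∀ i ≤ L, ∀ j ≤ L, p i = p j → i = j) ∧
      (∀ i, 0 < i → i < L → p i ∉ {z | LBox (cen (u σ)) R z} ∧ p i ∉ {z | LBox (cen (v σ)) R z}) := by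
    intro σ
    apply min_walk
    obtain ⟨L, p, h0, hL, hC, ha⟩ := walk_of_conn (hself _ _ (hu σ)) (conn_all hN0 (hKp σ) (hu σ) (hv σ))
    refine ⟨L, p, ?_, ?_, hC, ha⟩
    · rw [h0]; exact hbox _
    · rw [hL]; exact hbox _
  choose L p h0 hL hC ha hinj hinner using hex
  have hnob : ∀ σ c i, 0 < i → i < L σ → ¬ LBox (cen c) R (p σ i) := by
    intro σ c i hi hiL hb
    by_cases h1 : c = u σ
    · rw [h1] at hb; exact (hinner σ i hi hiL).1 hb
    by_cases h2 : c = v σ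
    · rw [h2] at hb; exact (hinner σ i hi hiL).2 hb
    obtain ⟨q, hq, hq'⟩ := hC σ i hiL.le
    have e1 := lbox_near hN0 hq' hb
    have e2 := mul_lt_mul_of_pos_left (hρ2 σ c h1 h2 q hq) hN0
    linarith
  refine ⟨cen, R, p, L, hfar, fun σ => ⟨⟨?_, ha σ, hinj σ⟩, h0 σ, hL σ, hnob σ, ?_⟩⟩
  · by_contra hc
    have f := hfar _ _ (huv σ)
    have b0 : LBox _ R _ := h0 σ
    have bL : LBox _ R _ := hL σ
    have hL01 : L σ = 0 ∨ L σ = 1 := by omega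
    unfold FarApart at f
    unfold LBox at b0 bL
    rcases hL01 with h | h
    · rw [h] at bL
      simp only [abs_le, le_abs] at *
      omega
    · have hadj := ha σ 0 (by omega)
      rw [h] at bL
      simp only [abs_le, le_abs, LAdj, zero_add, Prod.ext_iff] at *
      omega
  · intro σ' hne i j hi hiL hj hjL he
    obtain ⟨q, hq, hq1⟩ := hC σ i hiL.le
    obtain ⟨q', hq', hq1'⟩ := hC σ' j hjL.le
    have key : ∀ σ i q, 0 < i → i < L σ → (|(N : ℝ) * q.1 - (p σ i).1| ≤ 1 ∧ |(N : ℝ) * q.2 - (p σ i).2| ≤ 1) →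
        ∀ c, ρ / 2 ≤ Dist.dist q (w c) := by
      intro σ i q h1 h2 h3 c
      have := lbox_far hN0 h3 (hnob σ c i h1 h2)
      by_contra hcc
      push Not at hcc
      have := mul_lt_mul_of_pos_left hcc hN0
      linarith
    have hd := hδ1 σ σ' hne q hq q' hq' (key σ i q hi hiL hq1) (key σ' j q' hj hjL hq1')
    have h2 : (N : ℝ) * Dist.dist q q' ≤ 2 := by
      rw [← he] at hq1'
      obtain ⟨c1, c2⟩ := hq1
      obtain ⟨d1, d2⟩ := hq1'
      have hh : ∀ t : ℝ, (N : ℝ) * |t| = |N * t| := fun t => by rw [abs_mul, abs_of_pos hN0]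
      rw [dist_pl, mul_max_of_nonneg _ _ hN0.le, max_le_iff, hh, hh, mul_sub, mul_sub]
      rw [abs_le] at c1 c2 d1 d2
      rw [abs_le, abs_le]
      refine ⟨⟨?_, ?_⟩, ⟨?_, ?_⟩⟩ <;> linarith
    have := mul_lt_mul_of_pos_left hd hN0
    linarith

end HB

namespace HB

open Set

variable {V : Type}

/-- oriented edges -/
abbrev OE (G : SimpleGraph V) (o : V → ℕ) := {e : V × V // G.Adj e.1 e.2 ∧ o e.1 < o e.2}

/-- planarized lattice version of a drawing -/
structure Plan {G : SimpleGraph V} (D : Drawing G) (o : V → ℕ) where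
  W : Type
  vtx : V → W
  vtx_inj : Function.Injective vtx
  n : OE G o → ℕ
  n_pos : ∀ e, 0 < n e
  node : OE G o → ℕ → W
  node_zero : ∀ e, node e 0 = vtx e.1.1
  node_last : ∀ e, node e (n e) = vtx e.1.2
  node_inj : ∀ e i j, i ≤ n e → j ≤ n e → node e i = node e j → i = j
  node_int : ∀ e i a, 0 < i → i < n e → node e i ≠ vtx a
  node_cr : ∀ e f i j, e ≠ f → 0 < i → i < n e → 0 < j → j < n f → node e i = node f j →
    X D e.1.1 e.1.2 f.1.1 f.1.2
  node_once : ∀ e f i j i' j', e ≠ f → 0 < i → i < n e → 0 < j → j < n f → 0 < i' → i' < n e →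
    0 < j' → j' < n f → node e i = node f j → node e i' = node f j' → i = i'
  node_tri : ∀ e f g i j l, e ≠ f → e ≠ g → f ≠ g → 0 < i → i < n e → 0 < j → j < n f → 0 < l →
    l < n g → node e i = node f j → node e i = node g l → False
  cen : W → La
  R : ℕ
  p : OE G o → ℕ → ℕ → La
  L : OE G o → ℕ → ℕ
  far : ∀ c c', c ≠ c' → FarApart R (cen c) (cen c')
  path : ∀ e i, i < n e → LPath (p e i) (L e i)
  box0 : ∀ e i, i < n e → LBox (cen (node e i)) R (p e i 0)
  box1 : ∀ e i, i < n e → LBox (cen (node e (i + 1))) R (p e i (L e i))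
  nobox : ∀ e i, i < n e → ∀ c t, 0 < t → t < L e i → ¬ LBox (cen c) R (p e i t)
  disj : ∀ e i f j, i < n e → j < n f → (e ≠ f ∨ i ≠ j) → ∀ t t', 0 < t → t < L e i → 0 < t' →
    t' < L f j → p e i t ≠ p f j t'

theorem sorted_times {S : Set ℝ} (hS : S.Finite) (h0 : (0 : ℝ) ∈ S) (h1 : (1 : ℝ) ∈ S)
    (hI : S ⊆ Icc 0 1) : ∃ (n : ℕ) (τ : ℕ → ℝ), 0 < n ∧ τ 0 = 0 ∧ τ n = 1 ∧
      (∀ i j, i < j → j ≤ n → τ i < τ j) ∧ ∀ t, t ∈ S ↔ ∃ i ≤ n, t = τ i := by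
  classical
  set s := hS.toFinset with hs
  have m : ∀ t, t ∈ s ↔ t ∈ S := fun t => by simp [hs]
  have hc : 1 < s.card := Finset.one_lt_card.mpr ⟨0, (m 0).2 h0, 1, (m 1).2 h1, by norm_num⟩
  let f := s.orderEmbOfFin (k := s.card) rfl
  have hr : ∀ t, t ∈ S ↔ ∃ i, f i = t := by
    intro t
    have := Finset.range_orderEmbOfFin s (k := s.card) rfl
    rw [← m, ← Finset.mem_coe, ← this]; rfl
  let τ : ℕ → ℝ := fun i => if h : i < s.card then f ⟨i, h⟩ else 0
  have hτ : ∀ i (h : i < s.card), τ i = f ⟨i, h⟩ := fun i h => dif_pos h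
  have hmono : ∀ i j, i < j → j ≤ s.card - 1 → τ i < τ j := by
    intro i j hij hj
    rw [hτ i (by omega), hτ j (by omega)]
    exact f.strictMono (by simpa using hij)
  have hmem : ∀ t, t ∈ S ↔ ∃ i ≤ s.card - 1, t = τ i := by
    intro t
    rw [hr]
    constructor
    · rintro ⟨i, rfl⟩
      exact ⟨i.1, by omega, by rw [hτ i.1 i.2]⟩
    · rintro ⟨i, hi, rfl⟩
      exact ⟨⟨i, by omega⟩, (hτ i (by omega)).symm⟩
  refine ⟨s.card - 1, τ, by omega, ?_, ?_, hmono, hmem⟩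
  · obtain ⟨i, hi, h⟩ := (hmem 0).1 h0
    have h2 : τ 0 ∈ S := (hmem _).2 ⟨0, by omega, rfl⟩
    have := (hI h2).1
    by_contra hne
    have hi0 : 0 < i := by
      rcases Nat.eq_zero_or_pos i with rfl | h'
      · exact absurd h.symm hne
      · exact h'
    have := hmono 0 i hi0 hi
    linarith
  · obtain ⟨i, hi, h⟩ := (hmem 1).1 h1
    have h2 : τ (s.card - 1) ∈ S := (hmem _).2 ⟨_, le_rfl, rfl⟩
    have := (hI h2).2
    by_contra hne
    have hi0 : i < s.card - 1 := by
      rcases hi.eq_or_lt with rfl | h'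
      · exact absurd h.symm hne
      · exact h'
    have := hmono i _ hi0 le_rfl
    linarith

theorem oe_ne_sym {G : SimpleGraph V} {o : V → ℕ} {e f : OE G o} (h : e ≠ f) :
    s(e.1.1, e.1.2) ≠ s(f.1.1, f.1.2) := by
  intro he
  rw [Sym2.eq_iff] at he
  rcases he with ⟨h1, h2⟩ | ⟨h1, h2⟩
  · exact h (Subtype.ext (Prod.ext h1 h2))
  · have a := e.2.2
    have b := f.2.2
    rw [h1, h2] at a
    omega

theorem exists_plan [Finite V] {G : SimpleGraph V} (D : Drawing G) (hD : D.IsGood) (o : V → ℕ) :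
    Nonempty (Plan D o) := by
  classical
  -- crossing points
  let CP : Set Pl := {q | ∃ e f : OE G o, D.IsCrossing s(e.1.1, e.1.2) s(f.1.1, f.1.2) q}
  have hCP : CP.Finite := by
    have : CP = ⋃ e : OE G o, ⋃ f : OE G o, {q | D.IsCrossing s(e.1.1, e.1.2) s(f.1.1, f.1.2) q} := by
      ext q; simp [CP]
    rw [this]
    exact Set.finite_iUnion fun e => Set.finite_iUnion fun f => (hD.cross_once _ _).finite
  let Ws : Set Pl := range D.pos ∪ CP
  have hWs : Ws.Finite := (Set.finite_range _).union hCP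
  have : Finite Ws := hWs
  -- geometry of interior points
  have hinner : ∀ (e : OE G o) t, 0 < t → t < 1 → D.arc e.1.1 e.1.2 t ∉ range D.pos := by
    rintro e t h0 h1 ⟨a, ha⟩
    have hm : t ∈ Icc (0 : ℝ) 1 := ⟨h0.le, h1.le⟩
    by_cases h2 : a = e.1.1
    · rw [h2, ← D.arc_zero e.2.1] at ha
      have := hD.arc_inj e.2.1 (by simp) hm ha
      linarith
    by_cases h3 : a = e.1.2
    · rw [h3, ← D.arc_one e.2.1] at ha
      have := hD.arc_inj e.2.1 (by simp) hm ha
      linarith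
    exact D.arc_avoid e.2.1 a h2 h3 ⟨t, hm, ha.symm⟩
  have hcross : ∀ (e f : OE G o) q, e ≠ f → q ∈ es D e.1.1 e.1.2 → q ∈ es D f.1.1 f.1.2 →
      q ∉ range D.pos → D.IsCrossing s(e.1.1, e.1.2) s(f.1.1, f.1.2) q := by
    intro e f q hne h1 h2 h3
    rw [isCrossing_iff]
    exact ⟨e.2.1, f.2.1, oe_ne_sym hne, h1, h2, fun h => h3 ⟨_, h.symm⟩, fun h => h3 ⟨_, h.symm⟩,
      fun h => h3 ⟨_, h.symm⟩, fun h => h3 ⟨_, h.symm⟩⟩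
  -- times
  have htimes : ∀ e : OE G o, ∃ (n : ℕ) (τ : ℕ → ℝ), 0 < n ∧ τ 0 = 0 ∧ τ n = 1 ∧
      (∀ i j, i < j → j ≤ n → τ i < τ j) ∧
      ∀ t, (t ∈ Icc (0 : ℝ) 1 ∧ D.arc e.1.1 e.1.2 t ∈ Ws) ↔ ∃ i ≤ n, t = τ i := by
    intro e
    refine sorted_times (S := {t | t ∈ Icc (0 : ℝ) 1 ∧ D.arc e.1.1 e.1.2 t ∈ Ws}) ?_ ?_ ?_ ?_
    · refine Set.Finite.of_finite_image (f := D.arc e.1.1 e.1.2) (hWs.subset ?_) ?_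
      · rintro _ ⟨t, ht, rfl⟩; exact ht.2
      · exact (hD.arc_inj e.2.1).mono fun t ht => ht.1
    · exact ⟨by simp, Or.inl ⟨_, (D.arc_zero e.2.1).symm⟩⟩
    · exact ⟨by simp, Or.inl ⟨_, (D.arc_one e.2.1).symm⟩⟩
    · exact fun t ht => ht.1
  choose n τ hn hτ0 hτ1 hτm hτS using htimes
  have hτI : ∀ e i, i ≤ n e → τ e i ∈ Icc (0 : ℝ) 1 := fun e i hi => ((hτS e _).2 ⟨i, hi, rfl⟩).1
  have hτW : ∀ e i, i ≤ n e → D.arc e.1.1 e.1.2 (τ e i) ∈ Ws := fun e i hi => ((hτS e _).2 ⟨i, hi, rfl⟩).2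
  have hτinj : ∀ e i j, i ≤ n e → j ≤ n e → τ e i = τ e j → i = j := by
    intro e i j hi hj h
    rcases lt_trichotomy i j with h1 | h1 | h1
    · have := hτm e i j h1 hj; linarith
    · exact h1
    · have := hτm e j i h1 hi; linarith
  have hτint : ∀ e i, 0 < i → i < n e → 0 < τ e i ∧ τ e i < 1 := by
    intro e i h1 h2
    have a := hτm e 0 i h1 h2.le
    have b := hτm e i (n e) h2 le_rfl
    rw [hτ0] at a; rw [hτ1] at b
    exact ⟨a, b⟩
  let node : OE G o → ℕ → Ws := fun e i =>
    if h : i ≤ n e then ⟨D.arc e.1.1 e.1.2 (τ e i), hτW e i h⟩ else ⟨D.pos e.1.1, Or.inl ⟨_, rfl⟩⟩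
  have hnode : ∀ e i, i ≤ n e → (node e i : Pl) = D.arc e.1.1 e.1.2 (τ e i) := by
    intro e i h; simp only [node, dif_pos h]
  have hnes : ∀ e i, i ≤ n e → (node e i : Pl) ∈ es D e.1.1 e.1.2 := by
    intro e i h; rw [hnode e i h]; exact ⟨_, hτI e i h, rfl⟩
  have hnodeinj : ∀ e i j, i ≤ n e → j ≤ n e → node e i = node e j → i = j := by
    intro e i j hi hj h
    have h' : (node e i : Pl) = node e j := by rw [h]
    rw [hnode e i hi, hnode e j hj] at h'
    exact hτinj e i j hi hj (hD.arc_inj e.2.1 (hτI e i hi) (hτI e j hj) h')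
  have hnint : ∀ e i, 0 < i → i < n e → (node e i : Pl) ∉ range D.pos := by
    intro e i h1 h2
    rw [hnode e i h2.le]
    exact hinner e _ (hτint e i h1 h2).1 (hτint e i h1 h2).2
  have hncr : ∀ e f i j, e ≠ f → 0 < i → i < n e → j < n f → node e i = node f j →
      D.IsCrossing s(e.1.1, e.1.2) s(f.1.1, f.1.2) (node e i : Pl) := by
    intro e f i j hne h1 h2 h3 h4
    refine hcross e f _ hne (hnes e i h2.le) ?_ (hnint e i h1 h2)
    rw [h4]; exact hnes f j h3.le
  -- pieces
  let ι := Σ e : OE G o, Fin (n e)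
  let K : ι → Set Pl := fun σ => D.arc σ.1.1.1 σ.1.1.2 '' Icc (τ σ.1 σ.2) (τ σ.1 (σ.2 + 1))
  have hsub : ∀ σ : ι, Icc (τ σ.1 σ.2) (τ σ.1 (σ.2 + 1)) ⊆ Icc (0 : ℝ) 1 := by
    rintro ⟨e, i, hi⟩ t ⟨h1, h2⟩
    have a := (hτI e i hi.le).1
    have b := (hτI e (i + 1) hi).2
    dsimp only at h1 h2
    exact ⟨by linarith, by linarith⟩
  have hKes : ∀ σ, K σ ⊆ es D σ.1.1.1 σ.1.1.2 := fun σ => Set.image_mono (hsub σ)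
  have hcont : ∀ σ : ι, ContinuousOn (D.arc σ.1.1.1 σ.1.1.2) (Icc (τ σ.1 σ.2) (τ σ.1 (σ.2 + 1))) :=
    fun σ => (D.arc_cont σ.1.2.1).mono (hsub σ)
  obtain ⟨cen, R, p, L, hfar, hp⟩ := discretize (W := Ws) (ι := ι) (fun c => c.1) Subtype.val_injective K
    (fun σ => isCompact_Icc.image_of_continuousOn (hcont σ))
    (fun σ => isPreconnected_Icc.image _ (hcont σ))
    (fun σ => node σ.1 σ.2) (fun σ => node σ.1 (σ.2 + 1))
    (by
      rintro ⟨e, i, hi⟩ h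
      have := hnodeinj e i (i + 1) hi.le hi h
      omega)
    (by
      rintro ⟨e, i, hi⟩
      dsimp only [K]
      rw [hnode e i hi.le]
      exact ⟨_, ⟨le_rfl, (hτm e i (i + 1) (by omega) hi).le⟩, rfl⟩)
    (by
      rintro ⟨e, i, hi⟩
      dsimp only [K]
      rw [hnode e (i + 1) hi]
      exact ⟨_, ⟨(hτm e i (i + 1) (by omega) hi).le, le_rfl⟩, rfl⟩)
    (by
      rintro ⟨e, i, hi⟩ c ⟨t, ht, hc⟩
      dsimp only at *
      obtain ⟨j, hj, rfl⟩ := (hτS e t).1 ⟨hsub ⟨e, i, hi⟩ ht, by rw [hc]; exact c.2⟩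
      have h1 : i ≤ j := by
        by_contra h
        have := hτm e j i (by omega) hi.le
        linarith [ht.1]
      have h2 : j ≤ i + 1 := by
        by_contra h
        have := hτm e (i + 1) j (by omega) hj
        linarith [ht.2]
      have : j = i ∨ j = i + 1 := by omega
      rcases this with rfl | rfl
      · left; apply Subtype.ext; rw [hnode e j hj]; exact hc.symm
      · right; apply Subtype.ext; rw [hnode e _ hj]; exact hc.symm)
    (by
      intro σ σ' hne q hq hq'
      by_cases h : σ.1 = σ'.1
      · obtain ⟨e, i, hi⟩ := σ
        obtain ⟨e', j, hj⟩ := σ'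
        dsimp only at h
        subst h
        have hij : i ≠ j := by rintro rfl; exact hne rfl
        obtain ⟨t, ht, rfl⟩ := hq
        obtain ⟨t', ht', he⟩ := hq'
        have := hD.arc_inj e.2.1 (hsub ⟨e, j, hj⟩ ht') (hsub ⟨e, i, hi⟩ ht) he
        subst this
        dsimp only at *
        rcases lt_or_gt_of_ne hij with h1 | h1
        · have h3 : τ e (i + 1) ≤ τ e j := by
            rcases (by omega : i + 1 = j ∨ i + 1 < j) with h4 | h4
            · rw [h4]
            · exact (hτm e _ _ h4 hj.le).le
          have : t' = τ e j := le_antisymm (by linarith [ht.2]) ht'.1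
          exact ⟨⟨_, hτW e j hj.le⟩, by rw [this]⟩
        · have h3 : τ e (j + 1) ≤ τ e i := by
            rcases (by omega : j + 1 = i ∨ j + 1 < i) with h4 | h4
            · rw [h4]
            · exact (hτm e _ _ h4 hi.le).le
          have : t' = τ e i := le_antisymm (by linarith [ht'.2]) ht.1
          exact ⟨⟨_, hτW e i hi.le⟩, by rw [this]⟩
      · by_cases h2 : q ∈ range D.pos
        · exact ⟨⟨q, Or.inl h2⟩, rfl⟩
        · exact ⟨⟨q, Or.inr ⟨_, _, hcross _ _ q h (hKes σ hq) (hKes σ' hq') h2⟩⟩, rfl⟩)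
  exact ⟨{
    W := Ws
    vtx := fun a => ⟨D.pos a, Or.inl ⟨a, rfl⟩⟩
    vtx_inj := fun a b h => D.pos_inj (congrArg Subtype.val h)
    n := n
    n_pos := hn
    node := node
    node_zero := fun e => Subtype.ext (by rw [hnode e 0 (by omega), hτ0]; exact D.arc_zero e.2.1)
    node_last := fun e => Subtype.ext (by rw [hnode e _ le_rfl, hτ1]; exact D.arc_one e.2.1)
    node_inj := hnodeinj
    node_int := fun e i a h1 h2 h => hnint e i h1 h2 (by rw [h]; exact ⟨a, rfl⟩)
    node_cr := fun e f i j h1 h2 h3 _ h5 h6 => ⟨_, hncr e f i j h1 h2 h3 h5 h6⟩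
    node_once := fun e f i j i' j' h1 h2 h3 _ h5 h6 h7 _ h9 h10 h11 =>
      hnodeinj e i i' h3.le h7.le (Subtype.ext (hD.cross_once _ _ (hncr e f i j h1 h2 h3 h5 h10)
        (hncr e f i' j' h1 h6 h7 h9 h11)))
    node_tri := fun e f g i j l h1 h2 h3 a1 a2 b1 b2 c1 c2 h4 h5 =>
      hD.no_triple _ _ _ _ (oe_ne_sym h1) (oe_ne_sym h2) (oe_ne_sym h3)
        ⟨hncr e f i j h1 a1 a2 b2 h4,
        by rw [h4]; exact hncr f g j l h3 b1 b2 c2 (h4.symm.trans h5), hncr e g i l h2 a1 a2 c2 h5⟩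
    cen := cen
    R := R
    p := fun e i => if h : i < n e then p ⟨e, i, h⟩ else fun _ => (0, 0)
    L := fun e i => if h : i < n e then L ⟨e, i, h⟩ else 0
    far := hfar
    path := fun e i h => by simp only [dif_pos h]; exact (hp ⟨e, i, h⟩).1
    box0 := fun e i h => by simp only [dif_pos h]; exact (hp ⟨e, i, h⟩).2.1
    box1 := fun e i h => by simp only [dif_pos h]; exact (hp ⟨e, i, h⟩).2.2.1
    nobox := fun e i h => by simp only [dif_pos h]; exact (hp ⟨e, i, h⟩).2.2.2.1
    disj := fun e i f j h h' hne => by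
      simp only [dif_pos h, dif_pos h']
      refine (hp ⟨e, i, h⟩).2.2.2.2 ⟨f, j, h'⟩ ?_
      intro hc
      rcases hne with h1 | h1
      · exact h1 (congrArg Sigma.fst hc)
      · apply h1
        have h2 := congrArg (fun σ : ι => (σ.2 : ℕ)) hc
        exact h2 }⟩

end HB

namespace HB

open Set

theorem isArc_empty_false {p q : Pl} (h : IsArc ∅ p q) : False := h.left_mem

/-- A good drawing from a family of wires. -/
theorem exists_good {V Ω : Type*} [Nonempty Ω] (G : SimpleGraph V) (pos : V → Pl) (hpos : Function.Injective pos)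
    (src tgt : Ω → V) (S : Ω → Set Pl)
    (hcov : ∀ a b, G.Adj a b → ∃ ω, s(src ω, tgt ω) = s(a, b))
    (hadj : ∀ ω, G.Adj (src ω) (tgt ω))
    (hinj : ∀ ω ω', s(src ω, tgt ω) = s(src ω', tgt ω') → ω = ω')
    (harc : ∀ ω, IsArc (S ω) (pos (src ω)) (pos (tgt ω)))
    (havoid : ∀ ω c, c ≠ src ω → c ≠ tgt ω → pos c ∉ S ω)
    (hsh : ∀ ω ω', ω ≠ ω' → ∀ v, v ∈ s(src ω, tgt ω) → v ∈ s(src ω', tgt ω') →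
      ∀ q, q ∈ S ω → q ∈ S ω' → q = pos v)
    (honce : ∀ ω ω', ω ≠ ω' → (∀ v, v ∈ s(src ω, tgt ω) → v ∉ s(src ω', tgt ω')) →
      (S ω ∩ S ω').Subsingleton)
    (htri : ∀ ω ω' ω'', ω ≠ ω' → ω ≠ ω'' → ω' ≠ ω'' →
      (∀ v, v ∈ s(src ω, tgt ω) → v ∉ s(src ω', tgt ω')) →
      (∀ v, v ∈ s(src ω, tgt ω) → v ∉ s(src ω'', tgt ω'')) →
      (∀ v, v ∈ s(src ω', tgt ω') → v ∉ s(src ω'', tgt ω'')) →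
      ∀ q, q ∈ S ω → q ∈ S ω' → q ∈ S ω'' → False) :
    ∃ D : Drawing G, D.IsGood ∧ ∀ ω ω', X D (src ω) (tgt ω) (src ω') (tgt ω') →
      ω ≠ ω' ∧ (S ω ∩ S ω').Nonempty ∧ (∀ v, v ∈ s(src ω, tgt ω) → v ∉ s(src ω', tgt ω')) := by
  classical
  choose! w hw using hcov
  let S' : V → V → Set Pl := fun a b => S (w a b)
  have hws : ∀ a b, G.Adj a b → w a b = w b a := fun a b h => hinj _ _ (by
    rw [hw a b h, hw b a h.symm, Sym2.eq_swap])
  have hww : ∀ ω, w (src ω) (tgt ω) = ω := fun ω => hinj _ _ (hw _ _ (hadj ω))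
  obtain ⟨D, hp, hS, hI⟩ := exists_drawing G pos hpos S' (fun a b h => by simp only [S']; rw [hws a b h])
    (fun a b h => by
      have := hw a b h
      rw [Sym2.eq_iff] at this
      have h2 := harc (w a b)
      rcases this with ⟨h3, h4⟩ | ⟨h3, h4⟩
      · rw [h3, h4] at h2; exact h2
      · rw [h3, h4] at h2; exact h2.symm)
    (fun a b h c h1 h2 => by
      have := hw a b h
      rw [Sym2.eq_iff] at this
      apply havoid (w a b)
      · rcases this with ⟨h3, h4⟩ | ⟨h3, h4⟩
        · rw [h3]; exact h1
        · rw [h3]; exact h2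
      · rcases this with ⟨h3, h4⟩ | ⟨h3, h4⟩
        · rw [h4]; exact h2
        · rw [h4]; exact h1)
  have hes : ∀ a b, G.Adj a b → es D a b = S (w a b) := hS
  have hne : ∀ a b c d, G.Adj a b → G.Adj c d → s(a, b) ≠ s(c, d) → w a b ≠ w c d := by
    intro a b c d h1 h2 h3 h4
    apply h3
    rw [← hw a b h1, ← hw c d h2, h4]
  have hdj : ∀ a b c d : V, a ≠ c → a ≠ d → b ≠ c → b ≠ d → ∀ v, v ∈ s(a, b) → v ∉ s(c, d) := by
    intro a b c d h1 h2 h3 h4 v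
    simp only [Sym2.mem_iff]
    rintro (k | k) (l | l)
    · exact h1 (k.symm.trans l)
    · exact h2 (k.symm.trans l)
    · exact h3 (k.symm.trans l)
    · exact h4 (k.symm.trans l)
  have hne' : ∀ a b c d : V, a ≠ c → a ≠ d → s(a, b) ≠ s(c, d) := by
    intro a b c d h1 h2 h
    rw [Sym2.eq_iff] at h
    rcases h with h | h
    · exact h1 h.1
    · exact h2 h.1
  have hgood : D.IsGood := by
    refine isGood_of D hI ?_ ?_ ?_
    · rintro a b c hab hac hbc q ⟨h1, h2⟩
      rw [hes _ _ hab] at h1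
      rw [hes _ _ hac] at h2
      rw [hp]
      refine hsh _ _ (hne a b a c hab hac ?_) a ?_ ?_ q h1 h2
      · intro h; exact hbc (Sym2.congr_right.1 h)
      · rw [hw _ _ hab]; simp
      · rw [hw _ _ hac]; simp
    · intro a b c d hab hcd h1 h2 h3 h4
      rw [hes _ _ hab, hes _ _ hcd]
      refine honce _ _ (hne a b c d hab hcd (hne' _ _ _ _ h1 h2)) ?_
      rw [hw _ _ hab, hw _ _ hcd]
      exact hdj _ _ _ _ h1 h2 h3 h4
    · intro a b c d e f hab hcd hef h1 h2 h3 h4 k1 k2 k3 k4 l1 l2 l3 l4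
      rw [hes _ _ hab, hes _ _ hcd, hes _ _ hef]
      rw [Set.eq_empty_iff_forall_notMem]
      rintro q ⟨⟨q1, q2⟩, q3⟩
      refine htri (w a b) (w c d) (w e f) (hne a b c d hab hcd (hne' _ _ _ _ h1 h2))
        (hne _ _ _ _ hab hef (hne' _ _ _ _ k1 k2)) (hne _ _ _ _ hcd hef (hne' _ _ _ _ l1 l2))
        ?_ ?_ ?_ q q1 q2 q3
      · rw [hw _ _ hab, hw _ _ hcd]; exact hdj _ _ _ _ h1 h2 h3 h4
      · rw [hw _ _ hab, hw _ _ hef]; exact hdj _ _ _ _ k1 k2 k3 k4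
      · rw [hw _ _ hcd, hw _ _ hef]; exact hdj _ _ _ _ l1 l2 l3 l4
  refine ⟨D, hgood, ?_⟩
  rintro ω ω' ⟨q, hq⟩
  have hA := fun hh => hgood.adj_no_cross _ _ hh q hq
  rw [isCrossing_iff] at hq
  obtain ⟨h1, h2, h3, h4, h5, -⟩ := hq
  rw [hes _ _ h1, hww] at h4
  rw [hes _ _ h2, hww] at h5
  exact ⟨by rintro rfl; exact h3 rfl, ⟨q, h4, h5⟩, fun v hv hv' => hA ⟨v, hv, hv'⟩⟩

end HB

namespace HB

open Set

theorem nat_off {k k' : ℕ} {s s' : ℝ} (hs : |s| ≤ 1 / 4) (hs' : |s'| ≤ 1 / 4)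
    (h : (k : ℝ) + 1 / 2 + s = k' + 1 / 2 + s') : k = k' ∧ s = s' := by
  rw [abs_le] at hs hs'
  have h1 : (k : ℝ) < k' + 1 := by linarith
  have h2 : (k' : ℝ) < k + 1 := by linarith
  have h1' : k < k' + 1 := by exact_mod_cast h1
  have h2' : k' < k + 1 := by exact_mod_cast h2
  obtain rfl : k = k' := by omega
  exact ⟨rfl, by linarith⟩

theorem hw8 (R : ℕ) : 8 * hw R = 8 * R + 4 := by unfold hw; ring

theorem per_port {R k : ℕ} {s : ℝ} (hk : k < 8 * R + 4) (hs : |s| ≤ 1 / 4) :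
    0 < (k : ℝ) + 1 / 2 + s ∧ (k : ℝ) + 1 / 2 + s < 8 * hw R := by
  rw [abs_le] at hs
  rw [hw8]
  have h1 : (k : ℝ) + 1 ≤ 8 * R + 4 := by exact_mod_cast hk
  have h2 : (0 : ℝ) ≤ k := by positivity
  constructor <;> linarith

theorem per0 {R : ℕ} {U : ℝ} (h : 0 < U) (h' : U < 8 * hw R) : Per R 0 U :=
  ⟨le_rfl, by have := hw_pos R; linarith, h.le, by linarith⟩

/-- tent curve in a box chart -/
noncomputable def tpt (R : ℕ) (a b θ : ℝ) : ℝ × ℝ := (θ, 1 - min (θ - a) (b - θ) / (16 * hw R))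

def tent (c : La) (R : ℕ) (a b : ℝ) : Set Pl := (fun θ => ch c R (tpt R a b θ)) '' Icc a b

section tent

variable {c : La} {R : ℕ} {a b a' b' : ℝ}

theorem tpt_pos (h0 : 0 < a) (h1 : b < 8 * hw R) {θ : ℝ} (hθ : θ ∈ Icc a b) :
    0 < (tpt R a b θ).2 ∧ (tpt R a b θ).2 ≤ 1 := by
  have hp := hw_pos R
  unfold tpt
  dsimp only
  obtain ⟨h2, h3⟩ := hθ
  have hm : 0 ≤ min (θ - a) (b - θ) := le_min (by linarith) (by linarith)
  have hm2 : min (θ - a) (b - θ) ≤ θ - a := min_le_left _ _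
  have h4 : min (θ - a) (b - θ) / (16 * hw R) < 1 := by rw [div_lt_one (by positivity)]; linarith
  have h5 : 0 ≤ min (θ - a) (b - θ) / (16 * hw R) := by positivity
  constructor <;> linarith

theorem tent_per (h0 : 0 < a) (h1 : b < 8 * hw R) {θ : ℝ} (hθ : θ ∈ Icc a b) : Per R 0 θ :=
  per0 (by linarith [hθ.1]) (by linarith [hθ.2])

theorem tent_rbox (h0 : 0 < a) (h1 : b < 8 * hw R) {q : Pl} (hq : q ∈ tent c R a b) :
    RBox c R q := by
  obtain ⟨θ, hθ, rfl⟩ := hq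
  have := tpt_pos h0 h1 hθ
  have hp := hw_pos R
  have g1 : (0 : ℝ) ≤ θ := by linarith [hθ.1]
  have g2 : θ ≤ 16 * hw R := by linarith [hθ.2]
  exact ch_rbox g1 g2 this.1.le this.2

theorem tent_left (h : a < b) : ch c R (a, 1) ∈ tent c R a b :=
  ⟨a, ⟨le_rfl, h.le⟩, by simp [tpt, h.le]⟩

theorem tent_right (h : a < b) : ch c R (b, 1) ∈ tent c R a b :=
  ⟨b, ⟨h.le, le_rfl⟩, by simp [tpt, h.le]⟩

theorem tent_arc (h0 : 0 < a) (hab : a < b) (h1 : b < 8 * hw R) :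
    IsArc (tent c R a b) (ch c R (a, 1)) (ch c R (b, 1)) := by
  have hp := hw_pos R
  let γ : ℝ → ℝ × ℝ := fun t => tpt R a b (a + t * (b - a))
  have him : (fun t : ℝ => a + t * (b - a)) '' Icc 0 1 = Icc a b := by
    ext z
    constructor
    · rintro ⟨t, ⟨h2, h3⟩, rfl⟩
      dsimp only
      constructor <;> nlinarith
    · rintro ⟨h2, h3⟩
      have hpos : 0 < b - a := by linarith
      refine ⟨(z - a) / (b - a), ⟨div_nonneg (by linarith) hpos.le, ?_⟩, ?_⟩
      · rw [div_le_one hpos]; linarith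
      · dsimp only; field_simp; ring
  have hmem : ∀ t ∈ Icc (0 : ℝ) 1, a + t * (b - a) ∈ Icc a b := fun t ht => him ▸ ⟨t, ht, rfl⟩
  have hγ : Continuous γ := by
    simp only [γ, tpt]
    fun_prop
  have key := isArc_image (γ := γ) (f := ch c R) (K := univ) hγ.continuousOn (ch_cont c R).continuousOn
    (fun _ _ => mem_univ _) (by
      intro t ht t' ht' he
      have := ch_inj (tent_per h0 h1 (hmem t ht)) (tent_per h0 h1 (hmem t' ht'))
        (tpt_pos h0 h1 (hmem t ht)).1 (tpt_pos h0 h1 (hmem t' ht')).1.le he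
      have h2 := this.1
      have : t * (b - a) = t' * (b - a) := by linarith
      exact mul_right_cancel₀ (by linarith) this)
  have e0 : γ 0 = (a, 1) := by simp [γ, tpt, hab.le]
  have e1 : γ 1 = (b, 1) := by simp [γ, tpt, hab.le]
  rw [e0, e1] at key
  convert key using 1
  unfold tent
  rw [← him, Set.image_image]

theorem tent_eq (h0 : 0 < a) (h1 : b < 8 * hw R) (h0' : 0 < a') (h1' : b' < 8 * hw R) {q : Pl}
    (hq : q ∈ tent c R a b) (hq' : q ∈ tent c R a' b') :
    ∃ θ, θ ∈ Icc a b ∧ θ ∈ Icc a' b' ∧ q = ch c R (tpt R a b θ) ∧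
      min (θ - a) (b - θ) = min (θ - a') (b' - θ) := by
  have hp := hw_pos R
  obtain ⟨θ, hθ, rfl⟩ := hq
  obtain ⟨θ', hθ', he⟩ := hq'
  have := ch_inj (tent_per h0 h1 hθ) (tent_per h0' h1' hθ') (tpt_pos h0 h1 hθ).1
    (tpt_pos h0' h1' hθ').1.le he.symm
  obtain ⟨h2, h3⟩ := this
  subst h2
  refine ⟨θ, hθ, hθ', rfl, ?_⟩
  have h4 : min (θ - a) (b - θ) / (16 * hw R) = min (θ - a') (b' - θ) / (16 * hw R) := by
    simp only [tpt] at h3; linarith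
  exact (div_left_inj' (by positivity)).1 h4

theorem tent_nested (h0 : 0 < a) (h1 : b < 8 * hw R) (ha : a < a') (hb : b' < b) {q : Pl}
    (hq : q ∈ tent c R a b) (hq' : q ∈ tent c R a' b') : False := by
  obtain ⟨θ, hθ, hθ', -, he⟩ := tent_eq h0 h1 (by linarith) (by linarith) hq hq'
  rcases min_cases (θ - a) (b - θ) with h | h <;> rcases min_cases (θ - a') (b' - θ) with h' | h' <;>
    linarith

theorem tent_sub (h0 : 0 < a) (h1 : b < 8 * hw R) (h0' : 0 < a') (h1' : b' < 8 * hw R)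
    (n1 : a ≠ a') (n2 : b ≠ b') {q q' : Pl}
    (hq : q ∈ tent c R a b) (hq' : q ∈ tent c R a' b') (kq : q' ∈ tent c R a b)
    (kq' : q' ∈ tent c R a' b') : q = q' := by
  obtain ⟨θ, hθ, hθ', rfl, he⟩ := tent_eq h0 h1 h0' h1' hq hq'
  obtain ⟨φ, hφ, hφ', rfl, ke⟩ := tent_eq h0 h1 h0' h1' kq kq'
  have : θ = φ := by
    rcases lt_or_gt_of_ne n1 with n1 | n1 <;> rcases lt_or_gt_of_ne n2 with n2 | n2 <;>
    rcases min_cases (θ - a) (b - θ) with h | h <;> rcases min_cases (θ - a') (b' - θ) with h' | h' <;>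
    rcases min_cases (φ - a) (b - φ) with k | k <;> rcases min_cases (φ - a') (b' - φ) with k' | k' <;>
    linarith
  rw [this]

end tent

/-- radial spoke -/
def spk (c : La) (R : ℕ) (U : ℝ) : Set Pl := (fun ρ => ch c R (U, ρ)) '' Icc 0 1

theorem spk_rbox {c : La} {R : ℕ} {U : ℝ} (h0 : 0 ≤ U) (h1 : U ≤ 16 * hw R) {q : Pl}
    (hq : q ∈ spk c R U) : RBox c R q := by
  obtain ⟨ρ, hρ, rfl⟩ := hq
  exact ch_rbox h0 h1 hρ.1 hρ.2

theorem spk_arc {c : La} {R : ℕ} {U : ℝ} (h0 : 0 ≤ U) (h1 : U ≤ 16 * hw R) :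
    IsArc (spk c R U) (ch c R (U, 0)) (ch c R (U, 1)) := by
  refine isArc_image (γ := fun ρ : ℝ => (U, ρ)) (f := ch c R) (K := univ) (by fun_prop)
    (ch_cont c R).continuousOn (fun _ _ => mem_univ _) ?_
  intro t ht t' ht' he
  exact ch_rho h0 h1 ht.1 h0 h1 ht'.1 he

end HB

namespace HB

open Set

variable {V : Type} {G : SimpleGraph V} {D : Drawing G} {o : V → ℕ}

namespace Plan

variable (P : Plan D o)

theorem lbox_eq {c c' : P.W} {z : La} (h : LBox (P.cen c) P.R z) (h' : LBox (P.cen c') P.R z) :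
    c = c' := by
  by_contra hne
  have := P.far c c' hne
  simp only [LBox, FarApart, abs_le, le_abs] at *
  omega

theorem rbox_eq {c c' : P.W} {q : Pl} (h : RBox (P.cen c) P.R q) (h' : RBox (P.cen c') P.R q) :
    c = c' := by
  by_contra hne
  have := P.far c c' hne
  simp only [RBox, FarApart, abs_le, le_abs] at *
  obtain ⟨⟨h1, h2⟩, h3, h4⟩ := h
  obtain ⟨⟨h1', h2'⟩, h3', h4'⟩ := h'
  rcases this with (h | h) | (h | h)
  · have h : ((2 * P.R + 3 : ℤ) : ℝ) ≤ ((P.cen c).1 - (P.cen c').1 : ℤ) := by exact_mod_cast h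
    push_cast at h; linarith
  · have h : ((2 * P.R + 3 : ℤ) : ℝ) ≤ (-((P.cen c).1 - (P.cen c').1) : ℤ) := by exact_mod_cast h
    push_cast at h; linarith
  · have h : ((2 * P.R + 3 : ℤ) : ℝ) ≤ ((P.cen c).2 - (P.cen c').2 : ℤ) := by exact_mod_cast h
    push_cast at h; linarith
  · have h : ((2 * P.R + 3 : ℤ) : ℝ) ≤ (-((P.cen c).2 - (P.cen c').2) : ℤ) := by exact_mod_cast h
    push_cast at h; linarith

/-- node, inner cell, outer cell of a port -/
def pn (e : OE G o) (i : ℕ) (b : Bool) : P.W := if b then P.node e (i + 1) else P.node e i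
def pz (e : OE G o) (i : ℕ) (b : Bool) : La := if b then P.p e i (P.L e i) else P.p e i 0
def pu (e : OE G o) (i : ℕ) (b : Bool) : ℕ := if b then P.L e i - 1 else 1
def pw (e : OE G o) (i : ℕ) (b : Bool) : La := P.p e i (P.pu e i b)

theorem pu_pos {e : OE G o} {i : ℕ} (hi : i < P.n e) (b : Bool) :
    0 < P.pu e i b ∧ P.pu e i b < P.L e i := by
  have := (P.path e i hi).two_le
  cases b <;> simp only [pu, if_true, if_false, Bool.false_eq_true] <;> omega

theorem pw_out {e : OE G o} {i : ℕ} (hi : i < P.n e) (b : Bool) (c : P.W) :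
    ¬ LBox (P.cen c) P.R (P.pw e i b) := P.nobox e i hi c _ (P.pu_pos hi b).1 (P.pu_pos hi b).2

theorem pz_in {e : OE G o} {i : ℕ} (hi : i < P.n e) (b : Bool) :
    LBox (P.cen (P.pn e i b)) P.R (P.pz e i b) := by
  cases b
  · exact P.box0 e i hi
  · exact P.box1 e i hi

theorem p_adj {e : OE G o} {i : ℕ} (hi : i < P.n e) (b : Bool) : LAdj (P.pz e i b) (P.pw e i b) := by
  have h := (P.path e i hi).two_le
  cases b
  · exact (P.path e i hi).adj 0 (by omega)
  · have := (P.path e i hi).adj (P.L e i - 1) (by omega)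
    rw [Nat.sub_add_cancel (by omega)] at this
    exact this.symm

theorem ex_port (e : OE G o) (i : ℕ) (b : Bool) : ∃ k : ℕ, i < P.n e → k < 8 * P.R + 4 ∧
    ∀ s : ℝ, |s| < 1 / 2 → sp (P.pz e i b) (P.pw e i b) s =
      ch (P.cen (P.pn e i b)) P.R ((k : ℝ) + 1 / 2 + s, 1) := by
  by_cases hi : i < P.n e
  · obtain ⟨k, h⟩ := port _ P.R (P.pz_in hi b) (P.pw_out hi b _) (P.p_adj hi b)
    exact ⟨k, fun _ => h⟩
  · exact ⟨0, fun h => absurd h hi⟩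

/-- port index -/
noncomputable def k (e : OE G o) (i : ℕ) (b : Bool) : ℕ := (P.ex_port e i b).choose

theorem k_lt {e : OE G o} {i : ℕ} (hi : i < P.n e) (b : Bool) : P.k e i b < 8 * P.R + 4 :=
  ((P.ex_port e i b).choose_spec hi).1

theorem k_sp {e : OE G o} {i : ℕ} (hi : i < P.n e) (b : Bool) {s : ℝ} (hs : |s| < 1 / 2) :
    sp (P.pz e i b) (P.pw e i b) s = ch (P.cen (P.pn e i b)) P.R ((P.k e i b : ℝ) + 1 / 2 + s, 1) :=
  ((P.ex_port e i b).choose_spec hi).2 s hs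

theorem k_inj {e f : OE G o} {i j : ℕ} {b b' : Bool} (hi : i < P.n e) (hj : j < P.n f)
    (hn : P.pn e i b = P.pn f j b') (hk : P.k e i b = P.k f j b') : e = f ∧ i = j ∧ b = b' := by
  have h0 : |(0 : ℝ)| < 1 / 2 := by norm_num
  have h1 := P.k_sp hi b h0
  rw [hn, hk, ← P.k_sp hj b' h0] at h1
  have h2 : InCell (P.pw e i b) (sp (P.pz f j b') (P.pw f j b') 0) := by
    rw [← h1]; exact sp_inCell_right (P.p_adj hi b) h0
  rcases inCell_sp (P.p_adj hj b') h0 h2 with h3 | h3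
  · exact absurd (h3 ▸ P.pz_in hj b') (P.pw_out hi b _)
  · by_cases hef : e = f ∧ i = j
    · obtain ⟨rfl, rfl⟩ := hef
      refine ⟨rfl, rfl, ?_⟩
      by_contra hb
      have : P.node e i = P.node e (i + 1) := by
        cases b <;> cases b' <;> simp [pn] at hn hb ⊢ <;> first | exact hn | exact hn.symm
      have := P.node_inj e i (i + 1) (by omega) (by omega) this
      omega
    · exact absurd h3 (P.disj e i f j hi hj (by tauto) _ _ (P.pu_pos hi b).1 (P.pu_pos hi b).2
        (P.pu_pos hj b').1 (P.pu_pos hj b').2)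

/-- strand of piece i -/
def st (e : OE G o) (i : ℕ) (s : ℝ) : Set Pl := strand (P.p e i) (P.L e i) s

theorem st_disj {e f : OE G o} {i j : ℕ} {s s' : ℝ} (hi : i < P.n e) (hj : j < P.n f)
    (hs : |s| < 1 / 2) (hs' : |s'| < 1 / 2) {q : Pl} (hq : q ∈ P.st e i s) (hq' : q ∈ P.st f j s') :
    e = f ∧ i = j ∧ s = s' := by
  by_cases hef : e = f ∧ i = j
  · obtain ⟨rfl, rfl⟩ := hef
    exact ⟨rfl, rfl, (P.path e i hi).strand_disj_self hs hs' hq hq'⟩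
  · refine (strand_disj (P.path e i hi) (P.path f j hj) ?_ ?_ hs hs' hq hq').elim
    · intro t t' h1 h2 h3 h4
      exact P.disj e i f j hi hj (by tauto) t t' h1 h2 h3 h4
    · intro t h1 h2
      constructor <;> intro h
      · exact P.nobox f j hj _ t h1 h2 (h ▸ P.box0 e i hi)
      · exact P.nobox f j hj _ t h1 h2 (h ▸ P.box1 e i hi)

/-- start and end port points, in the chart of the box -/
noncomputable def uS (e : OE G o) (i : ℕ) (s : ℝ) : ℝ := (P.k e i false : ℝ) + 1 / 2 + s
noncomputable def uE (e : OE G o) (i : ℕ) (s : ℝ) : ℝ := (P.k e i true : ℝ) + 1 / 2 + -s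
noncomputable def C (c : P.W) (u : ℝ × ℝ) : Pl := ch (P.cen c) P.R u

theorem st_start {e : OE G o} {i : ℕ} {s : ℝ} (hi : i < P.n e) (hs : |s| < 1 / 2) :
    sp (P.p e i 0) (P.p e i 1) s = P.C (P.node e i) (P.uS e i s, 1) := P.k_sp hi false hs

theorem st_end {e : OE G o} {i : ℕ} {s : ℝ} (hi : i < P.n e) (hs : |s| < 1 / 2) :
    sp (P.p e i (P.L e i - 1)) (P.p e i (P.L e i)) s = P.C (P.node e (i + 1)) (P.uE e i s, 1) := by
  rw [sp_swap]; exact P.k_sp hi true (by simpa using hs)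

theorem st_arc {e : OE G o} {i : ℕ} {s : ℝ} (hi : i < P.n e) (hs : |s| < 1 / 2) :
    IsArc (P.st e i s) (P.C (P.node e i) (P.uS e i s, 1)) (P.C (P.node e (i + 1)) (P.uE e i s, 1)) := by
  rw [← P.st_start hi hs, ← P.st_end hi hs]
  exact (P.path e i hi).isArc_strand hs

theorem st_box {e : OE G o} {i : ℕ} {s : ℝ} (hi : i < P.n e) (hs : |s| < 1 / 2) {c : P.W} {q : Pl}
    (hq : q ∈ P.st e i s) (hR : RBox (P.cen c) P.R q) :
    (c = P.node e i ∧ q = P.C c (P.uS e i s, 1)) ∨ (c = P.node e (i + 1) ∧ q = P.C c (P.uE e i s, 1)) := by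
  rcases strand_box (P.path e i hi) (fun t h1 h2 => P.nobox e i hi c t h1 h2) hs hq hR with ⟨h, h'⟩ | ⟨h, h'⟩
  · have := P.lbox_eq h (P.box0 e i hi)
    subst this
    exact Or.inl ⟨rfl, by rw [h', P.st_start hi hs]⟩
  · have := P.lbox_eq h (P.box1 e i hi)
    subst this
    exact Or.inr ⟨rfl, by rw [h', P.st_end hi hs]⟩

theorem uS_per {e : OE G o} {i : ℕ} {s : ℝ} (hi : i < P.n e) (hs : |s| ≤ 1 / 4) :
    0 < P.uS e i s ∧ P.uS e i s < 8 * hw P.R := per_port (P.k_lt hi false) hs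

theorem uE_per {e : OE G o} {i : ℕ} {s : ℝ} (hi : i < P.n e) (hs : |s| ≤ 1 / 4) :
    0 < P.uE e i s ∧ P.uE e i s < 8 * hw P.R := per_port (P.k_lt hi true) (by simpa using hs)

theorem uS_inj {e f : OE G o} {i j : ℕ} {s s' : ℝ} (hi : i < P.n e) (hj : j < P.n f)
    (hs : |s| ≤ 1 / 4) (hs' : |s'| ≤ 1 / 4) (hn : P.node e i = P.node f j)
    (h : P.uS e i s = P.uS f j s') : e = f ∧ i = j ∧ s = s' := by
  have h1 := nat_off hs hs' h
  have := P.k_inj (b := false) (b' := false) hi hj hn h1.1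
  exact ⟨this.1, this.2.1, h1.2⟩

theorem uE_inj {e f : OE G o} {i j : ℕ} {s s' : ℝ} (hi : i < P.n e) (hj : j < P.n f)
    (hs : |s| ≤ 1 / 4) (hs' : |s'| ≤ 1 / 4) (hn : P.node e (i + 1) = P.node f (j + 1))
    (h : P.uE e i s = P.uE f j s') : e = f ∧ i = j ∧ s = s' := by
  have h1 := nat_off (s := -s) (s' := -s') (by simpa using hs) (by simpa using hs') h
  have := P.k_inj (b := true) (b' := true) hi hj hn h1.1
  exact ⟨this.1, this.2.1, by linarith [h1.2]⟩

theorem uS_ne_uE {e f : OE G o} {i j : ℕ} {s s' : ℝ} (hi : i < P.n e) (hj : j < P.n f)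
    (hs : |s| ≤ 1 / 4) (hs' : |s'| ≤ 1 / 4) (hn : P.node e i = P.node f (j + 1)) :
    P.uS e i s ≠ P.uE f j s' := by
  intro h
  have h1 := nat_off (s' := -s') hs (by simpa using hs') h
  have := P.k_inj (b := false) (b' := true) hi hj hn h1.1
  simp at this

end Plan

end HB

namespace HB

open Set

theorem tent_rim {c : La} {R : ℕ} {a b u : ℝ} (h0 : 0 < a) (h1 : b < 8 * hw R) (hu : 0 < u)
    (hu' : u < 8 * hw R) (h : ch c R (u, 1) ∈ tent c R a b) : u = a ∨ u = b := by
  obtain ⟨θ, hθ, he⟩ := h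
  have hp := hw_pos R
  have := ch_inj (tent_per h0 h1 hθ) (per0 hu hu') (tpt_pos h0 h1 hθ).1 zero_le_one he
  simp only [tpt] at this
  obtain ⟨h2, h3⟩ := this
  have h4 : min (θ - a) (b - θ) / (16 * hw R) = 0 := by linarith
  rw [div_eq_zero_iff] at h4
  rcases h4 with h4 | h4
  · rcases min_cases (θ - a) (b - θ) with h | h
    · left; linarith
    · right; linarith
  · linarith

variable {V : Type} {G : SimpleGraph V} {D : Drawing G} {o : V → ℕ}

namespace Plan

variable (P : Plan D o)

noncomputable def tnt (e : OE G o) (i : ℕ) (s : ℝ) : Set Pl :=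
  tent (P.cen (P.node e (i + 1))) P.R (min (P.uE e i s) (P.uS e (i + 1) s))
    (max (P.uE e i s) (P.uS e (i + 1) s))

section
variable {e f : OE G o} {i j : ℕ} {s s' : ℝ}

theorem tnt_lo (hi : i + 1 < P.n e) (hs : |s| ≤ 1 / 4) : 0 < min (P.uE e i s) (P.uS e (i + 1) s) :=
  lt_min (P.uE_per (by omega) hs).1 (P.uS_per hi hs).1

theorem tnt_hi (hi : i + 1 < P.n e) (hs : |s| ≤ 1 / 4) :
    max (P.uE e i s) (P.uS e (i + 1) s) < 8 * hw P.R :=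
  max_lt (P.uE_per (by omega) hs).2 (P.uS_per hi hs).2

theorem tnt_ne (hi : i + 1 < P.n e) (hs : |s| ≤ 1 / 4) : P.uE e i s ≠ P.uS e (i + 1) s :=
  (P.uS_ne_uE hi (by omega) hs hs rfl).symm

theorem tnt_arc (hi : i + 1 < P.n e) (hs : |s| ≤ 1 / 4) :
    IsArc (P.tnt e i s) (P.C (P.node e (i + 1)) (P.uE e i s, 1))
      (P.C (P.node e (i + 1)) (P.uS e (i + 1) s, 1)) := by
  have h0 := P.tnt_lo hi hs
  have h1 := P.tnt_hi hi hs
  unfold tnt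
  rcases lt_or_gt_of_ne (P.tnt_ne hi hs) with h | h
  · rw [min_eq_left h.le, max_eq_right h.le] at *
    exact tent_arc h0 h h1
  · rw [min_eq_right h.le, max_eq_left h.le] at *
    exact (tent_arc h0 h h1).symm

theorem tnt_rbox (hi : i + 1 < P.n e) (hs : |s| ≤ 1 / 4) {q : Pl} (hq : q ∈ P.tnt e i s) :
    RBox (P.cen (P.node e (i + 1))) P.R q := tent_rbox (P.tnt_lo hi hs) (P.tnt_hi hi hs) hq

theorem tnt_nested (hi : i + 1 < P.n e) (hs : |s| ≤ 1 / 4) (hs' : |s'| ≤ 1 / 4) (hss : s ≠ s') {q : Pl}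
    (hq : q ∈ P.tnt e i s) (hq' : q ∈ P.tnt e i s') : False := by
  wlog hlt : s' < s generalizing s s'
  · exact this hs' hs hss.symm hq' hq (lt_of_le_of_ne (not_lt.1 hlt) hss)
  have h0 := P.tnt_lo hi hs
  have h1 := P.tnt_hi hi hs
  have hk : P.k e i true ≠ P.k e (i + 1) false := fun h => by
    have := P.k_inj (e := e) (f := e) (i := i) (j := i + 1) (b := true) (b' := false) (by omega) hi rfl h
    simp at this
  have hE : ∀ t, P.uE e i t = (P.k e i true : ℝ) + 1 / 2 + -t := fun _ => rfl
  have hS : ∀ t, P.uS e (i + 1) t = (P.k e (i + 1) false : ℝ) + 1 / 2 + t := fun _ => rfl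
  have g := abs_le.1 hs
  have g' := abs_le.1 hs'
  unfold tnt at hq hq'
  rcases lt_or_gt_of_ne hk with h | h
  · have h : (P.k e i true : ℝ) + 1 ≤ P.k e (i + 1) false := by exact_mod_cast h
    have a1 : P.uE e i s ≤ P.uS e (i + 1) s := by rw [hE, hS]; linarith
    have a2 : P.uE e i s' ≤ P.uS e (i + 1) s' := by rw [hE, hS]; linarith
    rw [min_eq_left a1, max_eq_right a1] at hq
    rw [min_eq_left a2, max_eq_right a2] at hq'
    rw [min_eq_left a1] at h0
    rw [max_eq_right a1] at h1
    exact tent_nested h0 h1 (by rw [hE, hE]; linarith) (by rw [hS, hS]; linarith) hq hq'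
  · have h : (P.k e (i + 1) false : ℝ) + 1 ≤ P.k e i true := by exact_mod_cast h
    have a1 : P.uS e (i + 1) s ≤ P.uE e i s := by rw [hE, hS]; linarith
    have a2 : P.uS e (i + 1) s' ≤ P.uE e i s' := by rw [hE, hS]; linarith
    have h0' := P.tnt_lo hi hs'
    have h1' := P.tnt_hi hi hs'
    rw [min_eq_right a1, max_eq_left a1] at hq
    rw [min_eq_right a2, max_eq_left a2] at hq'
    rw [min_eq_right a2] at h0'
    rw [max_eq_left a2] at h1'
    exact tent_nested h0' h1' (by rw [hS, hS]; linarith) (by rw [hE, hE]; linarith) hq' hq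

theorem tnt_sub (hi : i + 1 < P.n e) (hj : j + 1 < P.n f) (hs : |s| ≤ 1 / 4) (hs' : |s'| ≤ 1 / 4)
    (hef : e ≠ f) (hn : P.node e (i + 1) = P.node f (j + 1)) {q q' : Pl}
    (h1 : q ∈ P.tnt e i s) (h2 : q ∈ P.tnt f j s') (h3 : q' ∈ P.tnt e i s) (h4 : q' ∈ P.tnt f j s') :
    q = q' := by
  have n1 : P.uE e i s ≠ P.uE f j s' := fun h =>
    hef (P.uE_inj (by omega) (by omega) hs hs' hn h).1
  have n2 : P.uS e (i + 1) s ≠ P.uS f (j + 1) s' := fun h => hef (P.uS_inj hi hj hs hs' hn h).1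
  have n3 : P.uS e (i + 1) s ≠ P.uE f j s' := P.uS_ne_uE hi (by omega) hs hs' hn
  have n4 : P.uE e i s ≠ P.uS f (j + 1) s' := (P.uS_ne_uE hj (by omega) hs' hs hn.symm).symm
  have a1 := P.tnt_lo hi hs
  have a2 := P.tnt_hi hi hs
  have a3 := P.tnt_lo hj hs'
  have a4 := P.tnt_hi hj hs'
  unfold tnt at *
  rw [← hn] at *
  refine tent_sub a1 a2 a3 a4 ?_ ?_ h1 h2 h3 h4
  · rcases min_choice (P.uE e i s) (P.uS e (i + 1) s) with h | h <;>
    rcases min_choice (P.uE f j s') (P.uS f (j + 1) s') with h' | h' <;> rw [h, h'] <;> assumption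
  · rcases max_choice (P.uE e i s) (P.uS e (i + 1) s) with h | h <;>
    rcases max_choice (P.uE f j s') (P.uS f (j + 1) s') with h' | h' <;> rw [h, h'] <;> assumption

def bodyTo (e : OE G o) (s : ℝ) (j : ℕ) : Set Pl :=
  {q | ∃ i, i ≤ j ∧ q ∈ P.st e i s} ∪ {q | ∃ i, i < j ∧ q ∈ P.tnt e i s}

theorem bodyTo_box (hj : j < P.n e) (hs : |s| ≤ 1 / 4) {c : P.W} {q : Pl} (hq : q ∈ P.bodyTo e s j)
    (hR : RBox (P.cen c) P.R q) : (c = P.node e 0 ∧ q = P.C c (P.uS e 0 s, 1)) ∨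
      (∃ i, i < j ∧ c = P.node e (i + 1) ∧ q ∈ P.tnt e i s) ∨
      (c = P.node e (j + 1) ∧ q = P.C c (P.uE e j s, 1)) := by
  have hs2 : |s| < 1 / 2 := by linarith
  rcases hq with ⟨i, hi, hq⟩ | ⟨i, hi, hq⟩
  · rcases P.st_box (by omega) hs2 hq hR with ⟨h1, h2⟩ | ⟨h1, h2⟩
    · rcases i with _ | i
      · exact Or.inl ⟨h1, h2⟩
      · refine Or.inr (Or.inl ⟨i, by omega, h1, ?_⟩)
        rw [h2, h1]; exact (P.tnt_arc (by omega) hs).right_mem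
    · rcases Nat.lt_or_eq_of_le hi with h | h
      · refine Or.inr (Or.inl ⟨i, by omega, h1, ?_⟩)
        rw [h2, h1]; exact (P.tnt_arc (by omega) hs).left_mem
      · subst h
        exact Or.inr (Or.inr ⟨h1, h2⟩)
  · exact Or.inr (Or.inl ⟨i, hi, P.rbox_eq hR (P.tnt_rbox (by omega) hs hq), hq⟩)

theorem bodyTo_arc (hj : j < P.n e) (hs : |s| ≤ 1 / 4) : IsArc (P.bodyTo e s j)
    (P.C (P.node e 0) (P.uS e 0 s, 1)) (P.C (P.node e (j + 1)) (P.uE e j s, 1)) := by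
  have hs2 : |s| < 1 / 2 := by linarith
  have ninj : ∀ a b, a ≤ P.n e → b ≤ P.n e → P.node e a = P.node e b → a = b := P.node_inj e
  induction j with
  | zero =>
    have : P.bodyTo e s 0 = P.st e 0 s := by
      ext q; simp [bodyTo]
    rw [this]; exact P.st_arc hj hs2
  | succ j ih =>
    have h1 := ih (by omega)
    have h2 := P.tnt_arc hj hs
    have h3 := P.st_arc hj hs2
    have h23 := h2.trans h3 (by
      rintro q ⟨hq, hq'⟩
      rcases P.st_box hj hs2 hq' (P.tnt_rbox hj hs hq) with ⟨-, h⟩ | ⟨h, -⟩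
      · exact h
      · have := ninj _ _ (by omega) (by omega) h
        omega)
    have h4 := h1.trans h23 (by
      rintro q ⟨hq, hq' | hq'⟩
      · rcases P.bodyTo_box (by omega) hs hq (P.tnt_rbox hj hs hq') with ⟨h, -⟩ | ⟨i, hi, h, -⟩ | ⟨-, h⟩
        · have := ninj _ _ (by omega) (by omega) h; omega
        · have := ninj _ _ (by omega) (by omega) h; omega
        · exact h
      · rcases hq with ⟨i, hi, hq⟩ | ⟨i, hi, hq⟩
        · have := (P.st_disj (by omega) (by omega) hs2 hs2 hq hq').2.1; omega
        · rcases P.st_box hj hs2 hq' (P.tnt_rbox (by omega) hs hq) with ⟨h, -⟩ | ⟨h, -⟩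
          · have := ninj _ _ (by omega) (by omega) h; omega
          · have := ninj _ _ (by omega) (by omega) h; omega)
    convert h4 using 1
    ext q
    simp only [bodyTo, mem_union, mem_ofPred_eq]
    constructor
    · rintro (⟨i, hi, h⟩ | ⟨i, hi, h⟩)
      · rcases Nat.lt_or_eq_of_le hi with h' | rfl
        · exact Or.inl (Or.inl ⟨i, by omega, h⟩)
        · exact Or.inr (Or.inr h)
      · rcases Nat.lt_or_eq_of_le (Nat.lt_succ_iff.1 hi) with h' | rfl
        · exact Or.inl (Or.inr ⟨i, by omega, h⟩)
        · exact Or.inr (Or.inl h)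
    · rintro ((⟨i, hi, h⟩ | ⟨i, hi, h⟩) | (h | h))
      · exact Or.inl ⟨i, by omega, h⟩
      · exact Or.inr ⟨i, by omega, h⟩
      · exact Or.inr ⟨j, by omega, h⟩
      · exact Or.inl ⟨j + 1, by omega, h⟩

noncomputable def spoke (e : OE G o) (s : ℝ) : Set Pl :=
  spk (P.cen (P.vtx e.1.2)) P.R (P.uE e (P.n e - 1) s)

def body (e : OE G o) (s : ℝ) : Set Pl := P.bodyTo e s (P.n e - 1) ∪ P.spoke e s

/-- centre of the box of a vertex -/
noncomputable def ctr (v : V) : Pl := P.C (P.vtx v) (0, 0)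

theorem C_zero (c : P.W) (U : ℝ) : P.C c (U, 0) = P.C c (0, 0) := by
  unfold C; rw [ch_zero, ch_zero]

theorem node_n (e : OE G o) : P.node e (P.n e - 1 + 1) = P.vtx e.1.2 := by
  rw [Nat.sub_add_cancel (P.n_pos e), P.node_last]

theorem spoke_rbox (hs : |s| ≤ 1 / 4) {q : Pl} (hq : q ∈ P.spoke e s) :
    RBox (P.cen (P.vtx e.1.2)) P.R q := by
  have := P.uE_per (e := e) (i := P.n e - 1) (by have := P.n_pos e; omega) hs
  have hp := hw_pos P.R
  exact spk_rbox this.1.le (by linarith) hq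

theorem spoke_arc (hs : |s| ≤ 1 / 4) : IsArc (P.spoke e s)
    (P.C (P.vtx e.1.2) (P.uE e (P.n e - 1) s, 1)) (P.ctr e.1.2) := by
  have := P.uE_per (e := e) (i := P.n e - 1) (by have := P.n_pos e; omega) hs
  have hp := hw_pos P.R
  have h := (spk_arc (c := P.cen (P.vtx e.1.2)) (R := P.R) this.1.le (by linarith)).symm
  have h2 : P.ctr e.1.2 = ch (P.cen (P.vtx e.1.2)) P.R (P.uE e (P.n e - 1) s, 0) :=
    (P.C_zero _ _).symm
  rw [h2]; exact h

theorem body_box (hs : |s| ≤ 1 / 4) {c : P.W} {q : Pl} (hq : q ∈ P.body e s)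
    (hR : RBox (P.cen c) P.R q) : (c = P.vtx e.1.1 ∧ q = P.C c (P.uS e 0 s, 1)) ∨
      (∃ i, i + 1 < P.n e ∧ c = P.node e (i + 1) ∧ q ∈ P.tnt e i s) ∨
      (c = P.vtx e.1.2 ∧ q ∈ P.spoke e s) := by
  have hn := P.n_pos e
  rcases hq with hq | hq
  · rcases P.bodyTo_box (by omega) hs hq hR with ⟨h1, h2⟩ | ⟨i, hi, h1, h2⟩ | ⟨h1, h2⟩
    · exact Or.inl ⟨by rw [h1, P.node_zero], h2⟩
    · exact Or.inr (Or.inl ⟨i, by omega, h1, h2⟩)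
    · rw [P.node_n] at h1
      refine Or.inr (Or.inr ⟨h1, ?_⟩)
      rw [h2, h1]; exact (P.spoke_arc hs).left_mem
  · exact Or.inr (Or.inr ⟨P.rbox_eq hR (P.spoke_rbox hs hq), hq⟩)

theorem body_arc (hs : |s| ≤ 1 / 4) :
    IsArc (P.body e s) (P.C (P.vtx e.1.1) (P.uS e 0 s, 1)) (P.ctr e.1.2) := by
  have hn := P.n_pos e
  have h1 := P.bodyTo_arc (e := e) (j := P.n e - 1) (by omega) hs
  rw [P.node_n, P.node_zero] at h1
  refine h1.trans (P.spoke_arc hs) ?_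
  rintro q ⟨hq, hq'⟩
  rcases P.bodyTo_box (by omega) hs hq (P.spoke_rbox hs hq') with ⟨h, -⟩ | ⟨i, hi, h, -⟩ | ⟨-, h⟩
  · rw [← P.node_last] at h
    have := P.node_inj e _ _ le_rfl (by omega) h; omega
  · rw [← P.node_last] at h
    have := P.node_inj e _ _ le_rfl (by omega) h; omega
  · exact h

/-- crossing of bodies at a common interior node -/
def Cross (e : OE G o) (s : ℝ) (f : OE G o) (s' : ℝ) (q : Pl) : Prop :=
  e ≠ f ∧ ∃ i j, i + 1 < P.n e ∧ j + 1 < P.n f ∧ P.node e (i + 1) = P.node f (j + 1) ∧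
    q ∈ P.tnt e i s ∧ q ∈ P.tnt f j s'

theorem body_inter (hs : |s| ≤ 1 / 4) (hs' : |s'| ≤ 1 / 4) (hne : ¬ (e = f ∧ s = s')) {q : Pl}
    (hq : q ∈ P.body e s) (hq' : q ∈ P.body f s') :
    (e.1.2 = f.1.2 ∧ q = P.ctr e.1.2) ∨ P.Cross e s f s' q := by
  have hne0 := P.n_pos e
  have hnf0 := P.n_pos f
  have hp := hw_pos P.R
  have uE1 := P.uE_per (e := e) (i := P.n e - 1) (by omega) hs
  have uF1 := P.uE_per (e := f) (i := P.n f - 1) (by omega) hs'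
  have uS1 := P.uS_per (e := e) (i := 0) (by omega) hs
  have uS2 := P.uS_per (e := f) (i := 0) (by omega) hs'
  have key : ∀ c, RBox (P.cen c) P.R q →
      (e.1.2 = f.1.2 ∧ q = P.ctr e.1.2) ∨ P.Cross e s f s' q := by
    intro c hR
    rcases P.body_box hs hq hR with ⟨h1, h2⟩ | ⟨i, hi, h1, h2⟩ | ⟨h1, h2⟩ <;>
    rcases P.body_box hs' hq' hR with ⟨k1, k2⟩ | ⟨j, hj, k1, k2⟩ | ⟨k1, k2⟩
    · exfalso
      rw [h2] at k2
      have := (ch_inj (per0 uS1.1 uS1.2) (per0 uS2.1 uS2.2) one_pos zero_le_one k2).1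
      have := P.uS_inj (e := e) (f := f) (by omega) (by omega) hs hs' (by rw [P.node_zero, P.node_zero, ← h1, k1]) this
      exact hne ⟨this.1, this.2.2⟩
    · exact absurd (k1.symm.trans h1) (P.node_int f _ _ (by omega) hj)
    · exfalso
      obtain ⟨ρ, hρ, hk⟩ := k2
      rw [h2] at hk
      unfold C at hk
      rw [← k1] at hk
      have := (ch_inj (per0 uS1.1 uS1.2) (per0 uF1.1 uF1.2) one_pos hρ.1 hk.symm).1
      exact P.uS_ne_uE (e := e) (f := f) (by omega) (by omega) hs hs'
        (by rw [P.node_zero, P.node_n, ← h1, k1]) this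
    · exact absurd (h1.symm.trans k1) (P.node_int e _ _ (by omega) hi)
    · by_cases hef : e = f
      · subst hef
        have := P.node_inj e _ _ (by omega) (by omega) (h1.symm.trans k1)
        obtain rfl : i = j := by omega
        exact (P.tnt_nested hi hs hs' (fun h => hne ⟨rfl, h⟩) h2 k2).elim
      · exact Or.inr ⟨hef, i, j, hi, hj, h1.symm.trans k1, h2, k2⟩
    · exact absurd (h1.symm.trans k1) (P.node_int e _ _ (by omega) hi)
    · exfalso
      obtain ⟨ρ, hρ, hk⟩ := h2
      rw [k2] at hk
      unfold C at hk
      rw [← h1] at hk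
      have := (ch_inj (per0 uS2.1 uS2.2) (per0 uE1.1 uE1.2) one_pos hρ.1 hk.symm).1
      exact P.uS_ne_uE (e := f) (f := e) (by omega) (by omega) hs' hs
        (by rw [P.node_zero, P.node_n, ← k1, h1]) this
    · exact absurd (k1.symm.trans h1) (P.node_int f _ _ (by omega) hj)
    · have hv : e.1.2 = f.1.2 := P.vtx_inj (h1.symm.trans k1)
      left
      refine ⟨hv, ?_⟩
      obtain ⟨ρ, hρ, hk⟩ := h2
      obtain ⟨ρ', hρ', hk'⟩ := k2
      rw [← hv] at hk'
      rcases hρ.1.eq_or_lt with h0 | h0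
      · rw [← hk, ← h0]; exact P.C_zero _ _
      · exfalso
        rw [← hk'] at hk
        have := (ch_inj (per0 uE1.1 uE1.2) (per0 uF1.1 uF1.2) h0 hρ'.1 hk).1
        have := P.uE_inj (by omega) (by omega) hs hs' (by rw [P.node_n, P.node_n, hv]) this
        exact hne ⟨this.1, this.2.2⟩
  rcases hq with (⟨i, hi, h⟩ | ⟨i, hi, h⟩) | h
  · rcases hq' with (⟨j, hj, h'⟩ | ⟨j, hj, h'⟩) | h'
    · have := P.st_disj (by omega) (by omega) (by linarith) (by linarith) h h'
      exact absurd ⟨this.1, this.2.2⟩ hne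
    · exact key _ (P.tnt_rbox (by omega) hs' h')
    · exact key _ (P.spoke_rbox hs' h')
  · exact key _ (P.tnt_rbox (by omega) hs h)
  · exact key _ (P.spoke_rbox hs h)

theorem cross_once (hs : |s| ≤ 1 / 4) (hs' : |s'| ≤ 1 / 4) {q q' : Pl} (h : P.Cross e s f s' q)
    (h' : P.Cross e s f s' q') : q = q' := by
  obtain ⟨hef, i, j, hi, hj, hn, h1, h2⟩ := h
  obtain ⟨-, i', j', hi', hj', hn', h1', h2'⟩ := h'
  have a := P.node_once e f _ _ _ _ hef (by omega) hi (by omega) hj (by omega) hi' (by omega) hj' hn hn'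
  obtain rfl : i = i' := by omega
  have b := P.node_inj f _ _ (by omega) (by omega) (hn.symm.trans hn')
  obtain rfl : j = j' := by omega
  exact P.tnt_sub hi hj hs hs' hef hn h1 h2 h1' h2'

theorem cross_X (h : ∃ q, P.Cross e s f s' q) : X D e.1.1 e.1.2 f.1.1 f.1.2 := by
  obtain ⟨q, hef, i, j, hi, hj, hn, h1, h2⟩ := h
  exact P.node_cr e f _ _ hef (by omega) hi (by omega) hj hn

theorem Cross.symm {P : Plan D o} {q : Pl} (h : P.Cross e s f s' q) : P.Cross f s' e s q := by
  obtain ⟨hef, i, j, hi, hj, hn, h1, h2⟩ := h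
  exact ⟨hef.symm, j, i, hj, hi, hn.symm, h2, h1⟩

theorem cross_tri {g : OE G o} {t : ℝ} {q : Pl} (hs : |s| ≤ 1 / 4) (ht : |t| ≤ 1 / 4)
    (h : P.Cross e s f s' q) (h' : P.Cross e s g t q) (h'' : P.Cross f s' g t q) : False := by
  obtain ⟨hef, i, j, hi, hj, hn, h1, h2⟩ := h
  obtain ⟨heg, i', j', hi', hj', hn', h1', h2'⟩ := h'
  obtain ⟨hfg, -⟩ := h''
  have a := P.rbox_eq (P.tnt_rbox hi hs h1) (P.tnt_rbox hi' hs h1')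
  refine P.node_tri e f g _ _ _ hef heg hfg (by omega) hi (by omega) hj (by omega) hj' hn (a.trans hn')

theorem cross_node {q : Pl} (h : P.Cross e s f s' q) (hs : |s| ≤ 1 / 4) (a : V) : ¬ RBox (P.cen (P.vtx a)) P.R q := by
  obtain ⟨hef, i, j, hi, hj, hn, h1, h2⟩ := h
  intro h
  exact P.node_int e _ a (by omega) hi (P.rbox_eq (P.tnt_rbox hi hs h1) h)

end

end Plan

end HB

namespace HB

open Set

inductive Kd | rad | lft | rgt

/-- local configuration data at the satellite centre -/
structure LD where
  c : La
  R : ℕ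
  c0 : ℕ
  c1 : ℕ
  h0 : c0 < 8 * R + 4
  h1 : 0 < c1
  h2 : c1 < 8 * R + 4

namespace LD

variable (Q : LD)

def w (h : Bool) : ℕ := if h then Q.c1 else 8 * Q.R + 4 - Q.c1

noncomputable def del : ℝ := 1 / (4 * (8 * hw Q.R))

noncomputable def uu (h : Bool) (t : ℝ) : ℝ := if h then Q.c0 + t else Q.c0 + 8 * hw Q.R - t

noncomputable def phi (h : Bool) (u : ℝ × ℝ) : Pl := ch Q.c Q.R (Q.uu h u.1, u.2)

noncomputable def pt (w : ℕ) (κ : Kd) (j : ℕ) (τ : ℝ) : ℝ × ℝ :=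
  match κ with
  | .rad => (j + 1 / 2, τ)
  | .lft => (τ * (j + 1 / 4), 1 / 2 + τ / 2)
  | .rgt => (w - τ * (w - j - 3 / 4), 1 - Q.del * (1 - τ))

noncomputable def lp (h : Bool) (κ : Kd) (j : ℕ) (τ : ℝ) : Pl := Q.phi h (Q.pt (Q.w h) κ j τ)

theorem del_pos : 0 < Q.del := by have := hw_pos Q.R; unfold del; positivity

theorem per_ge : 4 ≤ 8 * hw Q.R := by rw [hw8]; have : (0 : ℝ) ≤ Q.R := by positivity
                                      linarith

theorem del_le : Q.del ≤ 1 / 16 := by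
  have := Q.per_ge
  unfold del
  rw [div_le_div_iff₀ (by linarith) (by norm_num)]
  linarith

theorem w_real (h : Bool) : (Q.w h : ℝ) = if h then (Q.c1 : ℝ) else 8 * hw Q.R - Q.c1 := by
  have := Q.h2
  cases h
  · simp only [w, Bool.false_eq_true, if_false, hw8]
    rw [Nat.cast_sub (by omega)]; push_cast; ring
  · simp [w]

theorem w_lt (h : Bool) : (Q.w h : ℝ) < 8 * hw Q.R := by
  have h1 : Q.w h < 8 * Q.R + 4 := by
    have := Q.h1; have := Q.h2
    cases h <;> simp only [w, if_true, if_false, Bool.false_eq_true] <;> omega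
  rw [hw8]; exact_mod_cast h1

theorem c0_lt : (Q.c0 : ℝ) < 8 * hw Q.R := by rw [hw8]; exact_mod_cast Q.h0

theorem uu_mem {h : Bool} {t : ℝ} (h1 : 0 ≤ t) (h2 : t ≤ Q.w h) :
    0 ≤ Q.uu h t ∧ Q.uu h t ≤ 16 * hw Q.R := by
  have a := Q.c0_lt
  have b := Q.w_lt h
  have c : (0 : ℝ) ≤ Q.c0 := by positivity
  cases h <;> simp only [uu, if_true, if_false, Bool.false_eq_true] <;> constructor <;> linarith

theorem phi_rho {h h' : Bool} {t t' ρ ρ' : ℝ} (a1 : 0 ≤ t) (a2 : t ≤ Q.w h) (b1 : 0 ≤ t')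
    (b2 : t' ≤ Q.w h') (r : 0 ≤ ρ) (r' : 0 ≤ ρ') (he : Q.phi h (t, ρ) = Q.phi h' (t', ρ')) : ρ = ρ' :=
  ch_rho (Q.uu_mem a1 a2).1 (Q.uu_mem a1 a2).2 r (Q.uu_mem b1 b2).1 (Q.uu_mem b1 b2).2 r' he

theorem ch_inj' {c : La} {R : ℕ} {U ρ U' ρ' : ℝ} (a1 : 0 ≤ U) (a2 : U ≤ 16 * hw R) (b1 : 0 ≤ U')
    (b2 : U' ≤ 16 * hw R) (d1 : U < U' + 8 * hw R) (d2 : U' < U + 8 * hw R)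
    (h3 : 0 < ρ) (h3' : 0 ≤ ρ') (h : ch c R (U, ρ) = ch c R (U', ρ')) : U = U' := by
  have e := ch_rho a1 a2 h3.le b1 b2 h3' h
  subst e
  simp only [ch, Prod.mk.injEq, add_right_inj] at h
  exact b_inj (hw_pos R) a1 b1 a2 b2 d1 d2 (mul_left_cancel₀ h3.ne' h.1) (mul_left_cancel₀ h3.ne' h.2)

theorem phi_inj {h h' : Bool} {t t' ρ ρ' : ℝ} (a1 : 0 ≤ t) (a2 : t ≤ Q.w h) (b1 : 0 ≤ t')
    (b2 : t' ≤ Q.w h') (r : 0 < ρ) (r' : 0 ≤ ρ') (he : Q.phi h (t, ρ) = Q.phi h' (t', ρ')) :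
    ρ = ρ' ∧ ((h = h' ∧ t = t') ∨ (h ≠ h' ∧ ((t = 0 ∧ t' = 0) ∨ (t = Q.w h ∧ t' = Q.w h')))) := by
  refine ⟨Q.phi_rho a1 a2 b1 b2 r.le r' he, ?_⟩
  have m := Q.uu_mem a1 a2
  have m' := Q.uu_mem b1 b2
  have key := fun d1 d2 => ch_inj' m.1 m.2 m'.1 m'.2 d1 d2 r r' he
  have hp := hw_pos Q.R
  have wl := Q.w_lt h
  have wl' := Q.w_lt h'
  have W := Q.w_real
  cases h <;> cases h' <;> simp only [uu, if_true, if_false, Bool.false_eq_true, W, true_and,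
    not_true_eq_false, false_and, or_false, ne_eq, reduceCtorEq, false_or, not_false_eq_true] at *
  · have := key (by linarith) (by linarith)
    linarith
  · by_cases hh : 8 * hw Q.R ≤ 8 * hw Q.R - t - t'
    · left; constructor <;> linarith
    · push Not at hh
      have := key (by linarith) (by linarith)
      right; constructor <;> linarith
  · by_cases hh : 8 * hw Q.R ≤ 8 * hw Q.R - t - t'
    · left; constructor <;> linarith
    · push Not at hh
      have := key (by linarith) (by linarith)
      right; constructor <;> linarith
  · have := key (by linarith) (by linarith)
    linarith

theorem pt_mem {w : ℕ} {κ : Kd} {j : ℕ} {τ : ℝ} (hj : j < w) (hτ : τ ∈ Icc (0 : ℝ) 1) :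
    0 ≤ (Q.pt w κ j τ).1 ∧ (Q.pt w κ j τ).1 ≤ w ∧ 0 ≤ (Q.pt w κ j τ).2 ∧ (Q.pt w κ j τ).2 ≤ 1 := by
  have hj' : (j : ℝ) + 1 ≤ w := by exact_mod_cast hj
  have hj0 : (0 : ℝ) ≤ j := by positivity
  have d := Q.del_pos
  have d' := Q.del_le
  obtain ⟨t0, t1⟩ := hτ
  cases κ <;> simp only [pt] <;> refine ⟨?_, ?_, ?_, ?_⟩ <;> nlinarith

theorem pt_rho_inj {w : ℕ} {κ : Kd} {j : ℕ} {τ τ' : ℝ}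
    (h : (Q.pt w κ j τ).2 = (Q.pt w κ j τ').2) : τ = τ' := by
  have d := Q.del_pos
  cases κ <;> simp only [pt] at h
  · exact h
  · linarith
  · have : Q.del * (τ - τ') = 0 := by linarith
    rcases mul_eq_zero.1 this with h | h <;> linarith

theorem lp_rbox {h : Bool} {κ : Kd} {j : ℕ} {τ : ℝ} (hj : j < Q.w h) (hτ : τ ∈ Icc (0 : ℝ) 1) :
    RBox Q.c Q.R (Q.lp h κ j τ) := by
  obtain ⟨a, b, c, d⟩ := Q.pt_mem (κ := κ) hj hτ
  exact ch_rbox (Q.uu_mem a b).1 (Q.uu_mem a b).2 c d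

def loc (h : Bool) (κ : Kd) (j : ℕ) : Set Pl := Q.lp h κ j '' Icc 0 1

theorem phi_cont (h : Bool) : Continuous (Q.phi h) := by
  unfold phi
  refine (ch_cont _ _).comp ?_
  cases h <;> simp only [uu, if_true, if_false, Bool.false_eq_true] <;> fun_prop

theorem pt_cont (w : ℕ) (κ : Kd) (j : ℕ) : Continuous (Q.pt w κ j) := by
  cases κ
  · exact (by fun_prop : Continuous fun τ : ℝ => ((j + 1 / 2 : ℝ), τ))
  · exact (by fun_prop : Continuous fun τ : ℝ => (τ * (j + 1 / 4 : ℝ), 1 / 2 + τ / 2))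
  · exact (by fun_prop : Continuous fun τ : ℝ => (w - τ * (w - j - 3 / 4 : ℝ), 1 - Q.del * (1 - τ)))

theorem loc_arc {h : Bool} {κ : Kd} {j : ℕ} (hj : j < Q.w h) :
    IsArc (Q.loc h κ j) (Q.lp h κ j 0) (Q.lp h κ j 1) := by
  refine isArc_image (γ := Q.pt (Q.w h) κ j) (f := Q.phi h) (K := univ) (Q.pt_cont _ _ _).continuousOn
    (Q.phi_cont h).continuousOn (fun _ _ => mem_univ _) ?_
  intro t ht t' ht' he
  obtain ⟨a1, a2, a3, a4⟩ := Q.pt_mem (κ := κ) hj ht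
  obtain ⟨b1, b2, b3, b4⟩ := Q.pt_mem (κ := κ) hj ht'
  exact Q.pt_rho_inj (Q.phi_rho a1 a2 b1 b2 a3 b3 he)

section meet

variable {h h' : Bool} {j j' : ℕ} {τ τ' : ℝ}

theorem lp_inj {κ κ' : Kd} (hj : j < Q.w h) (hj' : j' < Q.w h') (hτ : τ ∈ Icc (0 : ℝ) 1)
    (hτ' : τ' ∈ Icc (0 : ℝ) 1) (hr : 0 < (Q.pt (Q.w h) κ j τ).2)
    (he : Q.lp h κ j τ = Q.lp h' κ' j' τ') :
    (Q.pt (Q.w h) κ j τ).2 = (Q.pt (Q.w h') κ' j' τ').2 ∧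
    ((h = h' ∧ (Q.pt (Q.w h) κ j τ).1 = (Q.pt (Q.w h') κ' j' τ').1) ∨
     (h ≠ h' ∧ (((Q.pt (Q.w h) κ j τ).1 = 0 ∧ (Q.pt (Q.w h') κ' j' τ').1 = 0) ∨
      ((Q.pt (Q.w h) κ j τ).1 = Q.w h ∧ (Q.pt (Q.w h') κ' j' τ').1 = Q.w h')))) := by
  obtain ⟨a1, a2, a3, a4⟩ := Q.pt_mem (κ := κ) hj hτ
  obtain ⟨b1, b2, b3, b4⟩ := Q.pt_mem (κ := κ') hj' hτ'
  exact Q.phi_inj a1 a2 b1 b2 hr b3 he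

theorem cast_lt {j w : ℕ} (h : j < w) : (j : ℝ) + 1 ≤ w := by exact_mod_cast h

theorem rad_rad (hj : j < Q.w h) (hj' : j' < Q.w h') (hτ : τ ∈ Icc (0 : ℝ) 1)
    (hτ' : τ' ∈ Icc (0 : ℝ) 1) (hne : ¬ (h = h' ∧ j = j'))
    (he : Q.lp h .rad j τ = Q.lp h' .rad j' τ') : τ = 0 := by
  by_contra h0
  have h0' : 0 < τ := lt_of_le_of_ne hτ.1 (Ne.symm h0)
  have c1 := cast_lt hj
  have n1 : (0 : ℝ) ≤ j := by positivity
  rcases (Q.lp_inj (κ := .rad) (κ' := .rad) hj hj' hτ hτ' h0' he).2 with ⟨rfl, h2⟩ | ⟨-, ⟨h2, -⟩ | ⟨h2, -⟩⟩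
  · simp only [pt] at h2
    apply hne
    refine ⟨rfl, ?_⟩
    have : (j : ℝ) = j' := by linarith
    exact_mod_cast this
  · simp only [pt] at h2; linarith
  · simp only [pt] at h2; linarith

theorem lft_pos (hτ : τ ∈ Icc (0 : ℝ) 1) : 0 < (Q.pt (Q.w h) .lft j τ).2 := by
  simp only [pt]; linarith [hτ.1]

theorem rgt_pos (hτ : τ ∈ Icc (0 : ℝ) 1) : 0 < (Q.pt (Q.w h) .rgt j τ).2 := by
  simp only [pt]; nlinarith [hτ.1, Q.del_pos, Q.del_le, hτ.2]

theorem lft_rad (hj : j < Q.w h) (hj' : j' < Q.w h') (hτ : τ ∈ Icc (0 : ℝ) 1)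
    (hτ' : τ' ∈ Icc (0 : ℝ) 1) (he : Q.lp h .lft j τ = Q.lp h' .rad j' τ') :
    h = h' ∧ j' < j ∧ τ * (j + 1 / 4) = j' + 1 / 2 ∧ 1 / 2 + τ / 2 = τ' := by
  have c1 := cast_lt hj
  have c1' := cast_lt hj'
  have n1 : (0 : ℝ) ≤ j := by positivity
  have n1' : (0 : ℝ) ≤ j' := by positivity
  obtain ⟨h1, h2⟩ := Q.lp_inj hj hj' hτ hτ' (Q.lft_pos hτ) he
  rcases h2 with ⟨rfl, h2⟩ | ⟨-, ⟨-, h2⟩ | ⟨-, h2⟩⟩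
  · simp only [pt] at h1 h2
    refine ⟨rfl, ?_, h2, h1⟩
    by_contra hlt
    have : (j : ℝ) ≤ j' := by exact_mod_cast not_lt.1 hlt
    nlinarith [hτ.2, hτ.1]
  · simp only [pt] at h2; linarith
  · simp only [pt] at h2; linarith

theorem rgt_rad (hj : j < Q.w h) (hj' : j' < Q.w h') (hτ : τ ∈ Icc (0 : ℝ) 1)
    (hτ' : τ' ∈ Icc (0 : ℝ) 1) (he : Q.lp h .rgt j τ = Q.lp h' .rad j' τ') :
    h = h' ∧ j < j' ∧ Q.w h - τ * (Q.w h - j - 3 / 4) = j' + 1 / 2 ∧ 1 - Q.del * (1 - τ) = τ' := by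
  have c1 := cast_lt hj
  have c1' := cast_lt hj'
  have n1 : (0 : ℝ) ≤ j := by positivity
  have n1' : (0 : ℝ) ≤ j' := by positivity
  obtain ⟨h1, h2⟩ := Q.lp_inj hj hj' hτ hτ' (Q.rgt_pos hτ) he
  rcases h2 with ⟨rfl, h2⟩ | ⟨-, ⟨-, h2⟩ | ⟨-, h2⟩⟩
  · simp only [pt] at h1 h2
    refine ⟨rfl, ?_, h2, h1⟩
    by_contra hlt
    have : (j' : ℝ) ≤ j := by exact_mod_cast not_lt.1 hlt
    nlinarith [hτ.2, hτ.1]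
  · simp only [pt] at h2; linarith
  · simp only [pt] at h2; linarith

theorem lft_rgt (hj : j < Q.w h) (hj' : j' < Q.w h') (hτ : τ ∈ Icc (0 : ℝ) 1)
    (hτ' : τ' ∈ Icc (0 : ℝ) 1) (he : Q.lp h .lft j τ = Q.lp h' .rgt j' τ') :
    h = h' ∧ j' < j ∧ τ * (j + 1 / 4) = Q.w h - τ' * (Q.w h - j' - 3 / 4) ∧
      1 / 2 + τ / 2 = 1 - Q.del * (1 - τ') := by
  have c1 := cast_lt hj
  have c1' := cast_lt hj'
  have n1 : (0 : ℝ) ≤ j := by positivity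
  have n1' : (0 : ℝ) ≤ j' := by positivity
  obtain ⟨h1, h2⟩ := Q.lp_inj hj hj' hτ hτ' (Q.lft_pos hτ) he
  rcases h2 with ⟨rfl, h2⟩ | ⟨-, ⟨-, h2⟩ | ⟨h2, -⟩⟩
  · simp only [pt] at h1 h2
    refine ⟨rfl, ?_, h2, h1⟩
    by_contra hlt
    have : (j : ℝ) ≤ j' := by exact_mod_cast not_lt.1 hlt
    nlinarith [hτ.2, hτ.1, hτ'.1, hτ'.2]
  · simp only [pt] at h2; nlinarith [hτ'.1, hτ'.2]
  · simp only [pt] at h2; nlinarith [hτ.1, hτ.2]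

theorem lft_lft (hj : j < Q.w h) (hj' : j' < Q.w h') (hτ : τ ∈ Icc (0 : ℝ) 1)
    (hτ' : τ' ∈ Icc (0 : ℝ) 1) (hne : ¬ (h = h' ∧ j = j'))
    (he : Q.lp h .lft j τ = Q.lp h' .lft j' τ') : τ = 0 := by
  have c1 := cast_lt hj
  have n1 : (0 : ℝ) ≤ j := by positivity
  obtain ⟨h1, h2⟩ := Q.lp_inj hj hj' hτ hτ' (Q.lft_pos hτ) he
  rcases h2 with ⟨rfl, h2⟩ | ⟨-, ⟨h2, -⟩ | ⟨h2, -⟩⟩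
  · simp only [pt] at h1 h2
    obtain rfl : τ = τ' := by linarith
    have h3 : τ * ((j : ℝ) - j') = 0 := by linarith
    rcases mul_eq_zero.1 h3 with h3 | h3
    · exact h3
    · exfalso; apply hne; refine ⟨rfl, ?_⟩
      have : (j : ℝ) = j' := by linarith
      exact_mod_cast this
  · simp only [pt] at h2
    rcases mul_eq_zero.1 h2 with h3 | h3
    · exact h3
    · linarith
  · simp only [pt] at h2; nlinarith [hτ.1, hτ.2]

theorem rgt_rgt (hj : j < Q.w h) (hj' : j' < Q.w h') (hτ : τ ∈ Icc (0 : ℝ) 1)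
    (hτ' : τ' ∈ Icc (0 : ℝ) 1) (hne : ¬ (h = h' ∧ j = j'))
    (he : Q.lp h .rgt j τ = Q.lp h' .rgt j' τ') : τ = 0 := by
  have c1 := cast_lt hj
  have n1 : (0 : ℝ) ≤ j := by positivity
  have d := Q.del_pos
  obtain ⟨h1, h2⟩ := Q.lp_inj hj hj' hτ hτ' (Q.rgt_pos hτ) he
  rcases h2 with ⟨rfl, h2⟩ | ⟨-, ⟨h2, -⟩ | ⟨h2, -⟩⟩
  · simp only [pt] at h1 h2
    obtain rfl : τ = τ' := by
      have : Q.del * (τ - τ') = 0 := by linarith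
      rcases mul_eq_zero.1 this with h | h <;> linarith
    have h3 : τ * ((j : ℝ) - j') = 0 := by linarith
    rcases mul_eq_zero.1 h3 with h3 | h3
    · exact h3
    · exfalso; apply hne; refine ⟨rfl, ?_⟩
      have : (j : ℝ) = j' := by linarith
      exact_mod_cast this
  · simp only [pt] at h2; nlinarith [hτ.1, hτ.2]
  · simp only [pt] at h2
    have h2 : τ * (Q.w h - j - 3 / 4 : ℝ) = 0 := by linarith
    rcases mul_eq_zero.1 h2 with h3 | h3
    · exact h3
    · linarith

theorem no_tri {i l : ℕ} {τ' τ'' : ℝ} {h' h'' : Bool} (hj : j < Q.w h) (hi : i < Q.w h') (hl : l < Q.w h'')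
    (hτ : τ ∈ Icc (0 : ℝ) 1) (hτ' : τ' ∈ Icc (0 : ℝ) 1) (hτ'' : τ'' ∈ Icc (0 : ℝ) 1)
    (h1 : Q.lp h .lft j τ = Q.lp h' .rgt i τ') (h2 : Q.lp h .lft j τ = Q.lp h'' .rad l τ'') : False := by
  obtain ⟨rfl, a1, a2, a3⟩ := Q.lft_rgt hj hi hτ hτ' h1
  obtain ⟨rfl, b1, b2, b3⟩ := Q.lft_rad hj hl hτ hτ'' h2
  have c1 := cast_lt hj
  have c2 := cast_lt b1
  have n1 : (0 : ℝ) ≤ j := by positivity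
  have wl := Q.w_lt h
  have d := Q.del_pos
  have hd : Q.del * (4 * (8 * hw Q.R)) = 1 := by
    have := hw_pos Q.R
    unfold del; field_simp
  have e1 : 1 - τ ≤ 2 * Q.del := by nlinarith [hτ'.1, hτ'.2]
  have e2 : (1 - τ) * (j + 1 / 4) ≥ 3 / 4 := by nlinarith
  have e3 : (1 - τ) * (j + 1 / 4) ≤ 2 * Q.del * (j + 1 / 4) := by
    apply mul_le_mul_of_nonneg_right e1; positivity
  have e4 : 2 * Q.del * (j + 1 / 4) ≤ 2 * Q.del * (8 * hw Q.R) := by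
    apply mul_le_mul_of_nonneg_left _ (by positivity); linarith
  linarith

end meet

/-- positions of the two satellites -/
noncomputable def sat (b : Bool) : Pl := if b then Q.phi true (Q.w true, 1 - Q.del) else Q.phi true (0, 1 / 2)

noncomputable def stubPt (b : Bool) (τ : ℝ) : Pl :=
  if b then Q.phi true (Q.w true, (1 - Q.del) * τ) else Q.phi true (0, τ / 2)

def stub (b : Bool) : Set Pl := Q.stubPt b '' Icc 0 1

theorem w_pos (h : Bool) : 0 < Q.w h := by
  have := Q.h1; have := Q.h2
  cases h <;> simp only [w, if_true, if_false, Bool.false_eq_true] <;> omega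

theorem phi_glue0 (h : Bool) (ρ : ℝ) : Q.phi h (0, ρ) = Q.phi true (0, ρ) := by
  cases h
  · simp only [phi, uu, if_true, if_false, Bool.false_eq_true, add_zero, sub_zero]
    exact ch_per (by positivity) Q.c0_lt.le
  · rfl

theorem phi_gluew (h : Bool) (ρ : ℝ) : Q.phi h (Q.w h, ρ) = Q.phi true (Q.w true, ρ) := by
  cases h
  · simp only [phi, uu, w_real, if_true, if_false, Bool.false_eq_true]
    congr 2; ring
  · rfl

theorem lft_start (h : Bool) (j : ℕ) : Q.lp h .lft j 0 = Q.sat false := by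
  simp only [lp, pt, sat, Bool.false_eq_true, if_false]
  rw [← Q.phi_glue0 h]; norm_num

theorem rgt_start (h : Bool) (j : ℕ) : Q.lp h .rgt j 0 = Q.sat true := by
  simp only [lp, pt, sat, if_true]
  rw [← Q.phi_gluew h]; norm_num

theorem stub_rho {b : Bool} {τ : ℝ} (hτ : τ ∈ Icc (0 : ℝ) 1) : ∃ t ρ : ℝ, 0 ≤ t ∧ t ≤ Q.w true ∧ 0 ≤ ρ ∧ ρ ≤ 1 ∧
    Q.stubPt b τ = Q.phi true (t, ρ) ∧ ρ = (if b then (1 - Q.del) * τ else τ / 2) ∧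
    t = (if b then (Q.w true : ℝ) else 0) := by
  have d := Q.del_pos
  have d' := Q.del_le
  cases b
  · exact ⟨0, τ / 2, le_rfl, by positivity, by linarith [hτ.1], by linarith [hτ.2], rfl, rfl, rfl⟩
  · exact ⟨Q.w true, (1 - Q.del) * τ, by positivity, le_rfl, by nlinarith [hτ.1], by nlinarith [hτ.2, hτ.1], rfl, rfl, rfl⟩

theorem stub_rbox {b : Bool} {q : Pl} (hq : q ∈ Q.stub b) : RBox Q.c Q.R q := by
  obtain ⟨τ, hτ, rfl⟩ := hq
  obtain ⟨t, ρ, h1, h2, h3, h4, h5, -, -⟩ := Q.stub_rho (b := b) hτ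
  rw [h5]
  exact ch_rbox (Q.uu_mem h1 h2).1 (Q.uu_mem h1 h2).2 h3 h4

theorem stub_arc (b : Bool) : IsArc (Q.stub b) (Q.sat b) (ch Q.c Q.R (0, 0)) := by
  have e0 : Q.stubPt b 0 = ch Q.c Q.R (0, 0) := by
    cases b <;> simp only [stubPt, phi, if_true, if_false, Bool.false_eq_true, mul_zero, zero_div] <;>
      rw [ch_zero, ch_zero]
  have e1 : Q.stubPt b 1 = Q.sat b := by
    cases b <;> simp [stubPt, sat]
  rw [← e0, ← e1]
  have h := (isArc_image (γ := fun τ : ℝ => if b then ((Q.w true : ℝ), (1 - Q.del) * τ) else (0, τ / 2))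
    (f := Q.phi true) (K := univ) (by
    apply Continuous.continuousOn
    cases b <;> simp only [if_true, if_false, Bool.false_eq_true] <;> fun_prop) (Q.phi_cont true).continuousOn (fun _ _ => mem_univ _) (by
    intro τ hτ τ' hτ' he
    have hd := Q.del_le
    cases b
    · simp only [if_false, Bool.false_eq_true] at he
      have := Q.phi_rho le_rfl (by positivity) le_rfl (by positivity) (by linarith [hτ.1]) (by linarith [hτ'.1]) he
      linarith
    · simp only [if_true] at he
      have := Q.phi_rho (by positivity) le_rfl (by positivity) le_rfl (by nlinarith [hτ.1]) (by nlinarith [hτ'.1]) he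
      exact mul_left_cancel₀ (by linarith) this)).symm
  convert h using 1
  · unfold stub; congr 1; ext τ : 1; cases b <;> simp [stubPt]
  · cases b <;> simp [stubPt]
  · cases b <;> simp [stubPt]

/-- a stub meets a start only in a satellite position or at the centre -/
theorem stub_loc {b h : Bool} {κ : Kd} {j : ℕ} (hj : j < Q.w h) {q : Pl} (hq : q ∈ Q.stub b)
    (hq' : q ∈ Q.loc h κ j) : (κ = .rad ∧ q = ch Q.c Q.R (0, 0)) ∨ (κ = .lft ∧ b = false ∧ q = Q.sat false) ∨
      (κ = .rgt ∧ b = true ∧ q = Q.sat true) := by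
  obtain ⟨τ, hτ, rfl⟩ := hq
  obtain ⟨τ', hτ', he⟩ := hq'
  obtain ⟨t, ρ, h1, h2, h3, h4, h5, h6, h7⟩ := Q.stub_rho (b := b) hτ
  rw [h5] at he
  obtain ⟨a1, a2, a3, a4⟩ := Q.pt_mem (κ := κ) hj hτ'
  have c1 := cast_lt hj
  have n1 : (0 : ℝ) ≤ j := by positivity
  have d := Q.del_pos
  have d' := Q.del_le
  have wp : (0 : ℝ) < Q.w true := by exact_mod_cast Q.w_pos true
  have wp' : (0 : ℝ) < Q.w h := by exact_mod_cast Q.w_pos h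
  rcases a3.eq_or_lt with h0 | h0
  · have hr : κ = .rad := by
      cases κ
      · rfl
      · have := Q.lft_pos (h := h) (j := j) hτ'; linarith
      · have := Q.rgt_pos (h := h) (j := j) hτ'; linarith
    refine Or.inl ⟨hr, ?_⟩
    rw [h5, ← he]
    have : Q.pt (Q.w h) κ j τ' = ((Q.pt (Q.w h) κ j τ').1, 0) := by rw [h0]
    unfold lp phi
    rw [← h0, ch_zero, ch_zero]
  · obtain ⟨r, hh⟩ := Q.phi_inj a1 a2 h1 h2 h0 h3 he
    cases κ
    · exfalso
      simp only [pt] at hh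
      cases b <;> simp only [if_true, if_false, Bool.false_eq_true] at h7 <;> rw [h7] at hh <;>
      rcases hh with ⟨rfl, hh⟩ | ⟨-, ⟨hh, hh'⟩ | ⟨hh, hh'⟩⟩ <;> linarith
    · right; left
      refine ⟨rfl, ?_⟩
      simp only [pt] at hh r
      cases b <;> simp only [if_true, if_false, Bool.false_eq_true] at h7 h6 <;> rw [h7] at hh
      · refine ⟨rfl, ?_⟩
        have : τ = 1 := by linarith [hτ.2, hτ'.1]
        subst this
        simp [stubPt, sat]
      · exfalso
        rcases hh with ⟨rfl, hh⟩ | ⟨-, ⟨hh, hh'⟩ | ⟨hh, hh'⟩⟩ <;> nlinarith [hτ'.1, hτ'.2]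
    · right; right
      refine ⟨rfl, ?_⟩
      simp only [pt] at hh r
      cases b <;> simp only [if_true, if_false, Bool.false_eq_true] at h7 h6 <;> rw [h7] at hh
      · exfalso
        rcases hh with ⟨rfl, hh⟩ | ⟨-, ⟨hh, hh'⟩ | ⟨hh, hh'⟩⟩ <;> nlinarith [hτ'.1, hτ'.2]
      · refine ⟨rfl, ?_⟩
        have : τ = 1 := by nlinarith [hτ.2, hτ'.1]
        subst this
        simp [stubPt, sat]

theorem stub_stub {q : Pl} (hq : q ∈ Q.stub false) (hq' : q ∈ Q.stub true) : q = ch Q.c Q.R (0, 0) := by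
  obtain ⟨τ, hτ, rfl⟩ := hq
  obtain ⟨τ', hτ', he⟩ := hq'
  obtain ⟨t, ρ, h1, h2, h3, h4, h5, h6, h7⟩ := Q.stub_rho (b := false) hτ
  obtain ⟨t', ρ', h1', h2', h3', h4', h5', h6', h7'⟩ := Q.stub_rho (b := true) hτ'
  have wp : (0 : ℝ) < Q.w true := by exact_mod_cast Q.w_pos true
  rw [h5, h5'] at he
  rcases h3.eq_or_lt with h0 | h0
  · rw [h5, ← h0]; unfold phi; rw [ch_zero, ch_zero]
  · exfalso
    obtain ⟨r, hh⟩ := Q.phi_inj h1 h2 h1' h2' h0 h3' he.symm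
    simp only [if_true, if_false, Bool.false_eq_true] at h7 h7'
    rcases hh with ⟨-, hh⟩ | ⟨hh, -⟩
    · linarith
    · exact hh rfl

theorem sat_mem_loc {b h : Bool} {κ : Kd} {j : ℕ} (hj : j < Q.w h) (hq : Q.sat b ∈ Q.loc h κ j) :
    (κ = .lft ∧ b = false) ∨ (κ = .rgt ∧ b = true) := by
  rcases Q.stub_loc hj (Q.stub_arc b).left_mem hq with ⟨-, h⟩ | h | h
  · exfalso
    have d := Q.del_pos
    have d' := Q.del_le
    have h2 : Q.sat b = Q.phi true ((if b then (Q.w true : ℝ) else 0), (if b then 1 - Q.del else 1 / 2)) := by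
      cases b <;> rfl
    have h3 : ch Q.c Q.R (0, 0) = Q.phi true (0, 0) := by unfold phi; rw [ch_zero, ch_zero]
    rw [h2] at h
    have := Q.phi_rho (by split_ifs <;> positivity) (by split_ifs; exact le_rfl; positivity) le_rfl (by positivity)
      (by split_ifs <;> linarith) le_rfl (h.trans h3)
    split_ifs at this <;> linarith
  · exact Or.inl ⟨h.1, h.2.1⟩
  · exact Or.inr ⟨h.1, h.2.1⟩

end LD

end HB

namespace HB

open Set

variable {V : Type} {G : SimpleGraph V} {D : Drawing G} {o : V → ℕ}

/-- graph with two satellites of `x` -/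
def satG (G : SimpleGraph V) (x : V) : SimpleGraph (V ⊕ Bool) where
  Adj A B := match A, B with
    | .inl a, .inl b => G.Adj a b
    | .inl a, .inr _ => G.Adj x a ∨ a = x
    | .inr _, .inl b => G.Adj x b ∨ b = x
    | .inr _, .inr _ => False
  symm := ⟨by
    rintro (a | a) (b | b) h
    · exact SimpleGraph.Adj.symm h
    · exact h
    · exact h
    · exact h⟩
  loopless := ⟨by
    rintro (a | a) h
    · exact G.loopless.irrefl a h
    · exact h⟩

def spr (x : V) : V ⊕ Bool → V
  | .inl v => v
  | .inr _ => x

def ord' (p c0 k : ℕ) : ℕ := (k + p - c0) % p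

namespace Plan

variable (P : Plan D o)

def ld (x : V) (c0 c1 : ℕ) (h0 : c0 < 8 * P.R + 4) (h1 : 0 < c1) (h2 : c1 < 8 * P.R + 4) : LD :=
  ⟨P.cen (P.vtx x), P.R, c0, c1, h0, h1, h2⟩

section

variable (x : V) (c0 c1 : ℕ)

noncomputable def rr (e : OE G o) : ℕ := ord' (8 * P.R + 4) c0 (P.k e 0 false)
noncomputable def hb (e : OE G o) : Bool := decide (P.rr c0 e < c1)
noncomputable def jj (e : OE G o) : ℕ :=
  if P.rr c0 e < c1 then P.rr c0 e else 8 * P.R + 4 - 1 - P.rr c0 e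

theorem rr_lt (e : OE G o) : P.rr c0 e < 8 * P.R + 4 := Nat.mod_lt _ (by omega)

theorem rr_eq (e : OE G o) (h0 : c0 < 8 * P.R + 4) :
    c0 + P.rr c0 e = P.k e 0 false ∨ c0 + P.rr c0 e = P.k e 0 false + (8 * P.R + 4) := by
  have h := P.k_lt (P.n_pos e) false
  unfold rr ord'
  by_cases hc : c0 ≤ P.k e 0 false
  · left
    have : P.k e 0 false + (8 * P.R + 4) - c0 = (P.k e 0 false - c0) + (8 * P.R + 4) := by omega
    rw [this, Nat.add_mod_right, Nat.mod_eq_of_lt (by omega)]; omega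
  · right
    rw [Nat.mod_eq_of_lt (by omega)]; omega

variable {c0 c1} (h0 : c0 < 8 * P.R + 4) (h1 : 0 < c1) (h2 : c1 < 8 * P.R + 4)

theorem jj_lt (e : OE G o) : P.jj c0 c1 e < (P.ld x c0 c1 h0 h1 h2).w (P.hb c0 c1 e) := by
  have := P.rr_lt c0 e
  unfold jj hb LD.w
  simp only [decide_eq_true_eq, ld]
  split_ifs <;> omega

theorem hj_inj (h0 : c0 < 8 * P.R + 4) {e f : OE G o} (he : e.1.1 = x) (hf : f.1.1 = x) (h : P.hb c0 c1 e = P.hb c0 c1 f)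
    (hj : P.jj c0 c1 e = P.jj c0 c1 f) : e = f := by
  have a := P.rr_lt c0 e
  have b := P.rr_lt c0 f
  have hk1 := P.k_lt (P.n_pos e) false
  have hk2 := P.k_lt (P.n_pos f) false
  have r1 := P.rr_eq c0 e h0
  have r2 := P.rr_eq c0 f h0
  have hr : P.rr c0 e = P.rr c0 f := by
    unfold hb at h
    rw [decide_eq_decide] at h
    unfold jj at hj
    split_ifs at hj <;> omega
  have hk : P.k e 0 false = P.k f 0 false := by omega
  exact (P.k_inj (b := false) (b' := false) (P.n_pos e) (P.n_pos f)
    (by simp only [pn, Bool.false_eq_true, if_false]; rw [P.node_zero, P.node_zero, he, hf]) hk).1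

noncomputable def off (κ : Kd) : ℝ := match κ with
  | .rad => 0
  | .lft => -(1 / 4)
  | .rgt => 1 / 4

noncomputable def sf (c0 c1 : ℕ) (e : OE G o) (κ : Kd) : ℝ := if P.hb c0 c1 e then off κ else - off κ

theorem sf_abs (e : OE G o) (κ : Kd) : |P.sf c0 c1 e κ| ≤ 1 / 4 := by
  unfold sf
  cases κ <;> simp only [off] <;> split_ifs <;> norm_num [abs_le]

theorem sf_inj {e : OE G o} {κ κ' : Kd} (h : P.sf c0 c1 e κ = P.sf c0 c1 e κ') : κ = κ' := by
  unfold sf at h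
  cases κ <;> cases κ' <;> simp only [off] at h <;> first | rfl | (exfalso; split_ifs at h <;> norm_num at h)

theorem sf_rad (e : OE G o) : P.sf c0 c1 e .rad = 0 := by
  unfold sf off; simp

theorem lp_one {e : OE G o} (he : e.1.1 = x) (κ : Kd) :
    (P.ld x c0 c1 h0 h1 h2).lp (P.hb c0 c1 e) κ (P.jj c0 c1 e) 1 =
      P.C (P.vtx x) (P.uS e 0 (P.sf c0 c1 e κ), 1) := by
  set Q := P.ld x c0 c1 h0 h1 h2 with hQ
  have hpt : Q.pt (Q.w (P.hb c0 c1 e)) κ (P.jj c0 c1 e) 1 = ((P.jj c0 c1 e : ℝ) + 1 / 2 + off κ, 1) := by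
    cases κ <;> simp only [LD.pt, off, Prod.mk.injEq] <;> constructor <;> first | trivial | ring | norm_num
  unfold LD.lp
  rw [hpt]
  unfold LD.phi C
  have hR : Q.R = P.R := rfl
  have hc0 : Q.c0 = c0 := rfl
  have key : Q.uu (P.hb c0 c1 e) ((P.jj c0 c1 e : ℝ) + 1 / 2 + off κ) =
      (c0 + P.rr c0 e : ℕ) + 1 / 2 + P.sf c0 c1 e κ := by
    have := P.rr_lt c0 e
    unfold LD.uu sf jj hb
    rw [hR, hw8, hc0]
    by_cases hc : P.rr c0 e < c1
    · simp only [hc, decide_true, if_true]; push_cast; ring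
    · simp only [hc, decide_false, if_false, Bool.false_eq_true]
      rw [Nat.cast_sub (by omega), Nat.cast_sub (by omega)]; push_cast; ring
  change ch (P.cen (P.vtx x)) P.R _ = _
  dsimp only
  rw [key]
  have hu := P.uS_per (P.n_pos e) (P.sf_abs (c0 := c0) (c1 := c1) e κ)
  rcases P.rr_eq c0 e h0 with h | h
  · rw [h]; rfl
  · rw [h, ← ch_per hu.1.le hu.2.le]
    congr 2
    unfold uS; rw [hw8]; push_cast; ring

/-- start of a wire -/
noncomputable def A (e : OE G o) (κ : Kd) : Set Pl :=
  open Classical in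
  if e.1.1 = x then (P.ld x c0 c1 h0 h1 h2).loc (P.hb c0 c1 e) κ (P.jj c0 c1 e)
  else spk (P.cen (P.vtx e.1.1)) P.R (P.uS e 0 0)

theorem A_x {e : OE G o} (he : e.1.1 = x) (κ : Kd) :
    P.A x h0 h1 h2 e κ = (P.ld x c0 c1 h0 h1 h2).loc (P.hb c0 c1 e) κ (P.jj c0 c1 e) := if_pos he

theorem A_o {e : OE G o} (he : e.1.1 ≠ x) (κ : Kd) :
    P.A x h0 h1 h2 e κ = spk (P.cen (P.vtx e.1.1)) P.R (P.uS e 0 0) := if_neg he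

noncomputable def psn (A : V ⊕ Bool) : Pl := match A with
  | .inl v => P.ctr v
  | .inr b => (P.ld x c0 c1 h0 h1 h2).sat b

def wsrc (e : OE G o) (κ : Kd) : V ⊕ Bool := match κ with
  | .rad => .inl e.1.1
  | .lft => .inr false
  | .rgt => .inr true

theorem A_rbox {e : OE G o} {κ : Kd} {q : Pl} (hq : q ∈ P.A x h0 h1 h2 e κ) :
    RBox (P.cen (P.vtx e.1.1)) P.R q := by
  by_cases he : e.1.1 = x
  · rw [P.A_x x h0 h1 h2 he] at hq
    obtain ⟨τ, hτ, rfl⟩ := hq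
    rw [he]
    exact (P.ld x c0 c1 h0 h1 h2).lp_rbox (P.jj_lt x h0 h1 h2 e) hτ
  · rw [P.A_o x h0 h1 h2 he] at hq
    have := P.uS_per (e := e) (i := 0) (s := 0) (P.n_pos e) (by norm_num)
    have hp := hw_pos P.R
    exact spk_rbox this.1.le (by linarith) hq

theorem A_arc {e : OE G o} {κ : Kd} (hv : κ = .rad ∨ e.1.1 = x) :
    IsArc (P.A x h0 h1 h2 e κ) (P.psn x h0 h1 h2 (wsrc e κ))
      (P.C (P.vtx e.1.1) (P.uS e 0 (P.sf c0 c1 e κ), 1)) := by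
  by_cases he : e.1.1 = x
  · rw [P.A_x x h0 h1 h2 he]
    have h := (P.ld x c0 c1 h0 h1 h2).loc_arc (κ := κ) (P.jj_lt x h0 h1 h2 e)
    rw [P.lp_one x h0 h1 h2 he] at h
    rw [he]
    have hst : P.psn x h0 h1 h2 (wsrc e κ) =
        (P.ld x c0 c1 h0 h1 h2).lp (P.hb c0 c1 e) κ (P.jj c0 c1 e) 0 := by
      cases κ
      · simp only [wsrc, psn, ctr, LD.lp, LD.phi, LD.pt, C, ld, he]
        rw [ch_zero, ch_zero]
      · simp only [wsrc, psn]; rw [LD.lft_start]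
      · simp only [wsrc, psn]; rw [LD.rgt_start]
    rw [hst]
    exact h
  · obtain rfl : κ = .rad := by tauto
    rw [P.A_o x h0 h1 h2 he, sf_rad]
    have := P.uS_per (e := e) (i := 0) (s := 0) (P.n_pos e) (by norm_num)
    have hp := hw_pos P.R
    have h := spk_arc (c := P.cen (P.vtx e.1.1)) (R := P.R) this.1.le (by linarith)
    have hst : P.psn x h0 h1 h2 (wsrc e .rad) = ch (P.cen (P.vtx e.1.1)) P.R (P.uS e 0 0, 0) := by
      simp only [wsrc, psn, ctr, C]
      rw [ch_zero, ch_zero]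
    rw [hst]
    exact h

/-- full wire -/
def wire (e : OE G o) (κ : Kd) : Set Pl := P.A x h0 h1 h2 e κ ∪ P.body e (P.sf c0 c1 e κ)

theorem ne_ends (e : OE G o) : e.1.1 ≠ e.1.2 := e.2.1.ne

theorem wire_arc {e : OE G o} {κ : Kd} (hv : κ = .rad ∨ e.1.1 = x) :
    IsArc (P.wire x h0 h1 h2 e κ) (P.psn x h0 h1 h2 (wsrc e κ)) (P.psn x h0 h1 h2 (.inl e.1.2)) := by
  refine (P.A_arc x h0 h1 h2 hv).trans (P.body_arc (P.sf_abs e κ)) ?_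
  rintro q ⟨hq, hq'⟩
  rcases P.body_box (P.sf_abs e κ) hq' (P.A_rbox x h0 h1 h2 hq) with ⟨-, h⟩ | ⟨i, hi, h, -⟩ | ⟨h, -⟩
  · exact h
  · exact absurd h.symm (P.node_int e _ _ (by omega) hi)
  · exact absurd (P.vtx_inj h) (ne_ends e)

/-- body of `f` inside the box of the source of `e` -/
theorem A_body {e f : OE G o} {κ κ' : Kd} (hv' : κ' = .rad ∨ f.1.1 = x) {q : Pl}
    (hx : ∀ e : OE G o, e.1.2 ≠ x)
    (hv : κ = .rad ∨ e.1.1 = x) (hq : q ∈ P.A x h0 h1 h2 e κ) (hq' : q ∈ P.body f (P.sf c0 c1 f κ')) :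
    (e.1.1 = f.1.1 ∧ q ∈ P.A x h0 h1 h2 f κ') ∨ (κ = .rad ∧ e.1.1 = f.1.2 ∧ q = P.ctr e.1.1) := by
  have hR := P.A_rbox x h0 h1 h2 hq
  rcases P.body_box (P.sf_abs f κ') hq' hR with ⟨h, h'⟩ | ⟨i, hi, h, -⟩ | ⟨h, h'⟩
  · left
    refine ⟨P.vtx_inj h, ?_⟩
    rw [h', h]; exact (P.A_arc x h0 h1 h2 hv').right_mem
  · exact absurd h.symm (P.node_int f _ _ (by omega) hi)
  · have h := P.vtx_inj h
    have he : e.1.1 ≠ x := fun h' => hx f (h.symm.trans h')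
    right
    refine ⟨by tauto, h, ?_⟩
    rw [P.A_o x h0 h1 h2 he] at hq
    obtain ⟨ρ, hρ, hk⟩ := hq
    obtain ⟨ρ', hρ', hk'⟩ := h'
    rw [← h] at hk'
    have hn := P.n_pos f
    have u1 := P.uS_per (e := e) (i := 0) (s := 0) (P.n_pos e) (by norm_num)
    have u2 := P.uE_per (e := f) (i := P.n f - 1) (by omega) (P.sf_abs (c0 := c0) (c1 := c1) f κ')
    rcases hρ.1.eq_or_lt with hz | hz
    · rw [← hk, ← hz]; exact P.C_zero _ _
    · exfalso
      rw [← hk'] at hk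
      have := (ch_inj (per0 u1.1 u1.2) (per0 u2.1 u2.2) hz hρ'.1 hk).1
      exact P.uS_ne_uE (e := e) (f := f) (P.n_pos e) (by omega) (by norm_num) (P.sf_abs f κ')
        (by rw [P.node_zero, P.node_n, h]) this

theorem A_A {e f : OE G o} {κ κ' : Kd} (hv : κ = .rad ∨ e.1.1 = x) (hv' : κ' = .rad ∨ f.1.1 = x)
    (hne : ¬ (e = f ∧ κ = κ')) {q : Pl} (hs : e.1.1 = f.1.1)
    (hq : q ∈ P.A x h0 h1 h2 e κ) (hq' : q ∈ P.A x h0 h1 h2 f κ') :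
    (wsrc e κ = wsrc f κ' ∧ q = P.psn x h0 h1 h2 (wsrc e κ)) ∨
    (κ ≠ κ' ∧ e ≠ f ∧ e.1.1 = x ∧ f.1.1 = x) := by
  by_cases he : e.1.1 = x
  · have hf : f.1.1 = x := hs ▸ he
    by_cases hκ : κ = κ'
    · subst hκ
      have hef : e ≠ f := fun h => hne ⟨h, rfl⟩
      left
      have hww : wsrc e κ = wsrc f κ := by cases κ <;> simp [wsrc, hs]
      refine ⟨hww, ?_⟩
      rw [P.A_x x h0 h1 h2 he] at hq
      rw [P.A_x x h0 h1 h2 hf] at hq'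
      obtain ⟨τ, hτ, rfl⟩ := hq
      obtain ⟨τ', hτ', h⟩ := hq'
      have hn : ¬ (P.hb c0 c1 e = P.hb c0 c1 f ∧ P.jj c0 c1 e = P.jj c0 c1 f) := fun h =>
        hef (P.hj_inj x h0 he hf h.1 h.2)
      have hj := P.jj_lt x h0 h1 h2 e
      have hj' := P.jj_lt x h0 h1 h2 f
      cases κ
      · rw [LD.rad_rad _ hj hj' hτ hτ' hn h.symm]
        simp only [LD.lp, LD.phi, LD.pt, wsrc, psn, ctr, C, he, ld]
        rw [ch_zero, ch_zero]
      · rw [LD.lft_lft _ hj hj' hτ hτ' hn h.symm, LD.lft_start]; rfl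
      · rw [LD.rgt_rgt _ hj hj' hτ hτ' hn h.symm, LD.rgt_start]; rfl
    · by_cases hef : e = f
      · exfalso
        subst hef
        rw [P.A_x x h0 h1 h2 he] at hq hq'
        obtain ⟨τ, hτ, rfl⟩ := hq
        obtain ⟨τ', hτ', h⟩ := hq'
        have hj := P.jj_lt x h0 h1 h2 e
        cases κ <;> cases κ' <;> first | exact hκ rfl | skip
        · exact absurd (LD.lft_rad _ hj hj hτ' hτ h).2.1 (lt_irrefl _)
        · exact absurd (LD.rgt_rad _ hj hj hτ' hτ h).2.1 (lt_irrefl _)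
        · exact absurd (LD.lft_rad _ hj hj hτ hτ' h.symm).2.1 (lt_irrefl _)
        · exact absurd (LD.lft_rgt _ hj hj hτ hτ' h.symm).2.1 (lt_irrefl _)
        · exact absurd (LD.rgt_rad _ hj hj hτ hτ' h.symm).2.1 (lt_irrefl _)
        · exact absurd (LD.lft_rgt _ hj hj hτ' hτ h).2.1 (lt_irrefl _)
      · exact Or.inr ⟨hκ, hef, he, hf⟩
  · have hf : f.1.1 ≠ x := hs ▸ he
    obtain rfl : κ = .rad := by tauto
    obtain rfl : κ' = .rad := by tauto
    have hef : e ≠ f := fun h => hne ⟨h, rfl⟩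
    left
    refine ⟨by simp [wsrc, hs], ?_⟩
    rw [P.A_o x h0 h1 h2 he] at hq
    rw [P.A_o x h0 h1 h2 hf] at hq'
    obtain ⟨ρ, hρ, hk⟩ := hq
    obtain ⟨ρ', hρ', hk'⟩ := hq'
    rw [← hs] at hk'
    have u1 := P.uS_per (e := e) (i := 0) (s := 0) (P.n_pos e) (by norm_num)
    have u2 := P.uS_per (e := f) (i := 0) (s := 0) (P.n_pos f) (by norm_num)
    rcases hρ.1.eq_or_lt with hz | hz
    · rw [← hk, ← hz]; exact P.C_zero _ _
    · exfalso
      rw [← hk'] at hk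
      have := (ch_inj (per0 u1.1 u1.2) (per0 u2.1 u2.2) hz hρ'.1 hk).1
      exact hef (P.uS_inj (P.n_pos e) (P.n_pos f) (by norm_num) (by norm_num)
        (by rw [P.node_zero, P.node_zero, hs]) this).1

/-- how two wires can meet -/
theorem wire_wire {e f : OE G o} {κ κ' : Kd} (hx : ∀ e : OE G o, e.1.2 ≠ x)
    (hv : κ = .rad ∨ e.1.1 = x) (hv' : κ' = .rad ∨ f.1.1 = x)
    (hne : ¬ (e = f ∧ κ = κ')) {q : Pl}
    (hq : q ∈ P.wire x h0 h1 h2 e κ) (hq' : q ∈ P.wire x h0 h1 h2 f κ') :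
    (∃ v, v ∈ s(wsrc e κ, Sum.inl e.1.2) ∧ v ∈ s(wsrc f κ', Sum.inl f.1.2) ∧ q = P.psn x h0 h1 h2 v) ∨
    P.Cross e (P.sf c0 c1 e κ) f (P.sf c0 c1 f κ') q ∨
    (κ ≠ κ' ∧ e ≠ f ∧ e.1.1 = x ∧ f.1.1 = x ∧ q ∈ P.A x h0 h1 h2 e κ ∧ q ∈ P.A x h0 h1 h2 f κ') := by
  have loc : e.1.1 = f.1.1 → q ∈ P.A x h0 h1 h2 e κ → q ∈ P.A x h0 h1 h2 f κ' → 
      (∃ v, v ∈ s(wsrc e κ, Sum.inl e.1.2) ∧ v ∈ s(wsrc f κ', Sum.inl f.1.2) ∧ q = P.psn x h0 h1 h2 v) ∨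
      P.Cross e (P.sf c0 c1 e κ) f (P.sf c0 c1 f κ') q ∨
      (κ ≠ κ' ∧ e ≠ f ∧ e.1.1 = x ∧ f.1.1 = x ∧ q ∈ P.A x h0 h1 h2 e κ ∧ q ∈ P.A x h0 h1 h2 f κ') := by
    intro h k k'
    rcases P.A_A x h0 h1 h2 hv hv' hne h k k' with ⟨a, b⟩ | ⟨a, b, c, d⟩
    · exact Or.inl ⟨_, by simp, by rw [a]; simp, b⟩
    · exact Or.inr (Or.inr ⟨a, b, c, d, k, k'⟩)
  rcases hq with hq | hq <;> rcases hq' with hq' | hq'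
  · exact loc (P.vtx_inj (P.rbox_eq (P.A_rbox x h0 h1 h2 hq) (P.A_rbox x h0 h1 h2 hq'))) hq hq'
  · rcases P.A_body x h0 h1 h2 hv' hx hv hq hq' with ⟨h, h'⟩ | ⟨rfl, h, h'⟩
    · exact loc h hq h'
    · exact Or.inl ⟨.inl e.1.1, by simp [wsrc], by simp [h], h'⟩
  · rcases P.A_body x h0 h1 h2 hv hx hv' hq' hq with ⟨h, h'⟩ | ⟨rfl, h, h'⟩
    · exact loc h.symm h' hq'
    · exact Or.inl ⟨.inl f.1.1, by simp [h], by simp [wsrc], h'⟩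
  · rcases P.body_inter (P.sf_abs e κ) (P.sf_abs f κ') (fun h => hne ⟨h.1, by
      obtain ⟨rfl, h⟩ := h; exact P.sf_inj h⟩) hq hq' with ⟨h, h'⟩ | h
    · exact Or.inl ⟨.inl e.1.2, by simp, by simp [h], h'⟩
    · exact Or.inr (Or.inl h)

/-- a box point of vertex `v` on a wire -/
theorem wire_xbox {e : OE G o} {κ : Kd} (hx : ∀ e : OE G o, e.1.2 ≠ x)
    (hv : κ = .rad ∨ e.1.1 = x) {q : Pl} (hq : q ∈ P.wire x h0 h1 h2 e κ)
    (hR : RBox (P.cen (P.vtx x)) P.R q) : e.1.1 = x ∧ q ∈ P.A x h0 h1 h2 e κ := by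
  rcases hq with hq | hq
  · exact ⟨P.vtx_inj (P.rbox_eq (P.A_rbox x h0 h1 h2 hq) hR), hq⟩
  · rcases P.body_box (P.sf_abs e κ) hq hR with ⟨h, h'⟩ | ⟨i, hi, h, -⟩ | ⟨h, h'⟩
    · refine ⟨(P.vtx_inj h).symm, ?_⟩
      rw [h', h]; exact (P.A_arc x h0 h1 h2 hv).right_mem
    · exact absurd h.symm (P.node_int e _ _ (by omega) hi)
    · exact absurd (P.vtx_inj h).symm (hx e)

theorem ctr_rbox (v : V) : RBox (P.cen (P.vtx v)) P.R (P.ctr v) :=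
  ch_rbox le_rfl (by have := hw_pos P.R; linarith) le_rfl zero_le_one

theorem ctr_wire {e : OE G o} {κ : Kd}
    (hv : κ = .rad ∨ e.1.1 = x) {v : V} (hq : P.ctr v ∈ P.wire x h0 h1 h2 e κ) :
    Sum.inl v = wsrc e κ ∨ v = e.1.2 := by
  have hp := hw_pos P.R
  have hR := P.ctr_rbox v
  rcases hq with hq | hq
  · have hvv : v = e.1.1 := (P.vtx_inj (P.rbox_eq (P.A_rbox x h0 h1 h2 hq) hR)).symm
    subst hvv
    left
    cases κ
    · rfl
    · exfalso
      have he : e.1.1 = x := by simpa using hv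
      rw [P.A_x x h0 h1 h2 he] at hq
      obtain ⟨τ, hτ, h⟩ := hq
      have h3 : P.ctr e.1.1 = (P.ld x c0 c1 h0 h1 h2).phi true (0, 0) := by
        unfold LD.phi ctr C
        simp only [ld, he]
        rw [ch_zero, ch_zero]
      rw [h3] at h
      obtain ⟨a1, a2, a3, a4⟩ := LD.pt_mem (P.ld x c0 c1 h0 h1 h2) (κ := .lft)
        (P.jj_lt x h0 h1 h2 e) hτ
      have h5 := LD.phi_rho _ a1 a2 le_rfl (by positivity) a3 le_rfl h
      have h4 := LD.lft_pos (P.ld x c0 c1 h0 h1 h2) (h := P.hb c0 c1 e) (j := P.jj c0 c1 e) hτ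
      linarith
    · exfalso
      have he : e.1.1 = x := by simpa using hv
      rw [P.A_x x h0 h1 h2 he] at hq
      obtain ⟨τ, hτ, h⟩ := hq
      have h3 : P.ctr e.1.1 = (P.ld x c0 c1 h0 h1 h2).phi true (0, 0) := by
        unfold LD.phi ctr C
        simp only [ld, he]
        rw [ch_zero, ch_zero]
      rw [h3] at h
      obtain ⟨a1, a2, a3, a4⟩ := LD.pt_mem (P.ld x c0 c1 h0 h1 h2) (κ := .rgt)
        (P.jj_lt x h0 h1 h2 e) hτ
      have h5 := LD.phi_rho _ a1 a2 le_rfl (by positivity) a3 le_rfl h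
      have h4 := LD.rgt_pos (P.ld x c0 c1 h0 h1 h2) (h := P.hb c0 c1 e) (j := P.jj c0 c1 e) hτ
      linarith
  · rcases P.body_box (P.sf_abs e κ) hq hR with ⟨h, h'⟩ | ⟨i, hi, h, -⟩ | ⟨h, h'⟩
    · exfalso
      have u1 := P.uS_per (P.n_pos e) (P.sf_abs (c0 := c0) (c1 := c1) e κ)
      have := ch_rho le_rfl (by linarith) le_rfl u1.1.le (by linarith) zero_le_one h'
      linarith
    · exact absurd h.symm (P.node_int e _ _ (by omega) hi)
    · exact Or.inr (P.vtx_inj h)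

theorem sat_rbox (b : Bool) : RBox (P.cen (P.vtx x)) P.R ((P.ld x c0 c1 h0 h1 h2).sat b) :=
  LD.stub_rbox _ (LD.stub_arc _ b).left_mem

theorem sat_wire {e : OE G o} {κ : Kd} (hx : ∀ e : OE G o, e.1.2 ≠ x)
    (hv : κ = .rad ∨ e.1.1 = x) {b : Bool} (hq : (P.ld x c0 c1 h0 h1 h2).sat b ∈ P.wire x h0 h1 h2 e κ) :
    Sum.inr b = wsrc e κ := by
  obtain ⟨he, hq⟩ := P.wire_xbox x h0 h1 h2 hx hv hq (P.sat_rbox x h0 h1 h2 b)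
  rw [P.A_x x h0 h1 h2 he] at hq
  rcases LD.sat_mem_loc _ (P.jj_lt x h0 h1 h2 e) hq with ⟨rfl, rfl⟩ | ⟨rfl, rfl⟩ <;> rfl

theorem stub_wire {e : OE G o} {κ : Kd} (hx : ∀ e : OE G o, e.1.2 ≠ x)
    (hv : κ = .rad ∨ e.1.1 = x) {b : Bool} {q : Pl} (hs : q ∈ (P.ld x c0 c1 h0 h1 h2).stub b)
    (hq : q ∈ P.wire x h0 h1 h2 e κ) :
    ∃ v, v ∈ s(Sum.inr b, Sum.inl x) ∧ v ∈ s(wsrc e κ, Sum.inl e.1.2) ∧ q = P.psn x h0 h1 h2 v := by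
  obtain ⟨he, hq⟩ := P.wire_xbox x h0 h1 h2 hx hv hq (LD.stub_rbox _ hs)
  rw [P.A_x x h0 h1 h2 he] at hq
  rcases LD.stub_loc _ (P.jj_lt x h0 h1 h2 e) hs hq with ⟨rfl, h⟩ | ⟨rfl, rfl, h⟩ | ⟨rfl, rfl, h⟩
  · exact ⟨.inl x, by simp, by simp [wsrc, he], h⟩
  · exact ⟨.inr false, by simp, by simp [wsrc], h⟩
  · exact ⟨.inr true, by simp, by simp [wsrc], h⟩

end

end Plan

end HB

namespace HB

open Set

variable {V : Type} {G : SimpleGraph V} {D : Drawing G} {o : V → ℕ}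

theorem IsArc.ne {S : Set Pl} {p q : Pl} (h : IsArc S p q) : p ≠ q := by
  obtain ⟨γ, -, hi, rfl, rfl, -⟩ := h
  intro h
  exact zero_ne_one (hi (by simp) (by simp) h)

namespace LD

variable (Q : LD) {h h' : Bool} {j j' : ℕ} {τ τ' σ σ' : ℝ}

theorem lft_rad_uniq (hj : j < Q.w h) (hj' : j' < Q.w h') (hτ : τ ∈ Icc (0 : ℝ) 1)
    (hτ' : τ' ∈ Icc (0 : ℝ) 1) (hσ : σ ∈ Icc (0 : ℝ) 1) (hσ' : σ' ∈ Icc (0 : ℝ) 1)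
    (he : Q.lp h .lft j τ = Q.lp h' .rad j' τ') (hf : Q.lp h .lft j σ = Q.lp h' .rad j' σ') : τ = σ := by
  obtain ⟨-, -, a, -⟩ := Q.lft_rad hj hj' hτ hτ' he
  obtain ⟨-, -, b, -⟩ := Q.lft_rad hj hj' hσ hσ' hf
  have n1 : (0 : ℝ) ≤ j := by positivity
  exact mul_right_cancel₀ (b := (j : ℝ) + 1 / 4) (by positivity) (a.trans b.symm)

theorem rgt_rad_uniq (hj : j < Q.w h) (hj' : j' < Q.w h') (hτ : τ ∈ Icc (0 : ℝ) 1)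
    (hτ' : τ' ∈ Icc (0 : ℝ) 1) (hσ : σ ∈ Icc (0 : ℝ) 1) (hσ' : σ' ∈ Icc (0 : ℝ) 1)
    (he : Q.lp h .rgt j τ = Q.lp h' .rad j' τ') (hf : Q.lp h .rgt j σ = Q.lp h' .rad j' σ') : τ = σ := by
  obtain ⟨-, -, a, -⟩ := Q.rgt_rad hj hj' hτ hτ' he
  obtain ⟨-, -, b, -⟩ := Q.rgt_rad hj hj' hσ hσ' hf
  have n1 := cast_lt hj
  exact mul_right_cancel₀ (b := (Q.w h : ℝ) - j - 3 / 4) (by linarith) (by linarith)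

theorem lft_rgt_uniq (hj : j < Q.w h) (hj' : j' < Q.w h') (hτ : τ ∈ Icc (0 : ℝ) 1)
    (hτ' : τ' ∈ Icc (0 : ℝ) 1) (hσ : σ ∈ Icc (0 : ℝ) 1) (hσ' : σ' ∈ Icc (0 : ℝ) 1)
    (he : Q.lp h .lft j τ = Q.lp h' .rgt j' τ') (hf : Q.lp h .lft j σ = Q.lp h' .rgt j' σ') : τ = σ := by
  obtain ⟨h1, -, a, a'⟩ := Q.lft_rgt hj hj' hτ hτ' he
  obtain ⟨-, -, b, b'⟩ := Q.lft_rgt hj hj' hσ hσ' hf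
  have n1 := cast_lt hj
  subst h1
  have n2 := cast_lt hj'
  have n3 : (0 : ℝ) ≤ j := by positivity
  have d := Q.del_pos
  by_contra hne
  rcases lt_or_gt_of_ne hne with hlt | hlt
  · have k1 : Q.del * (1 - σ') < Q.del * (1 - τ') := by linarith
    have k2 : τ' < σ' := by nlinarith
    have k3 : τ * (j + 1 / 4) < σ * (j + 1 / 4) := by nlinarith
    have k4 : τ' * (Q.w h - j' - 3 / 4) ≤ σ' * (Q.w h - j' - 3 / 4) := by nlinarith
    linarith
  · have k1 : Q.del * (1 - τ') < Q.del * (1 - σ') := by linarith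
    have k2 : σ' < τ' := by nlinarith
    have k3 : σ * (j + 1 / 4) < τ * (j + 1 / 4) := by nlinarith
    have k4 : σ' * (Q.w h - j' - 3 / 4) ≤ τ' * (Q.w h - j' - 3 / 4) := by nlinarith
    linarith

theorem loc_uniq {κ κ' : Kd} (hκ : κ ≠ κ') (hj : j < Q.w h) (hj' : j' < Q.w h') {q q' : Pl}
    (a : q ∈ Q.loc h κ j) (a' : q ∈ Q.loc h' κ' j') (b : q' ∈ Q.loc h κ j) (b' : q' ∈ Q.loc h' κ' j') :
    q = q' := by
  obtain ⟨τ, hτ, rfl⟩ := a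
  obtain ⟨τ', hτ', h1⟩ := a'
  obtain ⟨σ, hσ, rfl⟩ := b
  obtain ⟨σ', hσ', h2⟩ := b'
  cases κ <;> cases κ' <;> first | exact absurd rfl hκ | skip
  · rw [← h1, ← h2, Q.lft_rad_uniq hj' hj hτ' hτ hσ' hσ h1 h2]
  · rw [← h1, ← h2, Q.rgt_rad_uniq hj' hj hτ' hτ hσ' hσ h1 h2]
  · rw [Q.lft_rad_uniq hj hj' hτ hτ' hσ hσ' h1.symm h2.symm]
  · rw [Q.lft_rgt_uniq hj hj' hτ hτ' hσ hσ' h1.symm h2.symm]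
  · rw [Q.rgt_rad_uniq hj hj' hτ hτ' hσ hσ' h1.symm h2.symm]
  · rw [← h1, ← h2, Q.lft_rgt_uniq hj' hj hτ' hτ hσ' hσ h1 h2]

theorem loc_tri0 {h'' : Bool} {j'' : ℕ} (hj : j < Q.w h) (hj' : j' < Q.w h') (hj'' : j'' < Q.w h'') {q : Pl}
    (a : q ∈ Q.loc h .lft j) (a' : q ∈ Q.loc h' .rgt j') (a'' : q ∈ Q.loc h'' .rad j'') : False := by
  obtain ⟨τ, hτ, rfl⟩ := a
  obtain ⟨τ', hτ', h1⟩ := a'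
  obtain ⟨τ'', hτ'', h2⟩ := a''
  exact Q.no_tri hj hj' hj'' hτ hτ' hτ'' h1.symm h2.symm

theorem loc_tri {h'' : Bool} {j'' : ℕ} {κ κ' κ'' : Kd} (h1 : κ ≠ κ') (h2 : κ ≠ κ'') (h3 : κ' ≠ κ'')
    (hj : j < Q.w h) (hj' : j' < Q.w h') (hj'' : j'' < Q.w h'') {q : Pl}
    (a : q ∈ Q.loc h κ j) (a' : q ∈ Q.loc h' κ' j') (a'' : q ∈ Q.loc h'' κ'' j'') : False := by
  cases κ <;> cases κ' <;> cases κ'' <;>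
    first
    | exact h1 rfl
    | exact h2 rfl
    | exact h3 rfl
    | exact Q.loc_tri0 hj hj' hj'' a a' a''
    | exact Q.loc_tri0 hj hj'' hj' a a'' a'
    | exact Q.loc_tri0 hj' hj hj'' a' a a''
    | exact Q.loc_tri0 hj' hj'' hj a' a'' a
    | exact Q.loc_tri0 hj'' hj hj' a'' a a'
    | exact Q.loc_tri0 hj'' hj' hj a'' a' a

end LD

theorem good_shared (hD : D.IsGood) {a b c d v : V} (h1 : v ∈ s(a, b)) (h2 : v ∈ s(c, d)) : ¬ X D a b c d := by
  rintro ⟨p, hp⟩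
  exact hD.adj_no_cross _ _ ⟨v, h1, h2⟩ p hp

theorem two_shared {W : Type} {a b c d u v : W} (h1 : u ∈ s(a, b)) (h2 : u ∈ s(c, d)) (h3 : v ∈ s(a, b))
    (h4 : v ∈ s(c, d)) (hne : u ≠ v) : s(a, b) = s(c, d) := by
  rw [(Sym2.mem_and_mem_iff hne).1 ⟨h1, h3⟩, (Sym2.mem_and_mem_iff hne).1 ⟨h2, h4⟩]

/-- wires of the surgery -/
def Om (G : SimpleGraph V) (o : V → ℕ) (x : V) : Type :=
  {ω : OE G o × Kd // ω.2 = .rad ∨ ω.1.1.1 = x} ⊕ Bool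

namespace Plan

variable (P : Plan D o) (x : V) {c0 c1 : ℕ} (h0 : c0 < 8 * P.R + 4) (h1 : 0 < c1) (h2 : c1 < 8 * P.R + 4)

def osrc (ω : Om G o x) : V ⊕ Bool := match ω with
  | .inl ω => wsrc ω.1.1 ω.1.2
  | .inr b => .inr b

def otgt (ω : Om G o x) : V ⊕ Bool := match ω with
  | .inl ω => .inl ω.1.1.1.2
  | .inr _ => .inl x

noncomputable def oS (ω : Om G o x) : Set Pl := match ω with
  | .inl ω => P.wire x h0 h1 h2 ω.1.1 ω.1.2
  | .inr b => (P.ld x c0 c1 h0 h1 h2).stub b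

theorem spr_wsrc {e : OE G o} {κ : Kd} (hv : κ = .rad ∨ e.1.1 = x) : spr x (wsrc e κ) = e.1.1 := by
  cases κ <;> simp [wsrc, spr] <;> simp at hv <;> exact hv.symm

/-- how two wires can meet -/
theorem meet (hD : D.IsGood) (hx : ∀ e : OE G o, e.1.2 ≠ x) {ω ω' : Om G o x} (hne : ω ≠ ω') {q : Pl}
    (hq : q ∈ P.oS x h0 h1 h2 ω) (hq' : q ∈ P.oS x h0 h1 h2 ω') :
    (∃ v, v ∈ s(osrc x ω, otgt x ω) ∧ v ∈ s(osrc x ω', otgt x ω') ∧ q = P.psn x h0 h1 h2 v) ∨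
    ((∀ v, v ∈ s(osrc x ω, otgt x ω) → v ∉ s(osrc x ω', otgt x ω')) ∧ 
     ∃ w w', ω = .inl w ∧ ω' = .inl w' ∧
      (P.Cross w.1.1 (P.sf c0 c1 w.1.1 w.1.2) w'.1.1 (P.sf c0 c1 w'.1.1 w'.1.2) q ∨
       (w.1.2 ≠ w'.1.2 ∧ w.1.1 ≠ w'.1.1 ∧ w.1.1.1.1 = x ∧ w'.1.1.1.1 = x ∧
        q ∈ P.A x h0 h1 h2 w.1.1 w.1.2 ∧ q ∈ P.A x h0 h1 h2 w'.1.1 w'.1.2))) := by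
  rcases ω with ⟨⟨e, κ⟩, hv⟩ | b <;> rcases ω' with ⟨⟨f, κ'⟩, hv'⟩ | b'
  · rcases P.wire_wire x h0 h1 h2 hx hv hv' (by
      rintro ⟨h3, h4⟩; apply hne; congr 2; exact Prod.ext h3 h4) hq hq' with h | h | h
    · exact Or.inl h
    · refine Or.inr ⟨?_, _, _, rfl, rfl, Or.inl h⟩
      intro v hv1 hv2
      refine good_shared hD (v := spr x v) ?_ ?_ (P.cross_X ⟨q, h⟩)
      · rw [← spr_wsrc x hv]
        simp only [osrc, otgt, Sym2.mem_iff] at hv1 ⊢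
        rcases hv1 with rfl | rfl
        · left; rfl
        · right; rfl
      · rw [← spr_wsrc x hv']
        simp only [osrc, otgt, Sym2.mem_iff] at hv2 ⊢
        rcases hv2 with rfl | rfl
        · left; rfl
        · right; rfl
    · refine Or.inr ⟨?_, _, _, rfl, rfl, Or.inr h⟩
      obtain ⟨k1, k2, k3, k4, -⟩ := h
      have k5 : e.1.2 ≠ f.1.2 := fun k => k2 (Subtype.ext (Prod.ext (k3.trans k4.symm) k))
      have e2 := hx e
      have f2 := hx f
      dsimp only at k1
      intro v hv1 hv2
      simp only [osrc, otgt, Sym2.mem_iff] at hv1 hv2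
      rcases hv1 with rfl | rfl <;> rcases hv2 with hh | hh
      · cases κ <;> cases κ' <;> simp [wsrc] at hh k1
      · cases κ <;> simp [wsrc, k3] at hh
        exact f2 (hh.symm.trans k3)
      · cases κ' <;> simp [wsrc, k4] at hh
        exact e2 (hh.trans k4)
      · simp at hh; exact k5 hh
  · left
    obtain ⟨v, a1, a2, a3⟩ := P.stub_wire x h0 h1 h2 hx hv hq' hq
    exact ⟨v, a2, a1, a3⟩
  · left
    obtain ⟨v, a1, a2, a3⟩ := P.stub_wire x h0 h1 h2 hx hv' hq hq'
    exact ⟨v, a1, a2, a3⟩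
  · left
    refine ⟨.inl x, by simp [otgt], by simp [otgt], ?_⟩
    cases b <;> cases b' <;> first | exact absurd rfl hne | skip
    · exact LD.stub_stub _ hq hq'
    · exact LD.stub_stub _ hq' hq

theorem o_inj (hx : ∀ e : OE G o, e.1.2 ≠ x) {ω ω' : Om G o x}
    (h : s(osrc x ω, otgt x ω) = s(osrc x ω', otgt x ω')) : ω = ω' := by
  rcases ω with ⟨⟨e, κ⟩, hv⟩ | b <;> rcases ω' with ⟨⟨f, κ'⟩, hv'⟩ | b'
  · have hef : s(e.1.1, e.1.2) = s(f.1.1, f.1.2) := by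
      have := congrArg (Sym2.map (spr x)) h
      simp only [Sym2.map_mk, osrc, otgt] at this
      rw [spr_wsrc x hv, spr_wsrc x hv'] at this
      exact this
    have hef' : e = f := by
      rw [Sym2.eq_iff] at hef
      rcases hef with ⟨h3, h4⟩ | ⟨h3, h4⟩
      · exact Subtype.ext (Prod.ext h3 h4)
      · have := e.2.2
        have := f.2.2
        rw [h3, h4] at *
        omega
    subst hef'
    have : κ = κ' := by
      simp only [osrc, otgt, Sym2.eq_iff] at h
      have := e.2.1.ne
      have := e.2.1.ne'
      cases κ <;> cases κ' <;> simp [wsrc] at h <;> first | rfl | simp_all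
    subst this
    rfl
  · exfalso
    simp only [osrc, otgt, Sym2.eq_iff] at h
    have := hx e
    cases κ <;> simp_all [wsrc]
  · exfalso
    simp only [osrc, otgt, Sym2.eq_iff] at h
    have := hx f
    cases κ' <;> simp_all [wsrc]
  · simp only [osrc, otgt, Sym2.eq_iff] at h
    simp at h
    rw [h]

theorem o_adj (ω : Om G o x) : (satG G x).Adj (osrc x ω) (otgt x ω) := by
  rcases ω with ⟨⟨e, κ⟩, hv⟩ | b
  · cases κ
    · exact e.2.1
    · simp at hv; left; change G.Adj x e.1.2; rw [← hv]; exact e.2.1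
    · simp at hv; left; change G.Adj x e.1.2; rw [← hv]; exact e.2.1
  · right; rfl

theorem psn_inj : Function.Injective (P.psn x h0 h1 h2) := by
  have key : ∀ v b, P.ctr v ≠ (P.ld x c0 c1 h0 h1 h2).sat b := by
    intro v b h
    have hv := P.ctr_rbox v
    rw [h] at hv
    have hvx := P.vtx_inj (P.rbox_eq hv (P.sat_rbox x h0 h1 h2 b))
    subst hvx
    exact (P.ld v c0 c1 h0 h1 h2).stub_arc b |>.ne h.symm
  rintro (v | b) (v' | b') h
  · have hv := P.ctr_rbox v
    have h' : P.ctr v = P.ctr v' := h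
    rw [h'] at hv
    rw [P.vtx_inj (P.rbox_eq hv (P.ctr_rbox v'))]
  · exact absurd h (key _ _)
  · exact absurd h.symm (key _ _)
  · cases b <;> cases b' <;> first | rfl | skip
    · exact absurd (LD.stub_stub _ (LD.stub_arc _ false).left_mem
        (by rw [show (P.ld x c0 c1 h0 h1 h2).sat false = (P.ld x c0 c1 h0 h1 h2).sat true from h]
            exact (LD.stub_arc _ true).left_mem)) (LD.stub_arc _ false).ne
    · exact absurd (LD.stub_stub _ (LD.stub_arc _ false).left_mem
        (by rw [show (P.ld x c0 c1 h0 h1 h2).sat false = (P.ld x c0 c1 h0 h1 h2).sat true from h.symm]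
            exact (LD.stub_arc _ true).left_mem)) (LD.stub_arc _ false).ne

theorem o_drawing (hD : D.IsGood) (ho : Function.Injective o) (hx : ∀ e : OE G o, e.1.2 ≠ x)
    (hox : ∀ a, a ≠ x → o x < o a) :
    ∃ D' : Drawing (satG G x), D'.IsGood ∧ ∀ ω ω', X D' (osrc x ω) (otgt x ω) (osrc x ω') (otgt x ω') →
      ω ≠ ω' ∧ (P.oS x h0 h1 h2 ω ∩ P.oS x h0 h1 h2 ω').Nonempty ∧
        (∀ v, v ∈ s(osrc x ω, otgt x ω) → v ∉ s(osrc x ω', otgt x ω')) := by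
  have : Nonempty (Om G o x) := ⟨.inr true⟩
  refine exists_good (satG G x) (P.psn x h0 h1 h2) (P.psn_inj x h0 h1 h2) (osrc x) (otgt x) (P.oS x h0 h1 h2)
    ?_ (o_adj x) (fun _ _ => o_inj x hx) ?_ ?_ ?_ ?_ ?_
  · have key : ∀ a b, G.Adj a b → ∃ e : OE G o, s(e.1.1, e.1.2) = s(a, b) := by
      intro a b h
      rcases lt_or_gt_of_ne (ho.ne h.ne) with hl | hl
      · exact ⟨⟨(a, b), h, hl⟩, rfl⟩
      · exact ⟨⟨(b, a), h.symm, hl⟩, Sym2.eq_swap⟩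
    have k2 : ∀ b c, (G.Adj x c ∨ c = x) → ∃ ω : Om G o x, s(osrc x ω, otgt x ω) = s(.inr b, .inl c) := by
      rintro b c (h | rfl)
      · cases b
        · exact ⟨.inl ⟨(⟨(x, c), h, hox c h.ne'⟩, .lft), Or.inr rfl⟩, rfl⟩
        · exact ⟨.inl ⟨(⟨(x, c), h, hox c h.ne'⟩, .rgt), Or.inr rfl⟩, rfl⟩
      · exact ⟨.inr b, rfl⟩
    rintro (a | a) (b | b) h
    · obtain ⟨e, he⟩ := key a b h
      refine ⟨.inl ⟨(e, .rad), Or.inl rfl⟩, ?_⟩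
      have := congrArg (Sym2.map (Sum.inl : V → V ⊕ Bool)) he
      exact this
    · obtain ⟨ω, hω⟩ := k2 b a h
      exact ⟨ω, hω.trans Sym2.eq_swap⟩
    · exact k2 a b h
    · exact h.elim
  · rintro (⟨⟨e, κ⟩, hv⟩ | b)
    · exact P.wire_arc x h0 h1 h2 hv
    · exact LD.stub_arc _ b
  · rintro (⟨⟨e, κ⟩, hv⟩ | b) (v | b') ha hb hq
    · rcases P.ctr_wire x h0 h1 h2 hv hq with h | h
      · exact ha h
      · exact hb (congrArg _ h)
    · exact ha (P.sat_wire x h0 h1 h2 hx hv hq)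
    · have hR := LD.stub_rbox _ hq
      have hvx : v = x := P.vtx_inj (P.rbox_eq (P.ctr_rbox v) hR)
      subst hvx
      exact hb rfl
    · have hbb : b' ≠ b := fun h => ha (by rw [h]; rfl)
      have hq' : (P.ld x c0 c1 h0 h1 h2).sat b' ∈ (P.ld x c0 c1 h0 h1 h2).stub b' := (LD.stub_arc _ b').left_mem
      refine (LD.stub_arc (P.ld x c0 c1 h0 h1 h2) b').ne ?_
      cases b <;> cases b' <;> first | exact absurd rfl hbb | skip
      · exact LD.stub_stub _ hq hq'
      · exact LD.stub_stub _ hq' hq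
  · intro ω ω' hne v hv hv' q hq hq'
    rcases P.meet x h0 h1 h2 hD hx hne hq hq' with ⟨u, a1, a2, a3⟩ | ⟨h, -⟩
    · by_cases huv : u = v
      · rw [← huv]; exact a3
      · exact absurd (o_inj x hx (two_shared a1 a2 hv hv' huv)) hne
    · exact absurd hv' (h v hv)
  · intro ω ω' hne hno q hq q' hq'
    have m1 := P.meet x h0 h1 h2 hD hx hne hq.1 hq.2
    have m2 := P.meet x h0 h1 h2 hD hx hne hq'.1 hq'.2
    rcases m1 with ⟨u, a1, a2, -⟩ | ⟨-, w, w', rfl, rfl, m1⟩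
    · exact absurd a2 (hno u a1)
    rcases m2 with ⟨u, a1, a2, -⟩ | ⟨-, w1, w1', e1, e2, m2⟩
    · exact absurd a2 (hno u a1)
    obtain rfl := Sum.inl.inj e1
    obtain rfl := Sum.inl.inj e2
    rcases m1 with m1 | ⟨c1, c2, c3, c4, c5, c6⟩
    · rcases m2 with m2 | ⟨c1, c2, c3, c4, c5, c6⟩
      · exact P.cross_once (P.sf_abs _ _) (P.sf_abs _ _) m1 m2
      · exact absurd (P.cross_X ⟨_, m1⟩) (good_shared hD (v := x) (by simp [c3]) (by simp [c4]))
    · rcases m2 with m2 | ⟨d1, d2, d3, d4, d5, d6⟩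
      · exact absurd (P.cross_X ⟨_, m2⟩) (good_shared hD (v := x) (by simp [c3]) (by simp [c4]))
      · rw [P.A_x x h0 h1 h2 c3] at c5 d5
        rw [P.A_x x h0 h1 h2 c4] at c6 d6
        exact LD.loc_uniq _ c1 (P.jj_lt x h0 h1 h2 _) (P.jj_lt x h0 h1 h2 _) c5 c6 d5 d6
  · intro ω ω' ω'' hne1 hne2 hne3 hn1 hn2 hn3 q hq1 hq2 hq3
    rcases P.meet x h0 h1 h2 hD hx hne1 hq1 hq2 with ⟨u, a1, a2, -⟩ | ⟨-, w, w', rfl, rfl, m1⟩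
    · exact absurd a2 (hn1 u a1)
    rcases P.meet x h0 h1 h2 hD hx hne2 hq1 hq3 with ⟨u, a1, a2, -⟩ | ⟨-, w1, w'', e1, rfl, m2⟩
    · exact absurd a2 (hn2 u a1)
    obtain rfl := Sum.inl.inj e1
    rcases P.meet x h0 h1 h2 hD hx hne3 hq2 hq3 with ⟨u, a1, a2, -⟩ | ⟨-, w2, w3, e2, e3, m3⟩
    · exact absurd a2 (hn3 u a1)
    obtain rfl := Sum.inl.inj e2
    obtain rfl := Sum.inl.inj e3
    have inbox : ∀ {e : OE G o} {κ : Kd}, e.1.1 = x → q ∈ P.A x h0 h1 h2 e κ →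
        RBox (P.cen (P.vtx x)) P.R q := by
      intro e κ he hh
      rw [← he]; exact P.A_rbox x h0 h1 h2 hh
    rcases m1 with m1 | ⟨c1, c2, c3, c4, c5, c6⟩
    · have out := P.cross_node m1 (P.sf_abs _ _) x
      rcases m2 with m2 | m2
      · rcases m3 with m3 | m3
        · exact P.cross_tri (P.sf_abs _ _) (P.sf_abs _ _) m1 m2 m3
        · exact out (inbox m3.2.2.1 m3.2.2.2.2.1)
      · exact out (inbox m2.2.2.1 m2.2.2.2.2.1)
    · have inb := inbox c3 c5
      rcases m2 with m2 | ⟨d1, d2, d3, d4, d5, d6⟩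
      · exact P.cross_node m2 (P.sf_abs _ _) x inb
      rcases m3 with m3 | ⟨f1, f2, f3, f4, f5, f6⟩
      · exact P.cross_node m3 (P.sf_abs _ _) x inb
      rw [P.A_x x h0 h1 h2 c3] at c5
      rw [P.A_x x h0 h1 h2 c4] at c6
      rw [P.A_x x h0 h1 h2 d4] at d6
      exact LD.loc_tri _ c1 d1 f1 (P.jj_lt x h0 h1 h2 _) (P.jj_lt x h0 h1 h2 _) (P.jj_lt x h0 h1 h2 _) c5 c6 d6

end Plan

end HB

namespace HB

open Set

variable {V : Type} {G : SimpleGraph V} {D : Drawing G}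

theorem X_swapl {W : Type*} {G : SimpleGraph W} {D : Drawing G} {a b c d : W} (h : X D a b c d) :
    X D b a c d := by
  unfold X at *; rw [Sym2.eq_swap]; exact h

theorem X_swapr {W : Type*} {G : SimpleGraph W} {D : Drawing G} {a b c d : W} (h : X D a b c d) :
    X D a b d c := by
  unfold X at *; rw [Sym2.eq_swap (a := d)]; exact h

theorem X_comm {W : Type*} {G : SimpleGraph W} {D : Drawing G} {a b c d : W} (h : X D a b c d) :
    X D c d a b := by
  obtain ⟨p, h1, h2, h3, h4, h5, h6, h7⟩ := h
  exact ⟨p, h2, h1, h3.symm, h5, h4, h7, h6⟩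

theorem X_adj {W : Type*} {G : SimpleGraph W} {D : Drawing G} {a b c d : W} (h : X D a b c d) :
    G.Adj a b ∧ G.Adj c d := by
  obtain ⟨p, h1, h2, -⟩ := h
  exact ⟨h1, h2⟩

theorem X_cast {W : Type*} {G : SimpleGraph W} {D : Drawing G} {a b c d a' b' c' d' : W}
    (h1 : s(a, b) = s(a', b')) (h2 : s(c, d) = s(c', d')) (h : X D a b c d) : X D a' b' c' d' := by
  unfold X at *; rw [← h1, ← h2]; exact h

/-- satellite drawing -/
structure Sat {V : Type} {G : SimpleGraph V} (D : Drawing G) (x : V) (D' : Drawing (satG G x)) (r : V → ℕ) (c : ℕ) :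
    Prop where
  good : D'.IsGood
  proj : ∀ A B C E, X D' A B C E → X D (spr x A) (spr x B) (spr x C) (spr x E) ∨
    (x ∈ s(spr x A, spr x B) ∧ x ∈ s(spr x C, spr x E))
  stub : ∀ b C E, ¬ X D' (.inr b) (.inl x) C E
  f0 : ∀ i j, G.Adj x i → G.Adj x j → X D' (.inr false) (.inl i) (.inl x) (.inl j) →
    (r i < c ∧ r j < r i) ∨ (c ≤ r i ∧ r i < r j)
  f1 : ∀ i j, G.Adj x i → G.Adj x j → X D' (.inr true) (.inl i) (.inl x) (.inl j) →
    (r i < r j ∧ r j < c) ∨ (c ≤ r j ∧ r j < r i)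
  f2 : ∀ i j, G.Adj x i → G.Adj x j → X D' (.inr false) (.inl i) (.inr true) (.inl j) →
    (r j < r i ∧ r i < c) ∨ (c ≤ r i ∧ r i < r j)

/-- Satellite surgery at the vertex `x`. -/
theorem satellite [Finite V] (hD : D.IsGood) (x : V) :
    ∃ (k : V → ℕ) (p : ℕ), (∀ a b, G.Adj x a → G.Adj x b → k a = k b → a = b) ∧
      (∀ a, k a < p) ∧
      ∀ c0, c0 < p → ∀ c, 0 < c → c < p → ∃ D' : Drawing (satG G x), Sat D x D' (fun a => ord' p c0 (k a)) c := by
  classical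
  obtain ⟨n, ⟨eqv⟩⟩ := Finite.exists_equiv_fin V
  let o : V → ℕ := fun v => if v = x then 0 else (eqv v : ℕ) + 1
  have ho : Function.Injective o := by
    intro a b h
    simp only [o] at h
    split_ifs at h with h1 h2 h2
    · rw [h1, h2]
    · exact eqv.injective (Fin.ext (by omega))
  have hox : ∀ a, a ≠ x → o x < o a := by
    intro a ha
    simp [o, ha]
  have hx : ∀ e : OE G o, e.1.2 ≠ x := by
    intro e he
    have := e.2.2
    rw [he] at this
    simp [o] at this
  obtain ⟨P⟩ := exists_plan D hD o
  let ed : ∀ a, G.Adj x a → OE G o := fun a h => ⟨(x, a), h, hox a h.ne'⟩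
  let k : V → ℕ := fun a => if h : G.Adj x a then P.k (ed a h) 0 false else 0
  have hk : ∀ a (h : G.Adj x a), k a = P.k (ed a h) 0 false := fun a h => by simp only [k, dif_pos h]
  refine ⟨k, 8 * P.R + 4, ?_, ?_, ?_⟩
  · intro a b ha hb hab
    rw [hk a ha, hk b hb] at hab
    have := (P.k_inj (b := false) (b' := false) (P.n_pos (ed a ha)) (P.n_pos (ed b hb))
      (by simp only [Plan.pn, Bool.false_eq_true, if_false]; rw [P.node_zero, P.node_zero]) hab).1
    exact congrArg (fun e => e.1.2) this
  · intro a
    simp only [k]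
    split_ifs with h
    · exact P.k_lt (P.n_pos (ed a h)) false
    · omega
  intro c0 h0
  let r : V → ℕ := fun a => ord' (8 * P.R + 4) c0 (k a)
  have hr : ∀ a (h : G.Adj x a), r a = P.rr c0 (ed a h) := fun a h => by simp only [r, hk a h]; rfl
  intro c h1 h2
  obtain ⟨D', hD', hX⟩ := P.o_drawing x h0 h1 h2 hD ho hx hox
  -- local crossings
  have loc : ∀ i j (hi : G.Adj x i) (hj : G.Adj x j) (κ κ' : Kd),
      X D' (Plan.wsrc (ed i hi) κ) (.inl i) (Plan.wsrc (ed j hj) κ') (.inl j) →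
      ∃ q, q ∈ P.A x h0 h1 h2 (ed i hi) κ ∧ q ∈ P.A x h0 h1 h2 (ed j hj) κ' := by
    intro i j hi hj κ κ' h
    obtain ⟨hne, ⟨q, hq, hq'⟩, hno⟩ := hX (.inl ⟨(ed i hi, κ), Or.inr rfl⟩) (.inl ⟨(ed j hj, κ'), Or.inr rfl⟩) h
    rcases P.meet x h0 h1 h2 hD hx hne hq hq' with ⟨u, a1, a2, -⟩ | ⟨-, w, w', e1, e2, m1⟩
    · exact absurd a2 (hno u a1)
    obtain rfl := Sum.inl.inj e1
    obtain rfl := Sum.inl.inj e2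
    rcases m1 with m1 | m1
    · exact absurd (P.cross_X ⟨_, m1⟩) (good_shared hD (v := x) (by simp [ed]) (by simp [ed]))
    · exact ⟨q, m1.2.2.2.2⟩
  have hhb : ∀ i (hi : G.Adj x i), P.hb c0 c (ed i hi) = decide (r i < c) := by
    intro i hi; rw [hr i hi]; rfl
  have hjj : ∀ i (hi : G.Adj x i), P.jj c0 c (ed i hi) = if r i < c then r i else 8 * P.R + 4 - 1 - r i := by
    intro i hi; rw [hr i hi]; rfl
  have hlt : ∀ i (hi : G.Adj x i), r i < 8 * P.R + 4 := by
    intro i hi; rw [hr i hi]; exact P.rr_lt _ _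
  have cmp : ∀ i j (hi : G.Adj x i) (hj : G.Adj x j), P.hb c0 c (ed i hi) = P.hb c0 c (ed j hj) →
      P.jj c0 c (ed i hi) < P.jj c0 c (ed j hj) → (r i < r j ∧ r j < c) ∨ (c ≤ r j ∧ r j < r i) := by
    intro i j hi hj h3 h4
    rw [hhb i hi, hhb j hj, decide_eq_decide] at h3
    rw [hjj i hi, hjj j hj] at h4
    have := hlt i hi
    have := hlt j hj
    split_ifs at h4 <;> omega
  have key : ∀ A B, (satG G x).Adj A B → ∃ ω : Om G o x, s(Plan.osrc x ω, Plan.otgt x ω) = s(A, B) := by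
    have key : ∀ a b, G.Adj a b → ∃ e : OE G o, s(e.1.1, e.1.2) = s(a, b) := by
      intro a b h
      rcases lt_or_gt_of_ne (ho.ne h.ne) with hl | hl
      · exact ⟨⟨(a, b), h, hl⟩, rfl⟩
      · exact ⟨⟨(b, a), h.symm, hl⟩, Sym2.eq_swap⟩
    have k2 : ∀ b c, (G.Adj x c ∨ c = x) → ∃ ω : Om G o x, s(Plan.osrc x ω, Plan.otgt x ω) = s(.inr b, .inl c) := by
      rintro b c (h | rfl)
      · cases b
        · exact ⟨.inl ⟨(ed c h, .lft), Or.inr rfl⟩, rfl⟩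
        · exact ⟨.inl ⟨(ed c h, .rgt), Or.inr rfl⟩, rfl⟩
      · exact ⟨.inr b, rfl⟩
    rintro (a | a) (b | b) h
    · obtain ⟨e, he⟩ := key a b h
      refine ⟨.inl ⟨(e, .rad), Or.inl rfl⟩, ?_⟩
      have := congrArg (Sym2.map (Sum.inl : V → V ⊕ Bool)) he
      exact this
    · obtain ⟨ω, hω⟩ := k2 b a h
      exact ⟨ω, hω.trans Sym2.eq_swap⟩
    · exact k2 a b h
    · exact h.elim
  refine ⟨D', hD', ?_, ?_, ?_, ?_, ?_⟩
  · intro A B C E h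
    obtain ⟨hA, hC⟩ := X_adj h
    obtain ⟨ω, hω⟩ := key A B hA
    obtain ⟨ω', hω'⟩ := key C E hC
    have h' := X_cast hω.symm hω'.symm h
    have g1 := congrArg (Sym2.map (spr x)) hω
    have g2 := congrArg (Sym2.map (spr x)) hω'
    simp only [Sym2.map_mk] at g1 g2
    obtain ⟨hne, ⟨q, hq, hq'⟩, hno⟩ := hX ω ω' h'
    rcases P.meet x h0 h1 h2 hD hx hne hq hq' with ⟨u, a1, a2, -⟩ | ⟨-, w, w', rfl, rfl, m1⟩
    · exact absurd a2 (hno u a1)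
    simp only [Plan.osrc, Plan.otgt] at g1 g2
    rw [Plan.spr_wsrc x w.2] at g1
    rw [Plan.spr_wsrc x w'.2] at g2
    rcases m1 with m1 | ⟨d1, d2, d3, d4, d5, d6⟩
    · left
      exact X_cast g1 g2 (P.cross_X ⟨_, m1⟩)
    · right
      rw [← g1, ← g2]
      constructor
      · simp [d3]
      · simp [d4]
  · intro b C E h
    obtain ⟨hA, hC⟩ := X_adj h
    have h3 := X_comm h
    obtain ⟨ω, hω⟩ := key C E hC
    obtain ⟨hne, ⟨q, hq, hq'⟩, hno⟩ := hX (.inr b) ω (X_cast rfl hω.symm h)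
    rcases P.meet x h0 h1 h2 hD hx hne hq hq' with ⟨u, a1, a2, -⟩ | ⟨-, w, w', e1, -⟩
    · exact absurd a2 (hno u a1)
    · cases e1
  · intro i j hi hj h
    obtain ⟨q, q1, q2⟩ := loc i j hi hj .lft .rad h
    rw [P.A_x x h0 h1 h2 rfl] at q1 q2
    obtain ⟨τ, hτ, rfl⟩ := q1
    obtain ⟨τ', hτ', h5⟩ := q2
    obtain ⟨a1, a2, -⟩ := LD.lft_rad _ (P.jj_lt x h0 h1 h2 _) (P.jj_lt x h0 h1 h2 _) hτ hτ' h5.symm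
    have := cmp j i hj hi a1.symm a2
    tauto
  · intro i j hi hj h
    obtain ⟨q, q1, q2⟩ := loc i j hi hj .rgt .rad h
    rw [P.A_x x h0 h1 h2 rfl] at q1 q2
    obtain ⟨τ, hτ, rfl⟩ := q1
    obtain ⟨τ', hτ', h5⟩ := q2
    obtain ⟨a1, a2, -⟩ := LD.rgt_rad _ (P.jj_lt x h0 h1 h2 _) (P.jj_lt x h0 h1 h2 _) hτ hτ' h5.symm
    exact cmp i j hi hj a1 a2
  · intro i j hi hj h
    obtain ⟨q, q1, q2⟩ := loc i j hi hj .lft .rgt h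
    rw [P.A_x x h0 h1 h2 rfl] at q1 q2
    obtain ⟨τ, hτ, rfl⟩ := q1
    obtain ⟨τ', hτ', h5⟩ := q2
    obtain ⟨a1, a2, -⟩ := LD.lft_rgt _ (P.jj_lt x h0 h1 h2 _) (P.jj_lt x h0 h1 h2 _) hτ hτ' h5.symm
    exact cmp j i hj hi a1.symm a2

theorem ord'_lt {p : ℕ} (hp : 0 < p) (c0 k : ℕ) : ord' p c0 k < p := Nat.mod_lt _ hp

theorem ord'_eq {p c0 k : ℕ} (h0 : c0 < p) (hk : k < p) : c0 + ord' p c0 k = k ∨ c0 + ord' p c0 k = k + p := by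
  unfold ord'
  by_cases hc : c0 ≤ k
  · left
    rw [show k + p - c0 = (k - c0) + p by omega, Nat.add_mod_right, Nat.mod_eq_of_lt (by omega)]; omega
  · right
    rw [Nat.mod_eq_of_lt (by omega)]; omega

theorem exists_sat {V : Type} {G : SimpleGraph V} {D : Drawing G} [Finite V] (hD : D.IsGood) {x y : V} (hxy : G.Adj x y) :
    ∃ (r : V → ℕ) (p : ℕ), (∀ a b, G.Adj x a → G.Adj x b → r a = r b → a = b) ∧ (∀ a, G.Adj x a → r a < p) ∧ r y = 0 ∧
      ∀ c, 0 < c → c < p → ∃ D' : Drawing (satG G x), Sat D x D' r c := by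
  obtain ⟨k, p, h1, h2, h3⟩ := satellite hD x
  refine ⟨fun a => ord' p (k y) (k a), p, fun a b ha hb h => h1 a b ha hb ?_, fun a _ => ord'_lt ((Nat.zero_le _).trans_lt (h2 y)) _ _,
    ?_, fun c c1 c2 => h3 _ (h2 y) c c1 c2⟩
  · have e1 := ord'_eq (h2 y) (h2 a)
    have e2 := ord'_eq (h2 y) (h2 b)
    have e3 := h2 a
    have e4 := h2 b
    dsimp only at h
    omega
  · have e1 := ord'_eq (h2 y) (h2 y)
    have e3 := ord'_lt ((Nat.zero_le _).trans_lt (h2 y)) (k y) (k y)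
    dsimp only
    omega

end HB

namespace HB

open Set

/-- indicator of a crossing -/
noncomputable def chi {V : Type*} {G : SimpleGraph V} (D : Drawing G) (a b c d : V) : ℕ :=
  open Classical in if X D a b c d then 1 else 0

section chi

variable {V : Type*} {G : SimpleGraph V} {D : Drawing G}

theorem chi_one {a b c d : V} (h : X D a b c d) : chi D a b c d = 1 := if_pos h

theorem chi_zero {a b c d : V} (h : ¬ X D a b c d) : chi D a b c d = 0 := if_neg h

theorem chi_le_one (a b c d : V) : chi D a b c d ≤ 1 := by
  unfold chi; split_ifs <;> simp

theorem chi_congr {V' : Type*} {G' : SimpleGraph V'} {D' : Drawing G'} {a b c d : V} {a' b' c' d' : V'}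
    (h : X D a b c d ↔ X D' a' b' c' d') : chi D a b c d = chi D' a' b' c' d' := by
  by_cases h1 : X D a b c d
  · rw [chi_one h1, chi_one (h.1 h1)]
  · rw [chi_zero h1, chi_zero (fun h2 => h1 (h.2 h2))]

theorem chi_swapl (a b c d : V) : chi D a b c d = chi D b a c d := chi_congr ⟨X_swapl, X_swapl⟩

theorem chi_swapr (a b c d : V) : chi D a b c d = chi D a b d c := chi_congr ⟨X_swapr, X_swapr⟩

theorem chi_comm (a b c d : V) : chi D a b c d = chi D c d a b := chi_congr ⟨X_comm, X_comm⟩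

theorem good_shared' (hD : D.IsGood) {a b c d v : V} (h1 : v ∈ s(a, b)) (h2 : v ∈ s(c, d)) :
    chi D a b c d = 0 := chi_zero (by
  rintro ⟨p, hp⟩
  exact hD.adj_no_cross _ _ ⟨v, h1, h2⟩ p hp)

end chi

/-- restriction of a drawing -/
def comap {V W : Type*} {G : SimpleGraph V} {H : SimpleGraph W} (D : Drawing G) (f : W → V)
    (hf : Function.Injective f) (hh : ∀ a b, H.Adj a b → G.Adj (f a) (f b)) : Drawing H where
  pos a := D.pos (f a)
  pos_inj := D.pos_inj.comp hf
  arc a b := D.arc (f a) (f b)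
  arc_cont a b h := D.arc_cont (hh a b h)
  arc_zero a b h := D.arc_zero (hh a b h)
  arc_one a b h := D.arc_one (hh a b h)
  arc_symm a b h := D.arc_symm (hh a b h)
  arc_avoid a b h c h1 h2 := D.arc_avoid (hh a b h) (f c) (hf.ne h1) (hf.ne h2)

section comap

variable {V W : Type*} {G : SimpleGraph V} {H : SimpleGraph W} {D : Drawing G} {f : W → V}
    {hf : Function.Injective f} {hh : ∀ a b, H.Adj a b → G.Adj (f a) (f b)}

theorem comap_cross {a b c d : W} {p : Pl} :
    (comap D f hf hh).IsCrossing s(a, b) s(c, d) p ↔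
      H.Adj a b ∧ H.Adj c d ∧ D.IsCrossing s(f a, f b) s(f c, f d) p := by
  rw [isCrossing_iff, isCrossing_iff]
  have hs : s(f a, f b) = s(f c, f d) ↔ s(a, b) = s(c, d) := by
    have := (Sym2.map.injective hf).eq_iff (a := s(a, b)) (b := s(c, d))
    simpa using this
  have e1 : ∀ a b, es (comap D f hf hh) a b = es D (f a) (f b) := fun _ _ => rfl
  have e2 : ∀ a, (comap D f hf hh).pos a = D.pos (f a) := fun _ => rfl
  simp only [e1, e2, ne_eq, hs]
  constructor
  · rintro ⟨h1, h2, h3⟩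
    exact ⟨h1, h2, hh _ _ h1, hh _ _ h2, h3⟩
  · rintro ⟨h1, h2, -, -, h3⟩
    exact ⟨h1, h2, h3⟩

theorem comap_cross' {e g : Sym2 W} {p : Pl} (h : (comap D f hf hh).IsCrossing e g p) :
    D.IsCrossing (e.map f) (g.map f) p := by
  induction e with | _ a b
  induction g with | _ c d
  exact (comap_cross.1 h).2.2

theorem comap_X {a b c d : W} (h1 : H.Adj a b) (h2 : H.Adj c d) :
    X (comap D f hf hh) a b c d ↔ X D (f a) (f b) (f c) (f d) := by
  unfold X
  simp only [comap_cross, h1, h2, true_and]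

theorem comap_good (hD : D.IsGood) : (comap D f hf hh).IsGood where
  arc_inj a b h := hD.arc_inj (hh a b h)
  adj_no_cross e g := by
    rintro ⟨a, ha, hb⟩ p hp
    exact hD.adj_no_cross _ _ ⟨f a, Sym2.mem_map.2 ⟨a, ha, rfl⟩, Sym2.mem_map.2 ⟨a, hb, rfl⟩⟩ p (comap_cross' hp)
  cross_once e g p hp q hq := hD.cross_once _ _ (comap_cross' hp) (comap_cross' hq)
  no_triple p e g k h1 h2 h3 := by
    rintro ⟨a, b, c⟩
    have i := Sym2.map.injective hf
    exact hD.no_triple p _ _ _ (i.ne h1) (i.ne h2) (i.ne h3)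
      ⟨comap_cross' a, comap_cross' b, comap_cross' c⟩

end comap

/-- counting crossings through a parametrisation of the edges -/
theorem two_crNum {V Ω : Type*} [Fintype Ω] {G : SimpleGraph V} {D : Drawing G} (hD : D.IsGood)
    (u v : Ω → V) (hinj : ∀ ω ω', s(u ω, v ω) = s(u ω', v ω') → ω = ω')
    (hcov : ∀ a b, G.Adj a b → ∃ ω, s(u ω, v ω) = s(a, b)) :
    ∑ ω, ∑ ω', chi D (u ω) (v ω) (u ω') (v ω') = 2 * D.crNum := by
  classical
  let H : SimpleGraph Ω :=
    { Adj := fun ω ω' => X D (u ω) (v ω) (u ω') (v ω')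
      symm := ⟨fun _ _ h => X_comm h⟩
      loopless := ⟨by
        rintro ω ⟨p, -, -, h, -⟩
        exact h rfl⟩ }
  have h1 : ∑ ω, ∑ ω', chi D (u ω) (v ω) (u ω') (v ω') = ∑ ω, H.degree ω := by
    refine Finset.sum_congr rfl fun ω _ => ?_
    rw [← SimpleGraph.card_neighborFinset_eq_degree, SimpleGraph.neighborFinset_eq_filter, Finset.card_filter]
    refine Finset.sum_congr rfl fun ω' _ => ?_
    unfold chi
    exact if_congr Iff.rfl rfl rfl
  rw [h1, SimpleGraph.sum_degrees_eq_twice_card_edges]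
  congr 1
  unfold Drawing.crNum Drawing.crBetween
  rw [Nat.card_coe_set_eq]
  have i1 : InjOn Prod.snd (D.crossings G.edgeSet G.edgeSet) := by
    rintro ⟨p, z⟩ ⟨e, f, h1, -, -, h2⟩ ⟨p', z'⟩ ⟨e', f', h1', -, -, h2'⟩ hz
    simp only at h1 h1' h2 h2' hz
    subst h1 h1'
    have : D.IsCrossing e f p' := by
      rw [Sym2.eq_iff] at hz
      rcases hz with ⟨rfl, rfl⟩ | ⟨rfl, rfl⟩
      · exact h2'
      · obtain ⟨a1, a2, a3, a4, a5, a6, a7⟩ := h2'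
        exact ⟨a2, a1, a3.symm, a5, a4, a7, a6⟩
    have hp := hD.cross_once _ _ h2 this
    exact Prod.ext hp hz
  have i2 : Function.Injective (fun ω => s(u ω, v ω)) := fun ω ω' h => hinj ω ω' h
  have hE : H.edgeFinset.card = H.edgeSet.ncard := by
    rw [← SimpleGraph.coe_edgeFinset, Set.ncard_coe_finset]
  rw [hE, ← i1.ncard_image]
  rw [← Set.ncard_image_of_injective _ (Sym2.map.injective i2)]
  congr 1
  ext z
  constructor
  · rintro ⟨w, hw, rfl⟩
    induction w with | _ ω ω'
    obtain ⟨p, hp⟩ : X D (u ω) (v ω) (u ω') (v ω') := hw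
    exact ⟨(p, s(s(u ω, v ω), s(u ω', v ω'))), ⟨_, _, rfl, hp.1, hp.2.1, hp⟩, rfl⟩
  · rintro ⟨⟨p, z⟩, ⟨e, f, h1, -, -, h2⟩, rfl⟩
    simp only at h1 h2
    subst h1
    have key : ∀ e ∈ G.edgeSet, ∃ ω, s(u ω, v ω) = e := by
      intro e
      induction e with | _ a b
      exact hcov a b
    obtain ⟨ω, rfl⟩ := key e h2.1
    obtain ⟨ω', rfl⟩ := key f h2.2.1
    exact ⟨s(ω, ω'), ⟨p, h2⟩, rfl⟩

theorem crossingNumber_le {V : Type*} {G : SimpleGraph V} {D : Drawing G} (hD : D.IsGood) :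
    crossingNumber G ≤ D.crNum := Nat.sInf_le ⟨D, hD, rfl⟩

/-- quadruple sum -/
noncomputable def QS {V A B : Type*} [Fintype A] [Fintype B] {G : SimpleGraph V} (D : Drawing G)
    (u : A → V) (v : B → V) : ℕ := ∑ a, ∑ b, ∑ a', ∑ b', chi D (u a) (v b) (u a') (v b')

theorem QS_swap {V A B : Type*} [Fintype A] [Fintype B] {G : SimpleGraph V} (D : Drawing G)
    (u : A → V) (v : B → V) : QS D u v = QS D v u := by
  unfold QS
  rw [Finset.sum_comm]
  refine Finset.sum_congr rfl fun b _ => Finset.sum_congr rfl fun a _ => ?_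
  rw [Finset.sum_comm]
  refine Finset.sum_congr rfl fun b' _ => Finset.sum_congr rfl fun a' _ => ?_
  rw [chi_swapl, chi_swapr]

theorem bip_lower {V A B : Type*} [Fintype A] [Fintype B] {G : SimpleGraph V} {D : Drawing G} (hD : D.IsGood)
    (hZC : ∀ a b : ℕ, 0 < a → 0 < b → crossingNumber (bipK a b) = Z a b)
    (hA : 0 < Fintype.card A) (hB : 0 < Fintype.card B)
    (u : A → V) (v : B → V) (hu : Function.Injective u) (hv : Function.Injective v)
    (hadj : ∀ a b, G.Adj (u a) (v b)) : 2 * Z (Fintype.card A) (Fintype.card B) ≤ QS D u v := by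
  let eA := Fintype.equivFin A
  let eB := Fintype.equivFin B
  let f : Fin (Fintype.card A) ⊕ Fin (Fintype.card B) → V := Sum.elim (fun i => u (eA.symm i)) (fun j => v (eB.symm j))
  have hf : Function.Injective f := by
    rintro (i | i) (j | j) h
    · exact congrArg _ (eA.symm.injective (hu h))
    · exact absurd h (hadj _ _).ne
    · exact absurd h (hadj _ _).ne'
    · exact congrArg _ (eB.symm.injective (hv h))
  have hh : ∀ a b, (bipK (Fintype.card A) (Fintype.card B)).Adj a b → G.Adj (f a) (f b) := by
    rintro (i | i) (j | j) h
    · simp [bipK] at h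
    · exact hadj _ _
    · exact (hadj _ _).symm
    · simp [bipK] at h
  have hg := comap_good (hf := hf) (hh := hh) hD
  rw [← hZC _ _ hA hB]
  refine (Nat.mul_le_mul_left 2 (crossingNumber_le hg)).trans (le_of_eq ?_)
  rw [← two_crNum hg (Ω := A × B) (fun ω => .inl (eA ω.1)) (fun ω => .inr (eB ω.2))]
  · unfold QS
    simp only [Fintype.sum_prod_type]
    refine Finset.sum_congr rfl fun a _ => Finset.sum_congr rfl fun b _ => Finset.sum_congr rfl fun a' _ =>
      Finset.sum_congr rfl fun b' _ => chi_congr ?_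
    rw [comap_X]
    · simp [f]
    · simp [bipK]
    · simp [bipK]
  · rintro ⟨a, b⟩ ⟨a', b'⟩ h
    simp only [Sym2.eq_iff] at h
    simp at h
    exact Prod.ext h.1 h.2
  · rintro (i | i) (j | j) h
    · simp [bipK] at h
    · exact ⟨(eA.symm i, eB.symm j), by simp⟩
    · exact ⟨(eA.symm j, eB.symm i), by simp [Sym2.eq_swap]⟩
    · simp [bipK] at h

end HB

namespace HB

open Set

/-- extend a family by one vertex -/
def oc {V A : Type*} (p : V) (u : A → V) : Option A → V := fun o => o.elim p u

@[simp] theorem oc_none {V A : Type*} (p : V) (u : A → V) : oc p u none = p := rfl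

@[simp] theorem oc_some {V A : Type*} (p : V) (u : A → V) (a : A) : oc p u (some a) = u a := rfl

theorem comp_oc {V W A : Type*} (f : V → W) (p : V) (u : A → V) : (fun a => f (oc p u a)) = oc (f p) (fun a => f (u a)) := by
  funext a; cases a <;> rfl

theorem oc_inj {V A : Type*} {p : V} {u : A → V} (hu : Function.Injective u) (hp : ∀ a, u a ≠ p) :
    Function.Injective (oc p u) := by
  rintro (_ | a) (_ | b) h
  · rfl
  · exact absurd h.symm (hp b)
  · exact absurd h (hp a)
  · exact congrArg _ (hu h)

section sums

variable {V A B : Type*} [Fintype A] [Fintype B] {G : SimpleGraph V}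

noncomputable def Es (D : Drawing G) (p : V) (u : A → V) (v : B → V) : ℕ :=
  ∑ b, ∑ a, ∑ b', chi D p (v b) (u a) (v b')

noncomputable def Gs (D : Drawing G) (p q : V) (v : B → V) : ℕ := ∑ b, ∑ b', chi D p (v b) q (v b')

noncomputable def Fs (D : Drawing G) (p q : V) (u : A → V) (v : B → V) : ℕ :=
  ∑ a, ∑ b, chi D p (v b) (u a) q

noncomputable def Ks (D : Drawing G) (p q : V) (u : A → V) (v : B → V) : ℕ :=
  ∑ a, ∑ b, chi D p q (u a) (v b)

theorem chi_loopl {D : Drawing G} (a c d : V) : chi D a a c d = 0 := chi_zero (by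
  rintro ⟨p, h, -⟩
  exact G.loopless.irrefl _ h)

theorem chi_loopr {D : Drawing G} (a c d : V) : chi D c d a a = 0 := by
  rw [chi_comm]; exact chi_loopl _ _ _

variable {D : Drawing G}

theorem chi_ac (hD : D.IsGood) (a b d : V) : chi D a b a d = 0 := good_shared' hD (v := a) (by simp) (by simp)

theorem chi_ad (hD : D.IsGood) (a b d : V) : chi D a b d a = 0 := good_shared' hD (v := a) (by simp) (by simp)

theorem chi_bc (hD : D.IsGood) (a b d : V) : chi D a b b d = 0 := good_shared' hD (v := b) (by simp) (by simp)

theorem chi_bd (hD : D.IsGood) (a b d : V) : chi D a b d b = 0 := good_shared' hD (v := b) (by simp) (by simp)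

theorem Gs_comm (p q : V) (v : B → V) : Gs D p q v = Gs D q p v := by
  unfold Gs
  rw [Finset.sum_comm]
  exact Finset.sum_congr rfl fun _ _ => Finset.sum_congr rfl fun _ _ => chi_comm _ _ _ _

theorem Fs_comm (p q : V) (u : A → V) (v : B → V) : Fs D p q u v = Fs D q p v u := by
  unfold Fs
  rw [Finset.sum_comm]
  refine Finset.sum_congr rfl fun _ _ => Finset.sum_congr rfl fun _ _ => ?_
  rw [chi_comm, chi_swapl, chi_swapr]

theorem Ks_comm (p q : V) (u : A → V) (v : B → V) : Ks D p q u v = Ks D q p u v := by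
  unfold Ks
  exact Finset.sum_congr rfl fun _ _ => Finset.sum_congr rfl fun _ _ => chi_swapl _ _ _ _

theorem Ks_swap (p q : V) (u : A → V) (v : B → V) : Ks D p q u v = Ks D p q v u := by
  unfold Ks
  rw [Finset.sum_comm]
  exact Finset.sum_congr rfl fun _ _ => Finset.sum_congr rfl fun _ _ => chi_swapr _ _ _ _

theorem Ks_self (p : V) (u : A → V) (v : B → V) : Ks D p p u v = 0 := by
  unfold Ks; simp [chi_loopl]


theorem Gs_self (hD : D.IsGood) (p : V) (v : B → V) : Gs D p p v = 0 := by
  unfold Gs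
  exact Finset.sum_eq_zero fun _ _ => Finset.sum_eq_zero fun _ _ => good_shared' hD (v := p) (by simp) (by simp)

theorem Fs_self (hD : D.IsGood) (p : V) (u : A → V) (v : B → V) : Fs D p p u v = 0 := by
  unfold Fs
  exact Finset.sum_eq_zero fun _ _ => Finset.sum_eq_zero fun _ _ => good_shared' hD (v := p) (by simp) (by simp)

theorem QS_A (hD : D.IsGood) (p : V) (u : A → V) (v : B → V) : QS D (oc p u) v = QS D u v + 2 * Es D p u v := by
  unfold QS Es
  simp only [Fintype.sum_option, oc_none, oc_some, Finset.sum_add_distrib]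
  have h0 : ∀ b b', chi D p (v b) p (v b') = 0 := fun b b' => good_shared' hD (v := p) (by simp) (by simp)
  have h1 : ∑ a, ∑ b, ∑ b', chi D (u a) (v b) p (v b') = ∑ b, ∑ a, ∑ b', chi D p (v b) (u a) (v b') := by
    rw [Finset.sum_comm' (s := Finset.univ) (t := fun _ => Finset.univ) (t' := Finset.univ) (s' := fun _ => Finset.univ) (by simp)]
    rw [Finset.sum_comm]
    conv_rhs => rw [Finset.sum_comm]
    refine Finset.sum_congr rfl fun a _ => ?_
    rw [Finset.sum_comm]
    exact Finset.sum_congr rfl fun _ _ => Finset.sum_congr rfl fun _ _ => chi_comm _ _ _ _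
  simp only [h0, h1, Finset.sum_const_zero]
  ring

theorem QS_B (hD : D.IsGood) (q : V) (u : A → V) (v : B → V) : QS D u (oc q v) = QS D u v + 2 * Es D q v u := by
  rw [QS_swap, QS_A hD, QS_swap]

theorem Es_A (hD : D.IsGood) (p q : V) (u : A → V) (v : B → V) : Es D p (oc q u) v = Es D p u v + Gs D p q v := by
  unfold Es Gs
  simp only [Fintype.sum_option, oc_none, oc_some, Finset.sum_add_distrib]
  ring

theorem Es_B (hD : D.IsGood) (p q : V) (u : A → V) (v : B → V) :
    Es D p u (oc q v) = Es D p u v + Fs D p q u v + Ks D p q u v := by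
  unfold Es Fs Ks
  have h0 : ∀ a, chi D p q (u a) q = 0 := fun b => good_shared' hD (v := q) (by simp) (by simp)
  simp only [Fintype.sum_option, oc_none, oc_some, Finset.sum_add_distrib, h0]
  rw [Finset.sum_comm (f := fun b a => chi D p (v b) (u a) q)]
  simp only [Finset.sum_const_zero]
  ring

variable {x y : V}

theorem Gs_oc (hD : D.IsGood) {p q t : V} (v : B → V) (hp : p = x ∨ p = y) (hq : q = x ∨ q = y) (ht : t = x ∨ t = y) :
    Gs D p q (oc t v) = Gs D p q v := by
  unfold Gs
  have h1 : ∀ b, chi D p t q b = 0 := by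
    intro b
    rcases hp with rfl | rfl <;> rcases hq with rfl | rfl <;> rcases ht with rfl | rfl <;>
    first | exact chi_loopl _ _ _ | exact chi_loopr _ _ _ | exact chi_ac hD _ _ _ | exact chi_ad hD _ _ _ | exact chi_bc hD _ _ _ | exact chi_bd hD _ _ _
  have h2 : ∀ b, chi D p b q t = 0 := by
    intro b
    rcases hp with rfl | rfl <;> rcases hq with rfl | rfl <;> rcases ht with rfl | rfl <;>
    first | exact chi_loopl _ _ _ | exact chi_loopr _ _ _ | exact chi_ac hD _ _ _ | exact chi_ad hD _ _ _ | exact chi_bc hD _ _ _ | exact chi_bd hD _ _ _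
  simp only [Fintype.sum_option, oc_none, oc_some, h1, h2, Finset.sum_const_zero, zero_add]

theorem Fs_A (hD : D.IsGood) {p q t : V} (u : A → V) (v : B → V) (hp : p = x ∨ p = y) (hq : q = x ∨ q = y) (ht : t = x ∨ t = y) :
    Fs D p q (oc t u) v = Fs D p q u v := by
  unfold Fs
  have h1 : ∀ b, chi D p b t q = 0 := by
    intro b
    rcases hp with rfl | rfl <;> rcases hq with rfl | rfl <;> rcases ht with rfl | rfl <;>
    first | exact chi_loopl _ _ _ | exact chi_loopr _ _ _ | exact chi_ac hD _ _ _ | exact chi_ad hD _ _ _ | exact chi_bc hD _ _ _ | exact chi_bd hD _ _ _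
  simp only [Fintype.sum_option, oc_none, oc_some, h1, Finset.sum_const_zero, zero_add]

theorem Fs_B (hD : D.IsGood) {p q t : V} (u : A → V) (v : B → V) (hp : p = x ∨ p = y) (hq : q = x ∨ q = y) (ht : t = x ∨ t = y) :
    Fs D p q u (oc t v) = Fs D p q u v := by
  rw [Fs_comm, Fs_A hD _ _ hq hp ht, Fs_comm]

theorem Ks_A (hD : D.IsGood) {p q t : V} (u : A → V) (v : B → V) (hp : p = x ∨ p = y) (hq : q = x ∨ q = y) (ht : t = x ∨ t = y) :
    Ks D p q (oc t u) v = Ks D p q u v := by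
  unfold Ks
  have h1 : ∀ b, chi D p q t b = 0 := by
    intro b
    rcases hp with rfl | rfl <;> rcases hq with rfl | rfl <;> rcases ht with rfl | rfl <;>
    first | exact chi_loopl _ _ _ | exact chi_loopr _ _ _ | exact chi_ac hD _ _ _ | exact chi_ad hD _ _ _ | exact chi_bc hD _ _ _ | exact chi_bd hD _ _ _
  simp only [Fintype.sum_option, oc_none, oc_some, h1, Finset.sum_const_zero, zero_add]

theorem Ks_B (hD : D.IsGood) {p q t : V} (u : A → V) (v : B → V) (hp : p = x ∨ p = y) (hq : q = x ∨ q = y) (ht : t = x ∨ t = y) :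
    Ks D p q u (oc t v) = Ks D p q u v := by
  rw [Ks_swap, Ks_A hD _ _ hp hq ht, Ks_swap]

end sums

end HB

namespace HB

open Set

structure Cfg {V M N : Type*} (G : SimpleGraph V) (x y : V) (u : M → V) (v : N → V) : Prop where
  hxy : G.Adj x y
  hxu : ∀ i, G.Adj x (u i)
  hxv : ∀ i, G.Adj x (v i)
  hyu : ∀ i, G.Adj y (u i)
  hyv : ∀ i, G.Adj y (v i)
  huv : ∀ i j, G.Adj (u i) (v j)
  iu : Function.Injective u
  iv : Function.Injective v

section

variable {V M N : Type*} {G : SimpleGraph V} {x y : V} {u : M → V} {v : N → V}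

theorem Cfg.swap (h : Cfg G x y u v) : Cfg G x y v u :=
  ⟨h.hxy, h.hxv, h.hxu, h.hyv, h.hyu, fun i j => (h.huv j i).symm, h.iv, h.iu⟩

variable [Fintype M] [Fintype N]

/-- twice the number of crossings without those on `xy` -/
noncomputable def T3 (D : Drawing G) (x y : V) (u : M → V) (v : N → V) : ℕ :=
  QS D u v + 2 * (Es D x v u + Es D y v u + Es D x u v + Es D y u v + Gs D x y u + Gs D x y v
    + Fs D x y u v + Fs D y x u v)

theorem T3_swap (D : Drawing G) : T3 D x y u v = T3 D x y v u := by
  unfold T3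
  rw [QS_swap, Fs_comm x y u v, Fs_comm y x u v]
  ring

def eu (x y : V) (u : M → V) : (Option (Option M) × N) ⊕ (M ⊕ M) → V :=
  Sum.elim (fun o => oc x (oc y u) o.1) (Sum.elim (fun _ => x) (fun _ => y))

def ev (u : M → V) (v : N → V) : (Option (Option M) × N) ⊕ (M ⊕ M) → V :=
  Sum.elim (fun o => v o.2) (Sum.elim u u)

variable {D : Drawing G}

theorem sum_sym {Ω₁ Ω₂ : Type*} [Fintype Ω₁] [Fintype Ω₂] (f : Ω₁ ⊕ Ω₂ → Ω₁ ⊕ Ω₂ → ℕ) (hf : ∀ a b, f a b = f b a) :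
    ∑ a, ∑ b, f a b = (∑ a, ∑ b, f (.inl a) (.inl b)) + 2 * (∑ a, ∑ b, f (.inr a) (.inl b)) +
      ∑ a, ∑ b, f (.inr a) (.inr b) := by
  simp only [Fintype.sum_sum_type, Finset.sum_add_distrib]
  have : ∑ a, ∑ b, f (.inl a) (.inr b) = ∑ a, ∑ b, f (.inr a) (.inl b) := by
    rw [Finset.sum_comm]
    exact Finset.sum_congr rfl fun _ _ => Finset.sum_congr rfl fun _ _ => hf _ _
  rw [this]
  ring

theorem sum_T3 (hD : D.IsGood) :
    ∑ ω, ∑ ω', chi D (eu (N := N) x y u ω) (ev u v ω) (eu (N := N) x y u ω') (ev u v ω') = T3 D x y u v := by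
  rw [sum_sym _ (fun a b => chi_comm _ _ _ _)]
  have h1 : ∑ a, ∑ b, chi D (eu (N := N) x y u (.inl a)) (ev u v (.inl a)) (eu (N := N) x y u (.inl b)) (ev u v (.inl b))
      = QS D (oc x (oc y u)) v := by
    unfold QS
    simp only [Fintype.sum_prod_type]
    rfl
  have h3 : ∑ a, ∑ b, chi D (eu (N := N) x y u (.inr a)) (ev u v (.inr a)) (eu (N := N) x y u (.inr b)) (ev u v (.inr b))
      = 2 * Gs D x y u := by
    have h := Gs_comm (D := D) x y u
    have h' := Gs_self hD x u
    have h'' := Gs_self hD y u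
    unfold Gs at h h' h'' ⊢
    simp only [Fintype.sum_sum_type, Finset.sum_add_distrib, eu, ev, Sum.elim_inl, Sum.elim_inr]
    omega
  have h2 : ∑ a, ∑ b, chi D (eu (N := N) x y u (.inr a)) (ev u v (.inr a)) (eu (N := N) x y u (.inl b)) (ev u v (.inl b))
      = Es D x v u + Es D y v u + Fs D x y u v + Fs D y x u v := by
    have e1 : ∀ x, Es D x v u = ∑ i, ∑ i', ∑ j, chi D x (u i) (u i') (v j) := by
      intro x
      unfold Es
      refine Finset.sum_congr rfl fun _ _ => ?_
      rw [Finset.sum_comm]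
      exact Finset.sum_congr rfl fun _ _ => Finset.sum_congr rfl fun _ _ => chi_swapr _ _ _ _
    have e2 : ∀ x y, Fs D x y u v = ∑ i, ∑ j, chi D y (u i) x (v j) := by
      intro x y
      unfold Fs
      refine Finset.sum_congr rfl fun _ _ => Finset.sum_congr rfl fun _ _ => ?_
      rw [chi_comm, chi_swapl]
    simp only [e1, e2, Fintype.sum_sum_type, Fintype.sum_prod_type, Fintype.sum_option, Finset.sum_add_distrib, eu, ev,
      Sum.elim_inl, Sum.elim_inr, oc_none, oc_some, chi_ac hD, Finset.sum_const_zero]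
    ring
  rw [h1, h2, h3, QS_A hD, QS_A hD, Es_A hD]
  unfold T3
  ring

theorem eu_inj (h : Cfg G x y u v) (ω ω' : (Option (Option M) × N) ⊕ (M ⊕ M))
    (he : s(eu (N := N) x y u ω, ev u v ω) = s(eu (N := N) x y u ω', ev u v ω')) : ω = ω' := by
  have a1 := h.hxy.ne
  have a2 := fun i => (h.hxu i).ne
  have a3 := fun i => (h.hxv i).ne
  have a4 := fun i => (h.hyu i).ne
  have a5 := fun i => (h.hyv i).ne
  have a6 := fun i j => (h.huv i j).ne
  have b1 := a1.symm
  have b2 := fun i => (a2 i).symm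
  have b3 := fun i => (a3 i).symm
  have b4 := fun i => (a4 i).symm
  have b5 := fun i => (a5 i).symm
  have b6 := fun i j => (a6 i j).symm
  have c1 : ∀ a b, u a = u b ↔ a = b := fun _ _ => h.iu.eq_iff
  have c2 : ∀ a b, v a = v b ↔ a = b := fun _ _ => h.iv.eq_iff
  rcases ω with ⟨(_ | _ | i), j⟩ | i | i <;> rcases ω' with ⟨(_ | _ | i'), j'⟩ | i' | i' <;>
    simp_all [eu, ev]

theorem total (hD : D.IsGood) (h : Cfg G x y u v)
    (hcov : ∀ a b, G.Adj a b → s(x, y) = s(a, b) ∨ ∃ ω, s(eu (N := N) x y u ω, ev u v ω) = s(a, b)) :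
    2 * D.crNum = T3 D x y u v + 2 * Ks D x y u v := by
  rw [← two_crNum hD (Ω := ((Option (Option M) × N) ⊕ (M ⊕ M)) ⊕ Unit)
    (Sum.elim (eu (N := N) x y u) (fun _ => x)) (Sum.elim (ev u v) (fun _ => y))]
  · rw [sum_sym _ (fun a b => chi_comm _ _ _ _)]
    simp only [Sum.elim_inl, Sum.elim_inr, sum_T3 hD, chi_ac hD, Finset.sum_const_zero, add_zero]
    simp only [Finset.univ_unique, Finset.sum_singleton]
    have hk : ∑ b, chi D x y (eu (N := N) x y u b) (ev u v b) = Ks D x y u v := by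
      unfold Ks
      simp only [Fintype.sum_sum_type, Fintype.sum_prod_type, Fintype.sum_option, eu, ev, Sum.elim_inl, Sum.elim_inr,
        oc_none, oc_some, chi_ac hD, chi_bc hD, Finset.sum_const_zero, zero_add, add_zero]
    rw [hk]
  · have key : ∀ ω, s(x, y) ≠ s(eu (N := N) x y u ω, ev u v ω) := by
      have a1 := h.hxy.ne
      have a2 := fun i => (h.hxu i).ne
      have a3 := fun i => (h.hxv i).ne
      have a4 := fun i => (h.hyu i).ne
      have a5 := fun i => (h.hyv i).ne
      rintro (⟨(_ | _ | i), j⟩ | i | i) <;> simp_all [eu, ev]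
    rintro (ω | ω) (ω' | ω') he
    · exact congrArg _ (eu_inj h _ _ he)
    · exact absurd he.symm (key _)
    · exact absurd he (key _)
    · rfl
  · intro a b hab
    rcases hcov a b hab with h | ⟨ω, h⟩
    · exact ⟨.inr (), h⟩
    · exact ⟨.inl ω, h⟩

end

/-- the vertices of `triK 2 m n` inside a configuration -/
def triMap {V : Type*} {m n : ℕ} (x y : V) (u : Fin m → V) (v : Fin n → V) :
    (Σ i : Fin 3, ![Fin 2, Fin m, Fin n] i) → V
  | ⟨0, a⟩ => if (show Fin 2 from a) = 0 then x else y
  | ⟨1, i⟩ => u i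
  | ⟨2, j⟩ => v j

theorem HC_lower {V : Type*} {m n : ℕ} {G : SimpleGraph V} {x y : V} {u : Fin m → V} {v : Fin n → V} {D : Drawing G}
    (hD : D.IsGood) (h : Cfg G x y u v) : 2 * crossingNumber (triK 2 m n) ≤ T3 D x y u v := by
  have a1 := h.hxy
  have a2 := fun i => (h.hxu i)
  have a3 := fun i => (h.hxv i)
  have a4 := fun i => (h.hyu i)
  have a5 := fun i => (h.hyv i)
  have a6 := fun i j => (h.huv i j)
  have b1 := a1.symm
  have b2 := fun i => (a2 i).symm
  have b3 := fun i => (a3 i).symm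
  have b4 := fun i => (a4 i).symm
  have b5 := fun i => (a5 i).symm
  have b6 := fun i j => (a6 i j).symm
  have hh : ∀ a b, (triK 2 m n).Adj a b → G.Adj (triMap x y u v a) (triMap x y u v b) := by
    rintro ⟨i, a⟩ ⟨j, b⟩ hab
    rw [SimpleGraph.comap_adj] at hab
    fin_cases i <;> fin_cases j <;> simp [triMap] at hab ⊢ <;> (try split_ifs) <;>
    first | exact a2 _ | exact a3 _ | exact a4 _ | exact a5 _ | exact a6 _ _ | exact b2 _ | exact b3 _ | exact b4 _ |
      exact b5 _ | exact b6 _ _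
  have hf : Function.Injective (triMap x y u v) := by
    rintro ⟨i, a⟩ ⟨j, b⟩ hab
    by_cases hij : i = j
    · subst hij
      congr 1
      fin_cases i
      · change Fin 2 at a b
        have := a1.ne
        have := b1.ne
        fin_cases a <;> fin_cases b <;> simp_all [triMap]
      · exact h.iu hab
      · exact h.iv hab
    · exact absurd hab (hh ⟨i, a⟩ ⟨j, b⟩ hij).ne
  have hg := comap_good (hf := hf) (hh := hh) hD
  refine (Nat.mul_le_mul_left 2 (crossingNumber_le hg)).trans (le_of_eq ?_)
  have hc : Cfg G x y u v := h
  rw [← sum_T3 hD]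
  let tx : Σ i : Fin 3, ![Fin 2, Fin m, Fin n] i := ⟨0, (0 : Fin 2)⟩
  let ty : Σ i : Fin 3, ![Fin 2, Fin m, Fin n] i := ⟨0, (1 : Fin 2)⟩
  let tu : Fin m → Σ i : Fin 3, ![Fin 2, Fin m, Fin n] i := fun i => ⟨1, i⟩
  let tv : Fin n → Σ i : Fin 3, ![Fin 2, Fin m, Fin n] i := fun i => ⟨2, i⟩
  have e1 : ∀ ω, triMap x y u v (eu (N := Fin n) tx ty tu ω) = eu (N := Fin n) x y u ω := by
    rintro (⟨(_ | _ | i), j⟩ | i | i) <;> rfl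
  have e2 : ∀ ω, triMap x y u v (ev tu tv ω) = ev u v ω := by
    rintro (⟨(_ | _ | i), j⟩ | i | i) <;> rfl
  have e3 : ∀ ω, (triK 2 m n).Adj (eu (N := Fin n) tx ty tu ω) (ev tu tv ω) := by
    rintro (⟨(_ | _ | i), j⟩ | i | i) <;> simp [eu, ev, tx, ty, tu, tv]
  rw [← two_crNum hg (eu (N := Fin n) tx ty tu) (ev tu tv)]
  · refine Finset.sum_congr rfl fun ω _ => Finset.sum_congr rfl fun ω' _ => chi_congr ?_
    rw [comap_X (e3 _) (e3 _), e1, e1, e2, e2]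
  · intro ω ω' he
    have := congrArg (Sym2.map (triMap x y u v)) he
    simp only [Sym2.map_mk, e1, e2] at this
    exact eu_inj h _ _ this
  · have key : ∀ a b : (Σ i : Fin 3, ![Fin 2, Fin m, Fin n] i), a.1 < b.1 →
        ∃ ω, s(eu (N := Fin n) tx ty tu ω, ev tu tv ω) = s(a, b) := by
      rintro ⟨i, a⟩ ⟨j, b⟩ hab
      fin_cases i <;> fin_cases j <;> simp at hab
      · change Fin 2 at a
        fin_cases a
        · exact ⟨.inr (.inl b), rfl⟩
        · exact ⟨.inr (.inr b), rfl⟩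
      · change Fin 2 at a
        fin_cases a
        · exact ⟨.inl (none, b), rfl⟩
        · exact ⟨.inl (some none, b), rfl⟩
      · exact ⟨.inl (some (some a), b), rfl⟩
    intro a b hab
    have hne : a.1 ≠ b.1 := hab
    rcases lt_or_gt_of_ne hne with h | h
    · exact key a b h
    · rw [Sym2.eq_swap]; exact key b a h

end HB

namespace HB

open Set

section step

variable {V : Type} {A B : Type*} [Fintype A] [Fintype B] {G : SimpleGraph V} {D : Drawing G} {x : V}
  {D' : Drawing (satG G x)} {r : V → ℕ} {c : ℕ}

theorem Sat.le (h : Sat D x D' r c) {P Q R S : V ⊕ Bool} (hn : ¬ (x ∈ s(spr x P, spr x Q) ∧ x ∈ s(spr x R, spr x S))) :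
    chi D' P Q R S ≤ chi D (spr x P) (spr x Q) (spr x R) (spr x S) := by
  by_cases hX : X D' P Q R S
  · rw [chi_one hX, chi_one ((h.proj _ _ _ _ hX).resolve_right hn)]
  · rw [chi_zero hX]; exact Nat.zero_le _

theorem Sat.stub' (h : Sat D x D' r c) (b : Bool) (P Q : V ⊕ Bool) : chi D' (.inr b) (.inl x) P Q = 0 :=
  chi_zero (h.stub b P Q)

variable {u : A → V} {v : B → V}

theorem Sat.QS_le (h : Sat D x D' r c) (hu : ∀ a, u a ≠ x) (hv : ∀ b, v b ≠ x) :
    QS D' (fun a => .inl (u a)) (fun b => .inl (v b)) ≤ QS D u v := by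
  unfold QS
  refine Finset.sum_le_sum fun a _ => Finset.sum_le_sum fun b _ => Finset.sum_le_sum fun a' _ => Finset.sum_le_sum fun b' _ => ?_
  refine h.le ?_
  rintro ⟨h1, -⟩
  simp only [Sym2.mem_iff, spr] at h1
  rcases h1 with h1 | h1
  exacts [hu _ h1.symm, hv _ h1.symm]

theorem Sat.Es_le (h : Sat D x D' r c) (hu : ∀ a, u a ≠ x) (hv : ∀ b, v b ≠ x) (P : V ⊕ Bool) :
    Es D' P (fun a => .inl (u a)) (fun b => .inl (v b)) ≤ Es D (spr x P) u v := by
  unfold Es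
  refine Finset.sum_le_sum fun a _ => Finset.sum_le_sum fun b _ => Finset.sum_le_sum fun a' _ => ?_
  refine h.le ?_
  rintro ⟨-, h1⟩
  simp only [Sym2.mem_iff, spr] at h1
  rcases h1 with h1 | h1
  exacts [hu _ h1.symm, hv _ h1.symm]

theorem Sat.Ks_zero (h : Sat D x D' r c) {A' B' : Type*} [Fintype A'] [Fintype B'] (s : Bool) (u' : A' → V ⊕ Bool)
    (v' : B' → V ⊕ Bool) : Ks D' (.inr s) (.inl x) u' v' = 0 := by
  unfold Ks
  exact Finset.sum_eq_zero fun _ _ => Finset.sum_eq_zero fun _ _ => h.stub' _ _ _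

theorem Sat.step1 (h : Sat D x D' r c) (hD : D.IsGood) (hu : ∀ a, u a ≠ x) (hv : ∀ b, v b ≠ x) (s : Bool) :
    QS D' (oc (.inl x) (fun a => .inl (u a))) (oc (.inr s) (fun b => .inl (v b))) ≤ QS D (oc x u) (oc x v) +
      2 * Fs D' (.inr s) (.inl x) (fun b => .inl (v b)) (fun a => .inl (u a)) := by
  have e1 := h.QS_le hu hv
  have e2 := h.Es_le hu hv (.inl x)
  have e3 := h.Es_le hv hu (.inr s)
  simp only [QS_B h.good, QS_B hD]
  simp only [QS_A h.good, QS_A hD, Es_B h.good, Es_B hD, h.Ks_zero, Fs_self hD, Ks_self]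
  simp only [spr] at e2 e3
  omega

theorem Sat.twin (h : Sat D x D' r c) (hD : D.IsGood) (hu : ∀ a, u a ≠ x) (hv : ∀ b, v b ≠ x) (s : Bool) :
    QS D' (oc (.inr s) (oc (.inl x) (fun a => .inl (u a)))) (fun b => .inl (v b)) ≤ QS D (oc x (oc x u)) v +
      2 * Gs D' (.inr s) (.inl x) (fun b => .inl (v b)) := by
  have e1 := h.QS_le hu hv
  have e2 := h.Es_le hu hv (.inl x)
  have e3 := h.Es_le hu hv (.inr s)
  simp only [QS_A h.good, QS_A hD, Es_A h.good, Es_A hD, Gs_self hD]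
  simp only [spr] at e2 e3
  omega

theorem Sat.double (h : Sat D x D' r c) (hD : D.IsGood) (hu : ∀ a, u a ≠ x) (hv : ∀ b, v b ≠ x) :
    QS D' (oc (.inl x) (fun a => .inl (u a))) (oc (.inr false) (oc (.inr true) (fun b => .inl (v b)))) ≤
      QS D (oc x u) (oc x (oc x v)) +
      2 * (Fs D' (.inr false) (.inl x) (fun b => .inl (v b)) (fun a => .inl (u a)) +
        Fs D' (.inr true) (.inl x) (fun b => .inl (v b)) (fun a => .inl (u a)) +
        Gs D' (.inr false) (.inr true) (fun a => .inl (u a))) := by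
  have e1 := h.QS_le hu hv
  have e2 := h.Es_le hu hv (.inl x)
  have e3 := h.Es_le hv hu (.inr false)
  have e4 := h.Es_le hv hu (.inr true)
  have e5 : Gs D' (.inr false) (.inr true) (oc (.inl x) (fun a => .inl (u a))) =
      Gs D' (.inr false) (.inr true) (fun a => .inl (u a)) := by
    unfold Gs
    have e : ∀ P Q b, chi D' P Q (.inr b) (.inl x) = 0 := fun P Q b => by rw [chi_comm]; exact h.stub' _ _ _
    simp only [Fintype.sum_option, oc_none, oc_some, h.stub', e, Finset.sum_const_zero, zero_add]
  simp only [QS_B h.good, QS_B hD]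
  simp only [QS_A h.good, QS_A hD, Es_A h.good, Es_A hD, Es_B h.good, Es_B hD, h.Ks_zero, Fs_self hD,
    Ks_self, e5, Gs_self hD]
  simp only [spr] at e2 e3 e4
  omega

end step

/-! ranks -/

def lf (c a b : ℕ) : ℕ := if (a < c ∧ b < a) ∨ (c ≤ a ∧ a < b) then 1 else 0
def rg (c a b : ℕ) : ℕ := if (a < b ∧ b < c) ∨ (c ≤ b ∧ b < a) then 1 else 0
def sm (c a b : ℕ) : ℕ := if (a < c ∧ b < c) ∨ (c ≤ a ∧ c ≤ b) then 1 else 0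

theorem lf_rg (c a b : ℕ) : lf c a b + rg c a b ≤ sm c a b := by
  unfold lf rg sm; split_ifs <;> omega

theorem lf_lf (c a b : ℕ) : lf c a b + lf c b a ≤ sm c a b := by
  unfold lf sm; split_ifs <;> omega

theorem lf_self (c a : ℕ) : lf c a a = 0 := by
  unfold lf; split_ifs <;> omega

theorem sm_self (c a : ℕ) : sm c a a = 1 := by
  unfold sm; split_ifs <;> omega

theorem lf_zero {c : ℕ} (hc : 0 < c) (b : ℕ) : lf c 0 b = 0 := by
  unfold lf; split_ifs <;> omega

section rank

variable {B : Type*} [Fintype B] (f : B → ℕ) (c : ℕ)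

theorem sum_sm (a : ℕ) : ∑ b, sm c a (f b) =
    if a < c then (Finset.univ.filter fun b => f b < c).card else Fintype.card B - (Finset.univ.filter fun b => f b < c).card := by
  classical
  split_ifs with h
  · rw [Finset.card_filter]
    refine Finset.sum_congr rfl fun b _ => ?_
    unfold sm; split_ifs <;> omega
  · rw [← Finset.card_compl, Finset.compl_filter, Finset.card_filter]
    refine Finset.sum_congr rfl fun b _ => ?_
    unfold sm; split_ifs <;> omega

theorem sum_lf : 2 * ∑ b, ∑ b', lf c (f b) (f b') + Fintype.card B ≤ ∑ b, ∑ b', sm c (f b) (f b') := by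
  classical
  have h1 : Fintype.card B = ∑ b : B, ∑ b' : B, (if b = b' then 1 else 0) := by simp
  have h2 : ∑ b, ∑ b', lf c (f b) (f b') = ∑ b, ∑ b', lf c (f b') (f b) := Finset.sum_comm
  rw [two_mul]
  nth_rw 2 [h2]
  rw [h1]
  simp only [← Finset.sum_add_distrib]
  refine Finset.sum_le_sum fun b _ => Finset.sum_le_sum fun b' _ => ?_
  split_ifs with h
  · subst h; rw [lf_self, sm_self]
  · exact lf_lf _ _ _

theorem sum_sm2 (h d : ℕ) (hh : (Finset.univ.filter fun b => f b < c).card = h) (hd : Fintype.card B = h + d) :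
    ∑ b, ∑ b', sm c (f b) (f b') = h * h + d * d := by
  classical
  simp only [sum_sm, hh, hd, Nat.add_sub_cancel_left]
  rw [Finset.sum_ite]
  simp only [Finset.sum_const, hh, smul_eq_mul]
  congr 2
  rw [← Finset.compl_filter, Finset.card_compl, hh, hd, Nat.add_sub_cancel_left]

theorem exists_cut (hf : Function.Injective f) (h : ℕ) (h0 : 0 < h) (h1 : h < Fintype.card B) :
    ∃ c, 0 < c ∧ (∃ b, c ≤ f b) ∧ (Finset.univ.filter fun b => f b < c).card = h := by
  classical
  have key : ∀ h, h ≤ Fintype.card B → ∃ c, (Finset.univ.filter fun b => f b < c).card = h := by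
    intro h
    induction h with
    | zero => intro _; exact ⟨0, by simp⟩
    | succ k ih =>
      intro hk
      obtain ⟨c, hc⟩ := ih (by omega)
      have hex : ∃ n, c ≤ n ∧ ∃ b, f b = n := by
        by_contra hcon
        push Not at hcon
        have : (Finset.univ.filter fun b => f b < c) = Finset.univ := by
          ext b
          simp only [Finset.mem_filter, Finset.mem_univ, true_and, iff_true]
          by_contra hb
          exact hcon (f b) (not_lt.1 hb) b rfl
        rw [this, Finset.card_univ] at hc
        omega
      obtain ⟨hn, b0, hb0⟩ := Nat.find_spec hex
      refine ⟨Nat.find hex + 1, ?_⟩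
      have : (Finset.univ.filter fun b => f b < Nat.find hex + 1) = insert b0 (Finset.univ.filter fun b => f b < c) := by
        ext b
        simp only [Finset.mem_filter, Finset.mem_univ, true_and, Finset.mem_insert]
        constructor
        · intro hb
          by_cases hbc : f b < c
          · exact Or.inr hbc
          · left
            apply hf
            have := Nat.find_min' hex ⟨not_lt.1 hbc, b, rfl⟩
            omega
        · rintro (rfl | hb)
          · omega
          · omega
      rw [this, Finset.card_insert_of_notMem, hc]
      simp only [Finset.mem_filter, Finset.mem_univ, true_and]
      omega
  obtain ⟨c, hc⟩ := key h h1.le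
  refine ⟨c, ?_, ?_, hc⟩
  · rcases Nat.eq_zero_or_pos c with rfl | h
    · simp at hc; omega
    · exact h
  · by_contra hcon
    push Not at hcon
    have : (Finset.univ.filter fun b => f b < c) = Finset.univ := by
      ext b; simp [hcon b]
    rw [this, Finset.card_univ] at hc
    omega

end rank

end HB

namespace HB

open Set

theorem inl_oc {V A : Type} (p : V) (u : A → V) :
    (fun a => (Sum.inl (oc p u a) : V ⊕ Bool)) = oc (.inl p) (fun a => .inl (u a)) := comp_oc _ p u

section cost

variable {V A B : Type} [Fintype A] [Fintype B] {G : SimpleGraph V} {D : Drawing G} {x : V}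
  {D' : Drawing (satG G x)} {r : V → ℕ} {c : ℕ} {u : A → V} {v : B → V}

theorem chi_le_ite {p : Prop} [Decidable p] {P Q R S : V} (h : X D P Q R S → p) :
    chi D P Q R S ≤ if p then 1 else 0 := by
  by_cases hX : X D P Q R S
  · rw [chi_one hX, if_pos (h hX)]
  · rw [chi_zero hX]; exact Nat.zero_le _

theorem Sat.c0 (h : Sat D x D' r c) (hu : ∀ a, G.Adj x (u a)) (hv : ∀ b, G.Adj x (v b)) :
    Fs D' (.inr false) (.inl x) (fun b => .inl (v b)) (fun a => .inl (u a)) ≤ ∑ a, ∑ b, lf c (r (u a)) (r (v b)) := by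
  rw [Finset.sum_comm]
  unfold Fs
  refine Finset.sum_le_sum fun b _ => Finset.sum_le_sum fun a _ => ?_
  rw [chi_swapr]
  exact chi_le_ite (h.f0 _ _ (hu a) (hv b))

theorem Sat.c1 (h : Sat D x D' r c) (hu : ∀ a, G.Adj x (u a)) (hv : ∀ b, G.Adj x (v b)) :
    Fs D' (.inr true) (.inl x) (fun b => .inl (v b)) (fun a => .inl (u a)) ≤ ∑ a, ∑ b, rg c (r (u a)) (r (v b)) := by
  rw [Finset.sum_comm]
  unfold Fs
  refine Finset.sum_le_sum fun b _ => Finset.sum_le_sum fun a _ => ?_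
  rw [chi_swapr]
  exact chi_le_ite (h.f1 _ _ (hu a) (hv b))

theorem Sat.cg (h : Sat D x D' r c) (hv : ∀ b, G.Adj x (v b)) :
    Gs D' (.inr false) (.inl x) (fun b => .inl (v b)) ≤ ∑ b, ∑ b', lf c (r (v b)) (r (v b')) := by
  unfold Gs
  refine Finset.sum_le_sum fun b _ => Finset.sum_le_sum fun a _ => ?_
  exact chi_le_ite (h.f0 _ _ (hv b) (hv a))

theorem Sat.cg2 (h : Sat D x D' r c) (hv : ∀ b, G.Adj x (v b)) :
    Gs D' (.inr false) (.inr true) (fun b => .inl (v b)) ≤ ∑ b, ∑ b', lf c (r (v b)) (r (v b')) := by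
  unfold Gs
  refine Finset.sum_le_sum fun b _ => Finset.sum_le_sum fun a _ => ?_
  refine chi_le_ite fun hX => ?_
  have := h.f2 _ _ (hv b) (hv a) hX
  omega

theorem sum_sm_half (w : A → ℕ) (f : B → ℕ) (h : ℕ) (hh : (Finset.univ.filter fun b => f b < c).card = h)
    (hd : Fintype.card B = 2 * h) : ∑ a, ∑ b, sm c (w a) (f b) = Fintype.card A * h := by
  simp only [sum_sm, hh, hd]
  have : 2 * h - h = h := by omega
  simp [this]

theorem QS_perm (hD : D.IsGood) (p q : V) : QS D (oc p (oc q u)) v = QS D (oc q (oc p u)) v := by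
  simp only [QS_A hD, Es_A hD, Gs_comm p q]
  ring

variable [Finite V]

theorem step_min (hD : D.IsGood) (hu : ∀ a, G.Adj x (u a)) (hv : ∀ b, G.Adj x (v b)) (iv : Function.Injective v)
    (h : ℕ) (h0 : 0 < h) (hd : Fintype.card B = 2 * h) : ∃ (D' : Drawing (satG G x)) (s : Bool), D'.IsGood ∧
      QS D' (oc (.inl x) (fun a => .inl (u a))) (oc (.inr s) (fun b => .inl (v b))) ≤ QS D (oc x u) (oc x v) +
        Fintype.card A * h := by
  obtain ⟨b0⟩ : Nonempty B := Fintype.card_pos_iff.1 (by omega)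
  obtain ⟨r, p, r1, r2, -, r4⟩ := exists_sat hD (hv b0)
  obtain ⟨c, c0, ⟨b1, hb1⟩, c2⟩ := exists_cut (fun b => r (v b)) (fun b b' e => iv (r1 _ _ (hv b) (hv b') e)) h h0 (by omega)
  obtain ⟨D', hS⟩ := r4 c c0 (hb1.trans_lt (r2 _ (hv b1)))
  have e0 := hS.c0 hu hv
  have e1 := hS.c1 hu hv
  have e2 := sum_sm_half (c := c) (fun a => r (u a)) (fun b => r (v b)) h c2 hd
  have e3 : ∑ a, ∑ b, lf c (r (u a)) (r (v b)) + ∑ a, ∑ b, rg c (r (u a)) (r (v b)) ≤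
      ∑ a, ∑ b, sm c (r (u a)) (r (v b)) := by
    simp only [← Finset.sum_add_distrib]
    exact Finset.sum_le_sum fun _ _ => Finset.sum_le_sum fun _ _ => lf_rg _ _ _
  have f0 := hS.step1 hD (fun a => (hu a).ne') (fun a => (hv a).ne') false
  have f1 := hS.step1 hD (fun a => (hu a).ne') (fun a => (hv a).ne') true
  by_cases hc : 2 * Fs D' (.inr false) (.inl x) (fun b => .inl (v b)) (fun a => .inl (u a)) ≤ Fintype.card A * h
  · exact ⟨D', false, hS.good, by omega⟩
  · exact ⟨D', true, hS.good, by omega⟩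

/-- a twin of `x`, joined to an odd family -/
theorem step_twin (hD : D.IsGood) (hu : ∀ a, u a ≠ x) (hv : ∀ b, G.Adj x (v b)) (iv : Function.Injective v)
    (h : ℕ) (h0 : 0 < h) (hd : Fintype.card B = 2 * h + 1) : ∃ (D' : Drawing (satG G x)), D'.IsGood ∧
      QS D' (oc (.inr false) (oc (.inl x) (fun a => .inl (u a)))) (fun b => .inl (v b)) ≤ QS D (oc x (oc x u)) v +
      2 * (h * h) := by
  obtain ⟨b0⟩ : Nonempty B := Fintype.card_pos_iff.1 (by omega)
  obtain ⟨r, p, r1, r2, -, r4⟩ := exists_sat hD (hv b0)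
  obtain ⟨c, c0, ⟨b1, hb1⟩, c2⟩ := exists_cut (fun b => r (v b)) (fun b b' e => iv (r1 _ _ (hv b) (hv b') e)) h h0 (by omega)
  obtain ⟨D', hS⟩ := r4 c c0 (hb1.trans_lt (r2 _ (hv b1)))
  have e0 := hS.cg hv
  have e1 := sum_lf (fun b => r (v b)) c
  rw [sum_sm2 _ c h (h + 1) c2 (by omega), hd] at e1
  have f0 := hS.twin hD hu (fun a => (hv a).ne') false
  refine ⟨D', hS.good, f0.trans ?_⟩
  nlinarith

/-- two satellites of `x` on the other side, halving an even family -/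
theorem step_double (hD : D.IsGood) (hu : ∀ a, G.Adj x (u a)) (hv : ∀ b, G.Adj x (v b)) (iu : Function.Injective u)
    (h : ℕ) (h0 : 0 < h) (hd : Fintype.card A = 2 * h) : ∃ (D' : Drawing (satG G x)), D'.IsGood ∧
      QS D' (oc (.inl x) (fun a => .inl (u a))) (oc (.inr false) (oc (.inr true) (fun b => .inl (v b)))) + 2 * h ≤
      QS D (oc x u) (oc x (oc x v)) + 2 * (Fintype.card B * h + h * h) := by
  obtain ⟨b0⟩ : Nonempty A := Fintype.card_pos_iff.1 (by omega)
  obtain ⟨r, p, r1, r2, -, r4⟩ := exists_sat hD (hu b0)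
  obtain ⟨c, c0, ⟨b1, hb1⟩, c2⟩ := exists_cut (fun b => r (u b)) (fun b b' e => iu (r1 _ _ (hu b) (hu b') e)) h h0 (by omega)
  obtain ⟨D', hS⟩ := r4 c c0 (hb1.trans_lt (r2 _ (hu b1)))
  have e0 := hS.c0 hu hv
  have e1 := hS.c1 hu hv
  have e4 := hS.cg2 hu
  have e5 := sum_lf (fun b => r (u b)) c
  rw [sum_sm2 _ c h h c2 (by omega), hd] at e5
  have e2 := sum_sm_half (c := c) (fun a => r (v a)) (fun b => r (u b)) h c2 hd
  have e3 : ∑ a, ∑ b, lf c (r (u a)) (r (v b)) + ∑ a, ∑ b, rg c (r (u a)) (r (v b)) ≤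
      ∑ b, ∑ a, sm c (r (v b)) (r (u a)) := by
    rw [Finset.sum_comm (f := fun b a => sm c (r (v b)) (r (u a)))]
    simp only [← Finset.sum_add_distrib]
    refine Finset.sum_le_sum fun _ _ => Finset.sum_le_sum fun _ _ => (lf_rg _ _ _).trans (le_of_eq ?_)
    unfold sm
    exact if_congr (by omega) rfl rfl
  have f0 := hS.double hD (fun a => (hu a).ne') (fun a => (hv a).ne')
  refine ⟨D', hS.good, ?_⟩
  nlinarith

end cost

end HB

namespace HB

open Set

theorem oc_all {V A : Type*} {P : V → Prop} {p : V} {u : A → V} (h1 : P p) (h2 : ∀ a, P (u a)) (o : Option A) :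
    P (oc p u o) := by
  cases o
  · exact h1
  · exact h2 _

theorem inl_inj {V A : Type} {u : A → V} (hu : Function.Injective u) :
    Function.Injective (fun a => (Sum.inl (u a) : V ⊕ Bool)) := Sum.inl_injective.comp hu

section cases3

variable {V M N : Type} [Fintype M] [Fintype N] {G : SimpleGraph V} {D : Drawing G} {x y : V}
  {u : M → V} {v : N → V}

theorem proj_1111 (hD : D.IsGood) : QS D (oc x (oc y u)) (oc x (oc y v)) = T3 D x y u v + 4 * Ks D x y u v := by
  simp only [QS_B hD]
  simp only [QS_A hD, Es_A hD, Es_B hD, Fs_A hD (x := x) (y := y), Fs_B hD (x := x) (y := y), Ks_A hD (x := x) (y := y),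
    Ks_B hD (x := x) (y := y), Gs_oc hD (x := x) (y := y), Gs_self hD, Fs_self hD, Ks_self, true_or, or_true]
  rw [Ks_comm y x v u, Ks_swap x y v u, Fs_comm x y v u, Fs_comm y x v u]
  unfold T3
  ring

variable [Finite V]

theorem case_oo (hD : D.IsGood) (h : Cfg G x y u v)
    (hZC : ∀ a b : ℕ, 0 < a → 0 < b → crossingNumber (bipK a b) = Z a b) (a b : ℕ)
    (hM : Fintype.card M = 2 * a + 1) (hN : Fintype.card N = 2 * b + 1) :
    2 * Z (2 * a + 3) (2 * b + 3) ≤ T3 D x y u v + 4 * Ks D x y u v + 4 * ((a + 1) * (b + 1)) := by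
  obtain ⟨D1, s, hD1, e1⟩ := step_min hD (x := x) (u := oc y u) (v := oc y v) (oc_all h.hxy h.hxu) (oc_all h.hxy h.hxv)
    (oc_inj h.iv fun a => (h.hyv a).ne') (b + 1) (by omega) (by rw [Fintype.card_option]; omega)
  rw [proj_1111 hD, inl_oc, inl_oc, QS_perm hD1, QS_swap, QS_perm hD1, QS_swap, Fintype.card_option, hM] at e1
  have av : ∀ o, (satG G x).Adj (.inl y) (oc (.inr s) (fun b => .inl (v b)) o) := oc_all (Or.inl h.hxy) h.hyv
  have au : ∀ o, (satG G x).Adj (.inl y) (oc (.inl x) (fun b => .inl (u b)) o) := oc_all h.hxy.symm h.hyu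
  have iv : Function.Injective (oc (.inr s) (fun b => .inl (v b)) : Option N → V ⊕ Bool) :=
    oc_inj (inl_inj h.iv) (by simp)
  have iu : Function.Injective (oc (.inl x) (fun b => .inl (u b)) : Option M → V ⊕ Bool) :=
    oc_inj (inl_inj h.iu) (by simpa using fun a => (h.hxu a).ne')
  obtain ⟨D2, s2, hD2, e2⟩ := step_min hD1 (x := .inl y) au av iv (b + 1) (by omega) (by rw [Fintype.card_option]; omega)
  rw [Fintype.card_option, hM] at e2
  have e3 := le_trans (bip_lower hD2 hZC (by simp) (by simp) _ _
    (oc_inj (inl_inj iu) (by simpa using fun a => (au a).ne')) (oc_inj (inl_inj iv) (by simp)) (by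
      rintro (_ | o) (_ | o')
      · exact Or.inr rfl
      · exact av o'
      · exact Or.inl (au o)
      · rcases o with _ | i <;> rcases o' with _ | j
        · exact Or.inr rfl
        · exact h.hxv j
        · exact Or.inl (h.hxu i)
        · exact h.huv i j)) e2
  simp only [Fintype.card_option, hM, hN] at e3
  nlinarith

theorem proj_1210 (hD : D.IsGood) : QS D (oc x (oc y (oc y u))) (oc x v) =
    QS D u v + 2 * (Es D x v u + Es D x u v + 2 * Es D y u v + 2 * Gs D x y v + 2 * Fs D y x u v + 2 * Ks D x y u v) := by
  simp only [QS_B hD]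
  simp only [QS_A hD, Es_A hD, Es_B hD, Fs_A hD (x := x) (y := y), Fs_B hD (x := x) (y := y), Ks_A hD (x := x) (y := y),
    Ks_B hD (x := x) (y := y), Gs_oc hD (x := x) (y := y), Gs_self hD, Fs_self hD, Ks_self, true_or, or_true]
  rw [Ks_swap x y v u, Fs_comm x y v u]
  ring

theorem proj_1110 (hD : D.IsGood) : QS D (oc x (oc y u)) (oc x v) =
    QS D u v + 2 * (Es D x v u + Es D x u v + Es D y u v + Gs D x y v + Fs D y x u v + Ks D x y u v) := by
  simp only [QS_B hD]
  simp only [QS_A hD, Es_A hD, Es_B hD, Fs_A hD (x := x) (y := y), Fs_B hD (x := x) (y := y), Ks_A hD (x := x) (y := y),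
    Ks_B hD (x := x) (y := y), Gs_oc hD (x := x) (y := y), Gs_self hD, Fs_self hD, Ks_self, true_or, or_true]
  rw [Ks_swap x y v u, Fs_comm x y v u]
  ring

theorem proj_1112 (hD : D.IsGood) : QS D (oc x (oc y u)) (oc x (oc y (oc y v))) =
    QS D u v + 2 * (Es D x v u + 2 * Es D y v u + Es D x u v + Es D y u v + 2 * Gs D x y u + Gs D x y v + Fs D y x u v
      + 2 * Fs D x y u v + 3 * Ks D x y u v) := by
  simp only [QS_B hD]
  simp only [QS_A hD, Es_A hD, Es_B hD, Fs_A hD (x := x) (y := y), Fs_B hD (x := x) (y := y), Ks_A hD (x := x) (y := y),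
    Ks_B hD (x := x) (y := y), Gs_oc hD (x := x) (y := y), Gs_self hD, Fs_self hD, Ks_self, true_or, or_true]
  rw [Ks_comm y x v u, Ks_swap x y v u, Fs_comm x y v u, Fs_comm y x v u]
  ring

/-- cost of the satellite -/
def Lc (r : V → ℕ) (c : ℕ) (u : M → V) (v : N → V) : ℕ := ∑ i, ∑ j, lf c (r (u i)) (r (v j))

theorem half_ee (hD : D.IsGood) (h : Cfg G x y u v)
    (hZC : ∀ a b : ℕ, 0 < a → 0 < b → crossingNumber (bipK a b) = Z a b) (b : ℕ) (hb : 0 < b)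
    (hN : Fintype.card N = 2 * b) {r : V → ℕ} {c : ℕ} {D1 : Drawing (satG G x)} (hS : Sat D x D1 r c) (hc : 0 < c)
    (hy : r y = 0) :
    2 * Z (Fintype.card M + 3) (2 * b + 1) ≤ QS D (oc x (oc y (oc y u))) (oc x v) + 2 * Lc r c u v + 2 * (b * b) := by
  have e1 := hS.step1 hD (u := oc y (oc y u)) (v := v) (oc_all (P := fun z => z ≠ x) h.hxy.ne' (oc_all (P := fun z => z ≠ x) h.hxy.ne' fun i => (h.hxu i).ne'))
    (fun i => (h.hxv i).ne') false
  have c1 := hS.c0 (u := oc y (oc y u)) (v := v) (oc_all h.hxy (oc_all h.hxy h.hxu)) h.hxv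
  simp only [Fintype.sum_option, oc_none, oc_some, hy, lf_zero hc, Finset.sum_const_zero, zero_add] at c1
  have av : ∀ o, (satG G x).Adj (.inl y) (oc (.inr false) (fun b => .inl (v b)) o) := oc_all (Or.inl h.hxy) h.hyv
  have au : ∀ o, (satG G x).Adj (.inl y) (oc (.inl x) (fun b => .inl (u b)) o) := oc_all h.hxy.symm h.hyu
  have iv : Function.Injective (oc (.inr false) (fun b => .inl (v b)) : Option N → V ⊕ Bool) :=
    oc_inj (inl_inj h.iv) (by simp)
  have iu : Function.Injective (oc (.inl x) (fun b => .inl (u b)) : Option M → V ⊕ Bool) :=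
    oc_inj (inl_inj h.iu) (by simpa using fun a => (h.hxu a).ne')
  obtain ⟨D2, hD2, e2⟩ := step_twin hS.good (x := .inl y) (fun a => (au a).ne') av iv b hb
    (by rw [Fintype.card_option]; omega)
  have e3 := le_trans (bip_lower hD2 hZC (by simp) (by simp) _ _
    (oc_inj (oc_inj (inl_inj iu) (by simpa using fun a => (au a).ne')) (by rintro (_ | o) <;> simp)) (inl_inj iv) (by
      rintro (_ | _ | o) o'
      · exact Or.inl (av o')
      · exact av o'
      · rcases o with _ | i <;> rcases o' with _ | j
        · exact Or.inr rfl
        · exact h.hxv j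
        · exact Or.inl (h.hxu i)
        · exact h.huv i j)) e2
  have e4 : ∀ w : Option N → V ⊕ Bool, QS D1 (oc (.inl x) (oc (.inl y) (oc (.inl y) (fun a => .inl (u a))))) w =
      QS D1 (oc (.inl y) (oc (.inl y) (oc (.inl x) (fun a => .inl (u a))))) w := by
    intro w
    simp only [QS_A hS.good, Es_A hS.good, Gs_comm (D := D1) (Sum.inl x) (Sum.inl y)]
    ring
  rw [inl_oc, inl_oc, e4] at e1
  rw [inl_oc, inl_oc] at c1
  simp only [Fintype.card_option, hN] at e3
  rw [show Fintype.card M + 1 + 1 + 1 = Fintype.card M + 3 from rfl] at e3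
  unfold Lc
  omega

theorem Lc_add (r : V → ℕ) (c b : ℕ) (hh : (Finset.univ.filter fun j => r (v j) < c).card = b)
    (hN : Fintype.card N = 2 * b) : Lc r c u v + Lc r c v u ≤ Fintype.card M * b := by
  rw [← sum_sm_half (c := c) (fun i => r (u i)) (fun j => r (v j)) b hh hN]
  unfold Lc
  rw [Finset.sum_comm (f := fun j i => lf c (r (v j)) (r (u i)))]
  simp only [← Finset.sum_add_distrib]
  exact Finset.sum_le_sum fun _ _ => Finset.sum_le_sum fun _ _ => lf_lf _ _ _

theorem case_ee (hD : D.IsGood) (h : Cfg G x y u v)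
    (hZC : ∀ a b : ℕ, 0 < a → 0 < b → crossingNumber (bipK a b) = Z a b) (a b : ℕ) (ha : 0 < a) (hb : 0 < b)
    (hM : Fintype.card M = 2 * a) (hN : Fintype.card N = 2 * b) :
    Z (2 * a + 3) (2 * b + 1) + Z (2 * b + 3) (2 * a + 1) ≤
      T3 D x y u v + 4 * Ks D x y u v + 2 * (a * b) + a * a + b * b := by
  obtain ⟨r, p, r1, r2, r3, r4⟩ := exists_sat hD h.hxy
  obtain ⟨c, c0, ⟨b1, hb1⟩, c2⟩ := exists_cut (fun b => r (v b)) (fun b b' e => h.iv (r1 _ _ (h.hxv b) (h.hxv b') e)) b hb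
    (by omega)
  obtain ⟨D', hS⟩ := r4 c c0 (hb1.trans_lt (r2 _ (h.hxv b1)))
  have e1 := half_ee hD h hZC b hb hN hS c0 r3
  have e2 := half_ee hD h.swap hZC a ha hM hS c0 r3
  have e3 := Lc_add (u := u) r c b c2 hN
  rw [proj_1210 hD] at e1 e2
  rw [hM] at e1 e3
  rw [hN] at e2
  rw [QS_swap D v u, Ks_swap x y v u, Fs_comm y x v u] at e2
  unfold T3
  nlinarith

theorem case_oe (hD : D.IsGood) (h : Cfg G x y u v)
    (hZC : ∀ a b : ℕ, 0 < a → 0 < b → crossingNumber (bipK a b) = Z a b) (a b : ℕ) (hb : 0 < b)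
    (hM : Fintype.card M = 2 * a + 1) (hN : Fintype.card N = 2 * b) :
    Z (2 * a + 3) (2 * b + 1) + Z (2 * a + 3) (2 * b + 3) ≤
      T3 D x y u v + 4 * Ks D x y u v + 4 * ((a + 1) * b) + (a + 1) * (a + 1) := by
  obtain ⟨r, p, r1, r2, r3, r4⟩ := exists_sat hD h.hxy
  obtain ⟨c, c0, ⟨b1, hb1⟩, c2⟩ := exists_cut (fun b => r (v b)) (fun b b' e => h.iv (r1 _ _ (h.hxv b) (h.hxv b') e)) b hb
    (by omega)
  obtain ⟨D1, hS⟩ := r4 c c0 (hb1.trans_lt (r2 _ (h.hxv b1)))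
  have e3 := Lc_add (u := u) r c b c2 hN
  rw [hM] at e3
  -- first inequality
  have g1 : 2 * Z (2 * a + 3) (2 * b + 1) ≤ QS D (oc x (oc y u)) (oc x v) + 2 * Lc r c u v := by
    have e1 := hS.step1 hD (u := oc y u) (v := v) (oc_all (P := fun z => z ≠ x) h.hxy.ne' fun i => (h.hxu i).ne')
      (fun i => (h.hxv i).ne') false
    have c1 := hS.c0 (u := oc y u) (v := v) (oc_all h.hxy h.hxu) h.hxv
    simp only [Fintype.sum_option, oc_none, oc_some, r3, lf_zero c0, Finset.sum_const_zero, zero_add] at c1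
    have e3 := le_trans (bip_lower hS.good hZC (by simp) (by simp) _ _
      (oc_inj (inl_inj (oc_inj h.iu fun a => (h.hyu a).ne'))
        (by simpa using oc_all (P := fun z => z ≠ x) h.hxy.ne' fun i => (h.hxu i).ne')) (oc_inj (inl_inj h.iv) (by simp)) (by
        rintro (_ | _ | o) (_ | o')
        · exact Or.inr rfl
        · exact h.hxv o'
        · exact Or.inl h.hxy
        · exact h.hyv o'
        · exact Or.inl (h.hxu o)
        · exact h.huv o o')) e1
    simp only [Fintype.card_option, hN, hM] at e3
    rw [show 2 * a + 1 + 1 + 1 = 2 * a + 3 from rfl] at e3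
    unfold Lc
    omega
  -- second inequality
  have g2 : 2 * Z (2 * a + 3) (2 * b + 3) + 2 * (a + 1) ≤ QS D (oc x (oc y u)) (oc x (oc y (oc y v))) +
      2 * (Lc r c v u + b) + 2 * ((2 * b + 1) * (a + 1) + (a + 1) * (a + 1)) := by
    have e1 := hS.step1 hD (u := oc y (oc y v)) (v := oc y u) (oc_all (P := fun z => z ≠ x) h.hxy.ne' (oc_all (P := fun z => z ≠ x) h.hxy.ne' fun i => (h.hxv i).ne'))
      (oc_all (P := fun z => z ≠ x) h.hxy.ne' (fun i => (h.hxu i).ne')) false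
    have c1 := hS.c0 (u := oc y (oc y v)) (v := oc y u) (oc_all h.hxy (oc_all h.hxy h.hxv)) (oc_all h.hxy h.hxu)
    simp only [Fintype.sum_option, oc_none, oc_some, r3, lf_zero c0, Finset.sum_const_zero, zero_add,
      Finset.sum_add_distrib] at c1
    have c3 : ∑ j, lf c (r (v j)) 0 ≤ b := by
      rw [← c2, Finset.card_filter]
      refine Finset.sum_le_sum fun j _ => ?_
      unfold lf
      split_ifs <;> omega
    have au : ∀ o, (satG G x).Adj (.inl y) (oc (.inr false) (fun b => .inl (u b)) o) := oc_all (Or.inl h.hxy) h.hyu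
    have av : ∀ o, (satG G x).Adj (.inl y) (oc (.inl x) (fun b => .inl (v b)) o) := oc_all h.hxy.symm h.hyv
    have iu : Function.Injective (oc (.inr false) (fun b => .inl (u b)) : Option M → V ⊕ Bool) :=
      oc_inj (inl_inj h.iu) (by simp)
    have iv : Function.Injective (oc (.inl x) (fun b => .inl (v b)) : Option N → V ⊕ Bool) :=
      oc_inj (inl_inj h.iv) (by simpa using fun a => (h.hxv a).ne')
    obtain ⟨D2, hD2, e2⟩ := step_double hS.good (x := .inl y) au av iu (a + 1) (by omega)
      (by rw [Fintype.card_option]; omega)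
    rw [Fintype.card_option, hN] at e2
    have e3 := le_trans (Nat.add_le_add_right (bip_lower hD2 hZC (by simp) (by simp) _ _
      (oc_inj (inl_inj iu) (by simpa using fun a => (au a).ne'))
        (oc_inj (oc_inj (inl_inj iv) (by simp)) (by rintro (_ | o) <;> simp)) (by
        rintro (_ | o) (_ | _ | o')
        · exact Or.inr rfl
        · exact Or.inr rfl
        · exact av o'
        · exact Or.inl (au o)
        · exact Or.inl (au o)
        · rcases o with _ | i <;> rcases o' with _ | j
          · exact Or.inr rfl
          · exact Or.inl (h.hxv j)
          · exact (h.hxu i).symm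
          · exact h.huv i j)) _) e2
    have e4 : ∀ w : Option (Option M) → V ⊕ Bool,
        QS D1 (oc (.inl x) (oc (.inl y) (oc (.inl y) (fun a => .inl (v a))))) w =
        QS D1 (oc (.inl y) (oc (.inl y) (oc (.inl x) (fun a => .inl (v a))))) w := by
      intro w
      simp only [QS_A hS.good, Es_A hS.good, Gs_comm (D := D1) (Sum.inl x) (Sum.inl y)]
      ring
    rw [inl_oc, inl_oc, inl_oc, e4, QS_swap, QS_perm hS.good, QS_swap D] at e1
    rw [inl_oc, inl_oc, inl_oc] at c1
    simp only [Fintype.card_option, hN, hM] at e3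
    rw [show 2 * a + 1 + 1 + 1 = 2 * a + 3 from rfl, show 2 * b + 1 + 1 + 1 = 2 * b + 3 from rfl] at e3
    unfold Lc
    omega
  rw [proj_1110 hD] at g1
  rw [proj_1112 hD] at g2
  unfold T3
  nlinarith

end cases3

end HB

namespace HB

open Set

abbrev QV (m n : ℕ) : Type := Σ i : Fin 4, ![Fin 1, Fin 1, Fin m, Fin n] i

def qx (m n : ℕ) : QV m n := ⟨0, (0 : Fin 1)⟩
def qy (m n : ℕ) : QV m n := ⟨1, (0 : Fin 1)⟩
def qu {m n : ℕ} (i : Fin m) : QV m n := ⟨2, i⟩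
def qv {m n : ℕ} (i : Fin n) : QV m n := ⟨3, i⟩

theorem finite_QV (m n : ℕ) : Finite (QV m n) := by
  have : ∀ i : Fin 4, Finite (![Fin 1, Fin 1, Fin m, Fin n] i) := by
    intro i
    fin_cases i
    · exact inferInstanceAs (Finite (Fin 1))
    · exact inferInstanceAs (Finite (Fin 1))
    · exact inferInstanceAs (Finite (Fin m))
    · exact inferInstanceAs (Finite (Fin n))
  exact inferInstance

theorem q_cases {m n : ℕ} (a : QV m n) : a = qx m n ∨ a = qy m n ∨ (∃ i, a = qu i) ∨ ∃ i, a = qv i := by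
  obtain ⟨i, a⟩ := a
  fin_cases i
  · exact Or.inl (congrArg (Sigma.mk (β := fun i => ![Fin 1, Fin 1, Fin m, Fin n] i) 0) (Subsingleton.elim (α := Fin 1) _ _))
  · exact Or.inr (Or.inl (congrArg (Sigma.mk (β := fun i => ![Fin 1, Fin 1, Fin m, Fin n] i) 1)
      (Subsingleton.elim (α := Fin 1) _ _)))
  · exact Or.inr (Or.inr (Or.inl ⟨a, rfl⟩))
  · exact Or.inr (Or.inr (Or.inr ⟨a, rfl⟩))

theorem q_adj {m n : ℕ} (a b : QV m n) : (quadK 1 1 m n).Adj a b ↔ a.1 ≠ b.1 := Iff.rfl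

theorem q_cfg (m n : ℕ) : Cfg (quadK 1 1 m n) (qx m n) (qy m n) qu qv := by
  refine ⟨?_, fun _ => ?_, fun _ => ?_, fun _ => ?_, fun _ => ?_, fun _ _ => ?_, fun i j h => ?_, fun i j h => ?_⟩
  · exact (q_adj _ _).2 (show (0 : Fin 4) ≠ 1 by decide)
  · exact (q_adj _ _).2 (show (0 : Fin 4) ≠ 2 by decide)
  · exact (q_adj _ _).2 (show (0 : Fin 4) ≠ 3 by decide)
  · exact (q_adj _ _).2 (show (1 : Fin 4) ≠ 2 by decide)
  · exact (q_adj _ _).2 (show (1 : Fin 4) ≠ 3 by decide)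
  · exact (q_adj _ _).2 (show (2 : Fin 4) ≠ 3 by decide)
  · exact eq_of_heq (Sigma.mk.inj h).2
  · exact eq_of_heq (Sigma.mk.inj h).2

theorem q_cov {m n : ℕ} (a b : QV m n) (h : (quadK 1 1 m n).Adj a b) :
    s(qx m n, qy m n) = s(a, b) ∨ ∃ ω, s(eu (N := Fin n) (qx m n) (qy m n) qu ω, ev qu qv ω) = s(a, b) := by
  rw [q_adj] at h
  rcases q_cases a with rfl | rfl | ⟨i, rfl⟩ | ⟨i, rfl⟩ <;> rcases q_cases b with rfl | rfl | ⟨j, rfl⟩ | ⟨j, rfl⟩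
  · exact absurd rfl h
  · exact Or.inl rfl
  · exact Or.inr ⟨.inr (.inl j), rfl⟩
  · exact Or.inr ⟨.inl (none, j), rfl⟩
  · exact Or.inl Sym2.eq_swap
  · exact absurd rfl h
  · exact Or.inr ⟨.inr (.inr j), rfl⟩
  · exact Or.inr ⟨.inl (some none, j), rfl⟩
  · exact Or.inr ⟨.inr (.inl i), Sym2.eq_swap⟩
  · exact Or.inr ⟨.inr (.inr i), Sym2.eq_swap⟩
  · exact absurd rfl h
  · exact Or.inr ⟨.inl (some (some i), j), rfl⟩
  · exact Or.inr ⟨.inl (none, i), Sym2.eq_swap⟩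
  · exact Or.inr ⟨.inl (some none, i), Sym2.eq_swap⟩
  · exact Or.inr ⟨.inl (some (some j), i), Sym2.eq_swap⟩
  · exact absurd rfl h

theorem Z_oo (a b : ℕ) : Z (2 * a + 1) (2 * b + 1) = a * a * b * b := by
  unfold Z
  rw [show (2 * a + 1) / 2 = a by omega, show (2 * a + 1 - 1) / 2 = a by omega, show (2 * b + 1) / 2 = b by omega,
    show (2 * b + 1 - 1) / 2 = b by omega]

theorem Z_oe (a b : ℕ) : Z (2 * a + 1) (2 * b + 2) = a * a * (b + 1) * b := by
  unfold Z
  rw [show (2 * a + 1) / 2 = a by omega, show (2 * a + 1 - 1) / 2 = a by omega, show (2 * b + 2) / 2 = b + 1 by omega,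
    show (2 * b + 2 - 1) / 2 = b by omega]

theorem Z_ee (a b : ℕ) : Z (2 * a + 2) (2 * b + 2) = (a + 1) * a * (b + 1) * b := by
  unfold Z
  rw [show (2 * a + 2) / 2 = a + 1 by omega, show (2 * a + 2 - 1) / 2 = a by omega, show (2 * b + 2) / 2 = b + 1 by omega,
    show (2 * b + 2 - 1) / 2 = b by omega]

theorem Z_comm (a b : ℕ) : Z a b = Z b a := by
  unfold Z; ring

theorem lower_oe (m n : ℕ) {V : Type} [Finite V] {G : SimpleGraph V} {D : Drawing G} {x y : V}
    {u : Fin m → V} {v : Fin n → V} (hD : D.IsGood) (h : Cfg G x y u v) 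
    (hZC : ∀ a b : ℕ, 0 < a → 0 < b → crossingNumber (bipK a b) = Z a b)
    (hH : 2 * Z (m + 2) (n + 2) ≤ T3 D x y u v + 2 * (m * n)) (a b : ℕ) (hm : m = 2 * a + 1) (hn : n = 2 * b) (hb : 0 < b) :
    4 * Z (m + 2) (n + 2) + 4 * (a * b) ≤ 2 * T3 D x y u v + 4 * Ks D x y u v + 4 * (m * n) := by
  have := case_oe hD h hZC a b hb (by simpa using hm) (by simpa using hn)
  subst hm hn
  rw [show 2 * a + 3 = 2 * (a + 1) + 1 by ring, show 2 * b + 3 = 2 * (b + 1) + 1 by ring, Z_oo, Z_oo] at this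
  rw [show 2 * a + 1 + 2 = 2 * (a + 1) + 1 by ring, Z_oe] at hH ⊢
  nlinarith

theorem lower {m n : ℕ} (hm : 0 < m) (hn : 0 < n)
    (hZC : ∀ a b : ℕ, 0 < a → 0 < b → crossingNumber (bipK a b) = Z a b)
    (hHC : (crossingNumber (triK 2 m n) : ℤ) = (Z (m + 2) (n + 2) : ℤ) - (m : ℤ) * n)
    {D : Drawing (quadK 1 1 m n)} (hD : D.IsGood) :
    Z (m + 2) (n + 2) + (m / 2) * (n / 2) ≤ D.crNum + m * n := by
  have := finite_QV m n
  have h := q_cfg m n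
  have e1 := HC_lower hD h
  have e2 := total hD h q_cov
  have hH : 2 * Z (m + 2) (n + 2) ≤ T3 D (qx m n) (qy m n) qu qv + 2 * (m * n) := by
    zify at e1 ⊢
    linarith
  rcases Nat.even_or_odd' m with ⟨a, ha | ha⟩ <;> rcases Nat.even_or_odd' n with ⟨b, hb | hb⟩
  · have := case_ee hD h hZC a b (by omega) (by omega) (by simpa using ha) (by simpa using hb)
    have h1 : m / 2 = a := by omega
    have h2 : n / 2 = b := by omega
    rw [h1, h2]
    rw [show 2 * a + 3 = 2 * (a + 1) + 1 by ring, show 2 * b + 3 = 2 * (b + 1) + 1 by ring, Z_oo, Z_oo] at this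
    have e : Z (m + 2) (n + 2) = (a + 1) * a * (b + 1) * b := by rw [ha, hb, Z_ee]
    have e' : m * n = 4 * (a * b) := by rw [ha, hb]; ring
    rw [e, e'] at hH ⊢
    nlinarith
  · have e3 := lower_oe n m hD h.swap hZC (by rw [Z_comm, T3_swap, mul_comm n]; exact hH) b a hb ha (by omega)
    rw [T3_swap, Ks_swap, Z_comm, mul_comm n m] at e3
    have h1 : m / 2 = a := by omega
    have h2 : n / 2 = b := by omega
    rw [h1, h2]
    nlinarith
  · have e3 := lower_oe m n hD h hZC hH a b ha hb (by omega)
    have h1 : m / 2 = a := by omega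
    have h2 : n / 2 = b := by omega
    rw [h1, h2]
    nlinarith
  · have := case_oo hD h hZC a b (by simpa using ha) (by simpa using hb)
    have h1 : m / 2 = a := by omega
    have h2 : n / 2 = b := by omega
    rw [h1, h2]
    rw [show 2 * a + 3 = m + 2 by omega, show 2 * b + 3 = n + 2 by omega] at this
    have e' : m * n = 4 * (a * b) + 2 * a + 2 * b + 1 := by rw [ha, hb]; ring
    rw [e'] at hH ⊢
    nlinarith

end HB

namespace HB

open Set

section dup

variable {V N : Type} {G : SimpleGraph V} {D : Drawing G} {r : V → ℕ} {c : ℕ} {ν : N → V} {j0 : N}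
  {D' : Drawing (satG G (ν j0))}

/-- the family with a duplicate -/
def dupl (ν : N → V) : Option N → V ⊕ Bool := oc (.inr false) (fun j => .inl (ν j))

def bk (j0 : N) (o : Option N) : N := o.getD j0

theorem spr_dupl (o : Option N) : spr (ν j0) (dupl ν o) = ν (bk j0 o) := by
  cases o <;> rfl

theorem dup_one (hS : Sat D (ν j0) D' r c) {p q s : V} (hp : p ≠ ν j0) (hq : q ≠ ν j0) (o : Option N) :
    chi D' (.inl p) (.inl q) (.inl s) (dupl ν o) ≤ chi D p q s (ν (bk j0 o)) := by
  rw [← spr_dupl (ν := ν) o]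
  refine hS.le (P := .inl p) (Q := .inl q) (R := .inl s) ?_
  rintro ⟨h, -⟩
  simp only [Sym2.mem_iff, spr] at h
  rcases h with h | h
  exacts [hp h.symm, hq h.symm]

theorem dup_none (hS : Sat D (ν j0) D' r c) {p q s t : V} (hp : p ≠ ν j0) (hq : q ≠ ν j0) :
    chi D' (.inl p) (.inl q) (.inl s) (.inl t) ≤ chi D p q s t := by
  refine hS.le (P := .inl p) (Q := .inl q) (R := .inl s) (S := .inl t) ?_
  rintro ⟨h, -⟩
  simp only [Sym2.mem_iff, spr] at h
  rcases h with h | h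
  exacts [hp h.symm, hq h.symm]

theorem dup_pair (hS : Sat D (ν j0) D' r c) (iν : Function.Injective ν) {p q : V} (hp : p ≠ ν j0) (hq : q ≠ ν j0)
    {o o' : Option N} (h : bk j0 o ≠ bk j0 o' ∨ o = o') :
    chi D' (.inl p) (dupl ν o) (.inl q) (dupl ν o') ≤ chi D p (ν (bk j0 o)) q (ν (bk j0 o')) := by
  rcases h with h | rfl
  · rw [← spr_dupl (ν := ν) o, ← spr_dupl (ν := ν) o']
    refine hS.le (P := .inl p) (R := .inl q) ?_
    rintro ⟨h1, h2⟩
    simp only [Sym2.mem_iff, spr_dupl] at h1 h2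
    simp only [spr] at h1 h2
    exact h (iν ((h1.resolve_left hp.symm).symm.trans (h2.resolve_left hq.symm)))
  · rw [chi_bd hS.good]; exact Nat.zero_le _

theorem dup_tw (hS : Sat D (ν j0) D' r c) {p q : V} (hp : G.Adj (ν j0) p) (hq : G.Adj (ν j0) q) :
    chi D' (.inl p) (dupl ν none) (.inl q) (dupl ν (some j0)) ≤ lf c (r p) (r q) :=
  chi_le_ite fun h => hS.f0 p q hp hq (X_swapr (X_swapl h))

theorem dup_tw' (hS : Sat D (ν j0) D' r c) {p q : V} (hp : G.Adj (ν j0) p) (hq : G.Adj (ν j0) q) :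
    chi D' (.inl p) (dupl ν (some j0)) (.inl q) (dupl ν none) ≤ lf c (r q) (r p) := by
  rw [chi_comm]; exact dup_tw hS hq hp

theorem dup_cases (o o' : Option N) : (bk j0 o ≠ bk j0 o' ∨ o = o') ∨ (o = none ∧ o' = some j0) ∨ (o = some j0 ∧ o' = none) := by
  rcases o with _ | j <;> rcases o' with _ | j'
  · exact Or.inl (Or.inr rfl)
  · by_cases h : j0 = j'
    · subst h; exact Or.inr (Or.inl ⟨rfl, rfl⟩)
    · exact Or.inl (Or.inl h)
  · by_cases h : j0 = j
    · subst h; exact Or.inr (Or.inr ⟨rfl, rfl⟩)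
    · exact Or.inl (Or.inl fun h' => h h'.symm)
  · by_cases h : j = j'
    · subst h; exact Or.inl (Or.inr rfl)
    · exact Or.inl (Or.inl h)

theorem cfg_dup {M : Type} {x y : V} {u : M → V} (h : Cfg G x y u ν) (j0 : N) :
    Cfg (satG G (ν j0)) (.inl x) (.inl y) (fun i => .inl (u i)) (dupl ν) := by
  refine ⟨h.hxy, h.hxu, ?_, h.hyu, ?_, ?_, inl_inj h.iu, oc_inj (inl_inj h.iv) (by simp)⟩
  · exact oc_all (Or.inl (h.hxv j0).symm) h.hxv
  · exact oc_all (Or.inl (h.hyv j0).symm) h.hyv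
  · exact fun i => oc_all (Or.inl (h.huv i j0).symm) (h.huv i)

end dup

theorem cut4 (p a b d e : ℕ) (ha : a < p) (hb : b < p) (hd : d < p) (he : e < p) (h1 : a ≠ b) (h2 : a ≠ d) (h3 : a ≠ e)
    (h4 : b ≠ d) (h5 : b ≠ e) (h6 : d ≠ e) : ∃ lo hi, lo < hi ∧ hi < p ∧ hi - lo + 1 < p ∧
      ((lo ≤ a ∧ a ≤ hi) ↔ ¬ (lo ≤ b ∧ b ≤ hi)) ∧ ((lo ≤ d ∧ d ≤ hi) ↔ ¬ (lo ≤ e ∧ e ≤ hi)) := by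
  rcases h1.lt_or_gt with h1 | h1 <;> rcases h2.lt_or_gt with h2 | h2 <;> rcases h3.lt_or_gt with h3 | h3 <;>
  rcases h4.lt_or_gt with h4 | h4 <;> rcases h5.lt_or_gt with h5 | h5 <;> rcases h6.lt_or_gt with h6 | h6 <;>
  first
  | (exfalso; omega)
  | exact ⟨a, d, by omega, by omega, by omega, by omega, by omega⟩
  | exact ⟨d, a, by omega, by omega, by omega, by omega, by omega⟩
  | exact ⟨a, e, by omega, by omega, by omega, by omega, by omega⟩
  | exact ⟨e, a, by omega, by omega, by omega, by omega, by omega⟩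
  | exact ⟨b, d, by omega, by omega, by omega, by omega, by omega⟩
  | exact ⟨d, b, by omega, by omega, by omega, by omega, by omega⟩
  | exact ⟨b, e, by omega, by omega, by omega, by omega, by omega⟩
  | exact ⟨e, b, by omega, by omega, by omega, by omega, by omega⟩

theorem exists_sat4 {V : Type} {G : SimpleGraph V} {D : Drawing G} [Finite V] (hD : D.IsGood) {w a b d e : V}
    (ha : G.Adj w a) (hb : G.Adj w b) (hd : G.Adj w d) (he : G.Adj w e) (h1 : a ≠ b) (h2 : a ≠ d) (h3 : a ≠ e)
    (h4 : b ≠ d) (h5 : b ≠ e) (h6 : d ≠ e) : ∃ (r : V → ℕ) (c : ℕ) (D' : Drawing (satG G w)), Sat D w D' r c ∧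
      (r a < c ↔ ¬ r b < c) ∧ (r d < c ↔ ¬ r e < c) := by
  obtain ⟨k, p, k1, k2, k3⟩ := satellite hD w
  obtain ⟨lo, hi, l1, l2, l3, l4, l5⟩ := cut4 p (k a) (k b) (k d) (k e) (k2 _) (k2 _) (k2 _) (k2 _)
    (fun h => h1 (k1 _ _ ha hb h)) (fun h => h2 (k1 _ _ ha hd h)) (fun h => h3 (k1 _ _ ha he h))
    (fun h => h4 (k1 _ _ hb hd h)) (fun h => h5 (k1 _ _ hb he h)) (fun h => h6 (k1 _ _ hd he h))
  obtain ⟨D', hS⟩ := k3 lo (by omega) (hi - lo + 1) (by omega) l3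
  have key : ∀ z, ord' p lo (k z) < hi - lo + 1 ↔ (lo ≤ k z ∧ k z ≤ hi) := by
    intro z
    have e1 := ord'_eq (p := p) (c0 := lo) (by omega) (k2 z)
    have e2 := ord'_lt (p := p) (by omega) lo (k z)
    have e3 := k2 z
    omega
  refine ⟨_, _, D', hS, ?_, ?_⟩
  · rw [key, key]; exact l4
  · rw [key, key]; exact l5

theorem sm_ne {c a b : ℕ} (h : a < c ↔ ¬ b < c) : sm c a b = 0 := by
  unfold sm; split_ifs <;> omega

theorem sm_two {c a b d : ℕ} (h : a < c ↔ ¬ b < c) : sm c d a + sm c d b ≤ 1 := by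
  unfold sm; split_ifs <;> omega

theorem lf_le_sm (c a b : ℕ) : lf c a b ≤ sm c a b := by
  have := lf_lf c a b
  omega

theorem sm_comm (c a b : ℕ) : sm c a b = sm c b a := by
  unfold sm; split_ifs <;> omega

/-- first stage -/
structure S1 {V N : Type} {G : SimpleGraph V} (D : Drawing G) (x y : V) (u : Bool → V) (v : N → V) (cl : N → Bool) :
    Prop where
  fin : Finite V
  good : D.IsGood
  cfg : Cfg G x y u v
  k : ∀ s j, chi D x y (u s) (v j) ≤ if s = false ∧ cl j = false then 1 else 0
  f : ∀ s j, chi D x (u s) y (v j) = 0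
  f' : ∀ s j, chi D y (u s) x (v j) = 0
  g : ∀ s s', chi D x (u s) y (u s') = 0
  ex : ∀ s s' j, chi D x (u s) (u s') (v j) = 0
  ey : ∀ s s' j, chi D y (u s) (u s') (v j) = 0
  q : ∀ s s' j j', chi D (u s) (v j) (u s') (v j') = 0
  gv : ∀ j j', chi D x (v j) y (v j') = 0
  e : ∀ s j j', chi D x (v j) (u s) (v j') + chi D x (v j') (u s) (v j) + chi D y (v j) (u s) (v j') +
    chi D y (v j') (u s) (v j) ≤ if cl j = cl j' then 1 else 0

theorem S1.dup {V N : Type} {G : SimpleGraph V} {D : Drawing G} {x y : V} {u : Bool → V} {v : N → V} {cl : N → Bool}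
    (h : S1 D x y u v cl) (j0 : N) : ∃ D' : Drawing (satG G (v j0)),
      S1 D' (.inl x) (.inl y) (fun i => .inl (u i)) (dupl v) (fun o => cl (bk j0 o)) := by
  have := h.fin
  obtain ⟨r, c, D', hS, c1, c2⟩ := exists_sat4 h.good (h.cfg.hxv j0).symm (h.cfg.hyv j0).symm (h.cfg.huv false j0).symm
    (h.cfg.huv true j0).symm h.cfg.hxy.ne (h.cfg.hxu _).ne (h.cfg.hxu _).ne (h.cfg.hyu _).ne (h.cfg.hyu _).ne
    (h.cfg.iu.ne (by decide))
  have nx := (h.cfg.hxv j0).ne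
  have ny := (h.cfg.hyv j0).ne
  have nu := fun s => (h.cfg.huv s j0).ne
  have ax := (h.cfg.hxv j0).symm
  have ay := (h.cfg.hyv j0).symm
  have au := fun s => (h.cfg.huv s j0).symm
  have iv := h.cfg.iv
  have zl : ∀ {a b : ℕ}, a ≤ b → b = 0 → a = 0 := fun h1 h2 => by omega
  have cu : ∀ s s', lf c (r (u s)) (r (u s')) = 0 := by
    have e1 := sm_ne c2
    have e2 := sm_comm c (r (u false)) (r (u true))
    have e3 := lf_le_sm c (r (u false)) (r (u true))
    have e4 := lf_le_sm c (r (u true)) (r (u false))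
    rintro (_ | _) (_ | _)
    · exact lf_self _ _
    · omega
    · omega
    · exact lf_self _ _
  have e1 := sm_ne c1
  have e2 := sm_comm c (r x) (r y)
  have e3 := lf_le_sm c (r x) (r y)
  have e4 := lf_le_sm c (r y) (r x)
  refine ⟨D', inferInstance, hS.good, cfg_dup h.cfg j0, fun s o => (dup_one hS nx ny o).trans (h.k _ _),
    fun s o => zl (dup_one hS nx (nu s) o) (h.f _ _), fun s o => zl (dup_one hS ny (nu s) o) (h.f' _ _),
    fun s s' => zl (dup_none hS nx (nu s)) (h.g _ _), fun s s' o => zl (dup_one hS nx (nu s) o) (h.ex _ _ _),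
    fun s s' o => zl (dup_one hS ny (nu s) o) (h.ey _ _ _), fun s s' o o' => ?_, fun o o' => ?_, fun s o o' => ?_⟩
  · rcases dup_cases (j0 := j0) o o' with ho | ⟨rfl, rfl⟩ | ⟨rfl, rfl⟩
    · exact zl (dup_pair hS iv (nu s) (nu s') ho) (h.q _ _ _ _)
    · exact zl (dup_tw hS (au s) (au s')) (cu _ _)
    · exact zl (dup_tw' hS (au s) (au s')) (cu _ _)
  · rcases dup_cases (j0 := j0) o o' with ho | ⟨rfl, rfl⟩ | ⟨rfl, rfl⟩
    · exact zl (dup_pair hS iv nx ny ho) (h.gv _ _)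
    · exact zl (dup_tw hS ax ay) (by omega)
    · exact zl (dup_tw' hS ax ay) (by omega)
  · have t1 := sm_two (d := r (u s)) c1
    have t2 := lf_lf c (r (u s)) (r x)
    have t3 := lf_lf c (r (u s)) (r y)
    rcases dup_cases (j0 := j0) o o' with ho | ⟨rfl, rfl⟩ | ⟨rfl, rfl⟩
    · have ho' : bk j0 o' ≠ bk j0 o ∨ o' = o := ho.imp Ne.symm Eq.symm
      have i1 := dup_pair hS iv nx (nu s) ho
      have i2 := dup_pair hS iv nx (nu s) ho'
      have i3 := dup_pair hS iv ny (nu s) ho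
      have i4 := dup_pair hS iv ny (nu s) ho'
      have := h.e s (bk j0 o) (bk j0 o')
      omega
    · have i1 := dup_tw hS ax (au s)
      have i2 := dup_tw' hS ax (au s)
      have i3 := dup_tw hS ay (au s)
      have i4 := dup_tw' hS ay (au s)
      rw [if_pos (show cl (bk j0 none) = cl (bk j0 (some j0)) from rfl)]
      omega
    · have i1 := dup_tw hS ax (au s)
      have i2 := dup_tw' hS ax (au s)
      have i3 := dup_tw hS ay (au s)
      have i4 := dup_tw' hS ay (au s)
      rw [if_pos (show cl (bk j0 (some j0)) = cl (bk j0 none) from rfl)]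
      omega

theorem S1.restrict {V N N' : Type} {G : SimpleGraph V} {D : Drawing G} {x y : V} {u : Bool → V} {v : N → V} {cl : N → Bool}
    (h : S1 D x y u v cl) (f : N' → N) (hf : Function.Injective f) : S1 D x y u (fun j => v (f j)) (fun j => cl (f j)) :=
  ⟨h.fin, h.good, ⟨h.cfg.hxy, h.cfg.hxu, fun _ => h.cfg.hxv _, h.cfg.hyu, fun _ => h.cfg.hyv _, fun _ _ => h.cfg.huv _ _,
    h.cfg.iu, h.cfg.iv.comp hf⟩, fun _ _ => h.k _ _, fun _ _ => h.f _ _, fun _ _ => h.f' _ _, h.g, fun _ _ _ => h.ex _ _ _,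
    fun _ _ _ => h.ey _ _ _, fun _ _ _ _ => h.q _ _ _ _, fun _ _ => h.gv _ _, fun _ _ _ => h.e _ _ _⟩

/-- second stage -/
structure S2 {V M N : Type} [Fintype N] {G : SimpleGraph V} (D : Drawing G) (x y : V) (u : M → V) (v : N → V) (cl : M → Bool)
    (C z κ : ℕ) : Prop where
  fin : Finite V
  good : D.IsGood
  cfg : Cfg G x y v u
  gv : ∀ j j', chi D x (v j) y (v j') = 0
  f : ∀ i j, chi D x (v j) y (u i) = 0
  f' : ∀ i j, chi D y (v j) x (u i) = 0
  e : ∀ i, ∑ j, ∑ j', (chi D x (v j) (v j') (u i) + chi D y (v j) (v j') (u i)) ≤ C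
  k : ∀ i, ∑ j, chi D x y (v j) (u i) ≤ if cl i then 0 else κ
  w : ∀ i i', ∑ o, ∑ o', chi D (oc x (oc y v) o) (u i) (oc x (oc y v) o') (u i') ≤ if cl i = cl i' then z else 0

theorem S2.restrict {V M M' N : Type} [Fintype N] {G : SimpleGraph V} {D : Drawing G} {x y : V} {u : M → V} {v : N → V}
    {cl : M → Bool} {C z κ : ℕ} (h : S2 D x y u v cl C z κ) (f : M' → M) (hf : Function.Injective f) :
    S2 D x y (fun j => u (f j)) v (fun j => cl (f j)) C z κ :=
  ⟨h.fin, h.good, ⟨h.cfg.hxy, h.cfg.hxu, fun _ => h.cfg.hxv _, h.cfg.hyu, fun _ => h.cfg.hyv _, fun _ _ => h.cfg.huv _ _,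
    h.cfg.iu, h.cfg.iv.comp hf⟩, h.gv, fun _ _ => h.f _ _, fun _ _ => h.f' _ _, fun _ => h.e _, fun _ => h.k _,
    fun _ _ => h.w _ _⟩

theorem exists_sat_half {V B : Type} [Fintype B] {G : SimpleGraph V} {D : Drawing G} [Finite V] (hD : D.IsGood) {w : V}
    (t : B → V) (ht : ∀ b, G.Adj w (t b)) (it : Function.Injective t) (hB : 2 ≤ Fintype.card B) :
    ∃ (r : V → ℕ) (c : ℕ) (D' : Drawing (satG G w)), Sat D w D' r c ∧
      ∑ b, ∑ b', lf c (r (t b)) (r (t b')) ≤ (Fintype.card B / 2) * ((Fintype.card B - 1) / 2) := by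
  have hne : Nonempty B := Fintype.card_pos_iff.1 (by omega)
  obtain ⟨r, p, r1, r2, r3, r4⟩ := exists_sat hD (ht hne.some)
  obtain ⟨c, c0, ⟨b1, hb1⟩, c2⟩ := exists_cut (fun b => r (t b)) (fun b b' e => it (r1 _ _ (ht b) (ht b') e))
    (Fintype.card B / 2) (by omega) (by omega)
  obtain ⟨D', hS⟩ := r4 c c0 (hb1.trans_lt (r2 _ (ht b1)))
  refine ⟨r, c, D', hS, ?_⟩
  have e1 := sum_lf (fun b => r (t b)) c
  rw [sum_sm2 _ _ _ (Fintype.card B - Fintype.card B / 2) c2 (by omega)] at e1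
  rcases Nat.even_or_odd' (Fintype.card B) with ⟨k, hk | hk⟩
  · obtain ⟨l, rfl⟩ : ∃ l, k = l + 1 := ⟨k - 1, by omega⟩
    rw [hk, show 2 * (l + 1) / 2 = l + 1 by omega, show 2 * (l + 1) - (l + 1) = l + 1 by omega] at e1
    rw [hk, show 2 * (l + 1) / 2 = l + 1 by omega, show (2 * (l + 1) - 1) / 2 = l by omega]
    nlinarith
  · rw [hk, show (2 * k + 1) / 2 = k by omega, show 2 * k + 1 - k = k + 1 by omega] at e1
    rw [hk, show (2 * k + 1) / 2 = k by omega, show (2 * k + 1 - 1) / 2 = k by omega]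
    nlinarith

theorem S2.dup {V M N : Type} [Fintype N] {G : SimpleGraph V} {D : Drawing G} {x y : V} {u : M → V} {v : N → V}
    {cl : M → Bool} {C z κ : ℕ} (h : S2 D x y u v cl C z κ)
    (hz : (Fintype.card N + 2) / 2 * ((Fintype.card N + 1) / 2) ≤ z) (i0 : M) : ∃ D' : Drawing (satG G (u i0)),
      S2 D' (.inl x) (.inl y) (dupl u) (fun j => .inl (v j)) (fun o => cl (bk i0 o)) C z κ := by
  have := h.fin
  have nx := (h.cfg.hxv i0).ne
  have ny := (h.cfg.hyv i0).ne
  have nv := fun s => (h.cfg.huv s i0).ne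
  have ax := (h.cfg.hxv i0).symm
  have ay := (h.cfg.hyv i0).symm
  have av := fun s => (h.cfg.huv s i0).symm
  have iu := h.cfg.iv
  have at' : ∀ o, G.Adj (u i0) (oc x (oc y v) o) := oc_all ax (oc_all ay av)
  have it : Function.Injective (oc x (oc y v)) := oc_inj (oc_inj h.cfg.iu fun j => (h.cfg.hyu j).ne')
    (oc_all (P := fun z => z ≠ x) h.cfg.hxy.ne' fun j => (h.cfg.hxu j).ne')
  obtain ⟨r, c, D', hS, hc⟩ := exists_sat_half h.good _ at' it (by simp)
  simp only [Fintype.card_option] at hc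
  have zl : ∀ {a b : ℕ}, a ≤ b → b = 0 → a = 0 := fun h1 h2 => by omega
  refine ⟨D', inferInstance, hS.good, cfg_dup h.cfg i0, fun j j' => zl (dup_none hS nx (nv j)) (h.gv _ _),
    fun o j => zl (dup_one hS nx (nv j) o) (h.f _ _), fun o j => zl (dup_one hS ny (nv j) o) (h.f' _ _), fun o => ?_,
    fun o => ?_, fun o o' => ?_⟩
  · refine le_trans (Finset.sum_le_sum fun j _ => Finset.sum_le_sum fun j' _ => ?_) (h.e (bk i0 o))
    exact Nat.add_le_add (dup_one hS nx (nv j) o) (dup_one hS ny (nv j) o)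
  · exact le_trans (Finset.sum_le_sum fun j _ => dup_one hS nx ny o) (h.k (bk i0 o))
  · rw [← inl_oc, ← inl_oc]
    rcases dup_cases (j0 := i0) o o' with ho | ⟨rfl, rfl⟩ | ⟨rfl, rfl⟩
    · refine le_trans (Finset.sum_le_sum fun b _ => Finset.sum_le_sum fun b' _ => ?_) (h.w (bk i0 o) (bk i0 o'))
      exact dup_pair hS iu (at' b).ne' (at' b').ne' ho
    · rw [if_pos (show cl (bk i0 none) = cl (bk i0 (some i0)) from rfl)]
      refine le_trans (Finset.sum_le_sum fun b _ => Finset.sum_le_sum fun b' _ => ?_) (hc.trans hz)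
      exact dup_tw hS (at' b) (at' b')
    · rw [if_pos (show cl (bk i0 (some i0)) = cl (bk i0 none) from rfl), Finset.sum_comm]
      refine le_trans (Finset.sum_le_sum fun b _ => Finset.sum_le_sum fun b' _ => ?_) (hc.trans hz)
      exact dup_tw' hS (at' b') (at' b)

end HB

namespace HB

open Set

/-- orientation functional -/
def lin (a b q : Pl) : ℝ := (b.1 - a.1) * (q.2 - a.2) - (b.2 - a.2) * (q.1 - a.1)

theorem seg_iff {a b q : Pl} (h : q ∈ segment ℝ a b) : ∃ t : ℝ, 0 ≤ t ∧ t ≤ 1 ∧ q.1 = a.1 + t * (b.1 - a.1) ∧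
    q.2 = a.2 + t * (b.2 - a.2) := by
  rw [segment_eq_image_lineMap] at h
  obtain ⟨t, ⟨h0, h1⟩, rfl⟩ := h
  refine ⟨t, h0, h1, ?_, ?_⟩
  · simp [AffineMap.lineMap_apply]; ring
  · simp [AffineMap.lineMap_apply]; ring

theorem lin_seg {a b q : Pl} (h : q ∈ segment ℝ a b) : lin a b q = 0 := by
  obtain ⟨t, -, -, h1, h2⟩ := seg_iff h
  unfold lin; rw [h1, h2]; ring

theorem seg_sep {a b c d q : Pl} (h : 0 < lin a b c * lin a b d) (h1 : q ∈ segment ℝ a b) (h2 : q ∈ segment ℝ c d) :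
    False := by
  have e1 := lin_seg h1
  obtain ⟨t, t0, t1, h3, h4⟩ := seg_iff h2
  have e2 : lin a b q = (1 - t) * lin a b c + t * lin a b d := by
    unfold lin; rw [h3, h4]; ring
  rw [e1] at e2
  rcases lt_or_gt_of_ne (show lin a b c ≠ 0 by rintro h'; rw [h'] at h; simp at h) with hc | hc
  · have hd : lin a b d < 0 := by nlinarith
    rcases eq_or_lt_of_le t0 with h' | h'
    · subst h'; linarith
    · nlinarith
  · have hd : 0 < lin a b d := by
      by_contra hh
      push Not at hh
      nlinarith
    rcases eq_or_lt_of_le t0 with h' | h'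
    · subst h'; linarith
    · nlinarith

theorem seg_share {a b c q : Pl} (h : lin a b c ≠ 0) (h1 : q ∈ segment ℝ a b) (h2 : q ∈ segment ℝ a c) : q = a := by
  have e1 := lin_seg h1
  obtain ⟨t, t0, t1, h3, h4⟩ := seg_iff h2
  have e2 : lin a b q = t * lin a b c := by
    unfold lin; rw [h3, h4]; ring
  rw [e1] at e2
  have : t = 0 := by
    rcases mul_eq_zero.1 e2.symm with h' | h'
    exacts [h', absurd h' h]
  subst this
  exact Prod.ext (by simpa using h3) (by simpa using h4)

theorem seg_once {a b c d : Pl} (h : (b.1 - a.1) * (d.2 - c.2) - (b.2 - a.2) * (d.1 - c.1) ≠ 0) :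
    (segment ℝ a b ∩ segment ℝ c d).Subsingleton := by
  rintro p ⟨hp, hp'⟩ q ⟨hq, hq'⟩
  obtain ⟨t, -, -, t1, t2⟩ := seg_iff hp
  obtain ⟨t', -, -, t1', t2'⟩ := seg_iff hp'
  obtain ⟨s, -, -, s1, s2⟩ := seg_iff hq
  obtain ⟨s', -, -, s1', s2'⟩ := seg_iff hq'
  have e1 : (t - s) * (b.1 - a.1) = (t' - s') * (d.1 - c.1) := by linarith
  have e2 : (t - s) * (b.2 - a.2) = (t' - s') * (d.2 - c.2) := by linarith
  have e3 : (t - s) * ((b.1 - a.1) * (d.2 - c.2) - (b.2 - a.2) * (d.1 - c.1)) = 0 := by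
    linear_combination (d.2 - c.2) * e1 - (d.1 - c.1) * e2
  have e4 : t = s := by
    rcases mul_eq_zero.1 e3 with h' | h'
    exacts [by linarith, absurd h' h]
  subst e4
  exact Prod.ext (by linarith) (by linarith)

/-- coordinates of the base drawing -/
def bpx : Fin 6 → ℤ := ![11, 3, 10, 1, 30, 0]

def bpy : Fin 6 → ℤ := ![12, 10, 3, 31, -1, 0]

def bdt (a b c : Fin 6) : ℤ := (bpx b - bpx a) * (bpy c - bpy a) - (bpy b - bpy a) * (bpx c - bpx a)

def bpar (a b c d : Fin 6) : ℤ := (bpx b - bpx a) * (bpy d - bpy c) - (bpy b - bpy a) * (bpx d - bpx c)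

noncomputable def bpos (a : Fin 6) : Pl := ((bpx a : ℝ), (bpy a : ℝ))

theorem lin_bpos (a b c : Fin 6) : lin (bpos a) (bpos b) (bpos c) = (bdt a b c : ℝ) := by
  simp [lin, bpos, bdt]

def bAdj (a b : Fin 6) : Prop := a ≠ b ∧ (a.1 + b.1 = 5 → a.1 = 0 ∨ b.1 = 0)

instance : DecidableRel bAdj := fun a b => by unfold bAdj; infer_instance

def bG : SimpleGraph (Fin 6) where
  Adj := bAdj
  symm := ⟨fun a b h => ⟨h.1.symm, fun e => (h.2 (by omega)).symm⟩⟩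
  loopless := ⟨fun a h => h.1 rfl⟩

/-- separated edges -/
def bSp (a b c d : Fin 6) : Prop := 0 < bdt a b c * bdt a b d ∨ 0 < bdt c d a * bdt c d b

instance (a b c d : Fin 6) : Decidable (bSp a b c d) := by unfold bSp; infer_instance

/-- possibly crossing edges -/
def bBd (a b c d : Fin 6) : Prop := a ≠ c ∧ a ≠ d ∧ b ≠ c ∧ b ≠ d ∧ ¬ bSp a b c d

instance (a b c d : Fin 6) : Decidable (bBd a b c d) := by unfold bBd; infer_instance

theorem bSp_disj {a b c d : Fin 6} (h : bSp a b c d) {q : Pl} (h1 : q ∈ segment ℝ (bpos a) (bpos b))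
    (h2 : q ∈ segment ℝ (bpos c) (bpos d)) : False := by
  rcases h with h | h
  · refine seg_sep ?_ h1 h2
    rw [lin_bpos, lin_bpos]; exact_mod_cast h
  · refine seg_sep ?_ h2 h1
    rw [lin_bpos, lin_bpos]; exact_mod_cast h

theorem bdt_ne : ∀ a b c : Fin 6, a ≠ b → a ≠ c → b ≠ c → bdt a b c ≠ 0 := by decide

theorem bshare {a b c : Fin 6} (h1 : a ≠ b) (h2 : a ≠ c) (h3 : b ≠ c) {q : Pl} (h : q ∈ segment ℝ (bpos a) (bpos b))
    (h' : q ∈ segment ℝ (bpos a) (bpos c)) : q = bpos a :=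
  seg_share (by rw [lin_bpos]; exact_mod_cast bdt_ne a b c h1 h2 h3) h h'

set_option maxRecDepth 100000 in
theorem bpar_ne : ∀ a b c d : Fin 6, a < b → bAdj a b → c < d → bAdj c d → bBd a b c d → bpar a b c d ≠ 0 := by decide

set_option maxRecDepth 100000 in
theorem bBd_only : ∀ a b c d : Fin 6, a < b → bAdj a b → c < d → bAdj c d → bBd a b c d →
    (a = 0 ∧ b = 5 ∧ c = 1 ∧ d = 2) ∨ (a = 1 ∧ b = 2 ∧ c = 0 ∧ d = 5) := by decide

theorem bpos_inj : Function.Injective bpos := by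
  have : ∀ a b, bpx a = bpx b → a = b := by decide
  intro a b h
  apply this
  have := congrArg Prod.fst h
  simpa [bpos] using this

abbrev bO := {e : Fin 6 × Fin 6 // e.1 < e.2 ∧ bAdj e.1 e.2}

theorem bAdj_symm {a b : Fin 6} (h : bAdj a b) : bAdj b a := bG.adj_symm h

theorem bcov (a b : Fin 6) (h : bG.Adj a b) : ∃ ω : bO, s(ω.1.1, ω.1.2) = s(a, b) := by
  rcases lt_or_gt_of_ne h.1 with h' | h'
  · exact ⟨⟨(a, b), h', h⟩, rfl⟩
  · exact ⟨⟨(b, a), h', bAdj_symm h⟩, Sym2.eq_swap⟩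

theorem bdisj {a b c d : Fin 6} : (∀ v, v ∈ s(a, b) → v ∉ s(c, d)) ↔ (a ≠ c ∧ a ≠ d ∧ b ≠ c ∧ b ≠ d) := by
  simp only [Sym2.mem_iff]
  constructor
  · intro h
    have h1 := h a (Or.inl rfl)
    have h2 := h b (Or.inr rfl)
    tauto
  · rintro ⟨h1, h2, h3, h4⟩ v (rfl | rfl) (h | h) <;> tauto

theorem bnot {ω ω' : bO} (h : ∀ v, v ∈ s(ω.1.1, ω.1.2) → v ∉ s(ω'.1.1, ω'.1.2)) {q : Pl}
    (h1 : q ∈ segment ℝ (bpos ω.1.1) (bpos ω.1.2)) (h2 : q ∈ segment ℝ (bpos ω'.1.1) (bpos ω'.1.2)) :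
    bBd ω.1.1 ω.1.2 ω'.1.1 ω'.1.2 := by
  obtain ⟨a, b, c, d⟩ := bdisj.1 h
  exact ⟨a, b, c, d, fun hs => bSp_disj hs h1 h2⟩

theorem base_good : ∃ D : Drawing bG, D.IsGood ∧ ∀ a b c d, X D a b c d → bBd a b c d := by
  have : Nonempty bO := ⟨⟨(0, 1), by decide⟩⟩
  refine Exists.elim (exists_good (Ω := bO) bG bpos bpos_inj (fun ω => ω.1.1) (fun ω => ω.1.2)
    (fun ω => segment ℝ (bpos ω.1.1) (bpos ω.1.2)) bcov (fun ω => ω.2.2) ?_ ?_ ?_ ?_ ?_ ?_) ?_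
  · intro ω ω' h
    obtain ⟨⟨a, b⟩, h1, h2⟩ := ω
    obtain ⟨⟨c, d⟩, h3, h4⟩ := ω'
    rcases Sym2.eq_iff.1 h with ⟨e1, e2⟩ | ⟨e1, e2⟩
    · simp only at e1 e2; subst e1 e2; rfl
    · simp only at e1 e2 h1 h3; subst e1 e2; exact absurd h1 h3.not_gt
  · exact fun ω => isArc_segment (bpos_inj.ne ω.2.1.ne)
  · intro ω c h1 h2 h
    have := lin_seg h
    rw [lin_bpos] at this
    exact bdt_ne _ _ _ ω.2.1.ne h1.symm h2.symm (by exact_mod_cast this)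
  · rintro ⟨⟨a, b⟩, h1, h2⟩ ⟨⟨c, d⟩, h3, h4⟩ hne v hv hv' q hq hq'
    simp only [Sym2.mem_iff] at hv hv' hq hq' h1 h3
    have hn : ¬ (a = c ∧ b = d) := by rintro ⟨rfl, rfl⟩; exact hne rfl
    rcases hv with rfl | rfl <;> rcases hv' with rfl | rfl
    · exact bshare h1.ne h3.ne (by tauto) hq hq'
    · rw [segment_symm ℝ (bpos c)] at hq'
      exact bshare h1.ne h3.ne' (h3.trans h1).ne' hq hq'
    · rw [segment_symm ℝ (bpos a)] at hq
      exact bshare h1.ne' h3.ne (h1.trans h3).ne hq hq'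
    · rw [segment_symm] at hq hq'
      exact bshare h1.ne' h3.ne' (by tauto) hq hq'
  · intro ω ω' hne hd p hp q hq
    have hb := bnot hd hp.1 hp.2
    refine seg_once ?_ hp hq
    have := bpar_ne _ _ _ _ ω.2.1 ω.2.2 ω'.2.1 ω'.2.2 hb
    simp only [bpos]
    unfold bpar at this
    exact_mod_cast this
  · intro ω ω' ω'' _ _ hne h1 h2 h3 q q1 q2 q3
    have b1 := bBd_only _ _ _ _ ω.2.1 ω.2.2 ω'.2.1 ω'.2.2 (bnot h1 q1 q2)
    have b2 := bBd_only _ _ _ _ ω.2.1 ω.2.2 ω''.2.1 ω''.2.2 (bnot h2 q1 q3)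
    have b3 := bBd_only _ _ _ _ ω'.2.1 ω'.2.2 ω''.2.1 ω''.2.2 (bnot h3 q2 q3)
    rcases b1 with ⟨a1, a2, a3, a4⟩ | ⟨a1, a2, a3, a4⟩ <;> rcases b2 with ⟨c1, c2, c3, c4⟩ | ⟨c1, c2, c3, c4⟩
    · exact hne (Subtype.ext (Prod.ext (a3.trans c3.symm) (a4.trans c4.symm)))
    · rw [a1] at c1; exact absurd c1 (by decide)
    · rw [a1] at c1; exact absurd c1 (by decide)
    · exact hne (Subtype.ext (Prod.ext (a3.trans c3.symm) (a4.trans c4.symm)))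
  · rintro D ⟨hD, hX⟩
    refine ⟨D, hD, fun a b c d h => ?_⟩
    obtain ⟨p, h1, h2, -⟩ := id h
    obtain ⟨ω, hω⟩ := bcov a b h1
    obtain ⟨ω', hω'⟩ := bcov c d h2
    have h3 : X D ω.1.1 ω.1.2 ω'.1.1 ω'.1.2 := by
      unfold X at h ⊢; rw [hω, hω']; exact h
    obtain ⟨-, ⟨q, q1, q2⟩, h5⟩ := hX _ _ h3
    rw [hω, hω'] at h5
    obtain ⟨n1, n2, n3, n4⟩ := bdisj.1 h5
    refine ⟨n1, n2, n3, n4, fun hs => bSp_disj hs (q := q) ?_ ?_⟩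
    · rcases Sym2.eq_iff.1 hω with ⟨e1, e2⟩ | ⟨e1, e2⟩
      · rw [← e1, ← e2]; exact q1
      · rw [← e1, ← e2, segment_symm]; exact q1
    · rcases Sym2.eq_iff.1 hω' with ⟨e1, e2⟩ | ⟨e1, e2⟩
      · rw [← e1, ← e2]; exact q2
      · rw [← e1, ← e2, segment_symm]; exact q2

def bu (s : Bool) : Fin 6 := if s then 4 else 1

def bv (s : Bool) : Fin 6 := if s then 3 else 2

theorem base_S1 : ∃ D : Drawing bG, S1 D 0 5 bu bv id := by
  obtain ⟨D, hD, hX⟩ := base_good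
  have z : ∀ {a b c d : Fin 6}, ¬ bBd a b c d → chi D a b c d = 0 := fun h => chi_zero (mt (hX _ _ _ _) h)
  refine ⟨D, inferInstance, hD, ⟨?_, ?_, ?_, ?_, ?_, ?_, ?_, ?_⟩, ?_, ?_, ?_, ?_, ?_, ?_, ?_, ?_, ?_⟩
  · show bAdj _ _; decide
  · show ∀ s, bAdj _ _; decide
  · show ∀ s, bAdj _ _; decide
  · show ∀ s, bAdj _ _; decide
  · show ∀ s, bAdj _ _; decide
  · show ∀ s s', bAdj _ _; decide
  · decide
  · decide
  · intro s j
    refine chi_le_ite fun h => ?_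
    have h2 := hX _ _ _ _ h
    clear h
    revert s j
    decide
  · exact fun s j => z (by revert s j; decide)
  · exact fun s j => z (by revert s j; decide)
  · exact fun s j => z (by revert s j; decide)
  · exact fun s j t => z (by revert s j t; decide)
  · exact fun s j t => z (by revert s j t; decide)
  · exact fun s j t t' => z (by revert s j t t'; decide)
  · exact fun s j => z (by revert s j; decide)
  · intro s j j'
    rw [z (by revert s j j'; decide), z (by revert s j j'; decide), z (by revert s j j'; decide),
      z (by revert s j j'; decide)]
    exact Nat.zero_le _

end HB

namespace HB

open Set

theorem count_par (n : ℕ) : (∑ i ∈ Finset.range n, if i % 2 = 0 then 1 else 0) = (n + 1) / 2 ∧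
    (∑ i ∈ Finset.range n, if i % 2 = 1 then 1 else 0) = n / 2 := by
  induction n with
  | zero => simp
  | succ k ih =>
    rw [Finset.sum_range_succ, Finset.sum_range_succ, ih.1, ih.2]
    constructor <;> split_ifs <;> omega

theorem count_par' (n : ℕ) : (∑ i ∈ Finset.range n, if i % 2 = n % 2 then 1 else 0) = n / 2 := by
  rcases Nat.mod_two_eq_zero_or_one n with h | h
  · rw [h, (count_par n).1]; omega
  · rw [h, (count_par n).2]

theorem count_pairs_range (n : ℕ) : (∑ i ∈ Finset.range n, ∑ j ∈ Finset.range n, if i ≠ j ∧ i % 2 = j % 2 then 1 else 0)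
    = 2 * (n / 2 * ((n - 1) / 2)) := by
  induction n with
  | zero => simp
  | succ k ih =>
    simp only [Finset.sum_range_succ, Finset.sum_add_distrib]
    rw [ih]
    have e1 : (∑ i ∈ Finset.range k, if i ≠ k ∧ i % 2 = k % 2 then 1 else 0) = k / 2 := by
      rw [← count_par' k]
      refine Finset.sum_congr rfl fun i hi => ?_
      have : i ≠ k := (Finset.mem_range.1 hi).ne
      simp [this]
    have e2 : (∑ i ∈ Finset.range k, if k ≠ i ∧ k % 2 = i % 2 then 1 else 0) = k / 2 := by
      rw [← e1]
      refine Finset.sum_congr rfl fun i hi => ?_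
      simp only [ne_comm (a := k), eq_comm (a := k % 2)]
    rw [e1, e2]
    simp only [ne_eq, not_true_eq_false, false_and, if_false, add_zero, Nat.add_sub_cancel]
    rcases Nat.even_or_odd' k with ⟨a, rfl | rfl⟩
    · rw [show 2 * a / 2 = a by omega, show (2 * a + 1) / 2 = a by omega]
      rcases a with _ | a
      · simp
      · rw [show (2 * (a + 1) - 1) / 2 = a by omega]; ring
    · rw [show (2 * a + 1) / 2 = a by omega, show (2 * a + 1 - 1) / 2 = a by omega, show (2 * a + 1 + 1) / 2 = a + 1 by omega]
      ring

/-- the parity class -/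
def pc (n : ℕ) (i : Fin n) : Bool := decide (i.1 % 2 = 0)

theorem pc_eq {n : ℕ} (i j : Fin n) : pc n i = pc n j ↔ i.1 % 2 = j.1 % 2 := by
  unfold pc
  rw [decide_eq_decide]
  omega

theorem count_pairs (n : ℕ) : (∑ i : Fin n, ∑ j : Fin n, if i ≠ j ∧ pc n i = pc n j then 1 else 0)
    = 2 * (n / 2 * ((n - 1) / 2)) := by
  rw [← count_pairs_range, ← Fin.sum_univ_eq_sum_range (fun i => ∑ j ∈ Finset.range n, if i ≠ j ∧ i % 2 = j % 2 then 1 else 0)]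
  refine Finset.sum_congr rfl fun i _ => ?_
  rw [← Fin.sum_univ_eq_sum_range (fun j => if (i : ℕ) ≠ j ∧ (i : ℕ) % 2 = j % 2 then 1 else 0)]
  refine Finset.sum_congr rfl fun j _ => ?_
  simp only [pc_eq, ne_eq, Fin.ext_iff]

theorem count_odd (n : ℕ) : (∑ i : Fin n, if pc n i = false then 1 else 0) = n / 2 := by
  rw [← (count_par n).2, ← Fin.sum_univ_eq_sum_range (fun i => if i % 2 = 1 then 1 else 0)]
  refine Finset.sum_congr rfl fun i _ => ?_
  simp only [pc, decide_eq_false_iff_not, Nat.mod_two_ne_zero]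

/-- the new index -/
def nf (n : ℕ) (i : Fin (n + 1)) : Option (Fin n) := if h : i.1 < n then some ⟨i, h⟩ else none

theorem nf_inj (n : ℕ) : Function.Injective (nf n) := by
  intro i j h
  unfold nf at h
  split_ifs at h with h1 h2 h2
  · simpa [Fin.ext_iff] using h
  · exact Fin.ext (by omega)

theorem nf_pc {n : ℕ} (h : 2 ≤ n) (i : Fin (n + 1)) : pc n (bk ⟨n - 2, by omega⟩ (nf n i)) = pc (n + 1) i := by
  unfold nf pc
  rw [decide_eq_decide]
  split_ifs with h1
  · exact Iff.rfl
  · have : i.1 = n := by omega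
    simp only [bk, Option.getD_none, this]
    omega

theorem pc_inj {n : ℕ} (h : n ≤ 2) : Function.Injective (pc n) := by
  intro i j hij
  rw [pc_eq] at hij
  exact Fin.ext (by omega)

theorem stage1 (n : ℕ) : ∃ (V : Type) (G : SimpleGraph V) (D : Drawing G) (x y : V) (u : Bool → V) (v : Fin n → V),
    S1 D x y u v (pc n) := by
  by_cases h : n ≤ 2
  · obtain ⟨D, hD⟩ := base_S1
    exact ⟨_, _, D, _, _, _, _, hD.restrict (pc n) (pc_inj h)⟩
  · push Not at h
    obtain ⟨k, rfl⟩ : ∃ k, n = k + 2 := ⟨n - 2, by omega⟩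
    clear h
    induction k with
    | zero =>
      obtain ⟨D, hD⟩ := base_S1
      exact ⟨_, _, D, _, _, _, _, hD.restrict (pc 2) (pc_inj le_rfl)⟩
    | succ k ih =>
      obtain ⟨V, G, D, x, y, u, v, hS⟩ := ih
      obtain ⟨D', hS'⟩ := hS.dup ⟨k + 2 - 2, by omega⟩
      have := hS'.restrict (nf (k + 2)) (nf_inj _)
      have e : (fun j => pc (k + 2) (bk ⟨k + 2 - 2, by omega⟩ (nf (k + 2) j))) = pc (k + 2 + 1) :=
        funext fun i => nf_pc (by omega) i
      rw [e] at this
      exact ⟨_, _, D', _, _, _, _, this⟩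

theorem S1.toS2 {V : Type} {n : ℕ} {G : SimpleGraph V} {D : Drawing G} {x y : V} {u : Bool → V} {v : Fin n → V}
    (h : S1 D x y u v (pc n)) (z : ℕ) : S2 D x y u v id (n / 2 * ((n - 1) / 2)) z (n / 2) := by
  refine ⟨h.fin, h.good, h.cfg.swap, h.gv, fun i j => by rw [chi_comm]; exact h.f' _ _,
    fun i j => by rw [chi_comm]; exact h.f _ _, fun s => ?_, fun s => ?_, fun s s' => ?_⟩
  · have e1 : 2 * ∑ j, ∑ j', (chi D x (v j) (v j') (u s) + chi D y (v j) (v j') (u s)) ≤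
        ∑ i : Fin n, ∑ j : Fin n, if i ≠ j ∧ pc n i = pc n j then 1 else 0 := by
      rw [two_mul]
      nth_rewrite 2 [Finset.sum_comm]
      simp only [← Finset.sum_add_distrib]
      refine Finset.sum_le_sum fun j _ => Finset.sum_le_sum fun j' _ => ?_
      rw [chi_swapr x, chi_swapr y, chi_swapr x (v j'), chi_swapr y (v j')]
      by_cases hj : j = j'
      · subst hj
        rw [chi_bd h.good, chi_bd h.good]; exact Nat.zero_le _
      · have := h.e s j j'
        simp only [ne_eq, hj, not_false_eq_true, true_and]
        omega
    rw [count_pairs] at e1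
    omega
  · cases s
    · simp only [id, Bool.false_eq_true, if_false]
      rw [← count_odd n]
      refine Finset.sum_le_sum fun j _ => ?_
      have := h.k false j
      rw [chi_swapr]
      simpa using this
    · simp only [id, if_true, Nat.le_zero]
      refine Finset.sum_eq_zero fun j _ => ?_
      have := h.k true j
      rw [chi_swapr]
      simpa using this
  · refine le_trans (le_of_eq ?_) (Nat.zero_le _)
    refine Finset.sum_eq_zero fun o _ => Finset.sum_eq_zero fun o' _ => ?_
    rcases o with _ | _ | j <;> rcases o' with _ | _ | j' <;> simp only [oc_none, oc_some]
    · exact chi_ac h.good _ _ _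
    · exact h.g _ _
    · rw [chi_swapr]; exact h.ex _ _ _
    · rw [chi_comm]; exact h.g _ _
    · exact chi_ac h.good _ _ _
    · rw [chi_swapr]; exact h.ey _ _ _
    · rw [chi_comm, chi_swapr]; exact h.ex _ _ _
    · rw [chi_comm, chi_swapr]; exact h.ey _ _ _
    · rw [chi_swapl, chi_swapr]; exact h.q _ _ _ _

theorem stage2 (m n : ℕ) : ∃ (V : Type) (G : SimpleGraph V) (D : Drawing G) (x y : V) (u : Fin m → V) (v : Fin n → V),
    S2 D x y u v (pc m) (n / 2 * ((n - 1) / 2)) ((n + 2) / 2 * ((n + 1) / 2)) (n / 2) := by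
  obtain ⟨V, G, D, x, y, u, v, hS⟩ := stage1 n
  have hB := hS.toS2 ((n + 2) / 2 * ((n + 1) / 2))
  by_cases h : m ≤ 2
  · exact ⟨_, _, D, _, _, _, _, hB.restrict (pc m) (pc_inj h)⟩
  · push Not at h
    obtain ⟨k, rfl⟩ : ∃ k, m = k + 2 := ⟨m - 2, by omega⟩
    clear h
    induction k with
    | zero => exact ⟨_, _, D, _, _, _, _, hB.restrict (pc 2) (pc_inj le_rfl)⟩
    | succ k ih =>
      obtain ⟨V, G, D, x, y, u, v, hS⟩ := ih
      obtain ⟨D', hS'⟩ := hS.dup (by simp) ⟨k + 2 - 2, by omega⟩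
      have := hS'.restrict (nf (k + 2)) (nf_inj _)
      have e : (fun j => pc (k + 2) (bk ⟨k + 2 - 2, by omega⟩ (nf (k + 2) j))) = pc (k + 2 + 1) :=
        funext fun i => nf_pc (by omega) i
      rw [e] at this
      exact ⟨_, _, D', _, _, _, _, this⟩

/-- the vertices of `quadK 1 1 m n` inside a configuration -/
def qMap {V : Type*} {m n : ℕ} (x y : V) (u : Fin m → V) (v : Fin n → V) : QV m n → V
  | ⟨0, _⟩ => x
  | ⟨1, _⟩ => y
  | ⟨2, i⟩ => u i
  | ⟨3, j⟩ => v j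

theorem qMap_hom {V : Type*} {m n : ℕ} {G : SimpleGraph V} {x y : V} {u : Fin m → V} {v : Fin n → V}
    (h : Cfg G x y u v) (a b : QV m n) (hab : (quadK 1 1 m n).Adj a b) : G.Adj (qMap x y u v a) (qMap x y u v b) := by
  rw [q_adj] at hab
  rcases q_cases a with rfl | rfl | ⟨i, rfl⟩ | ⟨i, rfl⟩ <;> rcases q_cases b with rfl | rfl | ⟨j, rfl⟩ | ⟨j, rfl⟩
  · exact absurd rfl hab
  · exact h.hxy
  · exact h.hxu _
  · exact h.hxv _
  · exact h.hxy.symm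
  · exact absurd rfl hab
  · exact h.hyu _
  · exact h.hyv _
  · exact (h.hxu _).symm
  · exact (h.hyu _).symm
  · exact absurd rfl hab
  · exact h.huv _ _
  · exact (h.hxv _).symm
  · exact (h.hyv _).symm
  · exact (h.huv _ _).symm
  · exact absurd rfl hab

theorem qMap_inj {V : Type*} {m n : ℕ} {G : SimpleGraph V} {x y : V} {u : Fin m → V} {v : Fin n → V}
    (h : Cfg G x y u v) : Function.Injective (qMap x y u v) := by
  intro a b hab
  by_cases hq : (quadK 1 1 m n).Adj a b
  · exact absurd hab (qMap_hom h a b hq).ne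
  · rw [q_adj, not_not] at hq
    rcases q_cases a with rfl | rfl | ⟨i, rfl⟩ | ⟨i, rfl⟩ <;> rcases q_cases b with rfl | rfl | ⟨j, rfl⟩ | ⟨j, rfl⟩
    · rfl
    · exact absurd (show (0 : Fin 4) = 1 from hq) (by decide)
    · exact absurd (show (0 : Fin 4) = 2 from hq) (by decide)
    · exact absurd (show (0 : Fin 4) = 3 from hq) (by decide)
    · exact absurd (show (1 : Fin 4) = 0 from hq) (by decide)
    · rfl
    · exact absurd (show (1 : Fin 4) = 2 from hq) (by decide)
    · exact absurd (show (1 : Fin 4) = 3 from hq) (by decide)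
    · exact absurd (show (2 : Fin 4) = 0 from hq) (by decide)
    · exact absurd (show (2 : Fin 4) = 1 from hq) (by decide)
    · exact congrArg qu (h.iu hab)
    · exact absurd (show (2 : Fin 4) = 3 from hq) (by decide)
    · exact absurd (show (3 : Fin 4) = 0 from hq) (by decide)
    · exact absurd (show (3 : Fin 4) = 1 from hq) (by decide)
    · exact absurd (show (3 : Fin 4) = 2 from hq) (by decide)
    · exact congrArg qv (h.iv hab)

theorem stage3 (m n : ℕ) : ∃ D : Drawing (quadK 1 1 m n),
    S2 D (qx m n) (qy m n) qu qv (pc m) (n / 2 * ((n - 1) / 2)) ((n + 2) / 2 * ((n + 1) / 2)) (n / 2) := by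
  obtain ⟨V, G, D, x, y, u, v, h⟩ := stage2 m n
  have hc := h.cfg.swap
  have e : ∀ {a b c d : QV m n}, (quadK 1 1 m n).Adj a b → (quadK 1 1 m n).Adj c d →
      chi (comap D (qMap x y u v) (qMap_inj hc) (qMap_hom hc)) a b c d =
        chi D (qMap x y u v a) (qMap x y u v b) (qMap x y u v c) (qMap x y u v d) :=
    fun h1 h2 => chi_congr (comap_X h1 h2)
  have q := q_cfg m n
  have hoc : ∀ o, qMap x y u v (oc (qx m n) (oc (qy m n) qv) o) = oc x (oc y v) o := by
    rintro (_ | _ | j) <;> rfl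
  have aoc : ∀ i o, (quadK 1 1 m n).Adj (oc (qx m n) (oc (qy m n) qv) o) (qu i) := fun i =>
    oc_all (P := fun z => (quadK 1 1 m n).Adj z (qu i)) (q.hxu i) (oc_all (P := fun z => (quadK 1 1 m n).Adj z (qu i))
      (q.hyu i) fun j => (q.huv i j).symm)
  refine ⟨comap D (qMap x y u v) (qMap_inj hc) (qMap_hom hc), finite_QV m n, comap_good h.good, q.swap,
    fun j j' => (e (q.hxv j) (q.hyv j')).trans (h.gv j j'), fun i j => (e (q.hxv j) (q.hyu i)).trans (h.f i j),
    fun i j => (e (q.hyv j) (q.hxu i)).trans (h.f' i j), fun i => ?_, fun i => ?_, fun i i' => ?_⟩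
  · refine le_trans (le_of_eq ?_) (h.e i)
    refine Finset.sum_congr rfl fun j _ => Finset.sum_congr rfl fun j' _ => ?_
    rw [e (q.hxv j) (q.huv i j').symm, e (q.hyv j) (q.huv i j').symm]
    rfl
  · refine le_trans (le_of_eq ?_) (h.k i)
    refine Finset.sum_congr rfl fun j _ => ?_
    rw [e q.hxy (q.huv i j).symm]
    rfl
  · refine le_trans (le_of_eq ?_) (h.w i i')
    refine Finset.sum_congr rfl fun o _ => Finset.sum_congr rfl fun o' _ => ?_
    rw [e (aoc i o) (aoc i' o'), hoc, hoc]
    rfl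

theorem upper {m n : ℕ} (hm : 0 < m) (hn : 0 < n) : ∃ D : Drawing (quadK 1 1 m n), D.IsGood ∧
    D.crNum + m * n ≤ Z (m + 2) (n + 2) + (m / 2) * (n / 2) := by
  obtain ⟨D, h⟩ := stage3 m n
  refine ⟨D, h.good, ?_⟩
  have t := total h.good (q_cfg m n) q_cov
  unfold T3 at t
  have w1 : QS D (oc (qx m n) (oc (qy m n) qv)) (qu (m := m)) ≤ (n + 2) / 2 * ((n + 1) / 2) * (2 * (m / 2 * ((m - 1) / 2))) := by
    have e1 : QS D (oc (qx m n) (oc (qy m n) qv)) (qu (m := m)) = ∑ i : Fin m, ∑ i' : Fin m, ∑ o, ∑ o',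
        chi D (oc (qx m n) (oc (qy m n) qv) o) (qu i) (oc (qx m n) (oc (qy m n) qv) o') (qu i') := by
      unfold QS
      rw [Finset.sum_comm]
      refine Finset.sum_congr rfl fun i _ => ?_
      refine Eq.trans (Finset.sum_congr rfl fun o _ => ?_) Finset.sum_comm
      exact Finset.sum_comm
    rw [e1, ← count_pairs, Finset.mul_sum]
    refine Finset.sum_le_sum fun i _ => ?_
    rw [Finset.mul_sum]
    refine Finset.sum_le_sum fun i' _ => ?_
    by_cases hi : i = i'
    · subst hi
      refine le_trans (le_of_eq ?_) (Nat.zero_le _)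
      refine Finset.sum_eq_zero fun o _ => Finset.sum_eq_zero fun o' _ => chi_bd h.good _ _ _
    · refine (h.w i i').trans ?_
      simp [hi]
  rw [QS_A h.good, QS_A h.good, Es_A h.good, QS_swap] at w1
  have w2 : Es D (qx m n) (qu (m := m)) (qv (n := n)) + Es D (qy m n) qu qv ≤ m * (n / 2 * ((n - 1) / 2)) := by
    unfold Es
    rw [Finset.sum_comm, Finset.sum_comm (f := fun b a => ∑ b', chi D (qy m n) (qv b) (qu a) (qv b')), ← Finset.sum_add_distrib]
    refine (Finset.sum_le_sum (g := fun _ => n / 2 * ((n - 1) / 2)) fun i _ => ?_).trans (by simp)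
    refine le_trans (le_of_eq ?_) (h.e i)
    simp only [← Finset.sum_add_distrib]
    refine Finset.sum_congr rfl fun j _ => Finset.sum_congr rfl fun j' _ => ?_
    rw [chi_swapr (qx m n), chi_swapr (qy m n)]
  have w3 : Gs D (qx m n) (qy m n) (qv (n := n)) = 0 :=
    Finset.sum_eq_zero fun j _ => Finset.sum_eq_zero fun j' _ => h.gv j j'
  have w4 : Fs D (qx m n) (qy m n) (qu (m := m)) (qv (n := n)) = 0 :=
    Finset.sum_eq_zero fun i _ => Finset.sum_eq_zero fun j _ => by rw [chi_swapr]; exact h.f i j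
  have w5 : Fs D (qy m n) (qx m n) (qu (m := m)) (qv (n := n)) = 0 :=
    Finset.sum_eq_zero fun i _ => Finset.sum_eq_zero fun j _ => by rw [chi_swapr]; exact h.f' i j
  have w6 : Ks D (qx m n) (qy m n) (qu (m := m)) (qv (n := n)) ≤ m / 2 * (n / 2) := by
    unfold Ks
    rw [← count_odd m, Finset.sum_mul]
    refine Finset.sum_le_sum fun i _ => ?_
    have := h.k i
    simp only [chi_swapr (qx m n) (qy m n) (qu i)]
    refine this.trans ?_
    cases pc m i <;> simp
  have hz : Z (m + 2) (n + 2) = (n + 2) / 2 * ((n + 1) / 2) * (m / 2 * ((m - 1) / 2)) + m * (n / 2 * ((n - 1) / 2)) + m * n := by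
    unfold Z
    obtain ⟨m, rfl⟩ : ∃ k, m = k + 1 := ⟨m - 1, by omega⟩
    obtain ⟨n, rfl⟩ : ∃ k, n = k + 1 := ⟨n - 1, by omega⟩
    rw [show (m + 1 + 2) / 2 = (m + 1) / 2 + 1 by omega, show (m + 1 + 2 - 1) / 2 = m / 2 + 1 by omega,
      show (n + 1 + 2) / 2 = (n + 1) / 2 + 1 by omega, show (n + 1 + 2 - 1) / 2 = n / 2 + 1 by omega,
      show (n + 1 + 1) / 2 = n / 2 + 1 by omega, Nat.add_sub_cancel, Nat.add_sub_cancel]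
    have e1 : m = (m + 1) / 2 + m / 2 := by omega
    have e2 : n = (n + 1) / 2 + n / 2 := by omega
    generalize (m + 1) / 2 = a at *
    generalize m / 2 = b at *
    generalize (n + 1) / 2 = c at *
    generalize n / 2 = d at *
    subst e1 e2
    ring
  nlinarith

end HB

/-- Let `m`, `n` be positive integers. Assuming Zarankiewicz's conjecture and
Harborth's conjecture for `K_{2,m,n}`, Harborth's conjecture holds for
`K_{1,1,m,n}`: `cr(K_{1,1,m,n}) = Z(m+2,n+2) − mn + ⌊m/2⌋⌊n/2⌋`. -/
theorem statement11 (m n : ℕ) (hm : 0 < m) (hn : 0 < n)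
    (hZC : ∀ a b : ℕ, 0 < a → 0 < b → crossingNumber (bipK a b) = Z a b)
    (hHC : (crossingNumber (triK 2 m n) : ℤ) = (Z (m + 2) (n + 2) : ℤ) - (m : ℤ) * n) :
    (crossingNumber (quadK 1 1 m n) : ℤ) =
      (Z (m + 2) (n + 2) : ℤ) - (m : ℤ) * n + ((m / 2 : ℕ) : ℤ) * ((n / 2 : ℕ) : ℤ) := by
  have hlow : Z (m + 2) (n + 2) + (m / 2) * (n / 2) ≤ crossingNumber (quadK 1 1 m n) + m * n := by
    obtain ⟨D0, h0, -⟩ := HB.upper hm hn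
    obtain ⟨D, hD, he⟩ := Nat.sInf_mem (s := {k | ∃ D : Drawing (quadK 1 1 m n), D.IsGood ∧ D.crNum = k}) ⟨_, D0, h0, rfl⟩
    have := HB.lower hm hn hZC hHC hD
    rw [he] at this
    exact this
  have hupp : crossingNumber (quadK 1 1 m n) + m * n ≤ Z (m + 2) (n + 2) + (m / 2) * (n / 2) := by
    obtain ⟨D, hD, h⟩ := HB.upper hm hn
    exact (Nat.add_le_add_right (HB.crossingNumber_le hD) _).trans h
  have h := le_antisymm hupp hlow
  zify at h
  push_cast at h ⊢
  linarith
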